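/- There exist a function σ : (0,1) → (0,∞) with σ(r) → 0 as r → 0⁺ and a constant c₀ > 0 depending only on M and the dimension N, such that: if u ∈ P₁(0,M) and δ_{r₀}(u) > σ(r₀) for some r₀ < 1, then ∂Ω ∩ B(0,c₀·r₀²) is the graph of a C¹ function. -/

import Mathlib

open MeasureTheory Metric Set Filter
open scoped RealInnerProductSpace

noncomputable section

/-- The Laplacian of `φ` at `x`, as the sum of the pure second derivatives. -/
def lap (N : ℕ) (φ : EuclideanSpace ℝ (Fin N) → ℝ) (x : EuclideanSpace ℝ (Fin N)) : ℝ :=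
  ∑ i : Fin N,
    fderiv ℝ (fun y => fderiv ℝ φ y (EuclideanSpace.single i 1)) x (EuclideanSpace.single i 1)

/-- Membership in the class `P_r(z, M)`. -/
def MemP (N : ℕ) (r : ℝ) (z : EuclideanSpace ℝ (Fin N)) (M : ℝ)
    (Ω : Set (EuclideanSpace ℝ (Fin N))) (u : EuclideanSpace ℝ (Fin N) → ℝ) : Prop :=
  IsOpen Ω ∧ ContDiff ℝ 1 u ∧
    (∀ φ : EuclideanSpace ℝ (Fin N) → ℝ, ContDiff ℝ (⊤ : ℕ∞) φ → tsupport φ ⊆ ball z r →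
      ∫ x, u x * lap N φ x = ∫ x in Ω, φ x) ∧
    (∀ x ∈ ball z r \ Ω, u x = 0 ∧ gradient u x = 0) ∧
    (∀ x ∈ ball z r, |u x| ≤ M) ∧
    z ∈ frontier Ω

/-- Membership in the class `P_∞(0, M)` of global solutions with quadratic growth. -/
def MemPinf (N : ℕ) (M : ℝ) (Ω : Set (EuclideanSpace ℝ (Fin N)))
    (u : EuclideanSpace ℝ (Fin N) → ℝ) : Prop :=
  IsOpen Ω ∧ ContDiff ℝ 1 u ∧
    (∀ φ : EuclideanSpace ℝ (Fin N) → ℝ, ContDiff ℝ (⊤ : ℕ∞) φ → HasCompactSupport φ →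
      ∫ x, u x * lap N φ x = ∫ x in Ω, φ x) ∧
    (∀ x ∈ Ωᶜ, u x = 0 ∧ gradient u x = 0) ∧
    (0 : EuclideanSpace ℝ (Fin N)) ∈ frontier Ω ∧
    (∀ x, |u x| ≤ M * (‖x‖ ^ 2 + 1))

/-- The minimum diameter of a set: the smallest width of a slab containing it. -/
def MD (N : ℕ) (D : Set (EuclideanSpace ℝ (Fin N))) : ℝ :=
  ⨅ e : {e : EuclideanSpace ℝ (Fin N) // ‖e‖ = 1},
    ((⨆ x : D, ⟪(x : EuclideanSpace ℝ (Fin N)), (e : EuclideanSpace ℝ (Fin N))⟫) -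
      ⨅ x : D, ⟪(x : EuclideanSpace ℝ (Fin N)), (e : EuclideanSpace ℝ (Fin N))⟫)

/-- The density function `δ_r(u)`. -/
def deltaFn (N : ℕ) (u : EuclideanSpace ℝ (Fin N) → ℝ) (r : ℝ) : ℝ :=
  MD N ({x | u x = 0 ∧ gradient u x = 0} ∩ ball 0 r) / r

/-- Half-space solutions `x ↦ (max(⟪x,e⟫,0))²/2`. -/
def IsHalfSpaceSol (N : ℕ) (u : EuclideanSpace ℝ (Fin N) → ℝ) : Prop :=
  ∃ e : EuclideanSpace ℝ (Fin N), ‖e‖ = 1 ∧ ∀ x, u x = (max ⟪x, e⟫ 0) ^ 2 / 2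

/-- `∂Ω ∩ B` is the graph of a `C¹` function. -/
def IsC1Graph (N : ℕ) (Ω B : Set (EuclideanSpace ℝ (Fin N))) : Prop :=
  ∃ (e : EuclideanSpace ℝ (Fin N)) (f : EuclideanSpace ℝ (Fin N) → ℝ),
    ‖e‖ = 1 ∧ ContDiff ℝ 1 f ∧
    Ω ∩ B = {x ∈ B | f (x - ⟪x, e⟫ • e) < ⟪x, e⟫} ∧
    frontier Ω ∩ B = {x ∈ B | ⟪x, e⟫ = f (x - ⟪x, e⟫ • e)}

/-- `∂Ω ∩ B` is the graph of a real-analytic function. -/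
def IsAnalyticGraph (N : ℕ) (Ω B : Set (EuclideanSpace ℝ (Fin N))) : Prop :=
  ∃ (e : EuclideanSpace ℝ (Fin N)) (f : EuclideanSpace ℝ (Fin N) → ℝ),
    ‖e‖ = 1 ∧ (∀ x, AnalyticAt ℝ f x) ∧
    Ω ∩ B = {x ∈ B | f (x - ⟪x, e⟫ • e) < ⟪x, e⟫} ∧
    frontier Ω ∩ B = {x ∈ B | ⟪x, e⟫ = f (x - ⟪x, e⟫ • e)}

/-- The Alt–Caffarelli–Friedman functional `φ(r, v)` centered at the origin. -/
def acf (N : ℕ) (v : EuclideanSpace ℝ (Fin N) → ℝ) (r : ℝ) : ℝ :=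
  r ^ (-4 : ℤ) *
    (∫ x in ball (0 : EuclideanSpace ℝ (Fin N)) r,
      ‖gradient (fun y => max (v y) 0) x‖ ^ 2 * ‖x‖ ^ ((2 : ℤ) - (N : ℤ))) *
    ∫ x in ball (0 : EuclideanSpace ℝ (Fin N)) r,
      ‖gradient (fun y => max (-v y) 0) x‖ ^ 2 * ‖x‖ ^ ((2 : ℤ) - (N : ℤ))

/-- `S_j(z, u) = sup_{B(z, 2^{-j})} |u|`. -/
def Sj (N : ℕ) (z : EuclideanSpace ℝ (Fin N)) (u : EuclideanSpace ℝ (Fin N) → ℝ) (j : ℕ) : ℝ :=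
  sSup ((fun x => |u x|) '' ball z ((2 : ℝ) ^ (-(j : ℤ))))

section

/-- Directional derivative. -/
def dd {V : Type*} [NormedAddCommGroup V] [NormedSpace ℝ V] (e : V) (f : V → ℝ) (x : V) : ℝ :=
  fderiv ℝ f x e

theorem hasFDerivAt_intervalIntegral_param {V W : Type} [NormedAddCommGroup V] [NormedSpace ℝ V]
    [FiniteDimensional ℝ V] [NormedAddCommGroup W] [NormedSpace ℝ W] [CompleteSpace W]
    {F : V × ℝ → W} (hF : ContDiff ℝ 1 F) (a b : ℝ) (x : V) :
    HasFDerivAt (fun x => ∫ t in a..b, F (x, t))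
      (∫ t in a..b, (fderiv ℝ F (x, t)).comp (ContinuousLinearMap.inl ℝ V ℝ)) x := by
  have hc : Continuous fun p : V × ℝ => (fderiv ℝ F p).comp (ContinuousLinearMap.inl ℝ V ℝ) :=
    (hF.continuous_fderiv one_ne_zero).clm_comp continuous_const
  have hK : IsCompact (closedBall x 1 ×ˢ uIcc a b) := (isCompact_closedBall x 1).prod isCompact_uIcc
  obtain ⟨C, hC⟩ := hK.exists_bound_of_continuousOn hc.continuousOn
  refine (intervalIntegral.hasFDerivAt_integral_of_dominated_of_fderiv_le
    (F' := fun x t => (fderiv ℝ F (x, t)).comp (ContinuousLinearMap.inl ℝ V ℝ)) (bound := fun _ => C)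
    (ball_mem_nhds x one_pos) ?_ ?_ ?_ ?_ ?_ ?_)
  · exact Eventually.of_forall fun y =>
      (hF.continuous.comp (Continuous.prodMk_right y)).aestronglyMeasurable
  · exact (hF.continuous.comp (Continuous.prodMk_right x)).intervalIntegrable _ _
  · exact (hc.comp (Continuous.prodMk_right x)).aestronglyMeasurable
  · refine Eventually.of_forall fun t ht y hy => hC (y, t) ⟨ball_subset_closedBall hy, uIoc_subset_uIcc ht⟩
  · exact intervalIntegrable_const
  · refine Eventually.of_forall fun t _ y _ => ?_
    exact ((hF.differentiable one_ne_zero) (y, t)).hasFDerivAt.comp y (hasFDerivAt_prodMk_left y t)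

theorem contDiff_intervalIntegral_param {V : Type} [NormedAddCommGroup V] [NormedSpace ℝ V]
    [FiniteDimensional ℝ V] (a b : ℝ) (n : ℕ) :
    ∀ {W : Type} [NormedAddCommGroup W] [NormedSpace ℝ W] [FiniteDimensional ℝ W]
    {F : V × ℝ → W} (_ : ContDiff ℝ (⊤ : ℕ∞) F),
    ContDiff ℝ n (fun x => ∫ t in a..b, F (x, t)) := by
  induction n with
  | zero =>
    intro W _ _ _ F hF
    have : CompleteSpace W := FiniteDimensional.complete ℝ W
    refine contDiff_zero.2 (continuous_iff_continuousAt.2 fun x => ?_)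
    exact (hasFDerivAt_intervalIntegral_param (hF.of_le (by exact_mod_cast le_top)) a b x).continuousAt
  | succ n ih =>
    intro W _ _ _ F hF
    have : CompleteSpace W := FiniteDimensional.complete ℝ W
    have h1 := fun x =>
      hasFDerivAt_intervalIntegral_param (hF.of_le (by exact_mod_cast le_top)) a b x
    push_cast
    refine contDiff_succ_iff_fderiv.2 ⟨fun x => (h1 x).differentiableAt, by simp, ?_⟩
    have : fderiv ℝ (fun x => ∫ t in a..b, F (x, t)) = fun x =>
      ∫ t in a..b, (fderiv ℝ F (x, t)).comp (ContinuousLinearMap.inl ℝ V ℝ) :=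
      funext fun x => (h1 x).fderiv
    rw [this]
    refine ih (F := fun p => (fderiv ℝ F p).comp (ContinuousLinearMap.inl ℝ V ℝ)) ?_
    exact (hF.fderiv_right (m := (⊤ : ℕ∞)) (by simp)).clm_comp contDiff_const

/-- Euclidean space of dimension `N`. -/
abbrev Euc (N : ℕ) := EuclideanSpace ℝ (Fin N)

/-- Smooth kernels supported in the closed unit ball. -/
structure Krn {N : ℕ} (ψ : Euc N → ℝ) : Prop where
  smooth : ContDiff ℝ (⊤ : ℕ∞) ψ
  supp : ∀ x, 1 ≤ ‖x‖ → ψ x = 0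

theorem deriv_expNegInvGlue_pos {t : ℝ} (ht : 0 < t) : 0 < deriv expNegInvGlue t := by
  have h : HasDerivAt (fun x : ℝ => Real.exp (-x⁻¹)) (Real.exp (-t⁻¹) * (-(-(t ^ 2)⁻¹))) t :=
    ((hasDerivAt_inv ht.ne').neg).exp
  have h2 : expNegInvGlue =ᶠ[nhds t] fun x : ℝ => Real.exp (-x⁻¹) := by
    filter_upwards [lt_mem_nhds ht] with x hx
    simp [expNegInvGlue, not_le.2 hx]
  rw [h2.deriv_eq, h.deriv, neg_neg]
  positivity

theorem deriv_expNegInvGlue_of_nonpos {t : ℝ} (ht : t ≤ 0) : deriv expNegInvGlue t = 0 := by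
  have hc : Continuous (deriv expNegInvGlue) :=
    (expNegInvGlue.contDiff (n := 1)).continuous_deriv le_rfl
  have h0 : ∀ s ∈ Iio (0:ℝ), deriv expNegInvGlue s = 0 := by
    intro s hs
    have : expNegInvGlue =ᶠ[nhds s] fun _ => (0:ℝ) := by
      filter_upwards [Iio_mem_nhds hs] with x hx
      exact expNegInvGlue.zero_of_nonpos (le_of_lt hx)
    rw [this.deriv_eq]; simp
  have : closure (Iio (0:ℝ)) ⊆ {s | deriv expNegInvGlue s = 0} :=
    closure_minimal h0 (isClosed_eq hc continuous_const)
  rw [closure_Iio] at this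
  exact this ht

theorem contDiff_deriv_expNegInvGlue : ContDiff ℝ (⊤ : ℕ∞) (deriv expNegInvGlue) :=
  (contDiff_infty_iff_deriv.1 (expNegInvGlue.contDiff (n := (⊤ : ℕ∞)))).2

variable {N : ℕ}

def rhoAux (x : Euc N) : ℝ := 2 * deriv expNegInvGlue (1 - ‖x‖ ^ 2)

theorem rhoAux_nonneg (x : Euc N) : 0 ≤ rhoAux x := by
  unfold rhoAux
  rcases le_or_gt (1 - ‖x‖^2) 0 with h | h
  · rw [deriv_expNegInvGlue_of_nonpos h]; simp
  · have := deriv_expNegInvGlue_pos h; positivity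

theorem rhoAux_pos {x : Euc N} (hx : ‖x‖ < 1) : 0 < rhoAux x := by
  unfold rhoAux
  have : 0 < 1 - ‖x‖^2 := by nlinarith [norm_nonneg x]
  have := deriv_expNegInvGlue_pos this; positivity

theorem krn_rhoAux : Krn (rhoAux (N := N)) where
  smooth := contDiff_const.mul
    (contDiff_deriv_expNegInvGlue.comp (contDiff_const.sub (contDiff_norm_sq ℝ)))
  supp x hx := by
    unfold rhoAux
    rw [deriv_expNegInvGlue_of_nonpos (by nlinarith [norm_nonneg x])]; simp

theorem Krn.tsupport_subset {ψ : Euc N → ℝ} (h : Krn ψ) : tsupport ψ ⊆ closedBall 0 1 := by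
  refine closure_minimal (fun x hx => ?_) isClosed_closedBall
  by_contra hn
  rw [mem_closedBall_zero_iff, not_le] at hn
  exact hx (h.supp x hn.le)

theorem Krn.hasCompactSupport {ψ : Euc N → ℝ} (h : Krn ψ) : HasCompactSupport ψ :=
  (isCompact_closedBall 0 1).of_isClosed_subset (isClosed_tsupport _) h.tsupport_subset

theorem Krn.continuous {ψ : Euc N → ℝ} (h : Krn ψ) : Continuous ψ := h.smooth.continuous

theorem Krn.integrable {ψ : Euc N → ℝ} (h : Krn ψ) : Integrable ψ :=
  h.continuous.integrable_of_hasCompactSupport h.hasCompactSupport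

def rhoMass (N : ℕ) : ℝ := ∫ x : Euc N, rhoAux x

theorem rhoMass_pos : 0 < rhoMass N := by
  unfold rhoMass
  refine (integral_pos_iff_support_of_nonneg rhoAux_nonneg krn_rhoAux.integrable).2 ?_
  exact (krn_rhoAux.continuous.isOpen_support).measure_pos _
    ⟨0, (rhoAux_pos (by simp)).ne.symm⟩

/-- The mollifier. -/
def rho (x : Euc N) : ℝ := rhoAux x / rhoMass N

/-- A primitive of the mollifier: its gradient at `x` is `-rho x • x`. -/
def eta (x : Euc N) : ℝ := expNegInvGlue (1 - ‖x‖ ^ 2) / rhoMass N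

theorem krn_rho : Krn (rho (N := N)) where
  smooth := krn_rhoAux.smooth.div_const _
  supp x hx := by simp [rho, krn_rhoAux.supp x hx]

theorem krn_eta : Krn (eta (N := N)) where
  smooth := ((expNegInvGlue.contDiff (n := (⊤ : ℕ∞))).comp
    (contDiff_const.sub (contDiff_norm_sq ℝ))).div_const _
  supp x hx := by
    simp [eta, expNegInvGlue.zero_of_nonpos (show 1 - ‖x‖^2 ≤ 0 by nlinarith [norm_nonneg x])]

theorem rho_nonneg (x : Euc N) : 0 ≤ rho x := div_nonneg (rhoAux_nonneg x) rhoMass_pos.le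
theorem rho_pos {x : Euc N} (hx : ‖x‖ < 1) : 0 < rho x := div_pos (rhoAux_pos hx) rhoMass_pos
theorem eta_nonneg (x : Euc N) : 0 ≤ eta x :=
  div_nonneg (expNegInvGlue.nonneg _) rhoMass_pos.le
theorem integral_rho : ∫ x : Euc N, rho x = 1 := by
  unfold rho
  rw [integral_div]
  exact div_self rhoMass_pos.ne'
theorem rho_neg (x : Euc N) : rho (-x) = rho x := by simp [rho, rhoAux]

theorem dd_eta (e x : Euc N) : dd e eta x = -(⟪x, e⟫ * rho x) := by
  have h1 : HasFDerivAt (fun x : Euc N => 1 - ‖x‖^2) (-(2 • (innerSL ℝ x))) x := by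
    simpa using ((hasStrictFDerivAt_norm_sq x).hasFDerivAt).const_sub 1
  have h2 : HasDerivAt expNegInvGlue (deriv expNegInvGlue (1 - ‖x‖^2)) (1 - ‖x‖^2) :=
    ((expNegInvGlue.contDiff (n := 1)).differentiable one_ne_zero _).hasDerivAt
  have h3 : HasFDerivAt (eta (N := N)) ((rhoMass N)⁻¹ • (deriv expNegInvGlue (1 - ‖x‖^2) •
      (-(2 • (innerSL ℝ x)) : Euc N →L[ℝ] ℝ))) x := by
    have := (h2.comp_hasFDerivAt x h1).const_mul (rhoMass N)⁻¹
    refine this.congr_of_eventuallyEq (Eventually.of_forall fun y => ?_)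
    simp [eta, div_eq_inv_mul]
  rw [dd, h3.fderiv]
  simp [rho, rhoAux]
  ring

theorem Krn.contDiff_fderiv {ψ : Euc N → ℝ} (h : Krn ψ) : ContDiff ℝ (⊤ : ℕ∞) (fderiv ℝ ψ) :=
  h.smooth.fderiv_right (by simp)

theorem Krn.differentiable {ψ : Euc N → ℝ} (h : Krn ψ) : Differentiable ℝ ψ :=
  h.smooth.differentiable (by simp)

theorem Krn.fderiv_eq_zero {ψ : Euc N → ℝ} (h : Krn ψ) {x : Euc N} (hx : 1 ≤ ‖x‖) :
    fderiv ℝ ψ x = 0 := by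
  have h0 : ∀ y, y ∈ (closedBall (0 : Euc N) 1)ᶜ → fderiv ℝ ψ y = 0 := by
    intro y hy
    have : ψ =ᶠ[nhds y] fun _ => (0:ℝ) := by
      filter_upwards [isClosed_closedBall.isOpen_compl.mem_nhds hy] with z hz
      rw [mem_compl_iff, mem_closedBall_zero_iff, not_le] at hz
      exact h.supp z hz.le
    rw [this.fderiv_eq]; simp
  by_cases hx1 : ‖x‖ = 1
  · have hcl : closure ((closedBall (0 : Euc N) 1)ᶜ) ⊆ {y | fderiv ℝ ψ y = 0} :=
      closure_minimal h0 (isClosed_eq h.contDiff_fderiv.continuous continuous_const)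
    apply hcl
    have ht : Tendsto (fun n : ℕ => (1 + 1 / ((n:ℝ) + 1)) • x) atTop (nhds ((1 + 0 : ℝ) • x)) :=
      (tendsto_const_nhds.add tendsto_one_div_add_atTop_nhds_zero_nat).smul_const x
    rw [add_zero, one_smul] at ht
    refine mem_closure_of_tendsto ht (Eventually.of_forall fun n => ?_)
    rw [mem_compl_iff, mem_closedBall_zero_iff, not_le, norm_smul, hx1, mul_one,
      Real.norm_of_nonneg (by positivity)]
    have : 0 < 1 / ((n:ℝ) + 1) := by positivity
    linarith
  · apply h0
    rw [mem_compl_iff, mem_closedBall_zero_iff, not_le]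
    exact lt_of_le_of_ne hx (Ne.symm hx1)

theorem Krn.dd {ψ : Euc N → ℝ} (h : Krn ψ) (e : Euc N) : Krn (dd e ψ) where
  smooth := h.contDiff_fderiv.clm_apply contDiff_const
  supp x hx := by simp [_root_.dd, h.fderiv_eq_zero hx]

/-- The radial kernel used to compare the mollifications at two consecutive dyadic scales. -/
def kap (x : Euc N) : ℝ :=
  ∫ t in (0:ℝ)..Real.log 2, Real.exp (((N : ℝ) - 2) * t) * eta (Real.exp t • x)

/-- The radial weight with `∇ kap x = - kapW x • x`. -/
def kapW (x : Euc N) : ℝ :=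
  ∫ t in (0:ℝ)..Real.log 2, Real.exp ((N : ℝ) * t) * rho (Real.exp t • x)

theorem contDiff_kapAux (a : ℝ) {ψ : Euc N → ℝ} (h : Krn ψ) :
    ContDiff ℝ (⊤ : ℕ∞) (fun p : Euc N × ℝ => Real.exp (a * p.2) * ψ (Real.exp p.2 • p.1)) :=
  (Real.contDiff_exp.comp (contDiff_const.mul contDiff_snd)).mul
    (h.smooth.comp ((Real.contDiff_exp.comp contDiff_snd).smul contDiff_fst))

theorem krn_kapAux (a : ℝ) {ψ : Euc N → ℝ} (h : Krn ψ) : Krn (fun x : Euc N =>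
    ∫ t in (0:ℝ)..Real.log 2, Real.exp (a * t) * ψ (Real.exp t • x)) where
  smooth := by
    refine contDiff_infty.2 fun n => ?_
    exact contDiff_intervalIntegral_param _ _ n (contDiff_kapAux a h)
  supp x hx := by
    have : ∀ t ∈ uIcc (0:ℝ) (Real.log 2), Real.exp (a * t) * ψ (Real.exp t • x) = 0 := by
      intro t ht
      rw [uIcc_of_le (Real.log_nonneg (by norm_num))] at ht
      rw [h.supp, mul_zero]
      rw [norm_smul, Real.norm_of_nonneg (Real.exp_pos t).le]
      nlinarith [Real.add_one_le_exp t, ht.1, norm_nonneg x]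
    rw [intervalIntegral.integral_congr this]; simp

theorem krn_kap : Krn (kap (N := N)) := krn_kapAux _ krn_eta
theorem krn_kapW : Krn (kapW (N := N)) := krn_kapAux _ krn_rho

theorem dd_kapAux (a : ℝ) {ψ : Euc N → ℝ} (h : Krn ψ) (e x : Euc N) :
    dd e (fun x : Euc N => ∫ t in (0:ℝ)..Real.log 2, Real.exp (a * t) * ψ (Real.exp t • x)) x =
    ∫ t in (0:ℝ)..Real.log 2, Real.exp ((a + 1) * t) * dd e ψ (Real.exp t • x) := by
  have hF := contDiff_kapAux a h
  have h1 := hasFDerivAt_intervalIntegral_param (hF.of_le (by exact_mod_cast le_top)) 0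
    (Real.log 2) x
  have hc : Continuous fun p : Euc N × ℝ => (fderiv ℝ (fun p : Euc N × ℝ =>
      Real.exp (a * p.2) * ψ (Real.exp p.2 • p.1)) p).comp (ContinuousLinearMap.inl ℝ (Euc N) ℝ) :=
    (hF.continuous_fderiv (by simp)).clm_comp continuous_const
  rw [dd, h1.fderiv]
  refine (ContinuousLinearMap.intervalIntegral_apply
    ((hc.comp (Continuous.prodMk_right x)).intervalIntegrable _ _) e).trans ?_
  refine intervalIntegral.integral_congr fun t _ => ?_
  have h2 : HasFDerivAt (fun y : Euc N => Real.exp (a * t) * ψ (Real.exp t • y))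
      (Real.exp (a * t) • ((fderiv ℝ ψ (Real.exp t • x)).comp (Real.exp t • ContinuousLinearMap.id ℝ (Euc N)))) x := by
    refine HasFDerivAt.const_mul ?_ _
    exact (h.differentiable _).hasFDerivAt.comp x ((hasFDerivAt_id x).const_smul (Real.exp t))
  have h3 := HasFDerivAt.comp (f := fun y : Euc N => (y, t)) x
    ((hF.differentiable (by simp)) (x, t)).hasFDerivAt (hasFDerivAt_prodMk_left x t)
  refine (congrArg (fun A : Euc N →L[ℝ] ℝ => A e) (h3.unique h2)).trans ?_
  simp [dd, add_mul, Real.exp_add]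
  ring

theorem dd_kap (e x : Euc N) : dd e kap x = -(⟪x, e⟫ * kapW x) := by
  have := dd_kapAux ((N : ℝ) - 2) krn_eta e x
  change dd e kap x = _ at this
  rw [this, kapW, ← neg_mul, ← intervalIntegral.integral_const_mul]
  refine intervalIntegral.integral_congr fun t _ => ?_
  simp only [dd_eta, inner_smul_left]
  have : Real.exp ((N:ℝ) * t) = Real.exp (((N:ℝ) - 2 + 1) * t) * Real.exp t := by
    rw [← Real.exp_add]; congr 1; ring
  rw [this]; simp; ring

theorem kapW_nonneg (x : Euc N) : 0 ≤ kapW x :=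
  intervalIntegral.integral_nonneg (Real.log_nonneg (by norm_num))
    fun t _ => mul_nonneg (Real.exp_pos _).le (rho_nonneg _)
theorem kap_nonneg (x : Euc N) : 0 ≤ kap x :=
  intervalIntegral.integral_nonneg (Real.log_nonneg (by norm_num))
    fun t _ => mul_nonneg (Real.exp_pos _).le (eta_nonneg _)

theorem kapW_pos {x : Euc N} (hx : ‖x‖ < 1) : 0 < kapW x := by
  have hc : Continuous fun t : ℝ => Real.exp ((N:ℝ) * t) * rho (Real.exp t • x) :=
    (contDiff_kapAux _ krn_rho).continuous.comp (Continuous.prodMk_right x)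
  refine intervalIntegral.integral_pos (Real.log_pos (by norm_num)) hc.continuousOn
    (fun t _ => mul_nonneg (Real.exp_pos _).le (rho_nonneg _)) ⟨0, ?_, ?_⟩
  · exact ⟨le_rfl, Real.log_nonneg (by norm_num)⟩
  · simpa using rho_pos hx

theorem lap_eq_sum_dd (φ : Euc N → ℝ) (x : Euc N) :
    lap N φ x = ∑ i : Fin N, dd (EuclideanSpace.single i 1) (dd (EuclideanSpace.single i 1) φ) x :=
  rfl

theorem sum_inner_smul_single (x : Euc N) :
    ∑ i : Fin N, ⟪x, EuclideanSpace.single i (1:ℝ)⟫ • EuclideanSpace.single i (1:ℝ) = x := by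
  have := (EuclideanSpace.basisFun (Fin N) ℝ).sum_repr x
  simpa [EuclideanSpace.inner_single_right] using this

theorem lap_kap (x : Euc N) : lap N kap x = rho x - 2 ^ N * rho ((2:ℝ) • x) := by
  have hW := (krn_kapW (N := N)).differentiable
  have h1 : ∀ e : Euc N, dd e (dd e kap) x = -(⟪e, e⟫ * kapW x + ⟪x, e⟫ * dd e kapW x) := by
    intro e
    have hfun : dd e (kap (N := N)) = fun x => -(⟪x, e⟫ * kapW x) := funext (dd_kap e)
    have hi : HasFDerivAt (fun x : Euc N => ⟪x, e⟫) (innerSL ℝ e) x := by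
      have := (innerSL ℝ e).hasFDerivAt (x := x)
      refine this.congr_of_eventuallyEq (Eventually.of_forall fun y => ?_)
      simp [real_inner_comm]
    have := (hi.mul (hW x).hasFDerivAt).neg
    rw [hfun, dd]
    rw [show (fun x : Euc N => -(⟪x, e⟫ * kapW x)) = -((fun x : Euc N => ⟪x, e⟫) * kapW) from rfl,
      this.fderiv]
    simp [dd]
    ring
  have h2 : lap N kap x = -(N * kapW x) - dd x kapW x := by
    rw [lap_eq_sum_dd]
    simp_rw [h1]
    have h3 : dd x kapW x = ∑ i : Fin N, ⟪x, EuclideanSpace.single i (1:ℝ)⟫ *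
        dd (EuclideanSpace.single i (1:ℝ)) kapW x := by
      unfold dd
      conv_lhs => rw [show (fderiv ℝ kapW x) x = (fderiv ℝ kapW x) (∑ i : Fin N,
        ⟪x, EuclideanSpace.single i (1:ℝ)⟫ • EuclideanSpace.single i (1:ℝ)) by
          rw [sum_inner_smul_single]]
      simp only [map_sum, map_smul, smul_eq_mul]
    rw [h3, Finset.sum_neg_distrib, Finset.sum_add_distrib]
    simp
    ring
  have hd : ∀ t : ℝ, HasDerivAt (fun t : ℝ => Real.exp ((N:ℝ) * t) * rho (Real.exp t • x))
      (N * (Real.exp ((N:ℝ) * t) * rho (Real.exp t • x)) +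
        Real.exp (((N:ℝ) + 1) * t) * dd x rho (Real.exp t • x)) t := by
    intro t
    have a1 : HasDerivAt (fun t : ℝ => Real.exp ((N:ℝ) * t)) (Real.exp ((N:ℝ) * t) * N) t := by
      simpa using ((hasDerivAt_id t).const_mul (N:ℝ)).exp
    have a2 : HasDerivAt (fun t : ℝ => Real.exp t • x) (Real.exp t • x) t :=
      (Real.hasDerivAt_exp t).smul_const x
    have a3 := ((krn_rho.differentiable (Real.exp t • x)).hasFDerivAt).comp_hasDerivAt t a2
    refine (a1.mul a3).congr_deriv ?_
    simp only [map_smul, dd, smul_eq_mul, add_mul, Real.exp_add, one_mul, Function.comp]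
    ring
  have hc1 : Continuous fun t : ℝ => Real.exp ((N:ℝ) * t) * rho (Real.exp t • x) :=
    (contDiff_kapAux _ krn_rho).continuous.comp (Continuous.prodMk_right x)
  have hc2 : Continuous fun t : ℝ => Real.exp (((N:ℝ) + 1) * t) * dd x rho (Real.exp t • x) :=
    (contDiff_kapAux _ (krn_rho.dd x)).continuous.comp (Continuous.prodMk_right x)
  have hF := intervalIntegral.integral_eq_sub_of_hasDerivAt (a := 0) (b := Real.log 2)
    (fun t _ => hd t) (((hc1.const_mul (N:ℝ)).add hc2).intervalIntegrable _ _)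
  rw [intervalIntegral.integral_add ((hc1.const_mul (N:ℝ)).intervalIntegrable _ _)
    (hc2.intervalIntegrable _ _), intervalIntegral.integral_const_mul] at hF
  have h4 : dd x kapW x = ∫ t in (0:ℝ)..Real.log 2,
    Real.exp (((N:ℝ) + 1) * t) * dd x rho (Real.exp t • x) := dd_kapAux _ krn_rho x x
  rw [h2, h4]
  change (N:ℝ) * kapW x + _ = _ at hF
  have h5 : Real.exp ((N:ℝ) * Real.log 2) = 2 ^ N := by
    rw [mul_comm, Real.exp_mul, Real.exp_log two_pos, Real.rpow_natCast]
  rw [h5, Real.exp_log two_pos] at hF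
  simp at hF
  linarith

/-- Averaging of `f` at scale `R` against the kernel `ψ`. -/
def Tk (ψ : Euc N → ℝ) (R : ℝ) (f : Euc N → ℝ) (x : Euc N) : ℝ := ∫ y, ψ y * f (x - R • y)

theorem Tk_eq (ψ : Euc N → ℝ) {R : ℝ} (hR : 0 < R) (f : Euc N → ℝ) (x : Euc N) :
    Tk ψ R f x = (R ^ N)⁻¹ * ∫ z, f z * ψ (R⁻¹ • (x - z)) := by
  unfold Tk
  have h1 := Measure.integral_comp_smul (volume : Measure (Euc N))
    (fun y => ψ (R⁻¹ • y) * f (x - y)) R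
  simp only [inv_smul_smul₀ hR.ne', finrank_euclideanSpace_fin, smul_eq_mul] at h1
  rw [h1, abs_of_pos (by positivity)]
  congr 1
  rw [← integral_sub_left_eq_self _ _ x]
  refine integral_congr_ae (Eventually.of_forall fun z => ?_)
  simp [mul_comm]

theorem Krn.comp_scale_hasCompactSupport {ψ : Euc N → ℝ} (h : Krn ψ) {R : ℝ} (hR : 0 < R) :
    HasCompactSupport fun y => ψ (R⁻¹ • y) :=
  h.hasCompactSupport.comp_homeomorph (Homeomorph.smulOfNeZero R⁻¹ (inv_ne_zero hR.ne'))

theorem Krn.exists_bound {ψ : Euc N → ℝ} (h : Krn ψ) : ∃ C, 0 < C ∧ ∀ x, |ψ x| ≤ C := by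
  obtain ⟨C, hC⟩ := h.hasCompactSupport.exists_bound_of_continuous h.continuous
  exact ⟨max C 1, by positivity, fun x => (hC x).trans (le_max_left _ _)⟩

theorem Krn.integrable_mul {ψ : Euc N → ℝ} (h : Krn ψ) {f : Euc N → ℝ}
    (hf : LocallyIntegrable f) (R : ℝ) (hR : 0 < R) (x : Euc N) :
    Integrable fun y => ψ y * f (x - R • y) := by
  have h1 : Integrable fun z => f z * ψ (R⁻¹ • (x - z)) := by
    have hc : HasCompactSupport fun z => ψ (R⁻¹ • (x - z)) :=
      (h.comp_scale_hasCompactSupport hR).comp_homeomorph (Homeomorph.subLeft x)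
    have hcont : Continuous fun z => ψ (R⁻¹ • (x - z)) := h.continuous.comp (by fun_prop)
    simpa [mul_comm] using hf.integrable_smul_left_of_hasCompactSupport hcont hc
  have h2 : Integrable fun y => f (x - y) * ψ (R⁻¹ • y) := by
    have := h1.comp_sub_left x
    simpa using this
  have h3 := (integrable_comp_smul_iff (volume : Measure (Euc N))
    (fun y => f (x - y) * ψ (R⁻¹ • y)) hR.ne').2 h2
  simpa [inv_smul_smul₀ hR.ne', mul_comm] using h3

theorem Tk_eq_convolution (ψ : Euc N → ℝ) {R : ℝ} (hR : 0 < R) (f : Euc N → ℝ) :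
    Tk ψ R f = fun x => (R ^ N)⁻¹ *
      (convolution f (fun y => ψ (R⁻¹ • y)) (ContinuousLinearMap.mul ℝ ℝ) volume) x := by
  funext x
  rw [Tk_eq ψ hR]
  rfl

theorem Krn.comp_scale_contDiff {ψ : Euc N → ℝ} (h : Krn ψ) (R : ℝ) :
    ContDiff ℝ (⊤ : ℕ∞) fun y => ψ (R⁻¹ • y) := h.smooth.comp (contDiff_const_smul _)

theorem contDiff_Tk {ψ : Euc N → ℝ} (h : Krn ψ) {R : ℝ} (hR : 0 < R) {f : Euc N → ℝ}
    (hf : LocallyIntegrable f) : ContDiff ℝ (⊤ : ℕ∞) (Tk ψ R f) := by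
  rw [Tk_eq_convolution ψ hR]
  exact contDiff_const.mul
    ((h.comp_scale_hasCompactSupport hR).contDiff_convolution_right _ hf (h.comp_scale_contDiff R))

theorem dd_Tk {ψ : Euc N → ℝ} (h : Krn ψ) {R : ℝ} (hR : 0 < R) {f : Euc N → ℝ}
    (hf : LocallyIntegrable f) (e x : Euc N) :
    dd e (Tk ψ R f) x = R⁻¹ * Tk (dd e ψ) R f x := by
  have h1 := ((h.comp_scale_hasCompactSupport hR).hasFDerivAt_convolution_right
    (ContinuousLinearMap.mul ℝ ℝ) hf ((h.comp_scale_contDiff R).of_le (by exact_mod_cast le_top)) x).const_mul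
      (R ^ N)⁻¹
  rw [Tk_eq_convolution ψ hR, dd, h1.fderiv]
  have h2 : ∀ z, fderiv ℝ (fun y => ψ (R⁻¹ • y)) z = R⁻¹ • fderiv ℝ ψ (R⁻¹ • z) := by
    intro z
    exact fderiv_comp_smul _
  rw [smul_apply, convolution_precompR_apply _ hf
    ((h.comp_scale_hasCompactSupport hR).fderiv ℝ)
    ((h.comp_scale_contDiff R).continuous_fderiv (by simp)), Tk_eq _ hR]
  simp only [convolution_def, h2, smul_apply, smul_eq_mul, dd,
    ContinuousLinearMap.mul_apply']
  rw [← integral_const_mul, ← integral_const_mul, ← integral_const_mul]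
  refine integral_congr_ae (Eventually.of_forall fun z => ?_)
  simp
  ring

theorem dd_Tk' {ψ : Euc N → ℝ} (h : Krn ψ) {R : ℝ} {u : Euc N → ℝ}
    (hu : ContDiff ℝ 1 u) (e x : Euc N) :
    dd e (Tk ψ R u) x = Tk ψ R (dd e u) x := by
  have hcd : Continuous (fderiv ℝ u) := hu.continuous_fderiv one_ne_zero
  have hcF : Continuous fun p : Euc N × Euc N => ψ p.2 • fderiv ℝ u (p.1 - R • p.2) :=
    (h.continuous.comp continuous_snd).smul (hcd.comp (by fun_prop))
  have hsupp : ∀ x, Integrable fun y => ψ y • fderiv ℝ u (x - R • y) := fun x =>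
    (hcF.comp (Continuous.prodMk_right x)).integrable_of_hasCompactSupport
      h.hasCompactSupport.smul_right
  obtain ⟨C, hC⟩ := ((isCompact_closedBall x 1).prod (isCompact_closedBall (0 : Euc N) 1)).exists_bound_of_continuousOn hcF.continuousOn
  have h1 : HasFDerivAt (Tk ψ R u) (∫ y, ψ y • fderiv ℝ u (x - R • y)) x := by
    refine hasFDerivAt_integral_of_dominated_of_fderiv_le
      (F' := fun x y => ψ y • fderiv ℝ u (x - R • y))
      (bound := (closedBall (0 : Euc N) 1).indicator fun _ => C)
      (ball_mem_nhds x one_pos) ?_ ?_ ?_ ?_ ?_ ?_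
    · refine Eventually.of_forall fun y => Continuous.aestronglyMeasurable ?_
      exact h.continuous.mul (hu.continuous.comp (by fun_prop))
    · refine Continuous.integrable_of_hasCompactSupport ?_ h.hasCompactSupport.mul_right
      exact h.continuous.mul (hu.continuous.comp (by fun_prop))
    · exact (hsupp x).aestronglyMeasurable
    · refine Eventually.of_forall fun y z hz => ?_
      by_cases hy : y ∈ closedBall (0 : Euc N) 1
      · rw [indicator_of_mem hy]
        exact hC (z, y) ⟨ball_subset_closedBall hz, hy⟩
      · rw [indicator_of_notMem hy]
        rw [mem_closedBall_zero_iff, not_le] at hy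
        simp [h.supp y hy.le]
    · exact (integrable_indicator_iff isClosed_closedBall.measurableSet).2
        (integrableOn_const (measure_closedBall_lt_top).ne)
    · refine Eventually.of_forall fun y z _ => ?_
      have := (((hu.differentiable one_ne_zero) (z - R • y)).hasFDerivAt.comp z
        ((hasFDerivAt_id z).sub_const (R • y))).const_mul (ψ y)
      simpa using this
  rw [dd, h1.fderiv, ContinuousLinearMap.integral_apply (hsupp x)]
  rfl

theorem Tk_resc (ψ : Euc N → ℝ) (R r : ℝ) (f : Euc N → ℝ) (z x : Euc N) :
    Tk ψ R (fun y => f (z + r • y)) x = Tk ψ (r * R) f (z + r • x) := by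
  unfold Tk
  simp only [smul_sub, smul_smul, add_sub_assoc]

theorem Tk_const_mul (ψ : Euc N → ℝ) (R c : ℝ) (f : Euc N → ℝ) (x : Euc N) :
    Tk ψ R (fun y => c * f y) x = c * Tk ψ R f x := by
  unfold Tk
  rw [← integral_const_mul]
  congr 1; funext y; ring

theorem Tk_kernel_mul (ψ : Euc N → ℝ) (R c : ℝ) (f : Euc N → ℝ) (x : Euc N) :
    Tk (fun y => c * ψ y) R f x = c * Tk ψ R f x := by
  unfold Tk
  rw [← integral_const_mul]
  congr 1; funext y; ring

theorem Tk_kernel_scale (ψ : Euc N → ℝ) (R c : ℝ) (hc : 0 < c) (f : Euc N → ℝ) (x : Euc N) :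
    Tk (fun y => ψ (c • y)) R f x = (c ^ N)⁻¹ * Tk ψ (R / c) f x := by
  unfold Tk
  have h1 := Measure.integral_comp_smul (volume : Measure (Euc N))
    (fun y => ψ y * f (x - (R / c) • y)) c
  simp only [finrank_euclideanSpace_fin, smul_eq_mul] at h1
  rw [abs_of_pos (by positivity)] at h1
  rw [← h1]
  congr 1; funext y
  rw [smul_smul, div_mul_cancel₀ _ hc.ne']

theorem Tk_sub_kernel {ψ χ : Euc N → ℝ} (h : Krn ψ) (h' : Krn χ) {R : ℝ} (hR : 0 < R)
    {f : Euc N → ℝ} (hf : LocallyIntegrable f) (x : Euc N) :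
    Tk (fun y => ψ y - χ y) R f x = Tk ψ R f x - Tk χ R f x := by
  unfold Tk
  rw [← integral_sub (h.integrable_mul hf R hR x) (h'.integrable_mul hf R hR x)]
  congr 1; funext y; ring

theorem Tk_sum_kernel {ι : Type*} (s : Finset ι) {ψ : ι → Euc N → ℝ} (h : ∀ i, Krn (ψ i)) {R : ℝ}
    (hR : 0 < R) {f : Euc N → ℝ} (hf : LocallyIntegrable f) (x : Euc N) :
    Tk (fun y => ∑ i ∈ s, ψ i y) R f x = ∑ i ∈ s, Tk (ψ i) R f x := by
  unfold Tk
  rw [← integral_finsetSum _ fun i _ => (h i).integrable_mul hf R hR x]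
  congr 1; funext y; rw [Finset.sum_mul]

theorem Tk_sub {ψ : Euc N → ℝ} (h : Krn ψ) {R : ℝ} (hR : 0 < R)
    {f g : Euc N → ℝ} (hf : LocallyIntegrable f) (hg : LocallyIntegrable g) (x : Euc N) :
    Tk ψ R (fun y => f y - g y) x = Tk ψ R f x - Tk ψ R g x := by
  unfold Tk
  rw [← integral_sub (h.integrable_mul hf R hR x) (h.integrable_mul hg R hR x)]
  congr 1; funext y; ring

/-- The average only depends on the values in the open ball. -/
theorem Tk_congr {ψ : Euc N → ℝ} (h : Krn ψ) {R : ℝ} (hR : 0 < R) {f g : Euc N → ℝ} {x : Euc N}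
    (hfg : ∀ y ∈ ball x R, f y = g y) : Tk ψ R f x = Tk ψ R g x := by
  unfold Tk
  congr 1; funext y
  rcases le_or_gt 1 ‖y‖ with hy | hy
  · simp [h.supp y hy]
  · rw [hfg]
    rw [mem_ball, dist_eq_norm, sub_sub_cancel_left, norm_neg, norm_smul, Real.norm_of_nonneg hR.le]
    nlinarith

theorem mem_ball_sub_smul {R : ℝ} (hR : 0 < R) {x y : Euc N} (hy : ‖y‖ < 1) :
    x - R • y ∈ ball x R := by
  rw [mem_ball, dist_eq_norm, sub_sub_cancel_left, norm_neg, norm_smul, Real.norm_of_nonneg hR.le]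
  nlinarith

theorem Tk_const {ψ : Euc N → ℝ} (R c : ℝ) (x : Euc N) :
    Tk ψ R (fun _ => c) x = (∫ y, ψ y) * c := by
  unfold Tk; rw [integral_mul_const]

theorem abs_Tk_le {ψ : Euc N → ℝ} (h : Krn ψ) {R : ℝ} (hR : 0 < R) {f : Euc N → ℝ} {x : Euc N}
    {A : ℝ} (hA : ∀ y ∈ ball x R, |f y| ≤ A) : |Tk ψ R f x| ≤ (∫ y, |ψ y|) * A := by
  unfold Tk
  rw [← integral_mul_const, ← Real.norm_eq_abs]
  refine norm_integral_le_of_norm_le (h.integrable.abs.mul_const _)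
    (Eventually.of_forall fun y => ?_)
  rw [Real.norm_eq_abs, abs_mul]
  rcases le_or_gt 1 ‖y‖ with hy | hy
  · simp [h.supp y hy]
  · exact mul_le_mul_of_nonneg_left (hA _ (mem_ball_sub_smul hR hy)) (abs_nonneg _)

theorem Krn.integral_abs_le {ψ : Euc N → ℝ} (h : Krn ψ) {C : ℝ} (hC : ∀ x, |ψ x| ≤ C) :
    ∫ y, |ψ y| ≤ C * volume.real (closedBall (0 : Euc N) 1) := by
  have : ∀ y, |ψ y| = (closedBall (0 : Euc N) 1).indicator (fun y => |ψ y|) y := by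
    intro y
    by_cases hy : y ∈ closedBall (0 : Euc N) 1
    · rw [indicator_of_mem hy]
    · rw [indicator_of_notMem hy]
      rw [mem_closedBall_zero_iff, not_le] at hy
      simp [h.supp y hy.le]
  rw [integral_congr_ae (Eventually.of_forall this), integral_indicator measurableSet_closedBall]
  calc _ ≤ ∫ y in closedBall (0 : Euc N) 1, C :=
        setIntegral_mono h.integrable.abs.integrableOn
          (integrableOn_const (measure_closedBall_lt_top).ne) hC
    _ = _ := by rw [setIntegral_const, smul_eq_mul, mul_comm]

/-- Bound of an average of a bounded function supported in `Λ` by the measure of `Λ`. -/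
theorem abs_Tk_indicator_le {ψ : Euc N → ℝ} (h : Krn ψ) {C : ℝ} (hC : ∀ x, |ψ x| ≤ C) {R : ℝ}
    (hR : 0 < R) {Λ : Set (Euc N)} (hΛ : MeasurableSet Λ) {f : Euc N → ℝ} {A : ℝ} (hA : 0 ≤ A)
    (hfA : ∀ y, |f y| ≤ Λ.indicator (fun _ => A) y) (x : Euc N) :
    |Tk ψ R f x| ≤ C * A * (R ^ N)⁻¹ * volume.real (Λ ∩ ball x R) := by
  rw [Tk_eq ψ hR, abs_mul, abs_of_pos (by positivity : 0 < (R ^ N)⁻¹)]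
  have hC0 : 0 ≤ C := (abs_nonneg _).trans (hC 0)
  have : |∫ z, f z * ψ (R⁻¹ • (x - z))| ≤ ∫ z, (Λ ∩ ball x R).indicator (fun _ => C * A) z := by
    rw [← Real.norm_eq_abs]
    refine norm_integral_le_of_norm_le ?_ (Eventually.of_forall fun z => ?_)
    · exact (integrable_indicator_iff (hΛ.inter measurableSet_ball)).2
        (integrableOn_const (measure_lt_top_of_subset inter_subset_right measure_ball_lt_top.ne).ne)
    · rw [Real.norm_eq_abs, abs_mul]
      by_cases hz : z ∈ Λ
      · by_cases hz2 : z ∈ ball x R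
        · rw [indicator_of_mem (show z ∈ Λ ∩ ball x R from ⟨hz, hz2⟩), mul_comm]
          have := hfA z
          rw [indicator_of_mem hz] at this
          exact mul_le_mul (hC _) this (abs_nonneg _) hC0
        · rw [h.supp, abs_zero, mul_zero]
          · exact indicator_nonneg (fun _ _ => by positivity) _
          · rw [mem_ball, not_lt, dist_comm, dist_eq_norm] at hz2
            rw [norm_smul, norm_inv, Real.norm_of_nonneg hR.le, inv_mul_eq_div, one_le_div hR]
            exact hz2
      · have := hfA z
        rw [indicator_of_notMem hz] at this
        have : |f z| = 0 := le_antisymm this (abs_nonneg _)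
        rw [this, zero_mul]
        exact indicator_nonneg (fun _ _ => by positivity) _
  rw [integral_indicator (hΛ.inter measurableSet_ball), setIntegral_const, smul_eq_mul] at this
  calc _ ≤ (R ^ N)⁻¹ * (volume.real (Λ ∩ ball x R) * (C * A)) := by gcongr
    _ = _ := by ring

theorem tendsto_Tk_rho {u : Euc N → ℝ} (hu : Continuous u) (x : Euc N) :
    Tendsto (fun R => Tk rho R u x) (nhdsWithin 0 (Ioi 0)) (nhds (u x)) := by
  rw [Metric.tendsto_nhds]
  intro ε hε
  obtain ⟨δ, hδ, h⟩ := Metric.continuous_iff.1 hu x (ε / 2) (by positivity)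
  filter_upwards [Ioo_mem_nhdsGT hδ] with R hR
  have h1 : Tk rho R u x - u x = Tk rho R (fun y => u y - u x) x := by
    rw [Tk_sub krn_rho hR.1 hu.locallyIntegrable continuous_const.locallyIntegrable, Tk_const,
      integral_rho, one_mul]
  rw [Real.dist_eq, h1]
  have := abs_Tk_le krn_rho hR.1 (f := fun y => u y - u x) (x := x) (A := ε / 2)
    (fun y hy => (h y ((mem_ball.1 hy).trans hR.2)).le)
  have h2 : ∫ y : Euc N, |rho y| = 1 := by
    rw [← integral_rho (N := N)]; congr 1; funext y; exact abs_of_nonneg (rho_nonneg y)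
  rw [h2] at this
  linarith

theorem contDiff_dd {V : Type*} [NormedAddCommGroup V] [NormedSpace ℝ V] {φ : V → ℝ} (h : ContDiff ℝ (⊤ : ℕ∞) φ) (e : V) :
    ContDiff ℝ (⊤ : ℕ∞) (dd e φ) :=
  (h.fderiv_right (m := (⊤ : ℕ∞)) (by simp)).clm_apply contDiff_const

theorem dd_comm {V : Type*} [NormedAddCommGroup V] [NormedSpace ℝ V] {φ : V → ℝ}
    (h : ContDiff ℝ (⊤ : ℕ∞) φ) (a b : V) :
    dd a (dd b φ) = dd b (dd a φ) := by
  funext x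
  have hd : DifferentiableAt ℝ (fderiv ℝ φ) x :=
    ((h.fderiv_right (m := (⊤ : ℕ∞)) (by simp)).differentiable (by simp)) x
  have key : ∀ a b : V, dd a (dd b φ) x = fderiv ℝ (fderiv ℝ φ) x a b := by
    intro a b
    have : HasFDerivAt (dd b φ) ((ContinuousLinearMap.apply ℝ ℝ b).comp (fderiv ℝ (fderiv ℝ φ) x)) x :=
      (ContinuousLinearMap.apply ℝ ℝ b).hasFDerivAt.comp x hd.hasFDerivAt
    rw [dd, this.fderiv]
    simp
  rw [key, key]
  have := h.contDiffAt.isSymmSndFDerivAt (x := x)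
    (by rw [minSmoothness_of_isRCLikeNormedField]; exact WithTop.coe_le_coe.2 (le_top (a := (2 : ℕ∞))))
  exact this a b

theorem dd_sum {V : Type*} [NormedAddCommGroup V] [NormedSpace ℝ V] {ι : Type*} (s : Finset ι)
    {φ : ι → V → ℝ} (h : ∀ i, Differentiable ℝ (φ i)) (a : V) :
    dd a (fun x => ∑ i ∈ s, φ i x) = fun x => ∑ i ∈ s, dd a (φ i) x := by
  funext x
  unfold dd
  rw [fderiv_fun_sum fun i _ => h i x]
  simp

theorem dd_lap_comm {φ : Euc N → ℝ} (h : ContDiff ℝ (⊤ : ℕ∞) φ) (e : Euc N) :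
    dd e (lap N φ) = lap N (dd e φ) := by
  have h1 : lap N φ = fun x => ∑ i : Fin N, dd (EuclideanSpace.single i 1)
    (dd (EuclideanSpace.single i 1) φ) x := rfl
  rw [h1, dd_sum _ fun i => (contDiff_dd (contDiff_dd h _) _).differentiable (by simp)]
  funext x
  rw [lap_eq_sum_dd]
  refine Finset.sum_congr rfl fun i _ => ?_
  rw [dd_comm (contDiff_dd h _) e, dd_comm h e]

theorem dd_comp_affine {ψ : Euc N → ℝ} (c : ℝ) (x e z : Euc N) :
    dd e (fun y => ψ (c • (x - y))) z = -c * dd e ψ (c • (x - z)) := by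
  have h1 : (fun y => ψ (c • (x - y))) = fun y => (fun w => ψ ((-c) • w)) (y - x) := by
    funext y; simp only [neg_smul, ← smul_neg, neg_sub]
  rw [dd, h1, fderiv_comp_sub (f := fun w => ψ ((-c) • w)), fderiv_comp_smul]
  simp only [neg_smul, ← smul_neg, neg_sub, dd, smul_apply, neg_apply, smul_eq_mul, neg_mul]
  ring

theorem dd_const_mul {V : Type*} [NormedAddCommGroup V] [NormedSpace ℝ V] (φ : V → ℝ) (c : ℝ) (e : V) :
    dd e (fun x => c * φ x) = fun x => c * dd e φ x := by
  funext x
  change fderiv ℝ (c • φ) x e = _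
  rw [fderiv_const_smul_field]
  simp [dd]

theorem dd_scale {ψ : Euc N → ℝ} (c : ℝ) (e : Euc N) :
    dd e (fun y => ψ (c • y)) = fun z => c * dd e ψ (c • z) := by
  funext z
  rw [dd, fderiv_comp_smul]
  simp [dd]

theorem lap_comp_affine {ψ : Euc N → ℝ} (c : ℝ) (x z : Euc N) :
    lap N (fun y => ψ (c • (x - y))) z = c ^ 2 * lap N ψ (c • (x - z)) := by
  rw [lap_eq_sum_dd, lap_eq_sum_dd, Finset.mul_sum]
  refine Finset.sum_congr rfl fun i _ => ?_
  have : dd (EuclideanSpace.single i 1) (fun y => ψ (c • (x - y))) =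
      fun z => (-c) * dd (EuclideanSpace.single i 1) ψ (c • (x - z)) :=
    funext fun z => dd_comp_affine c x _ z
  rw [this, dd_const_mul]
  simp only [dd_comp_affine]
  ring

/-- `Δu = f` in `D` in the sense of distributions. -/
def WeakLap (u f : Euc N → ℝ) (D : Set (Euc N)) : Prop :=
  ∀ φ : Euc N → ℝ, ContDiff ℝ (⊤ : ℕ∞) φ → HasCompactSupport φ → tsupport φ ⊆ D →
    ∫ x, u x * lap N φ x = ∫ x, f x * φ x

theorem WeakLap.mono {u f : Euc N → ℝ} {D D' : Set (Euc N)} (h : WeakLap u f D) (hD : D' ⊆ D) :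
    WeakLap u f D' := fun φ h1 h2 h3 => h φ h1 h2 (h3.trans hD)

theorem WeakLap.congr {u f g : Euc N → ℝ} {D : Set (Euc N)} (h : WeakLap u f D)
    (hfg : ∀ x ∈ D, f x = g x) : WeakLap u g D := by
  intro φ h1 h2 h3
  rw [h φ h1 h2 h3]
  congr 1; funext x
  by_cases hx : x ∈ D
  · rw [hfg x hx]
  · rw [image_eq_zero_of_notMem_tsupport fun h => hx (h3 h)]; simp

theorem tsupport_comp_affine {ψ : Euc N → ℝ} (h : Krn ψ) {R : ℝ} (hR : 0 < R) (x : Euc N) :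
    tsupport (fun y => ψ (R⁻¹ • (x - y))) ⊆ closedBall x R := by
  refine closure_minimal (fun y hy => ?_) isClosed_closedBall
  by_contra hn
  refine hy (h.supp _ ?_)
  rw [mem_closedBall, not_le, dist_comm, dist_eq_norm] at hn
  rw [norm_smul, norm_inv, Real.norm_of_nonneg hR.le, inv_mul_eq_div, one_le_div hR]
  exact hn.le

theorem WeakLap.Tk_lap {u f : Euc N → ℝ} {D : Set (Euc N)} (h : WeakLap u f D) {ψ : Euc N → ℝ}
    (hψ : Krn ψ) {R : ℝ} (hR : 0 < R) {x : Euc N} (hx : closedBall x R ⊆ D) :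
    Tk (lap N ψ) R u x = R ^ 2 * Tk ψ R f x := by
  have h1 := h (fun y => ψ (R⁻¹ • (x - y))) (hψ.smooth.comp (by fun_prop))
    ((isCompact_closedBall x R).of_isClosed_subset (isClosed_tsupport _)
      (tsupport_comp_affine hψ hR x)) ((tsupport_comp_affine hψ hR x).trans hx)
  simp only [lap_comp_affine] at h1
  rw [Tk_eq _ hR, Tk_eq _ hR, ← h1, ← integral_const_mul, ← integral_const_mul,
    ← integral_const_mul]
  congr 1; funext z
  have := hR.ne'
  field_simp

/-- The second directional derivative of the mollification of `u` at scale `R`. -/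
def Hes (R : ℝ) (u : Euc N → ℝ) (e x : Euc N) : ℝ := (R ^ 2)⁻¹ * Tk (dd e (dd e rho)) R u x

theorem Hes_eq_dd_dd {R : ℝ} (hR : 0 < R) {u : Euc N → ℝ} (hu : LocallyIntegrable u) (e x : Euc N) :
    Hes R u e x = dd e (dd e (Tk rho R u)) x := by
  have : dd e (Tk rho R u) = fun x => R⁻¹ * Tk (dd e rho) R u x :=
    funext fun x => dd_Tk krn_rho hR hu e x
  rw [this, dd_const_mul]
  simp only [dd_Tk (krn_rho.dd e) hR hu]
  rw [Hes]; field_simp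

theorem dd_Tk_rho_eq {R : ℝ} {u : Euc N → ℝ} (hu : ContDiff ℝ 1 u) (e : Euc N) :
    dd e (Tk rho R u) = Tk rho R (dd e u) := funext fun x => dd_Tk' krn_rho hu e x

theorem continuous_dd {u : Euc N → ℝ} (hu : ContDiff ℝ 1 u) (e : Euc N) : Continuous (dd e u) :=
  (hu.continuous_fderiv one_ne_zero).clm_apply continuous_const

theorem Hes_eq_dd_Tk {R : ℝ} (hR : 0 < R) {u : Euc N → ℝ} (hu : ContDiff ℝ 1 u) (e x : Euc N) :
    Hes R u e x = dd e (Tk rho R (dd e u)) x := by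
  rw [Hes_eq_dd_dd hR hu.continuous.locallyIntegrable, dd_Tk_rho_eq hu]

theorem Hes_eq_Tk_dd {R : ℝ} (hR : 0 < R) {u : Euc N → ℝ} (hu : ContDiff ℝ 1 u) (e x : Euc N) :
    Hes R u e x = R⁻¹ * Tk (dd e rho) R (dd e u) x := by
  rw [Hes_eq_dd_Tk hR hu, dd_Tk krn_rho hR (continuous_dd hu e).locallyIntegrable]

theorem lap_dd_dd_kap (e : Euc N) : lap N (dd e (dd e kap)) = fun x =>
    dd e (dd e rho) x - 2 ^ N * 4 * dd e (dd e rho) ((2:ℝ) • x) := by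
  rw [← dd_lap_comm (krn_kap.dd e).smooth, ← dd_lap_comm krn_kap.smooth]
  have h0 : lap N kap = fun x : Euc N => rho x - 2 ^ N * rho ((2:ℝ) • x) := funext lap_kap
  have hd : ∀ {φ χ : Euc N → ℝ}, Krn φ → Krn χ → ∀ c : ℝ, dd e (fun x => φ x - c * χ ((2:ℝ) • x)) =
      fun x => dd e φ x - c * 2 * dd e χ ((2:ℝ) • x) := by
    intro φ χ hφ hχ c
    funext x
    have hχ' : DifferentiableAt ℝ (fun x => c * χ ((2:ℝ) • x)) x :=
      ((hχ.smooth.comp (contDiff_const_smul (2:ℝ))).differentiable (by simp) x).const_mul c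
    rw [dd, fderiv_fun_sub (hφ.differentiable x) hχ']
    change dd e φ x - dd e (fun x => c * χ ((2:ℝ) • x)) x = _
    rw [dd_const_mul, dd_scale]
    ring
  rw [h0, hd krn_rho krn_rho, hd (krn_rho.dd e) (krn_rho.dd e)]
  funext x; ring

theorem Krn.scale_two {ψ : Euc N → ℝ} (h : Krn ψ) (c : ℝ) : Krn fun y => c * ψ ((2:ℝ) • y) where
  smooth := contDiff_const.mul (h.smooth.comp (contDiff_const_smul (2:ℝ)))
  supp x hx := by
    rw [h.supp, mul_zero]
    rw [norm_smul]; norm_num; linarith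

theorem WeakLap.Hes_sub {u f : Euc N → ℝ} {D : Set (Euc N)} (h : WeakLap u f D)
    (hu : LocallyIntegrable u) {R : ℝ} (hR : 0 < R) {x : Euc N} (hx : closedBall x R ⊆ D)
    (e : Euc N) :
    Hes R u e x - Hes (R / 2) u e x = Tk (dd e (dd e kap)) R f x := by
  have h1 := h.Tk_lap ((krn_kap.dd e).dd e) hR hx
  rw [lap_dd_dd_kap, Tk_sub_kernel ((krn_rho.dd e).dd e) (((krn_rho.dd e).dd e).scale_two _) hR hu,
    Tk_kernel_mul (fun y => dd e (dd e rho) ((2:ℝ) • y)),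
    Tk_kernel_scale _ _ _ two_pos] at h1
  rw [Hes, Hes]
  have h2 : Tk (dd e (dd e kap)) R f x = (R ^ 2)⁻¹ * (R ^ 2 * Tk (dd e (dd e kap)) R f x) := by
    field_simp
  rw [h2, ← h1]
  field_simp
  ring

theorem WeakLap.Tk_rho_sub {u f : Euc N → ℝ} {D : Set (Euc N)} (h : WeakLap u f D)
    (hu : LocallyIntegrable u) {R : ℝ} (hR : 0 < R) {x : Euc N} (hx : closedBall x R ⊆ D) :
    Tk rho R u x - Tk rho (R / 2) u x = R ^ 2 * Tk kap R f x := by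
  have h1 := h.Tk_lap krn_kap hR hx
  have h0 : lap N kap = fun x : Euc N => rho x - 2 ^ N * rho ((2:ℝ) • x) := funext lap_kap
  rw [h0, Tk_sub_kernel krn_rho (krn_rho.scale_two _) hR hu,
    Tk_kernel_mul (fun y => rho ((2:ℝ) • y)), Tk_kernel_scale _ _ _ two_pos] at h1
  rw [← h1]
  field_simp

theorem WeakLap.sum_Hes {u f : Euc N → ℝ} {D : Set (Euc N)} (h : WeakLap u f D)
    (hu : LocallyIntegrable u) {R : ℝ} (hR : 0 < R) {x : Euc N} (hx : closedBall x R ⊆ D) :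
    ∑ i : Fin N, Hes R u (EuclideanSpace.single i 1) x = Tk rho R f x := by
  have h1 := h.Tk_lap krn_rho hR hx
  have h0 : lap N rho = fun x : Euc N => ∑ i : Fin N, dd (EuclideanSpace.single i 1)
    (dd (EuclideanSpace.single i 1) rho) x := rfl
  rw [h0, Tk_sum_kernel _ (fun i => (krn_rho.dd _).dd _) hR hu] at h1
  simp only [Hes]
  rw [← Finset.mul_sum, h1]
  field_simp

theorem integral_dd_eq_zero {f : Euc N → ℝ} (hf : ContDiff ℝ 1 f) (hc : HasCompactSupport f)
    (a : Euc N) : ∫ x, dd a f x = 0 := by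
  have h := integral_mul_fderiv_eq_neg_fderiv_mul_of_integrable (μ := (volume : Measure (Euc N)))
    (f := fun _ => (1 : ℝ)) (g := f) (v := a) (by simp)
    (by
      simp only [one_mul]
      exact (continuous_dd hf a).integrable_of_hasCompactSupport (hc.fderiv_apply (𝕜 := ℝ) a))
    (by simpa using hf.continuous.integrable_of_hasCompactSupport hc)
    (fun x _ => differentiableAt_const _) (fun x _ => hf.differentiable one_ne_zero x)
  simpa [dd] using h

theorem dd_mul {f g : Euc N → ℝ} {x : Euc N} (hf : DifferentiableAt ℝ f x)
    (hg : DifferentiableAt ℝ g x) (a : Euc N) :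
    dd a (fun y => f y * g y) x = f x * dd a g x + dd a f x * g x := by
  rw [dd, fderiv_fun_mul hf hg]
  simp [dd]; ring

theorem dd_eq_sum (f : Euc N → ℝ) (e x : Euc N) :
    dd e f x = ∑ i : Fin N, e i * dd (EuclideanSpace.single i 1) f x := by
  conv_lhs => rw [← sum_inner_smul_single e]
  simp only [dd, map_sum, map_smul, smul_eq_mul]
  exact Finset.sum_congr rfl fun i _ => by simp [EuclideanSpace.inner_single_right]

/-- Squared length of the gradient. -/
def gsq (v : Euc N → ℝ) (x : Euc N) : ℝ := ∑ i : Fin N, dd (EuclideanSpace.single i 1) v x ^ 2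

theorem gsq_nonneg (v : Euc N → ℝ) (x : Euc N) : 0 ≤ gsq v x := Finset.sum_nonneg fun _ _ => sq_nonneg _

theorem dd_sq_le_gsq (v : Euc N → ℝ) {e : Euc N} (he : ‖e‖ = 1) (x : Euc N) :
    dd e v x ^ 2 ≤ gsq v x := by
  rw [dd_eq_sum]
  refine (Finset.sum_mul_sq_le_sq_mul_sq _ _ _).trans ?_
  rw [← EuclideanSpace.real_norm_sq_eq, he, one_pow, one_mul, gsq]

theorem abs_apply_le_one {e : Euc N} (he : ‖e‖ = 1) (i : Fin N) : |e i| ≤ 1 := by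
  rw [← he]; exact PiLp.norm_apply_le e i

theorem dd_dd_eq_sum {Z : Euc N → ℝ} (h : ContDiff ℝ (⊤ : ℕ∞) Z) (a b x : Euc N) :
    dd a (dd b Z) x = ∑ i : Fin N, ∑ j : Fin N,
      a i * (b j * dd (EuclideanSpace.single i 1) (dd (EuclideanSpace.single j 1) Z) x) := by
  rw [dd_eq_sum]
  refine Finset.sum_congr rfl fun i _ => ?_
  have : dd b Z = fun x => ∑ j : Fin N, b j * dd (EuclideanSpace.single j 1) Z x :=
    funext fun x => dd_eq_sum Z b x
  rw [this, dd_sum]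
  · rw [Finset.mul_sum]
    refine Finset.sum_congr rfl fun j _ => ?_
    rw [dd_const_mul]
  · intro j
    exact ((contDiff_dd h _).differentiable (by simp)).const_mul _

theorem Krn.exists_bound_dd_dd {Z : Euc N → ℝ} (h : Krn Z) :
    ∃ C, 0 < C ∧ ∀ a b : Euc N, ‖a‖ = 1 → ‖b‖ = 1 → ∀ x, |_root_.dd a (_root_.dd b Z) x| ≤ C := by
  choose C hC0 hC using fun p : Fin N × Fin N =>
    ((h.dd (EuclideanSpace.single p.2 1)).dd (EuclideanSpace.single p.1 1)).exists_bound
  refine ⟨1 + ∑ i : Fin N, ∑ j : Fin N, C (i, j), by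
    have := Finset.sum_nonneg fun i (_ : i ∈ Finset.univ) =>
      Finset.sum_nonneg fun j (_ : j ∈ (Finset.univ : Finset (Fin N))) => (hC0 (i, j)).le
    linarith, fun a b ha hb x => ?_⟩
  rw [dd_dd_eq_sum h.smooth]
  have : ∀ i j, |a i * (b j * _root_.dd (EuclideanSpace.single i 1)
      (_root_.dd (EuclideanSpace.single j 1) Z) x)| ≤ C (i, j) := by
    intro i j
    rw [abs_mul, abs_mul]
    have h1 := abs_apply_le_one ha i
    have h2 := abs_apply_le_one hb j
    have h3 := hC (i, j) x
    have h4 := abs_nonneg (a i)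
    have h5 := abs_nonneg (b j)
    calc _ ≤ 1 * (1 * C (i, j)) := by gcongr
      _ = C (i, j) := by ring
  refine (Finset.abs_sum_le_sum_abs _ _).trans ?_
  refine (Finset.sum_le_sum fun i _ => (Finset.abs_sum_le_sum_abs _ _).trans
    (Finset.sum_le_sum fun j _ => this i j)).trans ?_
  linarith

theorem Krn.integrable_cmul {Z : Euc N → ℝ} (h : Krn Z) {f : Euc N → ℝ} (hf : Continuous f) :
    Integrable fun x => Z x * f x :=
  (h.continuous.mul hf).integrable_of_hasCompactSupport h.hasCompactSupport.mul_right

theorem Krn.integral_dd_mul {Z : Euc N → ℝ} (h : Krn Z) {f : Euc N → ℝ} (hf : ContDiff ℝ 1 f)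
    (a : Euc N) : ∫ x, _root_.dd a (fun y => Z y * f y) x = 0 :=
  integral_dd_eq_zero ((h.smooth.of_le (by exact_mod_cast le_top)).mul hf)
    h.hasCompactSupport.mul_right a

/-- The integrated identity behind the `L²` theory of `Δ`, one term. -/
theorem integral_comm_identity {Z : Euc N → ℝ} (h : Krn Z) {v : Euc N → ℝ}
    (hv : ContDiff ℝ (⊤ : ℕ∞) v) (i e : Euc N) :
    ∫ x, Z x * (dd i (dd i v) x * dd e (dd e v) x - dd i (dd e v) x ^ 2) =
    ∫ x, (dd i (dd e Z) x * (dd i v x * dd e v x) - dd e (dd e Z) x * dd i v x ^ 2 / 2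
      - dd i (dd i Z) x * dd e v x ^ 2 / 2) := by
  have c1 : ∀ {f : Euc N → ℝ}, ContDiff ℝ (⊤ : ℕ∞) f → ContDiff ℝ 1 f := fun hf =>
    hf.of_le (by exact_mod_cast le_top)
  have sv := fun a => contDiff_dd hv a
  have sv2 := fun a b => contDiff_dd (contDiff_dd hv a) b
  have d1 := h.integral_dd_mul (c1 ((sv i).mul (sv2 e e))) i
  have d2 := h.integral_dd_mul (c1 ((sv i).mul (sv2 e i))) e
  have d3 := (h.dd e).integral_dd_mul (c1 ((sv i).mul (sv i))) e
  have d4 := (h.dd i).integral_dd_mul (c1 ((sv i).mul (sv e))) e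
  have d5 := (h.dd i).integral_dd_mul (c1 ((sv e).mul (sv e))) i
  have I : ∀ {Y f : Euc N → ℝ}, Krn Y → ContDiff ℝ (⊤ : ℕ∞) f → ∀ a,
      Integrable fun x => dd a (fun y => Y y * f y) x := by
    intro Y f hY hf a
    have := hY.smooth.mul hf
    exact (contDiff_dd this a).continuous.integrable_of_hasCompactSupport
      (hY.hasCompactSupport.mul_right.fderiv_apply (𝕜 := ℝ) a)
  have i1 := I h ((sv i).mul (sv2 e e)) i
  have i2 := I h ((sv i).mul (sv2 e i)) e
  have i3 := I (h.dd e) ((sv i).mul (sv i)) e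
  have i4 := I (h.dd i) ((sv i).mul (sv e)) e
  have i5 := I (h.dd i) ((sv e).mul (sv e)) i
  rw [← sub_eq_zero, ← integral_sub]
  · calc _ = ∫ x, ((dd i (fun y => Z y * (dd i v y * dd e (dd e v) y)) x
            - dd e (fun y => Z y * (dd i v y * dd i (dd e v) y)) x)
            + (1/2) * dd e (fun y => dd e Z y * (dd i v y * dd i v y)) x
            - dd e (fun y => dd i Z y * (dd i v y * dd e v y)) x
            + (1/2) * dd i (fun y => dd i Z y * (dd e v y * dd e v y)) x) := by
          congr 1; funext x
          have D : ∀ {f : Euc N → ℝ}, ContDiff ℝ (⊤ : ℕ∞) f → DifferentiableAt ℝ f x := fun hf =>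
            hf.differentiable (by simp) x
          rw [dd_mul (D h.smooth) (D ((sv i).mul (sv2 e e))), dd_mul (D (sv i)) (D (sv2 e e)),
            dd_mul (D h.smooth) (D ((sv i).mul (sv2 e i))), dd_mul (D (sv i)) (D (sv2 e i)),
            dd_mul (D (h.dd e).smooth) (D ((sv i).mul (sv i))), dd_mul (D (sv i)) (D (sv i)),
            dd_mul (D (h.dd i).smooth) (D ((sv i).mul (sv e))), dd_mul (D (sv i)) (D (sv e)),
            dd_mul (D (h.dd i).smooth) (D ((sv e).mul (sv e))), dd_mul (D (sv e)) (D (sv e)),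
            dd_comm hv e i, dd_comm h.smooth e i, dd_comm (contDiff_dd hv e) i e]
          ring
      _ = 0 := by
          rw [integral_add, integral_sub, integral_add, integral_sub, integral_const_mul,
            integral_const_mul, d1, d2, d3, d4, d5]
          · simp
          · exact i1
          · exact i2
          · exact i1.sub i2
          · exact i3.const_mul _
          · exact (i1.sub i2).add (i3.const_mul _)
          · exact i4
          · exact ((i1.sub i2).add (i3.const_mul _)).sub i4
          · exact i5.const_mul _
  · exact h.integrable_cmul ((((sv2 i i).mul (sv2 e e)).sub ((sv2 e i).pow 2)).continuous)
  · refine (((h.dd e).dd i).integrable_cmul ((sv i).mul (sv e)).continuous |>.sub ?_).sub ?_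
    · have := (((h.dd e).dd e).integrable_cmul ((sv i).pow 2).continuous).div_const 2
      exact this
    · have := (((h.dd i).dd i).integrable_cmul ((sv e).pow 2).continuous).div_const 2
      exact this

theorem norm_single_one (i : Fin N) : ‖(EuclideanSpace.single i (1:ℝ) : Euc N)‖ = 1 := by simp

theorem gsq_continuous {v : Euc N → ℝ} (hv : ContDiff ℝ 1 v) : Continuous (gsq v) :=
  continuous_finsetSum _ fun _ _ => (continuous_dd hv _).pow 2

theorem Krn.dd_eq_zero {Z : Euc N → ℝ} (h : Krn Z) (a : Euc N) {x : Euc N} (hx : x ∉ ball (0 : Euc N) 1) :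
    _root_.dd a Z x = 0 := (h.dd a).supp x (by simpa using hx)

theorem integrable_indicator_ball {f : Euc N → ℝ} (hf : Continuous f) (x : Euc N) (r : ℝ) :
    IntegrableOn f (ball x r) :=
  (hf.continuousOn.integrableOn_compact (isCompact_closedBall x r)).mono_set ball_subset_closedBall

/-- The key lower bound: `∫ Z Δv ∂ₑₑv` is nonnegative up to first-order terms. -/
theorem exists_energy_bound {Z : Euc N → ℝ} (h : Krn Z) (hZ : ∀ x, 0 ≤ Z x) :
    ∃ C, 0 < C ∧ ∀ (v : Euc N → ℝ) (e : Euc N), ContDiff ℝ (⊤ : ℕ∞) v → ‖e‖ = 1 →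
      ∫ x, Z x * dd e (dd e v) x ^ 2 ≤
        (∫ x, Z x * (lap N v x * dd e (dd e v) x)) + C * ∫ x in ball (0 : Euc N) 1, gsq v x := by
  obtain ⟨C, hC0, hC⟩ := h.exists_bound_dd_dd
  refine ⟨(N + 1) * (2 * C), by positivity, fun v e hv he => ?_⟩
  have c1 : ∀ {f : Euc N → ℝ}, ContDiff ℝ (⊤ : ℕ∞) f → ContDiff ℝ 1 f := fun hf =>
    hf.of_le (by exact_mod_cast le_top)
  set G := ∫ x in ball (0 : Euc N) 1, gsq v x with hG
  have hG0 : 0 ≤ G := setIntegral_nonneg measurableSet_ball fun x _ => gsq_nonneg v x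
  have gi : IntegrableOn (gsq v) (ball 0 1) := integrable_indicator_ball (gsq_continuous (c1 hv)) _ _
  have hi : ∀ i : Fin N, -(2 * C * G) ≤ ∫ x, Z x * (dd (EuclideanSpace.single i 1)
      (dd (EuclideanSpace.single i 1) v) x * dd e (dd e v) x
      - dd (EuclideanSpace.single i 1) (dd e v) x ^ 2) := by
    intro i
    rw [integral_comm_identity h hv]
    have n1 := norm_single_one i
    set s : Euc N := EuclideanSpace.single i 1
    rw [hG, ← integral_const_mul, ← integral_indicator measurableSet_ball]
    rw [← integral_neg]
    have sv := fun a => contDiff_dd hv a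
    refine integral_mono ((integrable_indicator_iff measurableSet_ball).2 (Integrable.const_mul gi (2 * C))).neg ?_ ?_
    · refine (((h.dd e).dd s).integrable_cmul ((sv s).mul (sv e)).continuous |>.sub ?_).sub ?_
      · have := (((h.dd e).dd e).integrable_cmul ((sv s).pow 2).continuous).div_const 2
        exact this
      · have := (((h.dd s).dd s).integrable_cmul ((sv e).pow 2).continuous).div_const 2
        exact this
    · intro x
      by_cases hx : x ∈ ball (0 : Euc N) 1
      · simp only [indicator_of_mem hx]
        have b1 := abs_le.1 (hC s e n1 he x)
        have b2 := abs_le.1 (hC e e he he x)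
        have b3 := abs_le.1 (hC s s n1 n1 x)
        have g1 := dd_sq_le_gsq v he x
        have g2 := dd_sq_le_gsq v n1 x
        set p := dd s v x
        set q := dd e v x
        have t1 : -(C * ((p ^ 2 + q ^ 2) / 2)) ≤ dd s (dd e Z) x * (p * q) := by
          have : |dd s (dd e Z) x * (p * q)| ≤ C * ((p ^ 2 + q ^ 2) / 2) := by
            rw [abs_mul]
            refine mul_le_mul (hC s e n1 he x) ?_ (abs_nonneg _) hC0.le
            rw [abs_le]; constructor <;> nlinarith [sq_nonneg (p + q), sq_nonneg (p - q)]
          exact (abs_le.1 this).1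
        nlinarith [mul_le_mul_of_nonneg_right b2.2 (sq_nonneg p),
          mul_le_mul_of_nonneg_right b3.2 (sq_nonneg q), mul_le_mul_of_nonneg_left g1 hC0.le,
          mul_le_mul_of_nonneg_left g2 hC0.le]
      · simp only [indicator_of_notMem hx]
        rw [(h.dd e).dd_eq_zero _ hx, (h.dd e).dd_eq_zero _ hx, (h.dd s).dd_eq_zero _ hx]
        simp
  have hsum := Finset.sum_le_sum fun i (_ : i ∈ Finset.univ) => hi i
  rw [← integral_finsetSum] at hsum
  · simp only [Finset.sum_const, Finset.card_univ, Fintype.card_fin, nsmul_eq_mul] at hsum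
    have e1 : (∫ x, ∑ i : Fin N, Z x * (dd (EuclideanSpace.single i 1)
      (dd (EuclideanSpace.single i 1) v) x * dd e (dd e v) x
      - dd (EuclideanSpace.single i 1) (dd e v) x ^ 2)) =
      ∫ x, (Z x * (lap N v x * dd e (dd e v) x) - Z x * gsq (dd e v) x) := by
      congr 1; funext x
      rw [← Finset.mul_sum, Finset.sum_sub_distrib, ← Finset.sum_mul, ← lap_eq_sum_dd, gsq]
      ring
    have cl : Continuous (lap N v) := continuous_finsetSum _ fun _ _ =>
      (contDiff_dd (contDiff_dd hv _) _).continuous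
    have ce : Continuous (dd e (dd e v)) := (contDiff_dd (contDiff_dd hv _) _).continuous
    have cg : Continuous (gsq (dd e v)) := gsq_continuous (c1 (contDiff_dd hv e))
    have i1 : Integrable fun x => Z x * (lap N v x * dd e (dd e v) x) :=
      h.integrable_cmul (cl.mul ce)
    rw [e1, integral_sub i1 (h.integrable_cmul cg)] at hsum
    have e2 : ∫ x, Z x * dd e (dd e v) x ^ 2 ≤ ∫ x, Z x * gsq (dd e v) x :=
      integral_mono (h.integrable_cmul (ce.pow 2)) (h.integrable_cmul cg) fun x =>
        mul_le_mul_of_nonneg_left (dd_sq_le_gsq _ he x) (hZ x)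
    nlinarith [mul_nonneg hC0.le hG0]
  · intro i _
    exact h.integrable_cmul (((contDiff_dd (contDiff_dd hv _) _).mul
      (contDiff_dd (contDiff_dd hv _) _)).sub ((contDiff_dd (contDiff_dd hv _) _).pow 2)).continuous

/-- The indicator function of `Λ`. -/
def chi (Λ : Set (Euc N)) (x : Euc N) : ℝ := Λ.indicator (fun _ => 1) x

theorem chi_of_mem {Λ : Set (Euc N)} {x : Euc N} (h : x ∈ Λ) : chi Λ x = 1 := indicator_of_mem h _
theorem chi_of_notMem {Λ : Set (Euc N)} {x : Euc N} (h : x ∉ Λ) : chi Λ x = 0 := indicator_of_notMem h _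

theorem chi_nonneg (Λ : Set (Euc N)) (x : Euc N) : 0 ≤ chi Λ x := indicator_nonneg (fun _ _ => zero_le_one) _

theorem chi_le_one (Λ : Set (Euc N)) (x : Euc N) : chi Λ x ≤ 1 := by
  by_cases h : x ∈ Λ
  · rw [chi_of_mem h]
  · rw [chi_of_notMem h]; exact zero_le_one

theorem abs_chi_le (Λ : Set (Euc N)) (x : Euc N) : |chi Λ x| ≤ 1 := by
  rw [abs_of_nonneg (chi_nonneg _ _)]; exact chi_le_one _ _

theorem chi_compl (Λ : Set (Euc N)) (x : Euc N) : chi Λᶜ x = 1 - chi Λ x := by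
  by_cases h : x ∈ Λ
  · rw [chi_of_mem h, chi_of_notMem (by simpa using h), sub_self]
  · rw [chi_of_notMem h, chi_of_mem h, sub_zero]

theorem measurable_chi {Λ : Set (Euc N)} (h : MeasurableSet Λ) : Measurable (chi Λ) :=
  measurable_const.indicator h

theorem locallyIntegrable_of_bdd {f : Euc N → ℝ} (hf : Measurable f) {C : ℝ} (hC : ∀ x, |f x| ≤ C) :
    LocallyIntegrable f :=
  (locallyIntegrable_const C).mono hf.aestronglyMeasurable
    (Eventually.of_forall fun x => (hC x).trans (le_abs_self C))

theorem locallyIntegrable_chi {Λ : Set (Euc N)} (h : MeasurableSet Λ) : LocallyIntegrable (chi Λ) :=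
  locallyIntegrable_of_bdd (measurable_chi h) (abs_chi_le Λ)

theorem volume_inter_ball_ne_top (Λ : Set (Euc N)) (x : Euc N) (r : ℝ) :
    volume (Λ ∩ ball x r) ≠ ⊤ :=
  (measure_lt_top_of_subset inter_subset_right measure_ball_lt_top.ne).ne

theorem abs_Tk_chi_le {ψ : Euc N → ℝ} (h : Krn ψ) {C : ℝ} (hC : ∀ x, |ψ x| ≤ C) {R : ℝ}
    (hR : 0 < R) {Λ : Set (Euc N)} (hΛ : MeasurableSet Λ) (x : Euc N) :
    |Tk ψ R (chi Λ) x| ≤ C * (R ^ N)⁻¹ * volume.real (Λ ∩ ball x R) := by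
  have := abs_Tk_indicator_le h hC hR hΛ zero_le_one (f := chi Λ)
    (fun y => by rw [abs_of_nonneg (chi_nonneg _ _), chi]) x
  rwa [mul_one] at this

theorem Tk_rho_nonneg {f : Euc N → ℝ} (hf : ∀ x, 0 ≤ f x) (R : ℝ) (x : Euc N) : 0 ≤ Tk rho R f x :=
  integral_nonneg fun y => mul_nonneg (rho_nonneg y) (hf _)

theorem Tk_chi_compl {ψ : Euc N → ℝ} (h : Krn ψ) {R : ℝ} (hR : 0 < R) {Λ : Set (Euc N)}
    (hΛ : MeasurableSet Λ) (x : Euc N) :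
    Tk ψ R (chi Λᶜ) x = (∫ y, ψ y) - Tk ψ R (chi Λ) x := by
  have : chi Λᶜ = fun x => (fun _ => (1:ℝ)) x - chi Λ x := funext fun x => chi_compl Λ x
  rw [this, Tk_sub h hR (locallyIntegrable_const 1) (locallyIntegrable_chi hΛ), Tk_const, mul_one]

theorem Tk_rho_chi_le_one {Λ : Set (Euc N)} (hΛ : MeasurableSet Λ) {R : ℝ} (hR : 0 < R) (x : Euc N) :
    Tk rho R (chi Λ) x ≤ 1 := by
  have := Tk_chi_compl krn_rho hR hΛ x
  rw [integral_rho] at this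
  linarith [Tk_rho_nonneg (chi_nonneg Λᶜ) R x]

theorem tendsto_Tk_chi_of_density {Λ : Set (Euc N)} (hΛ : MeasurableSet Λ) {x : Euc N} (hx : x ∉ Λ)
    (h : Tendsto (fun r => volume (Λ ∩ closedBall x r) / volume (closedBall x r)) (nhdsWithin 0 (Ioi 0))
      (nhds (Λ.indicator 1 x))) :
    Tendsto (fun R => Tk rho R (chi Λ) x) (nhdsWithin 0 (Ioi 0)) (nhds 0) := by
  rw [indicator_of_notMem hx] at h
  obtain ⟨C, hC0, hC⟩ := (krn_rho (N := N)).exists_bound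
  have h1 := ((ENNReal.tendsto_toReal ENNReal.zero_ne_top).comp h).const_mul
    (C * volume.real (closedBall (0 : Euc N) 1))
  simp only [ENNReal.toReal_zero, mul_zero] at h1
  refine squeeze_zero_norm' ?_ h1
  filter_upwards [self_mem_nhdsWithin] with R hR
  have hR : 0 < R := hR
  rw [Real.norm_eq_abs]
  refine (abs_Tk_chi_le krn_rho hC hR hΛ x).trans ?_
  simp only [Function.comp, ENNReal.toReal_div]
  have e1 := Measure.addHaar_real_closedBall' (volume : Measure (Euc N)) x hR.le
  rw [finrank_euclideanSpace_fin] at e1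
  have e2 : 0 < volume.real (closedBall (0 : Euc N) 1) :=
    ENNReal.toReal_pos (measure_closedBall_pos _ _ one_pos).ne' measure_closedBall_lt_top.ne
  have e3 : volume.real (Λ ∩ ball x R) ≤ volume.real (Λ ∩ closedBall x R) :=
    measureReal_mono (inter_subset_inter_right _ ball_subset_closedBall)
      (measure_lt_top_of_subset inter_subset_right measure_closedBall_lt_top.ne).ne
  change _ ≤ C * volume.real (closedBall (0 : Euc N) 1) *
    (volume.real (Λ ∩ closedBall x R) / volume.real (closedBall x R))
  rw [e1]
  have : C * volume.real (closedBall (0 : Euc N) 1) * (volume.real (Λ ∩ closedBall x R) /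
      (R ^ N * volume.real (closedBall (0 : Euc N) 1))) =
      C * (R ^ N)⁻¹ * volume.real (Λ ∩ closedBall x R) := by field_simp
  rw [this]
  gcongr

theorem ae_tendsto_Tk_chi {Λ : Set (Euc N)} (hΛ : MeasurableSet Λ) :
    ∀ᵐ x : Euc N, Tendsto (fun R => Tk rho R (chi Λ) x) (nhdsWithin 0 (Ioi 0)) (nhds (chi Λ x)) := by
  filter_upwards [Besicovitch.ae_tendsto_measure_inter_div_of_measurableSet volume hΛ,
    Besicovitch.ae_tendsto_measure_inter_div_of_measurableSet volume hΛ.compl] with x h1 h2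
  by_cases hx : x ∈ Λ
  · have h3 := (tendsto_Tk_chi_of_density hΛ.compl (by simpa using hx) h2).const_sub 1
    rw [sub_zero] at h3
    rw [chi_of_mem hx]
    refine h3.congr' ?_
    filter_upwards [self_mem_nhdsWithin] with R hR
    rw [Tk_chi_compl krn_rho hR hΛ, integral_rho]; ring
  · rw [chi_of_notMem hx]
    exact tendsto_Tk_chi_of_density hΛ hx h1

/-- The dyadic scale `2⁻ⁿ`. -/
def rn (n : ℕ) : ℝ := (1 / 2 : ℝ) ^ n

theorem rn_pos (n : ℕ) : 0 < rn n := pow_pos (by norm_num) n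
theorem rn_le_one (n : ℕ) : rn n ≤ 1 := pow_le_one₀ (by norm_num) (by norm_num)
theorem rn_zero : rn 0 = 1 := pow_zero _
theorem rn_succ (n : ℕ) : rn (n + 1) = rn n / 2 := by rw [rn, rn, pow_succ]; ring

theorem tendsto_rn : Tendsto rn atTop (nhdsWithin 0 (Ioi 0)) :=
  tendsto_nhdsWithin_iff.2 ⟨tendsto_pow_atTop_nhds_zero_of_lt_one (by norm_num) (by norm_num),
    Eventually.of_forall rn_pos⟩

theorem sum_rn_le (n : ℕ) : ∑ k ∈ Finset.range n, rn k ≤ 2 := by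
  have : ∑ k ∈ Finset.range n, rn k = 2 - 2 * rn n := by
    induction n with
    | zero => simp [rn_zero]
    | succ n ih => rw [Finset.sum_range_succ, ih, rn_succ]; ring
  rw [this]; linarith [rn_pos n]

theorem continuous_Tk_chi {ψ : Euc N → ℝ} (h : Krn ψ) {Λ : Set (Euc N)} (hΛ : MeasurableSet Λ) {R : ℝ} (hR : 0 < R) :
    Continuous (Tk ψ R (chi Λ)) := (contDiff_Tk h hR (locallyIntegrable_chi hΛ)).continuous

theorem tendsto_integral_Tk_chi_sub_sq {Λ : Set (Euc N)} (hΛ : MeasurableSet Λ) :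
    Tendsto (fun n => ∫ x in ball (0 : Euc N) 1, (Tk rho (rn n) (chi Λ) x - chi Λ x) ^ 2)
      atTop (nhds 0) := by
  have h0 : (0:ℝ) = ∫ x in ball (0 : Euc N) 1, (0:ℝ) := by simp
  rw [h0]
  refine tendsto_integral_of_dominated_convergence (fun _ => (1:ℝ)) (fun n => ?_)
    (integrableOn_const measure_ball_lt_top.ne) (fun n => ?_) ?_
  · exact (((continuous_Tk_chi krn_rho hΛ (rn_pos n)).measurable.sub (measurable_chi hΛ)).pow_const 2).aestronglyMeasurable
  · refine Eventually.of_forall fun x => ?_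
    rw [Real.norm_eq_abs, abs_pow, sq_le_one_iff_abs_le_one, abs_abs, abs_le]
    have := Tk_rho_nonneg (chi_nonneg Λ) (rn n) x
    have := Tk_rho_chi_le_one hΛ (rn_pos n) x
    have := chi_nonneg Λ x
    have := chi_le_one Λ x
    constructor <;> linarith
  · filter_upwards [ae_restrict_of_ae (ae_tendsto_Tk_chi hΛ)] with x hx
    have := ((hx.comp tendsto_rn).sub_const (chi Λ x)).pow 2
    rw [sub_self, zero_pow two_ne_zero] at this
    exact this

/-- The `L¹` norm of an average of `χ_Λ`. -/
theorem integral_abs_Tk_chi_le {ψ : Euc N → ℝ} (h : Krn ψ) {Λ : Set (Euc N)} (hΛ : MeasurableSet Λ)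
    {R : ℝ} (hR : 0 < R) (hR1 : R ≤ 1) :
    ∫ x in ball (0 : Euc N) 1, |Tk ψ R (chi Λ) x| ≤
      (∫ y, |ψ y|) * volume.real (Λ ∩ ball (0 : Euc N) 2) := by
  set lam := volume.real (Λ ∩ ball (0 : Euc N) 2)
  have hI : Integrable (Function.uncurry fun (x y : Euc N) => |ψ y| * chi Λ (x - R • y))
      ((volume.restrict (ball (0 : Euc N) 1)).prod volume) := by
    have h1 : Integrable (fun z : Euc N × Euc N => (1:ℝ) * |ψ z.2|)
        ((volume.restrict (ball (0 : Euc N) 1)).prod volume) :=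
      Integrable.mul_prod (f := fun _ => (1:ℝ)) (integrableOn_const measure_ball_lt_top.ne) h.integrable.abs
    refine h1.mono ?_ (Eventually.of_forall fun z => ?_)
    · have m1 : Measurable fun z : Euc N × Euc N => |ψ z.2| :=
        (h.continuous.comp continuous_snd).abs.measurable
      have m2 : Measurable fun z : Euc N × Euc N => chi Λ (z.1 - R • z.2) :=
        (measurable_chi hΛ).comp (by fun_prop)
      exact (m1.mul m2).aestronglyMeasurable
    · simp only [Function.uncurry, one_mul, norm_mul, Real.norm_eq_abs, abs_abs]
      exact mul_le_of_le_one_right (abs_nonneg _) (abs_chi_le _ _)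
  calc ∫ x in ball (0 : Euc N) 1, |Tk ψ R (chi Λ) x|
      ≤ ∫ x in ball (0 : Euc N) 1, ∫ y, |ψ y| * chi Λ (x - R • y) := by
        refine setIntegral_mono ?_ hI.integral_prod_left fun x => ?_
        · exact integrable_indicator_ball (continuous_Tk_chi h hΛ hR).abs _ _
        · refine (abs_integral_le_integral_abs).trans (le_of_eq ?_)
          congr 1; funext y
          rw [abs_mul, abs_of_nonneg (chi_nonneg _ _)]
    _ = ∫ y, ∫ x in ball (0 : Euc N) 1, |ψ y| * chi Λ (x - R • y) := integral_integral_swap hI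
    _ ≤ ∫ y, |ψ y| * lam := by
        refine integral_mono hI.integral_prod_right (h.integrable.abs.mul_const _) fun y => ?_
        simp only
        rw [integral_const_mul]
        rcases le_or_gt 1 ‖y‖ with hy | hy
        · rw [h.supp y hy]; simp
        refine mul_le_mul_of_nonneg_left ?_ (abs_nonneg _)
        have : (fun x => chi Λ (x - R • y)) = ((fun x => x - R • y) ⁻¹' Λ).indicator fun _ => 1 := by
          funext x; rfl
        rw [this, setIntegral_indicator (hΛ.preimage (by fun_prop)), setIntegral_const, smul_eq_mul,
          mul_one]
        have e : ball (0 : Euc N) 1 ∩ (fun x => x - R • y) ⁻¹' Λ ⊆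
            (fun x => x - R • y) ⁻¹' (Λ ∩ ball 0 2) := by
          rintro x ⟨hx1, hx2⟩
          refine ⟨hx2, ?_⟩
          rw [mem_ball_zero_iff] at hx1 ⊢
          calc ‖x - R • y‖ ≤ ‖x‖ + ‖R • y‖ := norm_sub_le _ _
            _ < 2 := by rw [norm_smul, Real.norm_of_nonneg hR.le]; nlinarith
        have e2 : volume ((fun x => x - R • y) ⁻¹' (Λ ∩ ball (0 : Euc N) 2)) = volume (Λ ∩ ball (0 : Euc N) 2) :=
          (measurePreserving_sub_right volume (R • y)).measure_preimage
            (hΛ.inter measurableSet_ball).nullMeasurableSet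
        refine (measureReal_mono e ?_).trans (le_of_eq ?_)
        · rw [e2]; exact volume_inter_ball_ne_top _ _ _
        · rw [measureReal_def, e2]; rfl
    _ = _ := integral_mul_const _ _

/-- `u` is a `C¹` function with `Δu = 1` off `Λ` and `∇u = 0` on `Λ`, inside `D`. -/
structure SolOn (u : Euc N → ℝ) (Λ D : Set (Euc N)) : Prop where
  contDiff : ContDiff ℝ 1 u
  meas : MeasurableSet Λ
  zero : ∀ x ∈ Λ ∩ D, fderiv ℝ u x = 0
  weak : WeakLap u (chi Λᶜ) D

theorem SolOn.mono {u : Euc N → ℝ} {Λ D D' : Set (Euc N)} (h : SolOn u Λ D) (hD : D' ⊆ D) :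
    SolOn u Λ D' :=
  ⟨h.contDiff, h.meas, fun x hx => h.zero x ⟨hx.1, hD hx.2⟩, h.weak.mono hD⟩

theorem SolOn.locallyIntegrable {u : Euc N → ℝ} {Λ D : Set (Euc N)} (h : SolOn u Λ D) :
    LocallyIntegrable u := h.contDiff.continuous.locallyIntegrable

theorem SolOn.contDiff_Tk_rho {u : Euc N → ℝ} {Λ D : Set (Euc N)} (h : SolOn u Λ D) {R : ℝ} (hR : 0 < R) :
    ContDiff ℝ (⊤ : ℕ∞) (Tk rho R u) := contDiff_Tk krn_rho hR h.locallyIntegrable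

theorem SolOn.lap_Tk_rho {u : Euc N → ℝ} {Λ D : Set (Euc N)} (h : SolOn u Λ D) {R : ℝ} (hR : 0 < R)
    {x : Euc N} (hx : closedBall x R ⊆ D) : lap N (Tk rho R u) x = 1 - Tk rho R (chi Λ) x := by
  have h1 := h.weak.sum_Hes h.locallyIntegrable hR hx
  rw [Tk_chi_compl krn_rho hR h.meas, integral_rho] at h1
  rw [← h1, lap_eq_sum_dd]
  exact Finset.sum_congr rfl fun i _ => (Hes_eq_dd_dd hR h.locallyIntegrable _ x).symm

theorem Krn.integral_dd {ψ : Euc N → ℝ} (h : Krn ψ) (a : Euc N) : ∫ x, _root_.dd a ψ x = 0 :=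
  integral_dd_eq_zero (h.smooth.of_le (by exact_mod_cast le_top)) h.hasCompactSupport a

theorem Krn.Tk_dd_chi_compl {ψ : Euc N → ℝ} (h : Krn ψ) {R : ℝ} (hR : 0 < R) {Λ : Set (Euc N)}
    (hΛ : MeasurableSet Λ) (a x : Euc N) :
    Tk (_root_.dd a ψ) R (chi Λᶜ) x = - Tk (_root_.dd a ψ) R (chi Λ) x := by
  rw [Tk_chi_compl (h.dd a) hR hΛ, h.integral_dd, zero_sub]

theorem SolOn.dd_Tk_rho_sub {u : Euc N → ℝ} {Λ D : Set (Euc N)} (h : SolOn u Λ D) {R : ℝ} (hR : 0 < R)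
    {x : Euc N} (hx : ∀ᶠ y in nhds x, closedBall y R ⊆ D) (a : Euc N) :
    dd a (Tk rho R u) x - dd a (Tk rho (R / 2) u) x = -(R * Tk (dd a kap) R (chi Λ) x) := by
  have h1 : (fun y => Tk rho R u y - Tk rho (R / 2) u y) =ᶠ[nhds x]
      fun y => R ^ 2 * Tk kap R (chi Λᶜ) y := by
    filter_upwards [hx] with y hy
    exact h.weak.Tk_rho_sub h.locallyIntegrable hR hy
  have h2 := congrArg (fun L : Euc N →L[ℝ] ℝ => L a) h1.fderiv_eq
  rw [fderiv_fun_sub ((h.contDiff_Tk_rho hR).differentiable (by simp) x)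
    ((h.contDiff_Tk_rho (half_pos hR)).differentiable (by simp) x)] at h2
  change dd a (Tk rho R u) x - dd a (Tk rho (R / 2) u) x = dd a (fun y => R ^ 2 * Tk kap R (chi Λᶜ) y) x at h2
  rw [h2, dd_const_mul]
  simp only
  rw [dd_Tk krn_kap hR (locallyIntegrable_chi h.meas.compl), krn_kap.Tk_dd_chi_compl hR h.meas]
  field_simp

theorem Krn.exists_bound_dd {Z : Euc N → ℝ} (h : Krn Z) :
    ∃ C, 0 < C ∧ ∀ a : Euc N, ‖a‖ = 1 → ∀ x, |_root_.dd a Z x| ≤ C := by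
  obtain ⟨C, hC⟩ := (h.hasCompactSupport.fderiv (𝕜 := ℝ)).exists_bound_of_continuous
    (h.smooth.continuous_fderiv (by simp))
  refine ⟨max C 1, by positivity, fun a ha x => ?_⟩
  refine ((fderiv ℝ Z x).le_opNorm a).trans ?_
  rw [ha, mul_one]
  exact (hC x).trans (le_max_left _ _)

/-- Uniform bounds for the directional derivatives of a kernel. -/
theorem Krn.exists_uniform_bounds {Z : Euc N → ℝ} (h : Krn Z) :
    ∃ C, 0 < C ∧ ∀ a : Euc N, ‖a‖ = 1 → (∀ x, |_root_.dd a Z x| ≤ C) ∧ ∫ x, |_root_.dd a Z x| ≤ C := by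
  obtain ⟨C, h0, hC⟩ := h.exists_bound_dd
  have hv : 0 ≤ volume.real (closedBall (0 : Euc N) 1) := measureReal_nonneg
  refine ⟨C * (1 + volume.real (closedBall (0 : Euc N) 1)), by positivity, fun a ha => ⟨fun x => ?_, ?_⟩⟩
  · exact (hC a ha x).trans (by nlinarith)
  · exact ((h.dd a).integral_abs_le (hC a ha)).trans (by nlinarith)

theorem closedBall_subset_ball_four {x : Euc N} (hx : x ∈ ball (0 : Euc N) 1) {R : ℝ} (hR : R ≤ 1) :
    closedBall x R ⊆ ball (0 : Euc N) 4 := by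
  refine closedBall_subset_ball' ?_
  rw [mem_ball] at hx; linarith

/-- `U_n - U_0` where `U_n` is `u` mollified at scale `2⁻ⁿ`. -/
def wn (u : Euc N → ℝ) (n : ℕ) (x : Euc N) : ℝ := Tk rho (rn n) u x - Tk rho (rn 0) u x

theorem SolOn.contDiff_wn {u : Euc N → ℝ} {Λ D : Set (Euc N)} (h : SolOn u Λ D) (n : ℕ) :
    ContDiff ℝ (⊤ : ℕ∞) (wn u n) := (h.contDiff_Tk_rho (rn_pos n)).sub (h.contDiff_Tk_rho (rn_pos 0))

theorem dd_sub {V : Type*} [NormedAddCommGroup V] [NormedSpace ℝ V] {f g : V → ℝ} (hf : Differentiable ℝ f)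
    (hg : Differentiable ℝ g) (a : V) :
    dd a (fun x => f x - g x) = fun x => dd a f x - dd a g x := by
  funext x
  rw [dd, fderiv_fun_sub (hf x) (hg x)]; rfl

theorem SolOn.dd_wn {u : Euc N → ℝ} {Λ D : Set (Euc N)} (h : SolOn u Λ D) (n : ℕ) (a : Euc N) :
    dd a (wn u n) = fun x => dd a (Tk rho (rn n) u) x - dd a (Tk rho (rn 0) u) x :=
  dd_sub ((h.contDiff_Tk_rho (rn_pos n)).differentiable (by simp))
    ((h.contDiff_Tk_rho (rn_pos 0)).differentiable (by simp)) a

theorem SolOn.dd_dd_wn {u : Euc N → ℝ} {Λ D : Set (Euc N)} (h : SolOn u Λ D) (n : ℕ) (a b : Euc N) :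
    dd b (dd a (wn u n)) = fun x => dd b (dd a (Tk rho (rn n) u)) x - dd b (dd a (Tk rho (rn 0) u)) x := by
  rw [h.dd_wn]
  exact dd_sub ((contDiff_dd (h.contDiff_Tk_rho (rn_pos n)) a).differentiable (by simp))
    ((contDiff_dd (h.contDiff_Tk_rho (rn_pos 0)) a).differentiable (by simp)) b

theorem SolOn.abs_dd_wn_le_sum {u : Euc N → ℝ} {Λ : Set (Euc N)} (h : SolOn u Λ (ball 0 4)) (n : ℕ)
    (a : Euc N) {x : Euc N} (hx : x ∈ ball (0 : Euc N) 1) :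
    |dd a (wn u n) x| ≤ ∑ k ∈ Finset.range n, rn k * |Tk (dd a kap) (rn k) (chi Λ) x| := by
  rw [h.dd_wn]
  simp only
  induction n with
  | zero => simp
  | succ n ih =>
    have h1 := h.dd_Tk_rho_sub (rn_pos n) (x := x) (a := a) (by
      filter_upwards [isOpen_ball.mem_nhds hx] with y hy
      exact closedBall_subset_ball_four hy (rn_le_one n))
    rw [← rn_succ] at h1
    rw [Finset.sum_range_succ]
    have h2 : dd a (Tk rho (rn (n + 1)) u) x - dd a (Tk rho (rn 0) u) x =
        (dd a (Tk rho (rn n) u) x - dd a (Tk rho (rn 0) u) x) + rn n * Tk (dd a kap) (rn n) (chi Λ) x := by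
      linarith
    rw [h2]
    refine (abs_add_le _ _).trans (add_le_add ih ?_)
    rw [abs_mul, abs_of_pos (rn_pos n)]

theorem sum_rn_tail_le (m n : ℕ) : ∑ k ∈ Finset.range n, (if m ≤ k then rn k else 0) ≤ 2 * rn m := by
  have : ∑ k ∈ Finset.range n, (if m ≤ k then rn k else 0) + 2 * rn (max n m) = 2 * rn m := by
    induction n with
    | zero => simp
    | succ n ih =>
      rw [Finset.sum_range_succ]
      by_cases hm : m ≤ n
      · rw [if_pos hm, max_eq_left (hm.trans n.le_succ), rn_succ]
        rw [max_eq_left hm] at ih; linarith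
      · rw [if_neg hm, max_eq_right (by omega)]
        rw [max_eq_right (by omega)] at ih; linarith
  linarith [rn_pos (max n m)]

theorem rn_anti {k m : ℕ} (h : k ≤ m) : rn m ≤ rn k :=
  pow_le_pow_of_le_one (by norm_num) (by norm_num) h

theorem vol_inter_ball_mono {Λ : Set (Euc N)} {x y : Euc N} {r s : ℝ} (h : ball x r ⊆ ball y s) :
    volume.real (Λ ∩ ball x r) ≤ volume.real (Λ ∩ ball y s) :=
  measureReal_mono (inter_subset_inter_right _ h) (volume_inter_ball_ne_top _ _ _)

theorem exists_dd_wn_bounds : ∃ C, 0 < C ∧ ∀ (u : Euc N → ℝ) (Λ : Set (Euc N)), SolOn u Λ (ball 0 4) →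
    ∀ (n : ℕ) (a : Euc N), ‖a‖ = 1 →
      (∀ m : ℕ, ∀ x ∈ ball (0 : Euc N) 1, |dd a (wn u n) x| ≤
        C * ((rn m ^ N)⁻¹ * volume.real (Λ ∩ ball (0 : Euc N) 2) + rn m)) ∧
      ∫ x in ball (0 : Euc N) 1, |dd a (wn u n) x| ≤ C * volume.real (Λ ∩ ball (0 : Euc N) 2) := by
  obtain ⟨C, hC0, hC⟩ := (krn_kap (N := N)).exists_uniform_bounds
  refine ⟨2 * C, by positivity, fun u Λ h n a ha => ⟨fun m x hx => ?_, ?_⟩⟩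
  · refine (h.abs_dd_wn_le_sum n a hx).trans ?_
    set lam := volume.real (Λ ∩ ball (0 : Euc N) 2)
    have hl : 0 ≤ lam := measureReal_nonneg
    have hm := rn_pos m
    have key : ∀ k, rn k * |Tk (dd a kap) (rn k) (chi Λ) x| ≤
        rn k * (C * ((rn m ^ N)⁻¹ * lam)) + C * (if m ≤ k then rn k else 0) := by
      intro k
      have hk := rn_pos k
      by_cases hmk : m ≤ k
      · rw [if_pos hmk]
        have h1 := abs_Tk_le (krn_kap.dd a) hk (f := chi Λ) (x := x) (A := 1) fun y _ => abs_chi_le _ _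
        have h2 := (hC a ha).2
        have : 0 ≤ C * ((rn m ^ N)⁻¹ * lam) := by positivity
        nlinarith
      · rw [if_neg hmk, mul_zero, add_zero]
        refine mul_le_mul_of_nonneg_left ?_ hk.le
        refine (abs_Tk_chi_le (krn_kap.dd a) (hC a ha).1 hk h.meas x).trans ?_
        rw [mul_assoc]
        have e1 : (rn k ^ N)⁻¹ ≤ (rn m ^ N)⁻¹ :=
          inv_anti₀ (by positivity) (pow_le_pow_left₀ hm.le (rn_anti (by omega)) N)
        have e2 : volume.real (Λ ∩ ball x (rn k)) ≤ lam := by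
          refine vol_inter_ball_mono (ball_subset_ball' ?_)
          have := rn_le_one k
          rw [mem_ball] at hx; linarith
        have : 0 ≤ volume.real (Λ ∩ ball x (rn k)) := measureReal_nonneg
        gcongr
    refine (Finset.sum_le_sum fun k _ => key k).trans ?_
    rw [Finset.sum_add_distrib, ← Finset.sum_mul, ← Finset.mul_sum]
    have := sum_rn_tail_le m n
    have := sum_rn_le n
    have e3 : 0 ≤ C * ((rn m ^ N)⁻¹ * lam) := by positivity
    nlinarith
  · have hcont : ∀ k, Continuous fun x => rn k * |Tk (dd a kap) (rn k) (chi Λ) x| := fun k =>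
      continuous_const.mul (continuous_Tk_chi (krn_kap.dd a) h.meas (rn_pos k)).abs
    have hwc : Continuous (dd a (wn u n)) := (contDiff_dd (h.contDiff_wn n) a).continuous
    calc ∫ x in ball (0 : Euc N) 1, |dd a (wn u n) x|
        ≤ ∫ x in ball (0 : Euc N) 1, ∑ k ∈ Finset.range n, rn k * |Tk (dd a kap) (rn k) (chi Λ) x| :=
          setIntegral_mono_on (integrable_indicator_ball hwc.abs _ _)
            (integrable_indicator_ball (continuous_finsetSum _ fun k _ => hcont k) _ _)
            measurableSet_ball fun x hx => h.abs_dd_wn_le_sum n a hx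
      _ = ∑ k ∈ Finset.range n, rn k * ∫ x in ball (0 : Euc N) 1, |Tk (dd a kap) (rn k) (chi Λ) x| := by
          rw [integral_finsetSum _ fun k _ => integrable_indicator_ball (hcont k) _ _]
          exact Finset.sum_congr rfl fun k _ => integral_const_mul _ _
      _ ≤ ∑ k ∈ Finset.range n, rn k * (C * volume.real (Λ ∩ ball (0 : Euc N) 2)) := by
          refine Finset.sum_le_sum fun k _ => mul_le_mul_of_nonneg_left ?_ (rn_pos k).le
          refine (integral_abs_Tk_chi_le (krn_kap.dd a) h.meas (rn_pos k) (rn_le_one k)).trans ?_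
          exact mul_le_mul_of_nonneg_right (hC a ha).2 measureReal_nonneg
      _ ≤ _ := by
          rw [← Finset.sum_mul]
          have : 0 ≤ C * volume.real (Λ ∩ ball (0 : Euc N) 2) := mul_nonneg hC0.le measureReal_nonneg
          nlinarith [sum_rn_le n]

theorem exists_integral_gsq_wn_le : ∃ C, 0 < C ∧ ∀ (u : Euc N → ℝ) (Λ : Set (Euc N)),
    SolOn u Λ (ball 0 4) → ∀ n m : ℕ, ∫ x in ball (0 : Euc N) 1, gsq (wn u n) x ≤
      C * volume.real (Λ ∩ ball (0 : Euc N) 2) *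
        ((rn m ^ N)⁻¹ * volume.real (Λ ∩ ball (0 : Euc N) 2) + rn m) := by
  obtain ⟨C, hC0, hC⟩ := exists_dd_wn_bounds (N := N)
  refine ⟨(N + 1) * C ^ 2, by positivity, fun u Λ h n m => ?_⟩
  set lam := volume.real (Λ ∩ ball (0 : Euc N) 2)
  have hl : 0 ≤ lam := measureReal_nonneg
  have hm := rn_pos m
  have hwc : ∀ a, Continuous (dd a (wn u n)) := fun a => (contDiff_dd (h.contDiff_wn n) a).continuous
  have hsq : ∀ a, Continuous fun x => dd a (wn u n) x ^ 2 := fun a => (hwc a).pow 2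
  unfold gsq
  rw [integral_finsetSum _ fun k _ => integrable_indicator_ball (hsq _) _ _]
  have : ∀ i ∈ (Finset.univ : Finset (Fin N)),
      ∫ x in ball (0 : Euc N) 1, dd (EuclideanSpace.single i 1) (wn u n) x ^ 2 ≤
      C * ((rn m ^ N)⁻¹ * lam + rn m) * (C * lam) := by
    intro i _
    obtain ⟨h1, h2⟩ := hC u Λ h n _ (norm_single_one i)
    refine le_trans ?_ (mul_le_mul_of_nonneg_left h2 (by positivity))
    rw [← integral_const_mul]
    refine setIntegral_mono_on (integrable_indicator_ball ((hwc _).pow 2) _ _)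
      (integrable_indicator_ball (continuous_const.mul (hwc _).abs) _ _) measurableSet_ball fun x hx => ?_
    rw [← sq_abs, sq]
    exact mul_le_mul_of_nonneg_right (h1 m x hx) (abs_nonneg _)
  refine (Finset.sum_le_sum this).trans ?_
  simp only [Finset.sum_const, Finset.card_univ, Fintype.card_fin, nsmul_eq_mul]
  have : 0 ≤ C ^ 2 * lam * ((rn m ^ N)⁻¹ * lam + rn m) := by positivity
  nlinarith

/-- A smooth cutoff equal to `1` on the ball of radius `1/2`. -/
def zb (x : Euc N) : ℝ := (⟨1 / 2, 1, by norm_num, by norm_num⟩ : ContDiffBump (0 : Euc N)) x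

theorem krn_zb : Krn (zb (N := N)) where
  smooth := ContDiffBump.contDiff _
  supp x hx := ContDiffBump.zero_of_le_dist _ (by simpa using hx)

theorem zb_nonneg (x : Euc N) : 0 ≤ zb x := ContDiffBump.nonneg _
theorem zb_le_one (x : Euc N) : zb x ≤ 1 := ContDiffBump.le_one _
theorem zb_eq_one {x : Euc N} (hx : x ∈ closedBall (0 : Euc N) (1 / 2)) : zb x = 1 :=
  ContDiffBump.one_of_mem_closedBall _ hx

theorem zb_mul_le_of_ball {f g : Euc N → ℝ} (h : ∀ x ∈ ball (0 : Euc N) 1, f x ≤ g x) (x : Euc N) :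
    zb x * f x ≤ zb x * g x := by
  by_cases hx : x ∈ ball (0 : Euc N) 1
  · exact mul_le_mul_of_nonneg_left (h x hx) (zb_nonneg x)
  · rw [krn_zb.supp x (by simpa using hx), zero_mul, zero_mul]

theorem zb_mul_congr {f g : Euc N → ℝ} (h : ∀ x ∈ ball (0 : Euc N) 1, f x = g x) (x : Euc N) :
    zb x * f x = zb x * g x :=
  le_antisymm (zb_mul_le_of_ball (fun x hx => (h x hx).le) x) (zb_mul_le_of_ball (fun x hx => (h x hx).ge) x)

theorem integral_zb_mul_le {f : Euc N → ℝ} (hf0 : ∀ x, 0 ≤ f x) (hf : IntegrableOn f (ball (0 : Euc N) 1)) :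
    ∫ x, zb x * f x ≤ ∫ x in ball (0 : Euc N) 1, f x := by
  rw [← integral_indicator measurableSet_ball]
  refine integral_mono_of_nonneg (Eventually.of_forall fun x => mul_nonneg (zb_nonneg x) (hf0 x))
    (hf.integrable_indicator measurableSet_ball) (Eventually.of_forall fun x => ?_)
  by_cases hx : x ∈ ball (0 : Euc N) 1
  · simp only [indicator_of_mem hx]
    exact mul_le_of_le_one_left (hf0 x) (zb_le_one x)
  · simp only [indicator_of_notMem hx]
    rw [krn_zb.supp x (by simpa using hx), zero_mul]

theorem integral_abs_rho : ∫ y, |rho (N := N) y| = 1 := by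
  rw [← integral_rho (N := N)]
  congr 1; funext y; exact abs_of_nonneg (rho_nonneg y)

/-- `L²` bounds on the second derivatives of mollified solutions. -/
theorem SolOn.exists_l2_bound {u : Euc N → ℝ} {Λ : Set (Euc N)} (h : SolOn u Λ (ball 0 4)) :
    ∃ K, 0 < K ∧ ∀ (n : ℕ) (e : Euc N), ‖e‖ = 1 →
      ∫ x, zb x * dd e (dd e (Tk rho (rn n) u)) x ^ 2 ≤ K := by
  obtain ⟨C, hC0, hC⟩ := exists_energy_bound (krn_zb (N := N)) zb_nonneg
  obtain ⟨G, hG⟩ := (isCompact_closedBall (0 : Euc N) 2).exists_bound_of_continuousOn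
    (h.contDiff.continuous_fderiv one_ne_zero).continuousOn
  have hgrad : ∀ n, ∀ x ∈ ball (0 : Euc N) 1, gsq (Tk rho (rn n) u) x ≤ N * G ^ 2 := by
    intro n x hx
    have : ∀ i ∈ (Finset.univ : Finset (Fin N)), dd (EuclideanSpace.single i 1) (Tk rho (rn n) u) x ^ 2 ≤ G ^ 2 := by
      intro i _
      rw [dd_Tk_rho_eq h.contDiff, ← sq_abs]
      refine pow_le_pow_left₀ (abs_nonneg _) ?_ 2
      refine (abs_Tk_le krn_rho (rn_pos n) (A := G) fun y hy => ?_).trans (by rw [integral_abs_rho, one_mul])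
      refine ((fderiv ℝ u y).le_opNorm _).trans ?_
      rw [norm_single_one, mul_one]
      refine hG y ?_
      have := rn_le_one n
      rw [mem_ball] at hx hy; rw [mem_closedBall]
      linarith [dist_triangle y x 0]
    refine (Finset.sum_le_sum this).trans ?_
    simp
  set V := volume.real (ball (0 : Euc N) 1)
  have hV : 0 ≤ V := measureReal_nonneg
  refine ⟨2 * ((∫ x, zb (N := N) x) + C * (N * G ^ 2 * V)) + 1, ?_, fun n e he => ?_⟩
  · have : 0 ≤ ∫ x, zb (N := N) x := integral_nonneg zb_nonneg
    positivity
  have hU := h.contDiff_Tk_rho (rn_pos n)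
  have ha : Continuous (dd e (dd e (Tk rho (rn n) u))) := (contDiff_dd (contDiff_dd hU e) e).continuous
  have hT : Continuous fun x => 1 - Tk rho (rn n) (chi Λ) x :=
    continuous_const.sub (continuous_Tk_chi krn_rho h.meas (rn_pos n))
  have h1 := hC _ e hU he
  have h2 : ∫ x in ball (0 : Euc N) 1, gsq (Tk rho (rn n) u) x ≤ N * G ^ 2 * V := by
    refine (setIntegral_mono_on (integrable_indicator_ball
      (gsq_continuous (hU.of_le (by exact_mod_cast le_top))) _ _)
      (integrableOn_const measure_ball_lt_top.ne) measurableSet_ball (hgrad n)).trans ?_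
    rw [setIntegral_const, smul_eq_mul, mul_comm]
  have h3 : (∫ x, zb x * (lap N (Tk rho (rn n) u) x * dd e (dd e (Tk rho (rn n) u)) x)) ≤
      ((∫ x, zb (N := N) x) + ∫ x, zb x * dd e (dd e (Tk rho (rn n) u)) x ^ 2) / 2 := by
    have i2 : Integrable fun x => zb x * dd e (dd e (Tk rho (rn n) u)) x ^ 2 :=
      krn_zb.integrable_cmul (ha.pow 2)
    have e2 : ((∫ x, zb (N := N) x) + ∫ x, zb x * dd e (dd e (Tk rho (rn n) u)) x ^ 2) / 2 =
        ∫ x, (zb x + zb x * dd e (dd e (Tk rho (rn n) u)) x ^ 2) / 2 := by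
      rw [integral_div, integral_add krn_zb.integrable i2]
    rw [e2]
    have e1 : (fun x => zb x * (lap N (Tk rho (rn n) u) x * dd e (dd e (Tk rho (rn n) u)) x)) =
        fun x => zb x * ((1 - Tk rho (rn n) (chi Λ) x) * dd e (dd e (Tk rho (rn n) u)) x) := by
      funext x
      refine zb_mul_congr (f := fun x => lap N (Tk rho (rn n) u) x * dd e (dd e (Tk rho (rn n) u)) x)
        (g := fun x => (1 - Tk rho (rn n) (chi Λ) x) * dd e (dd e (Tk rho (rn n) u)) x) (fun x hx => ?_) x
      rw [h.lap_Tk_rho (rn_pos n) (closedBall_subset_ball_four hx (rn_le_one n))]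
    rw [e1]
    refine integral_mono (krn_zb.integrable_cmul (hT.mul ha)) ((krn_zb.integrable.add i2).div_const 2) fun x => ?_
    simp only
    have z := zb_nonneg x
    have t0 := Tk_rho_nonneg (chi_nonneg Λ) (rn n) x
    have t1 := Tk_rho_chi_le_one h.meas (rn_pos n) x
    have : (1 - Tk rho (rn n) (chi Λ) x) * dd e (dd e (Tk rho (rn n) u)) x ≤
        (1 + dd e (dd e (Tk rho (rn n) u)) x ^ 2) / 2 := by
      nlinarith [sq_nonneg ((1 - Tk rho (rn n) (chi Λ) x) - dd e (dd e (Tk rho (rn n) u)) x)]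
    nlinarith
  have h4 : C * ∫ x in ball (0 : Euc N) 1, gsq (Tk rho (rn n) u) x ≤ C * (N * G ^ 2 * V) :=
    mul_le_mul_of_nonneg_left h2 hC0.le
  have : 0 ≤ ∫ x, zb (N := N) x := integral_nonneg zb_nonneg
  linarith

theorem SolOn.eventually_dd_Tk_le {u : Euc N → ℝ} {Λ : Set (Euc N)} (h : SolOn u Λ (ball 0 4)) (e : Euc N) {ω : ℝ} (hω : 0 < ω) :
    ∀ᶠ n in atTop, ∀ x ∈ Λ ∩ ball (0 : Euc N) 1, |dd e (Tk rho (rn n) u) x| ≤ ω := by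
  have hcont : Continuous (dd e u) := continuous_dd h.contDiff e
  obtain ⟨δ, hδ, hu⟩ := Metric.uniformContinuousOn_iff.1
    ((isCompact_closedBall (0 : Euc N) 2).uniformContinuousOn_of_continuous hcont.continuousOn) ω hω
  have hrn : ∀ᶠ n in atTop, rn n < δ := (tendsto_rn.mono_right nhdsWithin_le_nhds).eventually (gt_mem_nhds hδ)
  filter_upwards [hrn] with n hn x hx
  rw [dd_Tk_rho_eq h.contDiff]
  refine (abs_Tk_le krn_rho (rn_pos n) (A := ω) fun y hy => ?_).trans (by rw [integral_abs_rho, one_mul])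
  have hx0 : dd e u x = 0 := by
    rw [dd, h.zero x ⟨hx.1, ball_subset_ball (by norm_num) hx.2⟩]; rfl
  have h1 := rn_le_one n
  have hx2 := hx.2
  rw [mem_ball] at hy hx2
  have := hu y (by rw [mem_closedBall]; linarith [dist_triangle y x 0]) x (by rw [mem_closedBall]; linarith) (by linarith)
  rw [hx0, dist_zero_right] at this
  exact this.le

theorem hasDerivAt_arctan_scale {δ : ℝ} (hδ : 0 < δ) (t : ℝ) :
    HasDerivAt (fun t => δ * Real.arctan (t / δ)) (1 / (1 + (t / δ) ^ 2)) t := by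
  have h := ((Real.hasDerivAt_arctan (t / δ)).comp t ((hasDerivAt_id t).div_const δ)).const_mul δ
  refine h.congr_deriv ?_
  rw [mul_comm, mul_assoc, one_div_mul_cancel hδ.ne', mul_one]

theorem abs_arctan_scale_le {δ : ℝ} (hδ : 0 < δ) (t : ℝ) : |δ * Real.arctan (t / δ)| ≤ 2 * δ := by
  rw [abs_mul, abs_of_pos hδ, mul_comm]
  refine mul_le_mul_of_nonneg_right ?_ hδ.le
  have := Real.arctan_lt_pi_div_two (t / δ)
  have := Real.neg_pi_div_two_lt_arctan (t / δ)
  have := Real.pi_le_four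
  rw [abs_le]; constructor <;> linarith

theorem dd_arctan_scale {δ : ℝ} (hδ : 0 < δ) {g : Euc N → ℝ} (hg : Differentiable ℝ g) (e x : Euc N) :
    dd e (fun y => δ * Real.arctan (g y / δ)) x = 1 / (1 + (g x / δ) ^ 2) * dd e g x := by
  have := (hasDerivAt_arctan_scale hδ (g x)).comp_hasFDerivAt x (hg x).hasFDerivAt
  have h2 := this.fderiv
  rw [dd]
  change (fderiv ℝ ((fun t => δ * Real.arctan (t / δ)) ∘ g) x) e = _
  rw [h2]; rfl

theorem Krn.mul_smooth {Z φ : Euc N → ℝ} (h : Krn Z) (hφ : ContDiff ℝ (⊤ : ℕ∞) φ) :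
    Krn fun x => Z x * φ x where
  smooth := h.smooth.mul hφ
  supp x hx := by rw [h.supp x hx, zero_mul]

theorem Krn.integral_mul_dd {Z : Euc N → ℝ} (h : Krn Z) {f : Euc N → ℝ} (hf : ContDiff ℝ 1 f) (a : Euc N) :
    ∫ x, Z x * _root_.dd a f x = -∫ x, _root_.dd a Z x * f x := by
  have h1 := h.integral_dd_mul hf a
  have h2 : _root_.dd a (fun y => Z y * f y) = fun x => Z x * _root_.dd a f x + _root_.dd a Z x * f x :=
    funext fun x => dd_mul (h.smooth.differentiable (by simp) x) (hf.differentiable (by simp) x) a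
  rw [h2, integral_add (h.integrable_cmul (continuous_dd hf a))
    ((h.dd a).integrable_cmul hf.continuous)] at h1
  linarith

/-- The part of the truncated integral that is treated by integration by parts. -/
theorem Krn.abs_integral_arctan_le {φ : Euc N → ℝ} (h : Krn φ) {g : Euc N → ℝ} (hg : ContDiff ℝ (⊤ : ℕ∞) g)
    {δ : ℝ} (hδ : 0 < δ) (e : Euc N) :
    |∫ x, φ x * (1 / (1 + (g x / δ) ^ 2) * _root_.dd e g x)| ≤ 2 * δ * ∫ x, |_root_.dd e φ x| := by
  have hc : ContDiff ℝ 1 fun y => δ * Real.arctan (g y / δ) :=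
    (contDiff_const.mul (Real.contDiff_arctan.comp ((hg.of_le (by exact_mod_cast le_top)).div_const δ)))
  have h1 := h.integral_mul_dd hc e
  simp only [dd_arctan_scale hδ (hg.differentiable (by simp))] at h1
  rw [h1, abs_neg, mul_comm, ← integral_mul_const, ← Real.norm_eq_abs]
  refine norm_integral_le_of_norm_le ((h.dd e).integrable.abs.mul_const _) (Eventually.of_forall fun x => ?_)
  rw [norm_mul, Real.norm_eq_abs, Real.norm_eq_abs]
  exact mul_le_mul_of_nonneg_left (abs_arctan_scale_le hδ _) (abs_nonneg _)

theorem truncation_sq_le {T S c b : ℝ} (hb : 0 ≤ b) :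
    (T - S * (1 / (1 + b))) ^ 2 ≤ 3 * ((T - c) ^ 2 + (S - c) ^ 2 + c ^ 2 * b) := by
  have hp : 0 < 1 + b := by linarith
  have e1 : T - S * (1 / (1 + b)) = (T - c) + (c - S) * (1 / (1 + b)) + c * (b / (1 + b)) := by
    field_simp; ring
  have a1 : (1 / (1 + b)) ^ 2 ≤ 1 := by
    rw [sq_le_one_iff_abs_le_one, abs_of_pos (by positivity), div_le_one hp]; linarith
  have a2 : (b / (1 + b)) ^ 2 ≤ b := by
    rw [div_pow, div_le_iff₀ (by positivity)]; nlinarith [pow_nonneg hb 3, sq_nonneg b]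
  rw [e1]
  have b1 : ((c - S) * (1 / (1 + b))) ^ 2 ≤ (S - c) ^ 2 := by
    rw [mul_pow]; nlinarith [sq_nonneg (S - c)]
  have b2 : (c * (b / (1 + b))) ^ 2 ≤ c ^ 2 * b := by
    rw [mul_pow]; exact mul_le_mul_of_nonneg_left a2 (sq_nonneg c)
  generalize (c - S) * (1 / (1 + b)) = y at *
  generalize c * (b / (1 + b)) = z at *
  nlinarith [sq_nonneg ((T - c) - y), sq_nonneg ((T - c) - z), sq_nonneg (y - z)]

/-- The estimate behind the weak convergence `∂ₑₑUₙ → 0` on `Λ`. -/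
theorem SolOn.abs_integral_chi_dd_dd_le {u : Euc N → ℝ} {Λ : Set (Euc N)} (h : SolOn u Λ (ball 0 4))
    {e : Euc N} {K : ℝ} (n s : ℕ) {t δ ω : ℝ} (ht : 0 < t) (hδ : 0 < δ)
    (hK : ∫ x, zb x * dd e (dd e (Tk rho (rn n) u)) x ^ 2 ≤ K)
    (hω : ∀ x ∈ Λ ∩ ball (0 : Euc N) 1, |dd e (Tk rho (rn n) u) x| ≤ ω) :
    |∫ x, zb x * (Tk rho (rn n) (chi Λ) x * dd e (dd e (Tk rho (rn n) u)) x)| ≤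
      t * K + 3 / (4 * t) *
        ((∫ x in ball (0 : Euc N) 1, (Tk rho (rn n) (chi Λ) x - chi Λ x) ^ 2) +
         (∫ x in ball (0 : Euc N) 1, (Tk rho (rn s) (chi Λ) x - chi Λ x) ^ 2) +
         volume.real (ball (0 : Euc N) 1) * (ω / δ) ^ 2)
      + 2 * δ * ∫ x, |dd e (fun x => zb x * Tk rho (rn s) (chi Λ) x) x| := by
  have hU := h.contDiff_Tk_rho (rn_pos n)
  set g := dd e (Tk rho (rn n) u)
  have hg : ContDiff ℝ (⊤ : ℕ∞) g := contDiff_dd hU e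
  have ha : Continuous (dd e g) := (contDiff_dd hg e).continuous
  set T := Tk rho (rn n) (chi Λ)
  set S := Tk rho (rn s) (chi Λ)
  have hT : Continuous T := continuous_Tk_chi krn_rho h.meas (rn_pos n)
  have hS : ContDiff ℝ (⊤ : ℕ∞) S := contDiff_Tk krn_rho (rn_pos s) (locallyIntegrable_chi h.meas)
  have hφ : Krn fun x => zb x * S x := krn_zb.mul_smooth hS
  have hb : Continuous fun x => 1 / (1 + (g x / δ) ^ 2) :=
    continuous_const.div (continuous_const.add ((hg.continuous.div_const δ).pow 2))
      fun x => by positivity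
  set q := fun x => T x - S x * (1 / (1 + (g x / δ) ^ 2)) with hq
  have hqc : Continuous q := hT.sub (hS.continuous.mul hb)
  have i1 : Integrable fun x => zb x * (q x * dd e g x) := krn_zb.integrable_cmul (hqc.mul ha)
  have i2 : Integrable fun x => zb x * S x * (1 / (1 + (g x / δ) ^ 2) * dd e g x) :=
    hφ.integrable_cmul (hb.mul ha)
  have i3 : Integrable fun x => zb x * dd e g x ^ 2 := krn_zb.integrable_cmul (ha.pow 2)
  have i4 : Integrable fun x => zb x * q x ^ 2 := krn_zb.integrable_cmul (hqc.pow 2)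
  have e0 : (∫ x, zb x * (T x * dd e g x)) = (∫ x, zb x * (q x * dd e g x)) +
      ∫ x, zb x * S x * (1 / (1 + (g x / δ) ^ 2) * dd e g x) := by
    rw [← integral_add i1 i2]
    congr 1; funext x; simp only [hq]; ring
  have b1 : |∫ x, zb x * (q x * dd e g x)| ≤ t * K + 1 / (4 * t) * ∫ x, zb x * q x ^ 2 := by
    have : |∫ x, zb x * (q x * dd e g x)| ≤ ∫ x, (t * (zb x * dd e g x ^ 2) + 1 / (4 * t) * (zb x * q x ^ 2)) := by
      rw [← Real.norm_eq_abs]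
      refine norm_integral_le_of_norm_le ((i3.const_mul t).add (i4.const_mul _)) (Eventually.of_forall fun x => ?_)
      rw [norm_mul, Real.norm_of_nonneg (zb_nonneg x), norm_mul, Real.norm_eq_abs, Real.norm_eq_abs]
      have hz := zb_nonneg x
      have : |q x| * |dd e g x| ≤ t * dd e g x ^ 2 + 1 / (4 * t) * q x ^ 2 := by
        have h1 := sq_nonneg (2 * t * |dd e g x| - |q x|)
        rw [← sq_abs (dd e g x), ← sq_abs (q x)]
        have h2 : t * |dd e g x| ^ 2 + 1 / (4 * t) * |q x| ^ 2 - |q x| * |dd e g x| =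
          1 / (4 * t) * (2 * t * |dd e g x| - |q x|) ^ 2 := by field_simp; ring
        have : 0 ≤ 1 / (4 * t) * (2 * t * |dd e g x| - |q x|) ^ 2 := by positivity
        linarith
      nlinarith
    rw [integral_add (i3.const_mul t) (i4.const_mul _), integral_const_mul, integral_const_mul] at this
    nlinarith
  have mI : ∀ k, IntegrableOn (fun x => (Tk rho (rn k) (chi Λ) x - chi Λ x) ^ 2) (ball (0 : Euc N) 1) := by
    intro k
    refine Integrable.mono' (integrableOn_const (C := (1:ℝ)) (measure_ball_lt_top (μ := volume) (x := (0 : Euc N)) (r := 1)).ne)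
      ((((continuous_Tk_chi krn_rho h.meas (rn_pos k)).measurable.sub
        (measurable_chi h.meas)).pow_const 2).aestronglyMeasurable) (Eventually.of_forall fun x => ?_)
    rw [Real.norm_eq_abs, abs_pow, sq_le_one_iff_abs_le_one, abs_abs, abs_le]
    have := Tk_rho_nonneg (chi_nonneg Λ) (rn k) x
    have := Tk_rho_chi_le_one h.meas (rn_pos k) x
    have := chi_nonneg Λ x
    have := chi_le_one Λ x
    constructor <;> linarith
  have b2 : ∫ x, zb x * q x ^ 2 ≤ 3 * ((∫ x in ball (0 : Euc N) 1, (T x - chi Λ x) ^ 2) +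
         (∫ x in ball (0 : Euc N) 1, (S x - chi Λ x) ^ 2) +
         volume.real (ball (0 : Euc N) 1) * (ω / δ) ^ 2) := by
    refine (integral_zb_mul_le (fun x => sq_nonneg _) (integrable_indicator_ball (hqc.pow 2) _ _)).trans ?_
    have ic : IntegrableOn (fun _ => (ω / δ) ^ 2) (ball (0 : Euc N) 1) := integrableOn_const measure_ball_lt_top.ne
    have e3 : 3 * ((∫ x in ball (0 : Euc N) 1, (T x - chi Λ x) ^ 2) +
         (∫ x in ball (0 : Euc N) 1, (S x - chi Λ x) ^ 2) +
         volume.real (ball (0 : Euc N) 1) * (ω / δ) ^ 2) =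
         ∫ x in ball (0 : Euc N) 1, 3 * ((T x - chi Λ x) ^ 2 + (S x - chi Λ x) ^ 2 + (ω / δ) ^ 2) := by
      have iTS : IntegrableOn (fun x => (T x - chi Λ x) ^ 2 + (S x - chi Λ x) ^ 2) (ball (0 : Euc N) 1) :=
        (mI n).add (mI s)
      rw [integral_const_mul, integral_add iTS ic, integral_add (mI n) (mI s), setIntegral_const,
        smul_eq_mul]
    rw [e3]
    refine setIntegral_mono_on (integrable_indicator_ball (hqc.pow 2) _ _)
      ((((mI n).add (mI s)).add ic).const_mul 3) measurableSet_ball fun x hx => ?_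
    refine (truncation_sq_le (c := chi Λ x) (sq_nonneg (g x / δ))).trans ?_
    have : chi Λ x ^ 2 * (g x / δ) ^ 2 ≤ (ω / δ) ^ 2 := by
      by_cases hxΛ : x ∈ Λ
      · rw [chi_of_mem hxΛ, one_pow, one_mul, div_pow, div_pow]
        refine div_le_div_of_nonneg_right ?_ (sq_nonneg δ)
        rw [← sq_abs]
        exact pow_le_pow_left₀ (abs_nonneg _) (hω x ⟨hxΛ, hx⟩) 2
      · rw [chi_of_notMem hxΛ]; simpa using sq_nonneg (ω / δ)
    linarith
  have b3 := hφ.abs_integral_arctan_le hg hδ e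
  rw [e0]
  refine (abs_add_le _ _).trans (add_le_add ?_ b3)
  refine b1.trans ?_
  have : 1 / (4 * t) * ∫ x, zb x * q x ^ 2 ≤ 1 / (4 * t) * _ := mul_le_mul_of_nonneg_left b2 (by positivity)
  refine (add_le_add_right this _).trans (le_of_eq ?_)
  ring

theorem SolOn.tendsto_integral_chi_dd_dd {u : Euc N → ℝ} {Λ : Set (Euc N)} (h : SolOn u Λ (ball 0 4))
    {e : Euc N} (he : ‖e‖ = 1) :
    Tendsto (fun n => ∫ x, zb x * (Tk rho (rn n) (chi Λ) x * dd e (dd e (Tk rho (rn n) u)) x)) atTop (nhds 0) := by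
  obtain ⟨K, hK0, hK⟩ := h.exists_l2_bound
  have hI := tendsto_integral_Tk_chi_sub_sq h.meas
  rw [Metric.tendsto_nhds]
  intro ε hε
  set t := ε / (4 * K)
  have ht : 0 < t := by positivity
  have htK : t * K = ε / 4 := by simp only [t]; field_simp
  set A := 3 / (4 * t)
  have hA : 0 < A := by positivity
  have hsmall : ∀ᶠ k in atTop, ∫ x in ball (0 : Euc N) 1, (Tk rho (rn k) (chi Λ) x - chi Λ x) ^ 2 < ε / (16 * A) :=
    hI.eventually (gt_mem_nhds (by positivity))
  obtain ⟨s, hs⟩ := hsmall.exists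
  set D := ∫ x, |dd e (fun x => zb x * Tk rho (rn s) (chi Λ) x) x|
  have hD : 0 ≤ D := integral_nonneg fun _ => abs_nonneg _
  set δ := ε / (16 * (D + 1))
  have hδ : 0 < δ := by positivity
  have hδD : 2 * δ * D ≤ ε / 8 := by
    have : δ * (D + 1) = ε / 16 := by simp only [δ]; field_simp
    nlinarith
  set V := volume.real (ball (0 : Euc N) 1)
  have hV : 0 ≤ V := measureReal_nonneg
  set w := ε / (16 * A * (V + 1))
  have hw : 0 < w := by positivity
  have hwV : A * (V * w) ≤ ε / 16 := by
    have : A * ((V + 1) * w) = ε / 16 := by simp only [w]; field_simp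
    nlinarith
  filter_upwards [hsmall, h.eventually_dd_Tk_le e (ω := δ * Real.sqrt w) (by positivity)] with n hn hωn
  rw [dist_zero_right, Real.norm_eq_abs]
  have key := h.abs_integral_chi_dd_dd_le n s ht hδ (hK n e he) hωn
  have e1 : (δ * Real.sqrt w / δ) ^ 2 = w := by
    rw [mul_div_cancel_left₀ _ hδ.ne', Real.sq_sqrt hw.le]
  rw [e1] at key
  have eA : A * (ε / (16 * A)) = ε / 16 := by field_simp
  have h1 := mul_lt_mul_of_pos_left hn hA
  have h2 := mul_lt_mul_of_pos_left hs hA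
  rw [eA] at h1 h2
  calc _ ≤ _ := key
    _ < ε := by
      change t * K + A * (_ + _ + V * w) + 2 * δ * D < ε
      rw [mul_add, mul_add]; linarith

theorem tendsto_integral_zb_Tk_chi {Λ : Set (Euc N)} (hΛ : MeasurableSet Λ) :
    Tendsto (fun n => ∫ x, zb x * Tk rho (rn n) (chi Λ) x) atTop (nhds (∫ x, zb x * chi Λ x)) := by
  refine tendsto_integral_of_dominated_convergence zb (fun n => ?_) krn_zb.integrable (fun n => ?_) ?_
  · exact (krn_zb.continuous.mul (continuous_Tk_chi krn_rho hΛ (rn_pos n))).aestronglyMeasurable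
  · refine Eventually.of_forall fun x => ?_
    have h0 := Tk_rho_nonneg (chi_nonneg Λ) (rn n) x
    rw [Real.norm_of_nonneg (mul_nonneg (zb_nonneg x) h0)]
    exact mul_le_of_le_one_right (zb_nonneg x) (Tk_rho_chi_le_one hΛ (rn_pos n) x)
  · filter_upwards [ae_tendsto_Tk_chi hΛ] with x hx
    exact (hx.comp tendsto_rn).const_mul (zb x)

theorem vol_half_le_integral_zb_chi {Λ : Set (Euc N)} (hΛ : MeasurableSet Λ) :
    volume.real (Λ ∩ ball (0 : Euc N) (1 / 2)) ≤ ∫ x, zb x * chi Λ x := by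
  rw [← integral_indicator_one (hΛ.inter measurableSet_ball)]
  refine integral_mono_of_nonneg (Eventually.of_forall fun x => indicator_nonneg (fun _ _ => zero_le_one) x) ?_
    (Eventually.of_forall fun x => ?_)
  · refine krn_zb.integrable.mono ((krn_zb.continuous.measurable.mul (measurable_chi hΛ)).aestronglyMeasurable)
      (Eventually.of_forall fun x => ?_)
    rw [norm_mul]
    exact mul_le_of_le_one_right (norm_nonneg _) (abs_chi_le Λ x)
  · by_cases hx : x ∈ Λ ∩ ball (0 : Euc N) (1 / 2)
    · simp only [indicator_of_mem hx, Pi.one_apply]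
      rw [zb_eq_one (ball_subset_closedBall hx.2), chi_of_mem hx.1, one_mul]
    · simp only [indicator_of_notMem hx]
      exact mul_nonneg (zb_nonneg x) (chi_nonneg Λ x)

/-- If a pure second derivative is very negative at unit scale, the set `Λ` where `∇u = 0` occupies a
smaller proportion of a smaller ball. -/
theorem exists_decay : ∃ C, 0 < C ∧ ∀ (u : Euc N → ℝ) (Λ : Set (Euc N)) (e : Euc N) (μ : ℝ) (m : ℕ),
    SolOn u Λ (ball 0 4) → ‖e‖ = 1 → 0 ≤ μ → (∀ x ∈ ball (0 : Euc N) 1, Hes 1 u e x ≤ -μ) →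
      μ * volume.real (Λ ∩ ball (0 : Euc N) (1 / 2)) ≤ C * volume.real (Λ ∩ ball (0 : Euc N) 2) *
        ((rn m ^ N)⁻¹ * volume.real (Λ ∩ ball (0 : Euc N) 2) + rn m) := by
  obtain ⟨C1, hC1, hE⟩ := exists_energy_bound (krn_zb (N := N)) zb_nonneg
  obtain ⟨C2, hC2, hG⟩ := exists_integral_gsq_wn_le (N := N)
  obtain ⟨C3, hC3, hW⟩ := exists_dd_wn_bounds (N := N)
  obtain ⟨C4, hC4, hZ⟩ := (krn_zb (N := N)).exists_uniform_bounds
  obtain ⟨C5, hC5, hR⟩ := (krn_rho (N := N)).exists_uniform_bounds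
  obtain ⟨C6, hC6, hρ⟩ := (krn_rho (N := N)).exists_bound
  refine ⟨(C4 * C6 + C5) * C3 + C1 * C2, by positivity, fun u Λ e μ m h he hμ hH => ?_⟩
  set lam := volume.real (Λ ∩ ball (0 : Euc N) 2)
  have hl : 0 ≤ lam := measureReal_nonneg
  have hm := rn_pos m
  set T := fun n => Tk rho (rn n) (chi Λ)
  have hTs : ∀ n, ContDiff ℝ (⊤ : ℕ∞) (T n) := fun n =>
    contDiff_Tk krn_rho (rn_pos n) (locallyIntegrable_chi h.meas)
  set U := fun n => Tk rho (rn n) u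
  have hU : ∀ n, ContDiff ℝ (⊤ : ℕ∞) (U n) := fun n => h.contDiff_Tk_rho (rn_pos n)
  have hUe : ∀ n, ContDiff ℝ (⊤ : ℕ∞) (dd e (U n)) := fun n => contDiff_dd (hU n) e
  have hUee : ∀ n, Continuous (dd e (dd e (U n))) := fun n => (contDiff_dd (hUe n) e).continuous
  have hφ : Krn fun x => zb x * T 0 x := krn_zb.mul_smooth (hTs 0)
  have hballx : ∀ x ∈ ball (0 : Euc N) 1, volume.real (Λ ∩ ball x 1) ≤ lam := fun x hx => by
    refine vol_inter_ball_mono (ball_subset_ball' ?_)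
    rw [mem_ball] at hx; linarith
  have hφb : ∀ x ∈ ball (0 : Euc N) 1, |dd e (fun x => zb x * T 0 x) x| ≤ (C4 * C6 + C5) * lam := by
    intro x hx
    rw [dd_mul (krn_zb.smooth.differentiable (by simp) x) ((hTs 0).differentiable (by simp) x)]
    have b1 := abs_Tk_chi_le krn_rho hρ (rn_pos 0) h.meas x
    have b2 := abs_Tk_chi_le (krn_rho.dd e) (hR e he).1 (rn_pos 0) h.meas x
    have b3 := dd_Tk krn_rho (rn_pos 0) (locallyIntegrable_chi h.meas) e x
    simp only [rn_zero, one_pow, inv_one, mul_one, one_mul] at b1 b2 b3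
    have b4 := hballx x hx
    have eT : T 0 = Tk rho 1 (chi Λ) := by simp only [T, rn_zero]
    rw [eT, b3]
    have z0 := zb_nonneg x
    have z1 := zb_le_one x
    have c1 : |zb x * Tk (dd e rho) 1 (chi Λ) x| ≤ C5 * lam := by
      rw [abs_mul, abs_of_nonneg z0]
      have : 0 ≤ |Tk (dd e rho) 1 (chi Λ) x| := abs_nonneg _
      nlinarith
    have c2 : |dd e zb x * Tk rho 1 (chi Λ) x| ≤ C4 * (C6 * lam) := by
      rw [abs_mul]
      exact mul_le_mul ((hZ e he).1 x) (by nlinarith) (abs_nonneg _) hC4.le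
    refine (abs_add_le _ _).trans ?_
    linarith
  have key : ∀ n, μ * ∫ x, zb x * T n x ≤ (C4 * C6 + C5) * lam * (C3 * lam)
      - (∫ x, zb x * (T n x * dd e (dd e (U n)) x)) + C1 * (C2 * lam * ((rn m ^ N)⁻¹ * lam + rn m)) := by
    intro n
    have h1 := hE _ e (h.contDiff_wn n) he
    have h0 : 0 ≤ ∫ x, zb x * dd e (dd e (wn u n)) x ^ 2 :=
      integral_nonneg fun x => mul_nonneg (zb_nonneg x) (sq_nonneg _)
    have h2 := mul_le_mul_of_nonneg_left (hG u Λ h n m) hC1.le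
    have hww : dd e (dd e (wn u n)) = fun x => dd e (dd e (U n)) x - dd e (dd e (U 0)) x := h.dd_dd_wn n e e
    have hwc : Continuous (dd e (dd e (wn u n))) := (contDiff_dd (contDiff_dd (h.contDiff_wn n) e) e).continuous
    have i1 : Integrable fun x => zb x * T 0 x * dd e (dd e (wn u n)) x := hφ.integrable_cmul hwc
    have i2 : Integrable fun x => zb x * (T n x * dd e (dd e (U n)) x) :=
      krn_zb.integrable_cmul ((hTs n).continuous.mul (hUee n))
    have i3 : Integrable fun x => zb x * (T n x * dd e (dd e (U 0)) x) :=
      krn_zb.integrable_cmul ((hTs n).continuous.mul (hUee 0))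
    have e1 : (∫ x, zb x * (lap N (wn u n) x * dd e (dd e (wn u n)) x)) =
        (∫ x, zb x * T 0 x * dd e (dd e (wn u n)) x) - (∫ x, zb x * (T n x * dd e (dd e (U n)) x))
          + ∫ x, zb x * (T n x * dd e (dd e (U 0)) x) := by
      have : (∫ x, zb x * T 0 x * dd e (dd e (wn u n)) x) - (∫ x, zb x * (T n x * dd e (dd e (U n)) x))
          + (∫ x, zb x * (T n x * dd e (dd e (U 0)) x)) =
          ∫ x, (zb x * T 0 x * dd e (dd e (wn u n)) x - zb x * (T n x * dd e (dd e (U n)) x)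
            + zb x * (T n x * dd e (dd e (U 0)) x)) := by
        have i12 : Integrable fun x => zb x * T 0 x * dd e (dd e (wn u n)) x - zb x * (T n x * dd e (dd e (U n)) x) :=
          i1.sub i2
        rw [integral_add i12 i3, integral_sub i1 i2]
      rw [this]
      congr 1; funext x
      have hl : zb x * lap N (wn u n) x = zb x * (T 0 x - T n x) := by
        refine zb_mul_congr (g := fun x => T 0 x - T n x) (fun y hy => ?_) x
        have l1 := h.lap_Tk_rho (rn_pos n) (closedBall_subset_ball_four hy (rn_le_one n))
        have l2 := h.lap_Tk_rho (rn_pos 0) (closedBall_subset_ball_four hy (rn_le_one 0))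
        have l3 : lap N (wn u n) y = lap N (Tk rho (rn n) u) y - lap N (Tk rho (rn 0) u) y := by
          rw [lap_eq_sum_dd, lap_eq_sum_dd, lap_eq_sum_dd, ← Finset.sum_sub_distrib]
          exact Finset.sum_congr rfl fun i _ => congrFun (h.dd_dd_wn n _ _) y
        rw [l3, l1, l2]; simp only [T]; ring
      rw [← mul_assoc, hl, hww]; ring
    have h3 : (∫ x, zb x * T 0 x * dd e (dd e (wn u n)) x) ≤ (C4 * C6 + C5) * lam * (C3 * lam) := by
      have hwe : ContDiff ℝ (⊤ : ℕ∞) (dd e (wn u n)) := contDiff_dd (h.contDiff_wn n) e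
      rw [hφ.integral_mul_dd (hwe.of_le (by exact_mod_cast le_top))]
      have hA : 0 ≤ (C4 * C6 + C5) * lam := by positivity
      refine le_trans ?_ (mul_le_mul_of_nonneg_left ((hW u Λ h n e he).2) hA)
      rw [← integral_neg, ← integral_const_mul, ← integral_indicator measurableSet_ball]
      refine integral_mono ((hφ.dd e).integrable_cmul hwe.continuous).neg
        ((integrable_indicator_ball (continuous_const.mul hwe.continuous.abs) _ _).integrable_indicator
          measurableSet_ball) fun x => ?_
      by_cases hx : x ∈ ball (0 : Euc N) 1
      · simp only [indicator_of_mem hx]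
        refine (neg_le_abs _).trans ?_
        rw [abs_mul]
        exact mul_le_mul_of_nonneg_right (hφb x hx) (abs_nonneg _)
      · simp only [indicator_of_notMem hx]
        rw [hφ.dd_eq_zero e hx, zero_mul, neg_zero]
    have h4 : (∫ x, zb x * (T n x * dd e (dd e (U 0)) x)) ≤ -(μ * ∫ x, zb x * T n x) := by
      rw [← integral_const_mul, ← integral_neg]
      refine integral_mono i3 ((krn_zb.integrable_cmul (hTs n).continuous).const_mul μ).neg fun x => ?_
      have := zb_mul_le_of_ball (f := fun x => T n x * dd e (dd e (U 0)) x) (g := fun x => -(μ * T n x))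
        (fun x hx => by
          have t0 : 0 ≤ T n x := Tk_rho_nonneg (chi_nonneg Λ) (rn n) x
          have hh := hH x hx
          rw [Hes_eq_dd_dd one_pos h.locallyIntegrable] at hh
          simp only [U, rn_zero]
          nlinarith) x
      simp only at this ⊢
      linarith
    rw [e1] at h1
    linarith
  have lim := (((h.tendsto_integral_chi_dd_dd he).const_sub ((C4 * C6 + C5) * lam * (C3 * lam))).add_const
    (C1 * (C2 * lam * ((rn m ^ N)⁻¹ * lam + rn m))))
  have fin := le_of_tendsto_of_tendsto' ((tendsto_integral_zb_Tk_chi h.meas).const_mul μ) lim key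
  refine (mul_le_mul_of_nonneg_left (vol_half_le_integral_zb_chi h.meas) hμ).trans (fin.trans ?_)
  have hinv : 1 ≤ (rn m ^ N)⁻¹ := by
    rw [one_le_inv₀ (by positivity)]
    exact pow_le_one₀ hm.le (rn_le_one m)
  have : (C4 * C6 + C5) * lam * (C3 * lam) ≤ (C4 * C6 + C5) * C3 * lam * ((rn m ^ N)⁻¹ * lam + rn m) := by
    have : lam ≤ (rn m ^ N)⁻¹ * lam + rn m := by nlinarith
    have : (C4 * C6 + C5) * C3 * lam * lam ≤ (C4 * C6 + C5) * C3 * lam * ((rn m ^ N)⁻¹ * lam + rn m) :=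
      mul_le_mul_of_nonneg_left this (by positivity)
    linarith
  linarith

/-- The quadratic rescaling of `u` at `z`. -/
def resc (z : Euc N) (r : ℝ) (u : Euc N → ℝ) (x : Euc N) : ℝ := (r ^ 2)⁻¹ * u (z + r • x)

theorem Hes_resc (r : ℝ) (z : Euc N) (s : ℝ) (u : Euc N → ℝ) (e x : Euc N) :
    Hes s (resc z r u) e x = Hes (r * s) u e (z + r • x) := by
  unfold Hes resc
  rw [Tk_const_mul, Tk_resc, mul_pow, mul_inv]
  ring

theorem contDiff_resc {n : ℕ∞} {u : Euc N → ℝ} (h : ContDiff ℝ n u) (z : Euc N) (r : ℝ) : ContDiff ℝ n (resc z r u) :=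
  contDiff_const.mul (h.comp (contDiff_const.add (contDiff_const_smul r)))

theorem fderiv_resc {r : ℝ} (hr : 0 < r) {u : Euc N → ℝ} (z x : Euc N) (h : DifferentiableAt ℝ u (z + r • x)) :
    fderiv ℝ (resc z r u) x = r⁻¹ • fderiv ℝ u (z + r • x) := by
  have h1 : HasFDerivAt (fun x : Euc N => z + r • x) (r • ContinuousLinearMap.id ℝ (Euc N)) x :=
    ((hasFDerivAt_id x).const_smul r).const_add z
  have h2 := ((h.hasFDerivAt.comp x h1).const_mul (r ^ 2)⁻¹).fderiv
  change fderiv ℝ (fun x => (r ^ 2)⁻¹ * u (z + r • x)) x = _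
  refine Eq.trans h2 ?_
  ext v
  simp
  field_simp

theorem integral_comp_affine (f : Euc N → ℝ) {r : ℝ} (hr : 0 < r) (z : Euc N) :
    ∫ x, f (z + r • x) = (r ^ N)⁻¹ * ∫ y, f y := by
  have := Measure.integral_comp_smul (volume : Measure (Euc N)) (fun y => f (z + y)) r
  rw [this, integral_add_left_eq_self, finrank_euclideanSpace_fin, smul_eq_mul, abs_of_pos (by positivity)]

theorem WeakLap.resc {u f : Euc N → ℝ} {D : Set (Euc N)} (h : WeakLap u f D) {r : ℝ} (hr : 0 < r) (z : Euc N) :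
    WeakLap (resc z r u) (fun x => f (z + r • x)) ((fun x => z + r • x) ⁻¹' D) := by
  intro φ h1 h2 h3
  set ψ := fun y => φ (r⁻¹ • (y - z)) with hψ
  have hφψ : ∀ x, φ x = ψ (z + r • x) := fun x => by
    simp only [hψ, add_sub_cancel_left, smul_smul, inv_mul_cancel₀ hr.ne', one_smul]
  have hl : ∀ y, lap N ψ y = (r ^ 2)⁻¹ * lap N φ (r⁻¹ • (y - z)) := by
    intro y
    have := lap_comp_affine (ψ := φ) (-r⁻¹) z y
    simp only [neg_smul, ← smul_neg, neg_sub] at this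
    rw [this]; ring
  have hlφ : ∀ x, lap N φ x = r ^ 2 * lap N ψ (z + r • x) := fun x => by
    rw [hl, add_sub_cancel_left, smul_smul, inv_mul_cancel₀ hr.ne', one_smul]
    field_simp
  have key := h ψ (h1.comp (by fun_prop))
    (h2.comp_homeomorph ((Homeomorph.subRight z).trans (Homeomorph.smulOfNeZero r⁻¹ (inv_ne_zero hr.ne'))))
    (by
      intro y hy
      have hy2 : r⁻¹ • (y - z) ∈ tsupport φ :=
        tsupport_comp_subset_preimage φ (f := fun y => r⁻¹ • (y - z)) (by fun_prop) hy
      have := h3 hy2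
      simpa [smul_smul, mul_inv_cancel₀ hr.ne'] using this)
  have e1 := integral_comp_affine (fun y => u y * lap N ψ y) hr z
  have e2 := integral_comp_affine (fun y => f y * ψ y) hr z
  rw [key, ← e2] at e1
  simp only [← hφψ] at e1
  rw [← e1]
  congr 1; funext x
  rw [_root_.resc, hlφ]
  field_simp

theorem volume_real_preimage_affine {r : ℝ} (hr : 0 < r) (z : Euc N) {S : Set (Euc N)} (hS : MeasurableSet S) :
    volume.real ((fun x => z + r • x) ⁻¹' S) = (r ^ N)⁻¹ * volume.real S := by
  have h := integral_comp_affine (S.indicator (1 : Euc N → ℝ)) hr z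
  rw [integral_indicator_one hS] at h
  rw [← h, ← integral_indicator_one (hS.preimage (by fun_prop))]
  rfl

theorem preimage_affine_ball {r : ℝ} (hr : 0 < r) (z : Euc N) (s : ℝ) :
    (fun x : Euc N => z + r • x) ⁻¹' (ball z (r * s)) = ball 0 s := by
  ext x
  simp only [mem_preimage, mem_ball, dist_self_add_left, dist_zero_right, norm_smul, Real.norm_of_nonneg hr.le]
  exact mul_lt_mul_iff_right₀ hr

theorem SolOn.resc {u : Euc N → ℝ} {Λ : Set (Euc N)} {z : Euc N} {r s : ℝ} (h : SolOn u Λ (ball z (r * s)))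
    (hr : 0 < r) : SolOn (resc z r u) ((fun x => z + r • x) ⁻¹' Λ) (ball 0 s) where
  contDiff := contDiff_resc (n := 1) h.contDiff z r
  meas := h.meas.preimage (by fun_prop)
  zero x hx := by
    rw [fderiv_resc hr z x (h.contDiff.differentiable (by simp) _)]
    rw [← preimage_affine_ball hr z] at hx
    rw [h.zero _ hx, smul_zero]
  weak := by
    have := h.weak.resc hr z
    rw [preimage_affine_ball hr] at this
    exact this

/-- The proportion of the ball of radius `2s` around `z` occupied by `Λ` (up to a constant). -/
def dens (Λ : Set (Euc N)) (z : Euc N) (s : ℝ) : ℝ := (s ^ N)⁻¹ * volume.real (Λ ∩ ball z (2 * s))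

theorem dens_nonneg (Λ : Set (Euc N)) (z : Euc N) {s : ℝ} (hs : 0 < s) : 0 ≤ dens Λ z s :=
  mul_nonneg (by positivity) measureReal_nonneg

theorem dens_eq_resc {Λ : Set (Euc N)} (hΛ : MeasurableSet Λ) (z : Euc N) {r : ℝ} (hr : 0 < r) {s : ℝ} :
    volume.real ((fun x => z + r • x) ⁻¹' Λ ∩ ball 0 s) = (r ^ N)⁻¹ * volume.real (Λ ∩ ball z (r * s)) := by
  rw [← volume_real_preimage_affine hr z (hΛ.inter measurableSet_ball), preimage_inter, preimage_affine_ball hr]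

theorem exists_decay_scaled : ∃ C, 0 < C ∧ ∀ (u : Euc N → ℝ) (Λ : Set (Euc N)) (e z : Euc N) (μ s : ℝ) (m : ℕ),
    0 < s → SolOn u Λ (ball z (s * 4)) → ‖e‖ = 1 → 0 ≤ μ → (∀ x ∈ ball z s, Hes s u e x ≤ -μ) →
      μ * dens Λ z (s / 4) ≤ C * dens Λ z s * ((rn m ^ N)⁻¹ * dens Λ z s + rn m) := by
  obtain ⟨C, hC, h⟩ := exists_decay (N := N)
  refine ⟨4 ^ N * C, by positivity, fun u Λ e z μ s m hs hu he hμ hH => ?_⟩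
  have h1 := h _ _ e μ m (hu.resc hs) he hμ (fun x hx => by
    rw [Hes_resc, mul_one]
    refine hH _ ?_
    rw [← preimage_affine_ball hs z, mul_one] at hx
    exact hx)
  rw [dens_eq_resc hu.meas z hs, dens_eq_resc hu.meas z hs] at h1
  have e1 : (s ^ N)⁻¹ * volume.real (Λ ∩ ball z (s * 2)) = dens Λ z s := by rw [dens, mul_comm s]
  have e2 : dens Λ z (s / 4) = 4 ^ N * ((s ^ N)⁻¹ * volume.real (Λ ∩ ball z (s * (1 / 2)))) := by
    rw [dens, div_pow, inv_div]
    have : 2 * (s / 4) = s * (1 / 2) := by ring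
    rw [this]; ring
  rw [e1] at h1
  rw [e2]
  have := mul_le_mul_of_nonneg_left h1 (by positivity : (0:ℝ) ≤ 4 ^ N)
  calc _ = 4 ^ N * (μ * ((s ^ N)⁻¹ * volume.real (Λ ∩ ball z (s * (1 / 2))))) := by ring
    _ ≤ _ := this
    _ = _ := by ring

theorem SolOn.Hes_sub {u : Euc N → ℝ} {Λ D : Set (Euc N)} (h : SolOn u Λ D) {R : ℝ} (hR : 0 < R) {x : Euc N}
    (hx : closedBall x R ⊆ D) (e : Euc N) :
    Hes R u e x - Hes (R / 2) u e x = - Tk (dd e (dd e kap)) R (chi Λ) x := by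
  rw [h.weak.Hes_sub h.locallyIntegrable hR hx, (krn_kap.dd e).Tk_dd_chi_compl hR h.meas]

theorem exists_kap_bound : ∃ C, 0 < C ∧ ∀ e : Euc N, ‖e‖ = 1 →
    (∀ x, |dd e (dd e kap) x| ≤ C) ∧ ∫ x, |dd e (dd e kap) x| ≤ C := by
  obtain ⟨C, h0, hC⟩ := (krn_kap (N := N)).exists_bound_dd_dd
  have hv : 0 ≤ volume.real (closedBall (0 : Euc N) 1) := measureReal_nonneg
  refine ⟨C * (1 + volume.real (closedBall (0 : Euc N) 1)), by positivity, fun a ha => ⟨fun x => ?_, ?_⟩⟩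
  · exact (hC a a ha ha x).trans (by nlinarith)
  · exact (((krn_kap.dd a).dd a).integral_abs_le (hC a a ha ha)).trans (by nlinarith)

/-- Change of the Hessian when the scale is divided by four. -/
theorem exists_drift : ∃ C, 0 < C ∧ ∀ (u : Euc N → ℝ) (Λ : Set (Euc N)) (e z : Euc N) (s : ℝ),
    0 < s → SolOn u Λ (ball z (s * 4)) → ‖e‖ = 1 → ∀ x ∈ ball z s,
      |Hes (s / 4) u e x - Hes s u e x| ≤ C * dens Λ z s := by
  obtain ⟨C, hC, hk⟩ := exists_kap_bound (N := N)
  refine ⟨C * (1 + 2 ^ N), by positivity, fun u Λ e z s hs hu he x hx => ?_⟩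
  have hxd : dist x z < s := hx
  have h1 := hu.Hes_sub hs (x := x) (closedBall_subset_ball' (by linarith)) e
  have h2 := hu.Hes_sub (half_pos hs) (x := x) (closedBall_subset_ball' (by linarith)) e
  rw [div_div, show (2:ℝ) * 2 = 4 by norm_num] at h2
  have b1 := abs_Tk_chi_le ((krn_kap.dd e).dd e) (hk e he).1 hs hu.meas x
  have b2 := abs_Tk_chi_le ((krn_kap.dd e).dd e) (hk e he).1 (half_pos hs) hu.meas x
  have v1 : volume.real (Λ ∩ ball x s) ≤ volume.real (Λ ∩ ball z (2 * s)) :=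
    vol_inter_ball_mono (ball_subset_ball' (by linarith))
  have v2 : volume.real (Λ ∩ ball x (s / 2)) ≤ volume.real (Λ ∩ ball z (2 * s)) :=
    vol_inter_ball_mono (ball_subset_ball' (by linarith))
  have b1' : |Tk (dd e (dd e kap)) s (chi Λ) x| ≤ C * dens Λ z s := by
    refine b1.trans ?_
    rw [dens, mul_assoc]
    gcongr
  have b2' : |Tk (dd e (dd e kap)) (s / 2) (chi Λ) x| ≤ C * 2 ^ N * dens Λ z s := by
    refine b2.trans ?_
    rw [dens, div_pow, inv_div, mul_assoc, mul_assoc]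
    refine mul_le_mul_of_nonneg_left ?_ hC.le
    calc 2 ^ N / s ^ N * volume.real (Λ ∩ ball x (s / 2)) ≤ 2 ^ N / s ^ N * volume.real (Λ ∩ ball z (2 * s)) := by gcongr
      _ = _ := by ring
  have : Hes (s / 4) u e x - Hes s u e x =
    Tk (dd e (dd e kap)) s (chi Λ) x + Tk (dd e (dd e kap)) (s / 2) (chi Λ) x := by linarith
  rw [this]
  refine (abs_add_le _ _).trans ?_
  linarith

/-- If a second derivative is negative and `Λ` is sparse, then `Λ` is negligible. -/
theorem exists_null_of_sparse (μ : ℝ) (hμ : 0 < μ) : ∃ c, 0 < c ∧ ∀ (u : Euc N → ℝ) (Λ : Set (Euc N)) (e z : Euc N) (s : ℝ),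
    0 < s → SolOn u Λ (ball z (s * 8)) → ‖e‖ = 1 → (∀ x ∈ ball z (s * 2), Hes s u e x ≤ -μ) →
      (s ^ N)⁻¹ * volume.real (Λ ∩ ball z (s * 4)) ≤ c → volume (Λ ∩ ball z s) = 0 := by
  obtain ⟨C, hC, hdec⟩ := exists_decay_scaled (N := N)
  obtain ⟨C', hC', hdr⟩ := exists_drift (N := N)
  obtain ⟨B, hB, hρ⟩ := (krn_rho (N := N)).exists_bound
  obtain ⟨m, hm⟩ : ∃ m, rn m < μ / (8 * C) := by
    have : ∀ᶠ n in atTop, rn n < μ / (8 * C) :=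
      (tendsto_rn.mono_right nhdsWithin_le_nhds).eventually (gt_mem_nhds (by positivity))
    exact this.exists
  have hm0 := rn_pos m
  set A := (rn m ^ N)⁻¹
  have hA : 0 < A := by positivity
  refine ⟨min (μ / (8 * C * A)) (μ / (4 * C')), by positivity, fun u Λ e z s hs hu he hH hL => ?_⟩
  set c := min (μ / (8 * C * A)) (μ / (4 * C'))
  have hc : 0 < c := by positivity
  have hc1 : C * A * c ≤ μ / 8 := by
    have : c ≤ μ / (8 * C * A) := min_le_left _ _
    calc C * A * c ≤ C * A * (μ / (8 * C * A)) := by gcongr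
      _ = _ := by field_simp
  have hc2 : C' * (2 * c) ≤ μ / 2 := by
    have : c ≤ μ / (4 * C') := min_le_right _ _
    calc C' * (2 * c) ≤ C' * (2 * (μ / (4 * C'))) := by gcongr
      _ = _ := by field_simp; norm_num
  have hCm : C * rn m ≤ μ / 8 := by
    calc C * rn m ≤ C * (μ / (8 * C)) := by gcongr
      _ = _ := by field_simp
  have iter : ∀ y ∈ ball z s, ∀ k : ℕ, dens Λ y (s * rn (2 * k)) ≤ c * rn k ∧
      ∀ x ∈ ball y (s * rn (2 * k)), Hes (s * rn (2 * k)) u e x ≤ -μ + C' * (2 * c * (1 - rn k)) := by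
    intro y hy k
    have hyd : dist y z < s := hy
    induction k with
    | zero =>
      simp only [mul_zero, rn_zero, mul_one, sub_self, add_zero]
      refine ⟨le_trans ?_ hL, fun x hx => hH x ?_⟩
      · unfold dens
        refine mul_le_mul_of_nonneg_left (vol_inter_ball_mono (ball_subset_ball' (by linarith))) (by positivity)
      · exact ball_subset_ball' (by linarith) hx
    | succ k ih =>
      obtain ⟨ih1, ih2⟩ := ih
      set t := s * rn (2 * k) with ht
      have hrk := rn_pos (2 * k)
      have hrk1 := rn_le_one (2 * k)
      have ht0 : 0 < t := by positivity
      have hts : t ≤ s := by rw [ht]; nlinarith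
      have ht4 : s * rn (2 * (k + 1)) = t / 4 := by
        rw [ht, show 2 * (k + 1) = 2 * k + 1 + 1 by ring, rn_succ, rn_succ]; ring
      rw [ht4]
      have hsol : SolOn u Λ (ball y (t * 4)) := hu.mono (ball_subset_ball' (by linarith))
      have hk0 := rn_pos k
      have hk1 := rn_le_one k
      have hneg : ∀ x ∈ ball y t, Hes t u e x ≤ -(μ / 2) := fun x hx => by
        have := ih2 x hx
        have : C' * (2 * c * (1 - rn k)) ≤ C' * (2 * c) := by
          have : 2 * c * (1 - rn k) ≤ 2 * c := by nlinarith
          gcongr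
        linarith
      have d0 := dens_nonneg Λ y ht0
      have d1 := hdec u Λ e y (μ / 2) t m ht0 hsol he (by linarith) hneg
      have d2 := hdr u Λ e y t ht0 hsol he
      refine ⟨?_, fun x hx => ?_⟩
      · rw [rn_succ]
        have : dens Λ y t ≤ c := ih1.trans (by nlinarith)
        have e1 : C * dens Λ y t * (A * dens Λ y t + rn m) ≤ μ / 4 * dens Λ y t := by
          have : C * (A * dens Λ y t + rn m) ≤ μ / 4 := by
            have : C * A * dens Λ y t ≤ C * A * c := by gcongr
            linarith
          nlinarith
        have : dens Λ y (t / 4) ≤ dens Λ y t / 2 := by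
          have := d1.trans e1
          nlinarith
        linarith
      · rw [rn_succ]
        have hx' : x ∈ ball y t := ball_subset_ball (by linarith) hx
        have h1 := (abs_le.1 (d2 x hx')).2
        have h2 := ih2 x hx'
        have : C' * dens Λ y t ≤ C' * (c * rn k) := by gcongr
        nlinarith
  have hzero : ∀ᵐ y : Euc N, y ∉ Λ ∩ ball z s := by
    filter_upwards [ae_tendsto_Tk_chi hu.meas] with y hy hyΛ
    rw [chi_of_mem hyΛ.1] at hy
    have l0 : Tendsto (fun k => s * rn (2 * k)) atTop (nhdsWithin 0 (Ioi 0)) := by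
      refine tendsto_nhdsWithin_iff.2 ⟨?_, Eventually.of_forall fun k => mul_pos hs (rn_pos _)⟩
      have : Tendsto (fun k : ℕ => 2 * k) atTop atTop := tendsto_id.const_mul_atTop' (by norm_num)
      have := ((tendsto_rn.mono_right nhdsWithin_le_nhds).comp this).const_mul s
      rwa [mul_zero] at this
    have l1 := hy.comp l0
    have l2 : Tendsto (fun k => B * (c * rn k)) atTop (nhds 0) := by
      have := ((tendsto_rn.mono_right nhdsWithin_le_nhds).const_mul c).const_mul B
      rwa [mul_zero, mul_zero] at this
    have : (1:ℝ) ≤ 0 := by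
      refine le_of_tendsto_of_tendsto' l1 l2 fun k => ?_
      have hp : 0 < s * rn (2 * k) := mul_pos hs (rn_pos _)
      refine (le_abs_self _).trans ((abs_Tk_chi_le krn_rho hρ hp hu.meas y).trans ?_)
      rw [mul_assoc]
      refine mul_le_mul_of_nonneg_left (le_trans ?_ (iter y hyΛ.2 k).1) hB.le
      unfold dens
      exact mul_le_mul_of_nonneg_left (vol_inter_ball_mono (ball_subset_ball (by linarith))) (by positivity)
    linarith
  exact measure_eq_zero_iff_ae_notMem.2 hzero

/-- A very negative second derivative forces `Λ` to be negligible at a smaller scale. -/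
theorem exists_null_of_negative : ∃ C, 0 < C ∧ ∀ (u : Euc N → ℝ) (Λ : Set (Euc N)) (e z : Euc N) (s : ℝ),
    0 < s → SolOn u Λ (ball z (s * 4)) → ‖e‖ = 1 → (∀ x ∈ ball z s, Hes s u e x ≤ -C) →
      volume (Λ ∩ ball z (s / 8)) = 0 := by
  obtain ⟨C, hC, hdec⟩ := exists_decay_scaled (N := N)
  obtain ⟨c, hc, hnull⟩ := exists_null_of_sparse (N := N) 1 one_pos
  obtain ⟨K, hK, hk⟩ := exists_kap_bound (N := N)
  set V := volume.real (ball (0 : Euc N) 2)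
  have hV : 0 ≤ V := measureReal_nonneg
  refine ⟨max (1 + 3 * K) (C * V * (V + 1) * 2 ^ N / c), by positivity, fun u Λ e z s hs hu he hH => ?_⟩
  set Q := max (1 + 3 * K) (C * V * (V + 1) * 2 ^ N / c)
  have hQ : 0 < Q := by positivity
  have h1 := hdec u Λ e z Q s 0 hs hu he hQ.le hH
  have d0 := dens_nonneg Λ z hs
  have hdV : dens Λ z s ≤ V := by
    have := dens_eq_resc hu.meas z hs (s := 2)
    rw [dens, mul_comm 2 s, ← this]
    exact measureReal_mono inter_subset_right measure_ball_lt_top.ne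
  have h2 : dens Λ z (s / 4) * 2 ^ N ≤ c := by
    rw [rn_zero, one_pow, inv_one, one_mul] at h1
    have h3 : Q * dens Λ z (s / 4) ≤ C * V * (V + 1) := h1.trans (by gcongr)
    have h4 : C * V * (V + 1) * 2 ^ N / c ≤ Q := le_max_right _ _
    rw [div_le_iff₀ hc] at h4
    have h5 : Q * (dens Λ z (s / 4) * 2 ^ N) ≤ Q * c := by
      calc _ = Q * dens Λ z (s / 4) * 2 ^ N := by ring
        _ ≤ C * V * (V + 1) * 2 ^ N := by gcongr
        _ ≤ _ := h4
    exact le_of_mul_le_mul_left h5 hQ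
  have hd : ∀ R, 0 < R → R ≤ s → ∀ x ∈ ball z s, Hes (R / 2) u e x ≤ Hes R u e x + K := by
    intro R hR hRs x hx
    have hxd : dist x z < s := hx
    have := hu.Hes_sub hR (x := x) (closedBall_subset_ball' (by linarith)) e
    have b := abs_Tk_le ((krn_kap.dd e).dd e) hR (f := chi Λ) (x := x) (A := 1) fun y _ => abs_chi_le _ _
    rw [mul_one] at b
    have b2 := abs_le.1 (b.trans (hk e he).2)
    linarith [b2.1, b2.2]
  refine hnull u Λ e z (s / 8) (by positivity) (hu.mono (ball_subset_ball (by linarith))) he (fun x hx => ?_) ?_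
  · have hx' : x ∈ ball z s := ball_subset_ball (by linarith) hx
    have a1 := hd s hs le_rfl x hx'
    have a2 := hd (s / 2) (by positivity) (by linarith) x hx'
    have a3 := hd (s / 2 / 2) (by positivity) (by linarith) x hx'
    rw [show s / 2 / 2 / 2 = s / 8 by ring] at a3
    have a4 := hH x hx'
    have : 1 + 3 * K ≤ Q := le_max_left _ _
    linarith
  · refine le_trans (le_of_eq ?_) h2
    rw [dens, show 2 * (s / 4) = s / 8 * 4 by ring, div_pow, div_pow, inv_div, inv_div,
      show (8:ℝ) ^ N = 4 ^ N * 2 ^ N by rw [← mul_pow]; norm_num]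
    ring

theorem Krn.exists_bound_dd_dd_dd {Z : Euc N → ℝ} (h : Krn Z) : ∃ C, 0 < C ∧ ∀ a b c : Euc N,
    ‖a‖ = 1 → ‖b‖ = 1 → ‖c‖ = 1 → ∀ x, |_root_.dd a (_root_.dd b (_root_.dd c Z)) x| ≤ C := by
  choose C h0 hC using fun i : Fin N => (h.dd (EuclideanSpace.single i 1)).exists_bound_dd_dd
  have hs : 0 ≤ ∑ i, C i := Finset.sum_nonneg fun i _ => (h0 i).le
  refine ⟨1 + ∑ i, C i, by positivity, fun a b c ha hb hc x => ?_⟩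
  have e1 : _root_.dd a (_root_.dd b (_root_.dd c Z)) = _root_.dd c (_root_.dd a (_root_.dd b Z)) := by
    rw [dd_comm h.smooth b c, dd_comm (contDiff_dd h.smooth b) a c]
  rw [e1, dd_eq_sum]
  refine (Finset.abs_sum_le_sum_abs _ _).trans (le_trans (Finset.sum_le_sum fun i _ => ?_) (by linarith : ∑ i, C i ≤ _))
  rw [abs_mul]
  have := hC i a b ha hb x
  rw [dd_comm h.smooth b, dd_comm (contDiff_dd h.smooth b) a] at this
  have h1 := abs_apply_le_one hc i
  calc _ ≤ 1 * C i := by gcongr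
    _ = _ := one_mul _

theorem Krn.exists_integral_bound_dd {Z : Euc N → ℝ} (h : Krn Z) : ∃ C, 0 < C ∧ ∀ a e : Euc N,
    ‖a‖ = 1 → ‖e‖ = 1 → ∫ x, |_root_.dd a (_root_.dd e (_root_.dd e Z)) x| ≤ C := by
  obtain ⟨C, h0, hC⟩ := h.exists_bound_dd_dd_dd
  have hv : 0 ≤ volume.real (closedBall (0 : Euc N) 1) := measureReal_nonneg
  exact ⟨C * (1 + volume.real (closedBall (0 : Euc N) 1)), by positivity, fun a e ha he =>
    ((((h.dd e).dd e).dd a).integral_abs_le (hC a e e ha he he)).trans (by nlinarith)⟩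

theorem Krn.abs_Tk_sub_le {K : Euc N → ℝ} (h : Krn K) {B : ℝ} (hB0 : 0 ≤ B)
    (hB : ∀ a : Euc N, ‖a‖ = 1 → ∫ x, |_root_.dd a K x| ≤ B) {R : ℝ} (hR : 0 < R) {f : Euc N → ℝ}
    (hf : LocallyIntegrable f) {A : ℝ} (hA0 : 0 ≤ A) {D : Set (Euc N)} (hD : Convex ℝ D)
    (hA : ∀ z ∈ D, ∀ y ∈ ball z R, |f y| ≤ A) {x y : Euc N} (hx : x ∈ D) (hy : y ∈ D) :
    |Tk K R f x - Tk K R f y| ≤ R⁻¹ * (B * A) * ‖x - y‖ := by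
  have hd : Differentiable ℝ (Tk K R f) := (contDiff_Tk h hR hf).differentiable (by simp)
  rw [← Real.norm_eq_abs]
  refine hD.norm_image_sub_le_of_norm_fderiv_le (𝕜 := ℝ) (fun z _ => hd z) (fun z hz => ?_) hy hx
  refine ContinuousLinearMap.opNorm_le_of_unit_norm (by positivity) fun v hv => ?_
  change |_root_.dd v (Tk K R f) z| ≤ _
  rw [dd_Tk h hR hf, abs_mul, abs_of_pos (inv_pos.2 hR)]
  refine mul_le_mul_of_nonneg_left ((abs_Tk_le (h.dd v) hR (hA z hz)).trans ?_) (by positivity)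
  exact mul_le_mul_of_nonneg_right (hB v hv) hA0

/-- A sequence with bounded steps which freezes soon after dropping below `-A` is bounded below. -/
theorem lower_bound_of_freeze {q : ℕ → ℝ} {A K : ℝ} (hK : 0 ≤ K) (h0 : -A ≤ q 0) (hs : ∀ n, q n - K ≤ q (n + 1))
    (hf : ∀ m, q m < -A → ∀ n, m + 4 ≤ n → q (n + 1) = q n) (n : ℕ) : -(A + 5 * K) ≤ q n := by
  by_cases h : ∀ j ≤ n, -A ≤ q j
  · linarith [h n le_rfl]
  push Not at h
  have h' : ∃ j, q j < -A := let ⟨j, _, hj⟩ := h; ⟨j, hj⟩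
  classical
  obtain ⟨j, hjn, hj⟩ := h
  set m := Nat.find h' with hm
  have hmq : q m < -A := Nat.find_spec h'
  have hmn : m ≤ n := (Nat.find_min' h' hj).trans hjn
  have hm1 : -A - K ≤ q m := by
    rcases Nat.eq_zero_or_pos m with h1 | h1
    · rw [h1]; linarith
    · have h2 := Nat.find_min h' (m := m - 1) (by omega)
      have h3 := hs (m - 1)
      rw [Nat.sub_add_cancel h1] at h3
      linarith
  have key : ∀ i : ℕ, q m - K * min (i : ℝ) 4 ≤ q (m + i) := by
    intro i
    induction i with
    | zero => simp
    | succ i ih =>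
      rcases lt_or_ge i 4 with h4 | h4
      · have := hs (m + i)
        have e1 : min (i:ℝ) 4 = i := min_eq_left (by exact_mod_cast h4.le)
        have e2 : min ((i + 1 : ℕ):ℝ) 4 = i + 1 := by
          rw [min_eq_left (by exact_mod_cast h4)]; push_cast; ring
        rw [e2]; rw [e1] at ih
        rw [← add_assoc]; linarith
      · rw [← add_assoc, hf m hmq (m + i) (by omega)]
        have h4' : (4:ℝ) ≤ i := by exact_mod_cast h4
        have e1 : min (i:ℝ) 4 = 4 := min_eq_right h4'
        have e2 : min ((i + 1 : ℕ):ℝ) 4 = 4 := min_eq_right (by push_cast; linarith)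
        rw [e2]; rwa [e1] at ih
  have := key (n - m)
  rw [Nat.add_sub_cancel' hmn] at this
  have h4 : K * min ((n - m : ℕ):ℝ) 4 ≤ K * 4 := mul_le_mul_of_nonneg_left (min_le_right _ _) hK
  linarith

/-- A lower bound for the mollified second derivatives at all small scales. -/
theorem exists_Hes_lower_bound (M : ℝ) (hM : 0 ≤ M) : ∃ C, 0 < C ∧ ∀ (u : Euc N → ℝ) (Λ : Set (Euc N)),
    SolOn u Λ (ball 0 1) → (∀ x ∈ ball 0 1, |u x| ≤ M) → ∀ x ∈ ball (0 : Euc N) (1 / 2), ∀ (e : Euc N) (n : ℕ),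
      ‖e‖ = 1 → -C ≤ Hes (rn (n + 3)) u e x := by
  obtain ⟨C0, hC0, hnull⟩ := exists_null_of_negative (N := N)
  obtain ⟨K, hK, hk⟩ := exists_kap_bound (N := N)
  obtain ⟨B1, hB1, hb1⟩ := (krn_kap (N := N)).exists_integral_bound_dd
  obtain ⟨B2, hB2, hb2⟩ := (krn_rho (N := N)).exists_integral_bound_dd
  obtain ⟨B3, hB3, hb3⟩ := (krn_rho (N := N)).exists_bound_dd_dd
  set V := volume.real (closedBall (0 : Euc N) 1)
  have hV : 0 ≤ V := measureReal_nonneg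
  have r3 : (rn 3 : ℝ) = 1 / 8 := by norm_num [rn]
  set L := B1 + 64 * (B2 * M) with hL
  have hL0 : 0 < L := by positivity
  set A := C0 + L + 64 * (B3 * V * M) with hA
  refine ⟨A + 5 * K, by positivity, fun u Λ hu hM' x hx e n he => ?_⟩
  have hxn : dist x 0 < 1 / 2 := hx
  have hs1 : ∀ n, rn (n + 3) ≤ 1 / 8 := fun n => by
    rw [← r3]; exact pow_le_pow_of_le_one (by norm_num) (by norm_num) (by omega)
  have hs0 : ∀ n, 0 < rn (n + 3) := fun n => rn_pos _
  have hsucc : ∀ n, rn (n + 1 + 3) = rn (n + 3) / 2 := fun n => rn_succ (n + 3)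
  have hstep : ∀ n, ∀ y ∈ ball (0 : Euc N) (5 / 8),
      Hes (rn (n + 3)) u e y - Hes (rn (n + 1 + 3)) u e y = - Tk (dd e (dd e kap)) (rn (n + 3)) (chi Λ) y := by
    intro n y hy
    have hyd : dist y 0 < 5 / 8 := hy
    rw [hsucc]
    exact hu.Hes_sub (hs0 n) (closedBall_subset_ball' (by linarith [hs1 n])) e
  have hosc : ∀ n, ∀ y ∈ ball (0 : Euc N) (5 / 8), ∀ z ∈ ball (0 : Euc N) (5 / 8),
      |Hes (rn (n + 3)) u e y - Hes (rn (n + 3)) u e z| ≤ (rn (n + 3))⁻¹ * L * ‖y - z‖ := by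
    intro n y hy z hz
    induction n with
    | zero =>
      have := ((krn_rho.dd e).dd e).abs_Tk_sub_le hB2.le (fun a ha => hb2 a e ha he) (hs0 0) hu.locallyIntegrable hM
        (convex_ball (0 : Euc N) (5 / 8)) (fun z hz y hy => hM' y (by
          have h1 : dist z 0 < 5 / 8 := hz
          have h2 : dist y z < _ := hy
          have := dist_triangle y z 0
          have := hs1 0
          change dist y 0 < 1
          linarith)) hy hz
      unfold Hes
      rw [← mul_sub, abs_mul, abs_of_pos (by have := hs0 0; positivity)]
      rw [zero_add, r3] at this ⊢
      have hn := norm_nonneg (y - z)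
      calc _ ≤ ((1 / 8 : ℝ) ^ 2)⁻¹ * ((1 / 8 : ℝ)⁻¹ * (B2 * M) * ‖y - z‖) := by gcongr
        _ = (1 / 8 : ℝ)⁻¹ * (64 * (B2 * M)) * ‖y - z‖ := by ring
        _ ≤ _ := by gcongr; linarith
    | succ n ih =>
      have e1 := hstep n y hy
      have e2 := hstep n z hz
      have := ((krn_kap.dd e).dd e).abs_Tk_sub_le hB1.le (fun a ha => hb1 a e ha he) (hs0 n)
        (locallyIntegrable_chi hu.meas) zero_le_one (convex_ball (0 : Euc N) (5 / 8)) (fun z hz y hy => abs_chi_le Λ y) hy hz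
      have e3 : (rn (n + 1 + 3))⁻¹ = 2 * (rn (n + 3))⁻¹ := by
        rw [hsucc, inv_div]; ring
      rw [e3]
      have hi : 0 < (rn (n + 3))⁻¹ := inv_pos.2 (hs0 n)
      have : (rn (n + 3))⁻¹ * (B1 * 1) * ‖y - z‖ ≤ (rn (n + 3))⁻¹ * L * ‖y - z‖ := by
        have : B1 * 1 ≤ L := by rw [mul_one, hL]; have := mul_nonneg hB2.le hM; linarith
        gcongr
      have e4 : Hes (rn (n + 1 + 3)) u e y - Hes (rn (n + 1 + 3)) u e z = (Hes (rn (n + 3)) u e y - Hes (rn (n + 3)) u e z)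
        + (Tk (dd e (dd e kap)) (rn (n + 3)) (chi Λ) y - Tk (dd e (dd e kap)) (rn (n + 3)) (chi Λ) z) := by linarith
      rw [e4]
      refine (abs_add_le _ _).trans ?_
      linarith
  have hx58 : x ∈ ball (0 : Euc N) (5 / 8) := ball_subset_ball (by norm_num) hx
  refine lower_bound_of_freeze (q := fun n => Hes (rn (n + 3)) u e x) hK.le ?_ (fun n => ?_) (fun m hm n hn => ?_) n
  · have := abs_Tk_le ((krn_rho.dd e).dd e) (hs0 0) (f := u) (x := x) (A := M) (fun y hy => hM' y (by
      have h2 : dist y x < _ := hy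
      have := dist_triangle y x 0
      have := hs1 0
      change dist y 0 < 1
      linarith))
    have h2 : |Hes (rn (0 + 3)) u e x| ≤ 64 * (B3 * V * M) := by
      unfold Hes
      rw [abs_mul, abs_of_pos (by have := hs0 0; positivity)]
      rw [zero_add, r3] at this ⊢
      calc _ ≤ ((1 / 8 : ℝ) ^ 2)⁻¹ * ((∫ y, |dd e (dd e rho) y|) * M) := by gcongr
        _ ≤ ((1 / 8 : ℝ) ^ 2)⁻¹ * ((B3 * V) * M) := by
          gcongr; exact ((krn_rho.dd e).dd e).integral_abs_le (hb3 e e he he)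
        _ = _ := by ring
    have := (abs_le.1 h2).1
    show -A ≤ Hes (rn (0 + 3)) u e x
    linarith
  · have b := abs_Tk_le ((krn_kap.dd e).dd e) (hs0 n) (f := chi Λ) (x := x) (A := 1) fun y _ => abs_chi_le _ _
    rw [mul_one] at b
    have b2 := abs_le.1 (b.trans (hk e he).2)
    have := hstep n x hx58
    show Hes (rn (n + 3)) u e x - K ≤ Hes (rn (n + 1 + 3)) u e x
    linarith [b2.1, b2.2]
  · have hm' : Hes (rn (m + 3)) u e x < -A := hm
    have hz : volume (Λ ∩ ball x (rn (m + 3) / 8)) = 0 := by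
      refine hnull u Λ e x _ (hs0 m) (hu.mono (ball_subset_ball' (by linarith [hs1 m]))) he fun y hy => ?_
      have hyd : dist y x < rn (m + 3) := hy
      have hy58 : y ∈ ball (0 : Euc N) (5 / 8) := by
        have := dist_triangle y x 0
        change dist y 0 < 5 / 8
        linarith [hs1 m]
      have h1 := (abs_le.1 (hosc m y hy58 x hx58)).2
      have h2 : (rn (m + 3))⁻¹ * L * ‖y - x‖ ≤ L := by
        rw [← dist_eq_norm]
        calc _ ≤ (rn (m + 3))⁻¹ * L * rn (m + 3) := by have := hs0 m; gcongr
          _ = L := by have := (hs0 m).ne'; field_simp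
      have : 0 ≤ 64 * (B3 * V * M) := by positivity
      linarith
    have h1 := hstep n x hx58
    have b := abs_Tk_chi_le ((krn_kap.dd e).dd e) (hk e he).1 (hs0 n) hu.meas x
    have h3 : volume.real (Λ ∩ ball x (rn (n + 3))) = 0 := by
      rw [measureReal_def, measure_mono_null (inter_subset_inter_right _ (ball_subset_ball ?_)) hz, ENNReal.toReal_zero]
      rw [show rn (m + 3) / 8 = rn (m + 6) by rw [rn, rn, pow_add, pow_add]; ring]
      exact pow_le_pow_of_le_one (by norm_num) (by norm_num) (by omega)
    rw [h3, mul_zero] at b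
    have := abs_nonpos_iff.1 b
    show Hes (rn (n + 1 + 3)) u e x = Hes (rn (n + 3)) u e x
    linarith

theorem dd_smul_dir (c : ℝ) (e : Euc N) (f : Euc N → ℝ) (x : Euc N) : dd (c • e) f x = c * dd e f x := by
  simp [dd]

theorem dd_add_dir (a b : Euc N) (f : Euc N → ℝ) (x : Euc N) : dd (a + b) f x = dd a f x + dd b f x := by
  simp [dd]

theorem dd_dd_smul_dir (c : ℝ) (e : Euc N) (f : Euc N → ℝ) (x : Euc N) :
    dd (c • e) (dd (c • e) f) x = c ^ 2 * dd e (dd e f) x := by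
  have : dd (c • e) f = fun x => c * dd e f x := funext (dd_smul_dir c e f)
  rw [dd_smul_dir, this, dd_const_mul]; ring

theorem dd_dd_add_dir {T : Euc N → ℝ} (hT : ContDiff ℝ (⊤ : ℕ∞) T) (a b x : Euc N) :
    dd (a + b) (dd (a + b) T) x = dd a (dd a T) x + dd b (dd b T) x + 2 * dd a (dd b T) x := by
  have : dd (a + b) T = fun x => dd a T x + dd b T x := funext (dd_add_dir a b T)
  have h : ∀ v, Differentiable ℝ (dd v T) := fun v => (contDiff_dd hT v).differentiable (by simp)
  have e : ∀ v, dd v (dd (a + b) T) x = dd v (dd a T) x + dd v (dd b T) x := by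
    intro v
    rw [this]
    have := fderiv_add (h a x) (h b x)
    change fderiv ℝ (dd a T + dd b T) x v = _
    rw [this]; rfl
  rw [dd_add_dir, e, e, dd_comm hT b a]; ring

/-- A Hessian which is bounded below and has bounded trace is bounded. -/
theorem abs_dd_dd_le {T : Euc N → ℝ} (hT : ContDiff ℝ (⊤ : ℕ∞) T) {x : Euc N} {C : ℝ} (hC : 0 ≤ C)
    (hlow : ∀ e, ‖e‖ = 1 → -C ≤ dd e (dd e T) x)
    (htr : ∑ i, dd (EuclideanSpace.single i 1) (dd (EuclideanSpace.single i 1) T) x ≤ 1) {a b : Euc N}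
    (ha : ‖a‖ = 1) (hb : ‖b‖ = 1) : |dd a (dd b T) x| ≤ N * (N * (1 + (N + 2) * C)) := by
  set v : Fin N → Euc N := fun i => EuclideanSpace.single i 1 with hv
  have hlow' : ∀ e : Euc N, ‖e‖ ≤ 2 → -(4 * C) ≤ dd e (dd e T) x := by
    intro e he
    rcases eq_or_ne e 0 with h0 | h0
    · simp [h0, dd]; exact hC
    · have hn : ‖e‖ ≠ 0 := norm_ne_zero_iff.2 h0
      have h1 := hlow (‖e‖⁻¹ • e) (by rw [norm_smul, norm_inv, norm_norm, inv_mul_cancel₀ hn])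
      rw [dd_dd_smul_dir] at h1
      have h2 : dd e (dd e T) x = ‖e‖ ^ 2 * ((‖e‖⁻¹) ^ 2 * dd e (dd e T) x) := by field_simp
      rw [h2]
      have h3 : ‖e‖ ^ 2 ≤ 4 := by nlinarith [norm_nonneg e]
      have h4 : 0 ≤ ‖e‖ ^ 2 := by positivity
      nlinarith
  have hd : ∀ i, dd (v i) (dd (v i) T) x ≤ 1 + N * C := by
    intro i
    have : ∑ j ∈ Finset.univ.erase i, (-C) ≤ ∑ j ∈ Finset.univ.erase i, dd (v j) (dd (v j) T) x :=
      Finset.sum_le_sum fun j _ => hlow _ (norm_single_one j)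
    rw [Finset.sum_const, Finset.card_erase_of_mem (Finset.mem_univ _), nsmul_eq_mul, Finset.card_univ, Fintype.card_fin] at this
    have h2 := Finset.add_sum_erase Finset.univ (fun j => dd (v j) (dd (v j) T) x) (Finset.mem_univ i)
    have h3 : ((N - 1 : ℕ) : ℝ) * C ≤ N * C := by gcongr; exact Nat.sub_le _ _
    linarith
  have hNC : 0 ≤ (N : ℝ) * C := by positivity
  have hij : ∀ i j, |dd (v i) (dd (v j) T) x| ≤ 1 + (N + 2) * C := by
    intro i j
    have n1 : ‖v i + v j‖ ≤ 2 := (norm_add_le _ _).trans (by rw [norm_single_one, norm_single_one]; norm_num)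
    have n2 : ‖(-1 : ℝ) • v i + v j‖ ≤ 2 :=
      (norm_add_le _ _).trans (by rw [norm_smul, norm_single_one, norm_single_one]; norm_num)
    have h1 := hlow' _ n1
    have h2 := hlow' _ n2
    rw [dd_dd_add_dir hT] at h1 h2
    rw [dd_dd_smul_dir, dd_smul_dir] at h2
    have h3 := hd i
    have h4 := hd j
    rw [abs_le]; constructor <;> nlinarith
  rw [dd_dd_eq_sum hT]
  have hb' : 0 ≤ 1 + ((N:ℝ) + 2) * C := by positivity
  refine (Finset.abs_sum_le_sum_abs _ _).trans ?_
  calc _ ≤ ∑ i : Fin N, ((N:ℝ) * (1 + (N + 2) * C)) := Finset.sum_le_sum fun i _ => ?_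
    _ = _ := by simp
  refine (Finset.abs_sum_le_sum_abs _ _).trans ?_
  calc _ ≤ ∑ j : Fin N, (1 + ((N:ℝ) + 2) * C) := Finset.sum_le_sum fun j _ => ?_
    _ = _ := by simp; ring
  rw [abs_mul, abs_mul]
  have h1 := abs_apply_le_one ha i
  have h2 := abs_apply_le_one hb j
  calc _ ≤ 1 * (1 * (1 + ((N:ℝ) + 2) * C)) := by gcongr; exact hij i j
    _ = _ := by ring

/-- Interior `C^{1,1}` regularity. -/
theorem exists_lipschitz_fderiv (M : ℝ) (hM : 0 ≤ M) : ∃ C, 0 < C ∧ ∀ (u : Euc N → ℝ) (Λ : Set (Euc N)),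
    SolOn u Λ (ball 0 1) → (∀ x ∈ ball 0 1, |u x| ≤ M) → ∀ x ∈ ball (0 : Euc N) (1 / 2), ∀ y ∈ ball (0 : Euc N) (1 / 2),
      ‖fderiv ℝ u x - fderiv ℝ u y‖ ≤ C * ‖x - y‖ := by
  obtain ⟨C, hC, h⟩ := exists_Hes_lower_bound (N := N) M hM
  set D : ℝ := N * (N * (1 + (N + 2) * C))
  have hD : 0 ≤ D := by positivity
  refine ⟨D + 1, by positivity, fun u Λ hu hM' x hx y hy => ?_⟩
  have hb : ∀ n, ∀ z ∈ ball (0 : Euc N) (1 / 2), ∀ a b : Euc N, ‖a‖ = 1 → ‖b‖ = 1 →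
      |dd a (dd b (Tk rho (rn (n + 3)) u)) z| ≤ D := by
    intro n z hz a b ha hb
    have hzd : dist z 0 < 1 / 2 := hz
    have hr : rn (n + 3) ≤ 1 / 8 := by
      rw [show (1:ℝ) / 8 = rn 3 by norm_num [rn]]; exact pow_le_pow_of_le_one (by norm_num) (by norm_num) (by omega)
    refine abs_dd_dd_le (hu.contDiff_Tk_rho (rn_pos _)) hC.le (fun e he => ?_) ?_ ha hb
    · rw [← Hes_eq_dd_dd (rn_pos _) hu.locallyIntegrable]; exact h u Λ hu hM' z hz e n he
    · have := hu.weak.sum_Hes hu.locallyIntegrable (rn_pos (n + 3)) (x := z) (closedBall_subset_ball' (by linarith))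
      simp only [Hes_eq_dd_dd (rn_pos (n + 3)) hu.locallyIntegrable] at this
      rw [this]
      exact Tk_rho_chi_le_one hu.meas.compl (rn_pos _) z
  refine ContinuousLinearMap.opNorm_le_of_unit_norm (by positivity) fun b hb1 => ?_
  have key : ∀ n, |dd b (Tk rho (rn (n + 3)) u) x - dd b (Tk rho (rn (n + 3)) u) y| ≤ D * ‖x - y‖ := by
    intro n
    rw [← Real.norm_eq_abs]
    have hd : Differentiable ℝ (dd b (Tk rho (rn (n + 3)) u)) :=
      (contDiff_dd (hu.contDiff_Tk_rho (rn_pos _)) b).differentiable (by simp)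
    exact (convex_ball (0 : Euc N) (1 / 2)).norm_image_sub_le_of_norm_fderiv_le (𝕜 := ℝ) (fun z _ => hd z)
      (fun z hz => ContinuousLinearMap.opNorm_le_of_unit_norm hD fun v hv => hb n z hz v b hv hb1) hy hx
  have l : ∀ z, Tendsto (fun n => dd b (Tk rho (rn (n + 3)) u) z) atTop (nhds (dd b u z)) := by
    intro z
    simp only [dd_Tk_rho_eq hu.contDiff]
    exact (tendsto_Tk_rho (continuous_dd hu.contDiff b) z).comp (tendsto_rn.comp (tendsto_add_atTop_nat 3))
  have := le_of_tendsto ((l x).sub (l y)).abs (Eventually.of_forall key)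
  refine le_trans this ?_
  have := norm_nonneg (x - y)
  nlinarith

/-- The points where `u` vanishes together with its gradient. -/
def sing (u : Euc N → ℝ) : Set (Euc N) := {x | u x = 0 ∧ fderiv ℝ u x = 0}

/-- Solutions of the obstacle problem on `D` with a `C`-Lipschitz gradient. -/
structure Obst (C : ℝ) (u : Euc N → ℝ) (D : Set (Euc N)) : Prop where
  contDiff : ContDiff ℝ 1 u
  lip : ∀ x ∈ D, ∀ y ∈ D, ‖fderiv ℝ u x - fderiv ℝ u y‖ ≤ C * ‖x - y‖
  weak : WeakLap u (fun _ => 1) (D ∩ (sing u)ᶜ)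

theorem Obst.mono {C : ℝ} {u : Euc N → ℝ} {D D' : Set (Euc N)} (h : Obst C u D) (hD : D' ⊆ D) : Obst C u D' :=
  ⟨h.contDiff, fun x hx y hy => h.lip x (hD hx) y (hD hy), h.weak.mono (inter_subset_inter_left _ hD)⟩

theorem Obst.differentiable {C : ℝ} {u : Euc N → ℝ} {D : Set (Euc N)} (h : Obst C u D) : Differentiable ℝ u :=
  h.contDiff.differentiable (by simp)

theorem sing_resc {u : Euc N → ℝ} (h : Differentiable ℝ u) {r : ℝ} (hr : 0 < r) (z : Euc N) :
    sing (resc z r u) = (fun x => z + r • x) ⁻¹' sing u := by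
  ext x
  simp only [sing, Set.mem_ofPred_eq, mem_preimage, fderiv_resc hr z x (h _)]
  rw [resc, smul_eq_zero_iff_right (inv_ne_zero hr.ne'), mul_eq_zero_iff_left (by positivity)]

theorem Obst.resc {C : ℝ} {u : Euc N → ℝ} {D : Set (Euc N)} (h : Obst C u D) {r : ℝ} (hr : 0 < r) (z : Euc N) :
    Obst C (resc z r u) ((fun x => z + r • x) ⁻¹' D) where
  contDiff := contDiff_resc (n := 1) h.contDiff z r
  lip x hx y hy := by
    rw [fderiv_resc hr z x (h.differentiable _), fderiv_resc hr z y (h.differentiable _), ← smul_sub, norm_smul,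
      Real.norm_of_nonneg (inv_nonneg.2 hr.le)]
    have := h.lip _ hx _ hy
    rw [add_sub_add_left_eq_sub, ← smul_sub, norm_smul, Real.norm_of_nonneg hr.le] at this
    calc _ ≤ r⁻¹ * (C * (r * ‖x - y‖)) := by gcongr
      _ = _ := by field_simp
  weak := by
    have := h.weak.resc hr z
    rwa [preimage_inter, preimage_compl, ← sing_resc h.differentiable hr] at this

theorem isClosed_sing {u : Euc N → ℝ} (h : ContDiff ℝ 1 u) : IsClosed (sing u) :=
  (isClosed_eq h.continuous continuous_const).inter (isClosed_eq (h.continuous_fderiv (by simp)) continuous_const)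

theorem Obst.taylor {C : ℝ} {u : Euc N → ℝ} {D : Set (Euc N)} (h : Obst C u D) (hC : 0 ≤ C) (hD : Convex ℝ D) {x y : Euc N}
    (hx : x ∈ D) (hy : y ∈ D) : |u y - u x - fderiv ℝ u x (y - x)| ≤ C * ‖y - x‖ ^ 2 := by
  rw [pow_two, ← mul_assoc]
  refine (convex_segment x y).norm_image_sub_le_of_norm_fderiv_le' (𝕜 := ℝ) (fun z _ => h.differentiable z)
    (fun z hz => ?_) (left_mem_segment ℝ x y) (right_mem_segment ℝ x y)
  refine (h.lip z (hD.segment_subset hx hy hz) x hx).trans ?_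
  gcongr
  rw [← dist_eq_norm, ← dist_eq_norm, dist_comm, dist_comm y]
  rw [segment_eq_image_lineMap] at hz
  obtain ⟨t, ht, rfl⟩ := hz
  rw [dist_left_lineMap, Real.norm_of_nonneg ht.1]
  exact mul_le_of_le_one_left dist_nonneg ht.2

theorem Obst.norm_fderiv_le {C : ℝ} {u : Euc N → ℝ} {D : Set (Euc N)} (h : Obst C u D) {p x : Euc N}
    (hp : p ∈ D) (hx : x ∈ D) (hs : p ∈ sing u) : ‖fderiv ℝ u x‖ ≤ C * ‖x - p‖ := by
  have := h.lip x hx p hp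
  rwa [hs.2, sub_zero] at this

theorem Obst.abs_le {C : ℝ} {u : Euc N → ℝ} {D : Set (Euc N)} (h : Obst C u D) (hC : 0 ≤ C) (hD : Convex ℝ D)
    {p x : Euc N} (hp : p ∈ D) (hx : x ∈ D) (hs : p ∈ sing u) : |u x| ≤ C * ‖x - p‖ ^ 2 := by
  have := h.taylor hC hD hp hx
  rwa [hs.1, hs.2, sub_zero, _root_.zero_apply, sub_zero] at this

/-- Convergence of (local) solutions along an ultrafilter. -/
structure CV (C : ℝ) (F : Ultrafilter ℕ) (u : ℕ → Euc N → ℝ) (v : Euc N → ℝ) : Prop where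
  nonneg : 0 ≤ C
  sol : ∀ R : ℝ, ∀ᶠ j in (F : Filter ℕ), Obst C (u j) (ball 0 R)
  contDiff : ContDiff ℝ 1 v
  lip : ∀ x y, ‖fderiv ℝ v x - fderiv ℝ v y‖ ≤ C * ‖x - y‖
  tendsto : ∀ x, Tendsto (fun j => u j x) F (nhds (v x))
  tendsto_fderiv : ∀ x, Tendsto (fun j => fderiv ℝ (u j) x) F (nhds (fderiv ℝ v x))

theorem Ultrafilter.exists_tendsto_of_bdd {E : Type*} [NormedAddCommGroup E] [ProperSpace E] (F : Ultrafilter ℕ)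
    {a : ℕ → E} {A : ℝ} (h : ∀ᶠ j in (F : Filter ℕ), ‖a j‖ ≤ A) : ∃ b, Tendsto a F (nhds b) := by
  have hc : IsCompact (closedBall (0 : E) A) := isCompact_closedBall 0 A
  obtain ⟨b, -, hb⟩ := hc.ultrafilter_le_nhds (F.map a) (by
    rw [le_principal_iff]
    rw [Ultrafilter.mem_coe, Ultrafilter.mem_map, ← Ultrafilter.mem_coe]
    filter_upwards [h] with j hj
    simpa using hj)
  exact ⟨b, hb⟩

/-- Compactness of normalized solutions. -/
theorem exists_cv {C : ℝ} (hC : 0 ≤ C) (F : Ultrafilter ℕ) {u : ℕ → Euc N → ℝ} {A : ℝ}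
    (hs : ∀ R : ℝ, ∀ᶠ j in (F : Filter ℕ), Obst C (u j) (ball 0 R))
    (hp : ∀ᶠ j in (F : Filter ℕ), ∃ p ∈ sing (u j), ‖p‖ ≤ A) : ∃ v, CV C F u v := by
  have hb : ∀ x : Euc N, ∀ᶠ j in (F : Filter ℕ), ‖u j x‖ ≤ C * (‖x‖ + A) ^ 2 ∧ ‖fderiv ℝ (u j) x‖ ≤ C * (‖x‖ + A) := by
    intro x
    filter_upwards [hs (‖x‖ + |A| + 1), hp] with j hj ⟨p, hps, hpA⟩
    have hA := le_abs_self A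
    have hp' : p ∈ ball (0 : Euc N) (‖x‖ + |A| + 1) := by
      rw [mem_ball_zero_iff]; linarith [norm_nonneg x]
    have hx' : x ∈ ball (0 : Euc N) (‖x‖ + |A| + 1) := by
      rw [mem_ball_zero_iff]; linarith [abs_nonneg A]
    have hn : ‖x - p‖ ≤ ‖x‖ + A := (norm_sub_le _ _).trans (by linarith)
    refine ⟨(hj.abs_le hC (convex_ball _ _) hp' hx' hps).trans (by gcongr), (hj.norm_fderiv_le hp' hx' hps).trans (by gcongr)⟩
  choose v hv using fun x => F.exists_tendsto_of_bdd ((hb x).mono fun j h => h.1)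
  choose g hg using fun x => F.exists_tendsto_of_bdd ((hb x).mono fun j h => h.2)
  have hlip : ∀ x y, ‖g x - g y‖ ≤ C * ‖x - y‖ := by
    intro x y
    refine le_of_tendsto ((hg x).sub (hg y)).norm ?_
    filter_upwards [hs (‖x‖ + ‖y‖ + 1)] with j hj
    exact hj.lip x (by rw [mem_ball_zero_iff]; linarith [norm_nonneg y]) y (by rw [mem_ball_zero_iff]; linarith [norm_nonneg x])
  have htay : ∀ x y, |v y - v x - g x (y - x)| ≤ C * ‖y - x‖ ^ 2 := by
    intro x y
    have l : Tendsto (fun j => fderiv ℝ (u j) x (y - x)) F (nhds (g x (y - x))) :=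
      ((ContinuousLinearMap.apply ℝ ℝ (y - x)).continuous.tendsto _).comp (hg x)
    refine le_of_tendsto (((hv y).sub (hv x)).sub l).abs ?_
    filter_upwards [hs (‖x‖ + ‖y‖ + 1)] with j hj
    exact hj.taylor hC (convex_ball _ _) (by rw [mem_ball_zero_iff]; linarith [norm_nonneg y])
      (by rw [mem_ball_zero_iff]; linarith [norm_nonneg x])
  have hd : ∀ x, HasFDerivAt v (g x) x := by
    intro x
    rw [hasFDerivAt_iff_isLittleO]
    refine Asymptotics.IsBigO.trans_isLittleO (g := fun y => ‖y - x‖ ^ 2) ?_ ?_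
    · refine Asymptotics.IsBigO.of_bound C (Eventually.of_forall fun y => ?_)
      rw [norm_pow, norm_norm]; exact htay x y
    · have := Asymptotics.isLittleO_pow_sub_sub x one_lt_two
      simpa using this.norm_left
  have hgc : Continuous g := (LipschitzWith.of_dist_le_mul (K := C.toNNReal) fun x y => by
    rw [dist_eq_norm, dist_eq_norm, Real.coe_toNNReal _ hC]; exact hlip x y).continuous
  have hfd : fderiv ℝ v = g := funext fun x => (hd x).fderiv
  refine ⟨v, hC, hs, ?_, ?_, hv, ?_⟩
  · rw [contDiff_one_iff_fderiv]
    exact ⟨fun x => (hd x).differentiableAt, hfd ▸ hgc⟩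
  · rw [hfd]; exact hlip
  · rw [hfd]; exact hg

theorem CV.eventually_fderiv {C : ℝ} {F : Ultrafilter ℕ} {u : ℕ → Euc N → ℝ} {v : Euc N → ℝ} (h : CV C F u v)
    (R : ℝ) {ε : ℝ} (hε : 0 < ε) :
    ∀ᶠ j in (F : Filter ℕ), ∀ x ∈ ball (0 : Euc N) R, ‖fderiv ℝ (u j) x - fderiv ℝ v x‖ ≤ ε := by
  have hC := h.nonneg
  set δ := ε / (3 * (C + 1)) with hδ
  have hδ0 : 0 < δ := by positivity
  have hCδ : C * δ ≤ ε / 3 := by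
    calc C * δ ≤ (C + 1) * δ := by gcongr; linarith
      _ = ε / 3 := by rw [hδ]; field_simp
  obtain ⟨t, htR, htf, ht⟩ := ((isCompact_closedBall (0 : Euc N) R).totallyBounded.subset ball_subset_closedBall).exists_subset
    (dist_mem_uniformity hδ0)
  have h1 : ∀ᶠ j in (F : Filter ℕ), ∀ y ∈ t, ‖fderiv ℝ (u j) y - fderiv ℝ v y‖ ≤ ε / 3 := by
    rw [eventually_all_finite htf]
    intro y _
    have := (h.tendsto_fderiv y).sub_const (fderiv ℝ v y) |>.norm
    rw [sub_self, norm_zero] at this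
    exact (this.eventually (gt_mem_nhds (by positivity : (0:ℝ) < ε / 3))).mono fun j hj => hj.le
  filter_upwards [h1, h.sol R] with j hj hs x hx
  obtain ⟨y, hy, hxy⟩ := mem_iUnion₂.1 (ht hx)
  have hxy' : ‖x - y‖ < δ := by rw [← dist_eq_norm]; exact hxy
  have e1 := hs.lip x hx y (htR hy)
  have e2 := h.lip y x
  have e3 := hj y hy
  rw [norm_sub_rev y x] at e2
  have e4 : C * ‖x - y‖ ≤ ε / 3 := le_trans (by gcongr) hCδ
  calc _ = ‖(fderiv ℝ (u j) x - fderiv ℝ (u j) y) + (fderiv ℝ (u j) y - fderiv ℝ v y) + (fderiv ℝ v y - fderiv ℝ v x)‖ := by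
        congr 1; abel
    _ ≤ _ := norm_add₃_le
    _ ≤ ε := by linarith

theorem CV.eventually_abs {C : ℝ} {F : Ultrafilter ℕ} {u : ℕ → Euc N → ℝ} {v : Euc N → ℝ} (h : CV C F u v)
    (R : ℝ) {ε : ℝ} (hε : 0 < ε) : ∀ᶠ j in (F : Filter ℕ), ∀ x ∈ ball (0 : Euc N) R, |u j x - v x| ≤ ε := by
  rcases le_or_gt R 0 with hR | hR
  · rw [ball_eq_empty.2 hR]; simp
  have h0 := ((h.tendsto 0).sub_const (v 0)).abs
  rw [sub_self, abs_zero] at h0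
  filter_upwards [h.eventually_fderiv R (ε := ε / (2 * R)) (by positivity), h.sol R,
    h0.eventually (gt_mem_nhds (half_pos hε))] with j hj hs h0 x hx
  have hd : ∀ z, DifferentiableAt ℝ (fun x => u j x - v x) z := fun z =>
    (hs.differentiable z).sub (h.contDiff.differentiable (by simp) z)
  have h1 := (convex_ball (0 : Euc N) R).norm_image_sub_le_of_norm_fderiv_le (𝕜 := ℝ) (f := fun x => u j x - v x)
    (C := ε / (2 * R)) (fun z _ => hd z) (fun z hz => by
      have := fderiv_sub (hs.differentiable z) (h.contDiff.differentiable (by simp) z)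
      change ‖fderiv ℝ (u j - v) z‖ ≤ _
      rw [this]; exact hj z hz) (mem_ball_self hR) hx
  rw [sub_zero, Real.norm_eq_abs] at h1
  have h2 : ε / (2 * R) * ‖x‖ ≤ ε / 2 := by
    rw [mem_ball_zero_iff] at hx
    calc _ ≤ ε / (2 * R) * R := by gcongr
      _ = _ := by field_simp
  have h3 := abs_sub_abs_le_abs_sub (u j x - v x) (u j 0 - v 0)
  linarith

theorem CV.eventually_notMem_sing {C : ℝ} {F : Ultrafilter ℕ} {u : ℕ → Euc N → ℝ} {v : Euc N → ℝ} (h : CV C F u v)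
    {K : Set (Euc N)} (hK : IsCompact K) (hKs : K ∩ sing v = ∅) : ∀ᶠ j in (F : Filter ℕ), K ∩ sing (u j) = ∅ := by
  rcases K.eq_empty_or_nonempty with rfl | hne
  · simp
  have hcont : Continuous fun x => |v x| + ‖fderiv ℝ v x‖ :=
    h.contDiff.continuous.abs.add (h.contDiff.continuous_fderiv (by simp)).norm
  obtain ⟨x0, hx0, hmin⟩ := hK.exists_isMinOn hne hcont.continuousOn
  set m := |v x0| + ‖fderiv ℝ v x0‖
  have hm : 0 < m := by
    by_contra hcon
    have h1 := abs_nonneg (v x0)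
    have h2 := norm_nonneg (fderiv ℝ v x0)
    have : x0 ∈ K ∩ sing v := ⟨hx0, abs_eq_zero.1 (by linarith), norm_eq_zero.1 (by linarith)⟩
    rw [hKs] at this; exact this
  obtain ⟨R, hR⟩ := hK.isBounded.subset_ball (0 : Euc N)
  filter_upwards [h.eventually_fderiv R (ε := m / 3) (by positivity), h.eventually_abs R (ε := m / 3) (by positivity)]
    with j h1 h2
  rw [eq_empty_iff_forall_notMem]
  rintro x ⟨hxK, hx1, hx2⟩
  have e1 := h1 x (hR hxK)
  have e2 := h2 x (hR hxK)
  rw [hx2, zero_sub, norm_neg] at e1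
  rw [hx1, zero_sub, abs_neg] at e2
  have : m ≤ |v x| + ‖fderiv ℝ v x‖ := hmin hxK
  linarith

theorem CV.obst {C : ℝ} {F : Ultrafilter ℕ} {u : ℕ → Euc N → ℝ} {v : Euc N → ℝ} (h : CV C F u v) : Obst C v univ := by
  refine ⟨h.contDiff, fun x _ y _ => h.lip x y, fun φ h1 h2 h3 => ?_⟩
  rw [univ_inter] at h3
  obtain ⟨R, hR⟩ := h2.isCompact.isBounded.subset_ball (0 : Euc N)
  have hlap : Continuous (lap N φ) := by
    rw [show lap N φ = fun x => ∑ i, dd (EuclideanSpace.single i 1) (dd (EuclideanSpace.single i 1) φ) x from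
      funext fun x => lap_eq_sum_dd φ x]
    exact continuous_finsetSum _ fun i _ => (contDiff_dd (contDiff_dd h1 _) _).continuous
  have hls : ∀ x, x ∉ tsupport φ → lap N φ x = 0 := by
    intro x hx
    have hz : φ =ᶠ[nhds x] fun _ => 0 := notMem_tsupport_iff_eventuallyEq.1 hx
    unfold lap
    refine Finset.sum_eq_zero fun i _ => ?_
    have h2 : (fun y => fderiv ℝ φ y (EuclideanSpace.single i 1)) =ᶠ[nhds x] fun _ => 0 := by
      filter_upwards [hz.eventuallyEq_nhds] with y hy
      rw [hy.fderiv_eq]; simp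
    rw [h2.fderiv_eq]; simp
  have hlc : HasCompactSupport (lap N φ) := HasCompactSupport.intro h2.isCompact hls
  set I := ∫ x, |lap N φ x|
  have hI : 0 ≤ I := integral_nonneg fun _ => abs_nonneg _
  have hInt : ∀ w : Euc N → ℝ, Continuous w → Integrable fun x => w x * lap N φ x := fun w hw =>
    (hw.mul hlap).integrable_of_hasCompactSupport hlc.mul_left
  rw [← sub_eq_zero, ← abs_eq_zero]
  refine le_antisymm (le_of_forall_pos_le_add fun ε hε => ?_) (abs_nonneg _)
  rw [zero_add]
  have hdis : tsupport φ ∩ sing v = ∅ := disjoint_iff_inter_eq_empty.1 (disjoint_left.2 fun x hx => h3 hx)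
  obtain ⟨j, hj1, hj2, hj3⟩ := ((h.eventually_notMem_sing h2.isCompact hdis).and
    ((h.eventually_abs R (ε := ε / (I + 1)) (by positivity)).and (h.sol R))).exists
  have hw := hj3.weak φ h1 h2 (subset_inter hR fun x hx hxs => by
    have : x ∈ tsupport φ ∩ sing (u j) := ⟨hx, hxs⟩
    rw [hj1] at this; exact this)
  rw [← hw, ← integral_sub (hInt _ h.contDiff.continuous) (hInt _ hj3.contDiff.continuous)]
  rw [← Real.norm_eq_abs]
  refine (norm_integral_le_integral_norm _).trans ?_
  calc _ ≤ ∫ x, ε / (I + 1) * |lap N φ x| := by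
        refine integral_mono (((hInt _ h.contDiff.continuous).sub (hInt _ hj3.contDiff.continuous)).norm)
          ((hlap.integrable_of_hasCompactSupport hlc).abs.const_mul _) fun x => ?_
        simp only [Real.norm_eq_abs]
        rw [← sub_mul, abs_mul]
        by_cases hx : x ∈ tsupport φ
        · rw [abs_sub_comm]; gcongr; exact hj2 x (hR hx)
        · rw [hls x hx]; simp
    _ = ε / (I + 1) * I := integral_const_mul _ _
    _ ≤ ε / (I + 1) * (I + 1) := by gcongr; linarith
    _ = ε := by field_simp

theorem lap_eq_zero_of_notMem_tsupport {φ : Euc N → ℝ} {x : Euc N} (hx : x ∉ tsupport φ) : lap N φ x = 0 := by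
  have hz : φ =ᶠ[nhds x] fun _ => 0 := notMem_tsupport_iff_eventuallyEq.1 hx
  unfold lap
  refine Finset.sum_eq_zero fun i _ => ?_
  have h2 : (fun y => fderiv ℝ φ y (EuclideanSpace.single i 1)) =ᶠ[nhds x] fun _ => 0 := by
    filter_upwards [hz.eventuallyEq_nhds] with y hy
    rw [hy.fderiv_eq]; simp
  rw [h2.fderiv_eq]; simp

theorem contDiff_lap {φ : Euc N → ℝ} (h : ContDiff ℝ (⊤ : ℕ∞) φ) : ContDiff ℝ (⊤ : ℕ∞) (lap N φ) :=
  ContDiff.sum fun _ _ => contDiff_dd (contDiff_dd h _) _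

theorem hasCompactSupport_lap {φ : Euc N → ℝ} (h : HasCompactSupport φ) : HasCompactSupport (lap N φ) :=
  HasCompactSupport.intro h.isCompact fun _ hx => lap_eq_zero_of_notMem_tsupport hx

theorem lap_mul {f g : Euc N → ℝ} (hf : ContDiff ℝ (⊤ : ℕ∞) f) (hg : ContDiff ℝ (⊤ : ℕ∞) g) (x : Euc N) :
    lap N (fun y => f y * g y) x = ∑ i : Fin N,
      (f x * dd (EuclideanSpace.single i 1) (dd (EuclideanSpace.single i 1) g) x +
        2 * (dd (EuclideanSpace.single i 1) f x * dd (EuclideanSpace.single i 1) g x) +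
        dd (EuclideanSpace.single i 1) (dd (EuclideanSpace.single i 1) f) x * g x) := by
  rw [lap_eq_sum_dd]
  refine Finset.sum_congr rfl fun i _ => ?_
  set e : Euc N := EuclideanSpace.single i 1
  have df := hf.differentiable (by simp)
  have dg := hg.differentiable (by simp)
  have df' := (contDiff_dd hf e).differentiable (by simp)
  have dg' := (contDiff_dd hg e).differentiable (by simp)
  have h1 : dd e (fun y => f y * g y) = fun y => f y * dd e g y + dd e f y * g y := funext fun y => dd_mul (df y) (dg y) e
  have h2 : dd e (fun y => f y * dd e g y + dd e f y * g y) x =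
      dd e (fun y => f y * dd e g y) x + dd e (fun y => dd e f y * g y) x := by
    have := fderiv_fun_add ((df x).fun_mul (dg' x)) ((df' x).fun_mul (dg x))
    unfold dd at this ⊢
    rw [this]; rfl
  rw [h1, h2, dd_mul (df x) (dg' x), dd_mul (df' x) (dg x)]
  ring

theorem exists_dist_cutoff (N : ℕ) : ∃ K : ℝ, 0 ≤ K ∧ ∀ (S : Set (Euc N)) (s : ℝ), 0 < s →
    ∃ ζ : Euc N → ℝ, ContDiff ℝ (⊤ : ℕ∞) ζ ∧ (∀ x, 0 ≤ ζ x ∧ ζ x ≤ 1) ∧ (∀ x, infDist x S < s → ζ x = 1) ∧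
      (∀ x, 3 * s < infDist x S → ζ x = 0) ∧
      ∀ (i : Fin N) (x : Euc N), |dd (EuclideanSpace.single i 1) ζ x| ≤ s⁻¹ * K ∧
        |dd (EuclideanSpace.single i 1) (dd (EuclideanSpace.single i 1) ζ) x| ≤ s⁻¹ ^ 2 * K := by
  set e : Fin N → Euc N := fun i => EuclideanSpace.single i 1
  set K1 := fun i => ∫ y, |dd (e i) (rho : Euc N → ℝ) y|
  set K2 := fun i => ∫ y, |dd (e i) (dd (e i) (rho : Euc N → ℝ)) y|
  have p1 : ∀ i, 0 ≤ K1 i := fun i => integral_nonneg fun _ => abs_nonneg _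
  have p2 : ∀ i, 0 ≤ K2 i := fun i => integral_nonneg fun _ => abs_nonneg _
  have q1 : ∀ i, K1 i ≤ ∑ i, (K1 i + K2 i) := fun i => (le_add_of_nonneg_right (p2 i)).trans
    (Finset.single_le_sum (f := fun i => K1 i + K2 i) (fun i _ => add_nonneg (p1 i) (p2 i)) (Finset.mem_univ i))
  have q2 : ∀ i, K2 i ≤ ∑ i, (K1 i + K2 i) := fun i => (le_add_of_nonneg_left (p1 i)).trans
    (Finset.single_le_sum (f := fun i => K1 i + K2 i) (fun i _ => add_nonneg (p1 i) (p2 i)) (Finset.mem_univ i))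
  refine ⟨∑ i, (K1 i + K2 i), Finset.sum_nonneg fun i _ => add_nonneg (p1 i) (p2 i), fun S s hs => ?_⟩
  set A := {x : Euc N | infDist x S ≤ 2 * s}
  have hA : MeasurableSet A := (isClosed_le (continuous_infDist_pt S) continuous_const).measurableSet
  have hl := locallyIntegrable_chi hA
  have hclose : ∀ {x y : Euc N}, y ∈ ball x s → infDist y S < infDist x S + s ∧ infDist x S < infDist y S + s := by
    intro x y hy
    have h1 := infDist_le_infDist_add_dist (s := S) (x := x) (y := y)
    have h2 := infDist_le_infDist_add_dist (s := S) (x := y) (y := x)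
    rw [mem_ball] at hy
    rw [dist_comm x y] at h1
    exact ⟨by linarith, by linarith⟩
  refine ⟨Tk rho s (chi A), contDiff_Tk krn_rho hs hl, fun x => ⟨Tk_rho_nonneg (chi_nonneg A) s x,
    Tk_rho_chi_le_one hA hs x⟩, fun x hx => ?_, fun x hx => ?_, fun i x => ⟨?_, ?_⟩⟩
  · rw [Tk_congr krn_rho hs (g := fun _ => 1) fun y hy => chi_of_mem ?_, Tk_const, integral_rho, one_mul]
    have := hclose hy
    change infDist y S ≤ 2 * s
    linarith
  · rw [Tk_congr krn_rho hs (g := fun _ => 0) fun y hy => chi_of_notMem ?_, Tk_const, mul_zero]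
    have := hclose hy
    change ¬ infDist y S ≤ 2 * s
    linarith
  · rw [dd_Tk krn_rho hs hl, abs_mul, abs_of_pos (inv_pos.2 hs)]
    have := abs_Tk_le (krn_rho.dd (e i)) hs (x := x) (A := 1) fun y _ => abs_chi_le A y
    have := q1 i
    gcongr
    linarith
  · have h1 : dd (e i) (Tk rho s (chi A)) = fun x => s⁻¹ * Tk (dd (e i) rho) s (chi A) x :=
      funext fun x => dd_Tk krn_rho hs hl _ x
    rw [h1, dd_const_mul]
    beta_reduce
    rw [dd_Tk (krn_rho.dd (e i)) hs hl, ← mul_assoc, ← pow_two, abs_mul, abs_of_pos (by positivity)]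
    have := abs_Tk_le ((krn_rho.dd (e i)).dd (e i)) hs (x := x) (A := 1) fun y _ => abs_chi_le A y
    have := q2 i
    gcongr
    linarith

theorem Obst.solOn {C : ℝ} {u : Euc N → ℝ} (h : Obst C u univ) (hC : 0 ≤ C) : SolOn u (sing u) univ := by
  have hcl := isClosed_sing h.contDiff
  refine ⟨h.contDiff, hcl.measurableSet, fun x hx => hx.1.2, fun φ hφ hc _ => ?_⟩
  have hw := h.weak
  rw [univ_inter] at hw
  rcases (sing u).eq_empty_or_nonempty with hS | hne
  · rw [hw φ hφ hc (by rw [hS]; simp), hS]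
    simp [chi]
  obtain ⟨K, hK, hcut⟩ := exists_dist_cutoff N
  choose ζ hζ h01 hζ1 hζ0 hζb using fun n : ℕ => hcut (sing u) (rn n) (rn_pos n)
  have hbd : ∀ g : Euc N → ℝ, Continuous g → HasCompactSupport g → ∃ B, ∀ x, |g x| ≤ B := fun g h1 h2 => by
    obtain ⟨B, hB⟩ := h2.exists_bound_of_continuous h1
    exact ⟨B, hB⟩
  have hcs : ∀ i, HasCompactSupport (dd (EuclideanSpace.single i (1:ℝ)) φ) := fun i => hc.fderiv_apply (𝕜 := ℝ) _
  obtain ⟨B0, hB0⟩ := hbd φ hφ.continuous hc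
  choose B1 hB1 using fun i => hbd _ (contDiff_dd hφ (EuclideanSpace.single i (1:ℝ))).continuous (hcs i)
  choose B2 hB2 using fun i => hbd _ (contDiff_dd (contDiff_dd hφ (EuclideanSpace.single i (1:ℝ)))
    (EuclideanSpace.single i (1:ℝ))).continuous ((hcs i).fderiv_apply (𝕜 := ℝ) _)
  have hB00 : 0 ≤ B0 := (abs_nonneg _).trans (hB0 0)
  have hB10 : ∀ i, 0 ≤ B1 i := fun i => (abs_nonneg _).trans (hB1 i 0)
  have hB20 : ∀ i, 0 ≤ B2 i := fun i => (abs_nonneg _).trans (hB2 i 0)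
  set G := ∑ i, (B0 * K + 2 * (B1 i * K) + B2 i)
  have hG : 0 ≤ G := Finset.sum_nonneg fun i _ => by have := hB10 i; have := hB20 i; positivity
  have hlap : ∀ n x, |lap N (fun y => φ y * ζ n y) x| ≤ (rn n)⁻¹ ^ 2 * G := by
    intro n x
    rw [lap_mul hφ (hζ n), Finset.mul_sum]
    refine (Finset.abs_sum_le_sum_abs _ _).trans (Finset.sum_le_sum fun i _ => ?_)
    have hr : 1 ≤ (rn n)⁻¹ := (one_le_inv₀ (rn_pos n)).2 (rn_le_one n)
    obtain ⟨b1, b2⟩ := hζb n i x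
    have b3 := h01 n x
    have := hB10 i
    have := hB20 i
    refine (abs_add_three _ _ _).trans ?_
    rw [abs_mul, abs_mul 2, abs_mul (dd _ φ x), abs_mul (dd _ (dd _ φ) x), abs_two, abs_of_nonneg b3.1]
    calc _ ≤ B0 * ((rn n)⁻¹ ^ 2 * K) + 2 * (B1 i * ((rn n)⁻¹ * K)) + B2 i * 1 := by
          gcongr
          · exact hB0 x
          · exact hB1 i x
          · exact b3.1
          · exact hB2 i x
          · exact b3.2
      _ ≤ B0 * ((rn n)⁻¹ ^ 2 * K) + 2 * (B1 i * ((rn n)⁻¹ ^ 2 * K)) + B2 i * (rn n)⁻¹ ^ 2 := by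
          gcongr
          · exact le_self_pow₀ hr (by simp)
          · exact one_le_pow₀ hr
      _ = _ := by ring
  have hsm : ∀ n, ContDiff ℝ (⊤ : ℕ∞) fun y => φ y * ζ n y := fun n => hφ.mul (hζ n)
  have hcp : ∀ n, HasCompactSupport fun y => φ y * ζ n y := fun n => hc.mul_right
  have hu := h.contDiff.continuous
  have hInt : ∀ g : Euc N → ℝ, ContDiff ℝ (⊤ : ℕ∞) g → HasCompactSupport g → Integrable fun x => u x * lap N g x :=
    fun g h1 h2 => (hu.mul (contDiff_lap h1).continuous).integrable_of_hasCompactSupport (hasCompactSupport_lap h2).mul_left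
  have hid : ∀ n, ∫ x, u x * lap N φ x = (∫ x, φ x * (1 - ζ n x)) + ∫ x, u x * lap N (fun y => φ y * ζ n y) x := by
    intro n
    have hsm' : ContDiff ℝ (⊤ : ℕ∞) fun y => φ y * (1 - ζ n y) := hφ.mul (contDiff_const.sub (hζ n))
    have hcp' : HasCompactSupport fun y => φ y * (1 - ζ n y) := hc.mul_right
    have e1 : ∫ x, φ x * (1 - ζ n x) = ∫ x, u x * lap N (fun y => φ y * (1 - ζ n y)) x := by
      rw [hw _ hsm' hcp']
      · simp
      · intro x hx hxs
        refine absurd hx (notMem_tsupport_iff_eventuallyEq.2 ?_)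
        have hx0 : infDist x (sing u) < rn n := by rw [infDist_zero_of_mem hxs]; exact rn_pos n
        filter_upwards [(continuous_infDist_pt (sing u)).continuousAt.eventually (gt_mem_nhds hx0)] with y hy
        rw [hζ1 n y hy]; simp
    rw [e1, ← integral_add (hInt _ hsm' hcp') (hInt _ (hsm n) (hcp n))]
    refine integral_congr_ae (Eventually.of_forall fun x => ?_)
    beta_reduce
    rw [← mul_add, lap_mul hφ (hζ n), lap_mul hφ (contDiff_const.sub (hζ n)), ← Finset.sum_add_distrib, lap_eq_sum_dd]
    congr 1
    refine Finset.sum_congr rfl fun i _ => ?_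
    have e2 : ∀ e : Euc N, dd e (fun y => 1 - ζ n y) = fun y => (-1) * dd e (ζ n) y := fun e => by
      funext y; unfold dd; rw [fderiv_const_sub]; simp
    rw [e2, dd_const_mul]
    ring
  have hev : ∀ x, x ∉ sing u → ∀ᶠ n in atTop, 3 * rn n < infDist x (sing u) := by
    intro x hx
    have hpos : 0 < infDist x (sing u) := (hcl.notMem_iff_infDist_pos hne).1 hx
    have : Tendsto (fun n => 3 * rn n) atTop (nhds (3 * 0)) :=
      ((tendsto_rn.mono_right nhdsWithin_le_nhds)).const_mul 3
    rw [mul_zero] at this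
    exact this.eventually (gt_mem_nhds hpos)
  have hnear : ∀ n x, 3 * rn n < infDist x (sing u) → lap N (fun y => φ y * ζ n y) x = 0 := by
    intro n x hx
    apply lap_eq_zero_of_notMem_tsupport
    rw [notMem_tsupport_iff_eventuallyEq]
    filter_upwards [(continuous_infDist_pt (sing u)).continuousAt.eventually (lt_mem_nhds hx)] with y hy
    rw [hζ0 n y hy]; simp
  have l1 : Tendsto (fun n => ∫ x, φ x * (1 - ζ n x)) atTop (nhds (∫ x, chi (sing u)ᶜ x * φ x)) := by
    refine tendsto_integral_of_dominated_convergence (fun x => |φ x|)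
      (fun n => (hφ.continuous.mul (continuous_const.sub (hζ n).continuous)).aestronglyMeasurable)
      (hφ.continuous.integrable_of_hasCompactSupport hc).abs (fun n => Eventually.of_forall fun x => ?_)
      (Eventually.of_forall fun x => ?_)
    · rw [Real.norm_eq_abs, abs_mul]
      refine mul_le_of_le_one_right (abs_nonneg _) ?_
      have := h01 n x
      rw [_root_.abs_le]; constructor <;> linarith
    · by_cases hx : x ∈ sing u
      · rw [chi_of_notMem (by simpa using hx), zero_mul]
        refine tendsto_const_nhds.congr fun n => ?_
        rw [hζ1 n x (by rw [infDist_zero_of_mem hx]; exact rn_pos n)]; simp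
      · rw [chi_of_mem (by simpa using hx), one_mul]
        refine tendsto_const_nhds.congr' ?_
        filter_upwards [hev x hx] with n hn
        rw [hζ0 n x hn]; simp
  have l2 : Tendsto (fun n => ∫ x, u x * lap N (fun y => φ y * ζ n y) x) atTop (nhds (∫ x : Euc N, (0:ℝ))) := by
    refine tendsto_integral_of_dominated_convergence (fun x => (tsupport φ).indicator (fun _ => 9 * C * G) x)
      (fun n => (hInt _ (hsm n) (hcp n)).aestronglyMeasurable)
      ((integrable_indicator_iff hc.isCompact.measurableSet).2 (integrableOn_const hc.isCompact.measure_lt_top.ne))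
      (fun n => Eventually.of_forall fun x => ?_) (Eventually.of_forall fun x => ?_)
    · rw [Real.norm_eq_abs, abs_mul]
      by_cases hx : x ∈ tsupport φ
      · rw [indicator_of_mem hx]
        by_cases hd : 3 * rn n < infDist x (sing u)
        · rw [hnear n x hd]; simp; positivity
        · obtain ⟨p, hp, hxp⟩ := hcl.exists_infDist_eq_dist hne x
          have hxp' : ‖x - p‖ ≤ 3 * rn n := by rw [← dist_eq_norm, ← hxp]; exact not_lt.1 hd
          have hrn := rn_pos n
          calc |u x| * |lap N (fun y => φ y * ζ n y) x| ≤ (C * (3 * rn n) ^ 2) * ((rn n)⁻¹ ^ 2 * G) := by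
                gcongr
                · exact (h.abs_le hC convex_univ (mem_univ p) (mem_univ x) hp).trans (by gcongr)
                · exact hlap n x
            _ = 9 * C * G := by field_simp; ring
      · rw [indicator_of_notMem hx, lap_eq_zero_of_notMem_tsupport fun hx' => hx (closure_mono (fun y hy => ?_) hx')]
        · simp
        · rw [Function.mem_support] at hy ⊢
          exact left_ne_zero_of_mul hy
    · by_cases hx : x ∈ sing u
      · rw [hx.1]; simp
      · refine tendsto_const_nhds.congr' ?_
        filter_upwards [hev x hx] with n hn
        rw [hnear n x hn, mul_zero]
  have := (l1.add l2).congr fun n => (hid n).symm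
  rw [integral_zero, add_zero] at this
  exact tendsto_nhds_unique tendsto_const_nhds this

theorem hasFDerivAt_inner_left (e : Euc N) (x : Euc N) : HasFDerivAt (fun y : Euc N => ⟪y, e⟫) (innerSL ℝ e) x := by
  have : (fun y : Euc N => ⟪y, e⟫) = innerSL ℝ e := by
    funext y; rw [innerSL_apply_apply, real_inner_comm]
  rw [this]; exact (innerSL ℝ e).hasFDerivAt

theorem dd_affine (α β : ℝ) (e a x : Euc N) : dd a (fun y : Euc N => α * ⟪y, e⟫ + β) x = α * ⟪a, e⟫ := by
  unfold dd
  rw [(((hasFDerivAt_inner_left e x).const_mul α).add_const β).fderiv]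
  simp [real_inner_comm]

theorem contDiff_affine (α β : ℝ) (e : Euc N) : ContDiff ℝ 1 (fun y : Euc N => α * ⟪y, e⟫ + β) :=
  (contDiff_const.mul (contDiff_id.inner ℝ contDiff_const)).add contDiff_const

theorem Hes_eq_of_affine {u : Euc N → ℝ} (hu : ContDiff ℝ 1 u) {R : ℝ} (hR : 0 < R) {a e x : Euc N} {α β : ℝ}
    (h : ∀ y ∈ ball x R, dd a u y = α * ⟪y, e⟫ + β) : Hes R u a x = α * ⟪a, e⟫ := by
  rw [Hes_eq_Tk_dd hR hu, Tk_congr (krn_rho.dd a) hR h,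
    ← dd_Tk krn_rho hR (contDiff_affine α β e).continuous.locallyIntegrable, dd_Tk' krn_rho (contDiff_affine α β e)]
  have : dd a (fun y : Euc N => α * ⟪y, e⟫ + β) = fun _ => α * ⟪a, e⟫ := funext fun y => dd_affine α β e a y
  rw [this, Tk_const, integral_rho, one_mul]

theorem abs_Tk_sub_Tk_le {ψ : Euc N → ℝ} (h : Krn ψ) {R : ℝ} (hR : 0 < R) {g : Euc N → ℝ} (hg : Continuous g) {L : ℝ}
    (hL : ∀ x y, |g x - g y| ≤ L * ‖x - y‖) (x y : Euc N) :
    |Tk ψ R g x - Tk ψ R g y| ≤ (∫ z, |ψ z|) * (L * ‖x - y‖) := by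
  have e1 : Tk ψ R g y = Tk ψ R (fun z => g (z + (y - x))) x := by
    unfold Tk
    refine integral_congr_ae (Eventually.of_forall fun z => ?_)
    beta_reduce
    rw [show x - R • z + (y - x) = y - R • z by abel]
  have hg' : Continuous fun z => g (z + (y - x)) := by fun_prop
  rw [e1, ← Tk_sub h hR hg.locallyIntegrable hg'.locallyIntegrable]
  refine abs_Tk_le h hR fun z _ => ?_
  refine (hL _ _).trans (le_of_eq ?_)
  rw [show z - (z + (y - x)) = x - y by abel]

theorem abs_Tk_rho_sub_le {s : ℝ} (hs : 0 < s) {g : Euc N → ℝ} (hg : Continuous g) {L : ℝ} (hL0 : 0 ≤ L)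
    (hL : ∀ x y, |g x - g y| ≤ L * ‖x - y‖) (x : Euc N) : |Tk rho s g x - g x| ≤ L * s := by
  have e1 : g x = Tk rho s (fun _ => g x) x := by rw [Tk_const, integral_rho, one_mul]
  have : |Tk rho s g x - Tk rho s (fun _ => g x) x| ≤ (∫ z, |(rho : Euc N → ℝ) z|) * (L * s) := by
    rw [← Tk_sub krn_rho hs hg.locallyIntegrable continuous_const.locallyIntegrable]
    refine abs_Tk_le krn_rho hs fun z hz => (hL _ _).trans ?_
    gcongr
    rw [← dist_eq_norm]; exact (mem_ball.1 hz).le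
  rwa [← e1, integral_abs_rho, one_mul] at this

theorem Obst.abs_dd_sub_le {C : ℝ} {u : Euc N → ℝ} (h : Obst C u univ) (e x y : Euc N) :
    |_root_.dd e u x - _root_.dd e u y| ≤ C * ‖e‖ * ‖x - y‖ := by
  have h1 := h.lip x (mem_univ x) y (mem_univ y)
  have h2 := (fderiv ℝ u x - fderiv ℝ u y).le_opNorm e
  rw [_root_.sub_apply, Real.norm_eq_abs] at h2
  unfold _root_.dd
  calc _ ≤ _ := h2
    _ ≤ C * ‖x - y‖ * ‖e‖ := by gcongr
    _ = _ := by ring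

theorem Obst.abs_Hes_le {C : ℝ} (hC : 0 ≤ C) {u : Euc N → ℝ} (h : Obst C u univ) {R : ℝ} (hR : 0 < R) (e x : Euc N) :
    |Hes R u e x| ≤ C * ‖e‖ ^ 2 := by
  rw [Hes_eq_dd_Tk hR h.contDiff]
  have hc := continuous_dd h.contDiff e
  have h1 : ‖fderiv ℝ (Tk rho R (_root_.dd e u)) x‖ ≤ C * ‖e‖ := by
    refine norm_fderiv_le_of_lip' ℝ (by positivity) (Eventually.of_forall fun y => ?_)
    have := abs_Tk_sub_Tk_le krn_rho hR hc (h.abs_dd_sub_le e) y x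
    rwa [integral_abs_rho, one_mul] at this
  have h2 := (fderiv ℝ (Tk rho R (_root_.dd e u)) x).le_opNorm e
  calc _ ≤ _ := h2
    _ ≤ C * ‖e‖ * ‖e‖ := by gcongr
    _ = _ := by ring

theorem Obst.abs_Hes_sub_le {C : ℝ} {u : Euc N → ℝ} (h : Obst C u univ) {R : ℝ} (hR : 0 < R) (e x y : Euc N) :
    |Hes R u e x - Hes R u e y| ≤ R⁻¹ * ((∫ z, |_root_.dd e (rho : Euc N → ℝ) z|) * (C * ‖e‖ * ‖x - y‖)) := by
  rw [Hes_eq_Tk_dd hR h.contDiff, Hes_eq_Tk_dd hR h.contDiff, ← mul_sub, abs_mul, abs_of_pos (inv_pos.2 hR)]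
  gcongr
  exact abs_Tk_sub_Tk_le (krn_rho.dd e) hR (continuous_dd h.contDiff e) (h.abs_dd_sub_le e) x y

theorem Tk_rho_Hes {u : Euc N → ℝ} (hu : ContDiff ℝ 1 u) {R s : ℝ} (hR : 0 < R) (hs : 0 < s) (e x : Euc N) :
    Tk rho R (Hes s u e) x = Hes R (Tk rho s u) e x := by
  have hl := hu.continuous.locallyIntegrable (μ := volume)
  have hsm := contDiff_Tk krn_rho hs hl
  rw [Hes_eq_dd_Tk hR (hsm.of_le (by simp)), dd_Tk' krn_rho ((contDiff_dd hsm e).of_le (by simp))]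
  congr 1
  funext y
  exact Hes_eq_dd_dd hs hl e y

theorem Obst.abs_Tk_rho_Hes_sub_le {C : ℝ} (hC : 0 ≤ C) {u : Euc N → ℝ} (h : Obst C u univ) {R s : ℝ} (hR : 0 < R) (hs : 0 < s)
    (e x : Euc N) : |Tk rho R (Hes s u e) x - Hes R u e x| ≤
      R⁻¹ * ((∫ z, |_root_.dd e (rho : Euc N → ℝ) z|) * (C * ‖e‖ * s)) := by
  have hsm := contDiff_Tk krn_rho hs (h.contDiff.continuous.locallyIntegrable (μ := volume))
  have hc := continuous_dd h.contDiff e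
  have hc' := continuous_dd (hsm.of_le (by simp)) e
  rw [Tk_rho_Hes h.contDiff hR hs, Hes_eq_Tk_dd hR (hsm.of_le (by simp)), Hes_eq_Tk_dd hR h.contDiff, ← mul_sub, abs_mul,
    abs_of_pos (inv_pos.2 hR), ← Tk_sub (krn_rho.dd e) hR hc'.locallyIntegrable hc.locallyIntegrable]
  gcongr
  refine abs_Tk_le (krn_rho.dd e) hR fun y _ => ?_
  rw [dd_Tk_rho_eq h.contDiff]
  exact abs_Tk_rho_sub_le hs hc (by positivity) (h.abs_dd_sub_le e) y

theorem continuous_Hes {R : ℝ} (hR : 0 < R) {u : Euc N → ℝ} (hu : Continuous u) (e : Euc N) : Continuous (Hes R u e) :=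
  continuous_const.mul (contDiff_Tk ((krn_rho.dd e).dd e) hR hu.locallyIntegrable).continuous

theorem exists_Tk_rho_le {x x0 : Euc N} {R R0 : ℝ} (hR : 0 < R) (hR0 : 0 < R0) (hsub : closedBall x R ⊆ ball x0 R0) :
    ∃ K : ℝ, 0 ≤ K ∧ ∀ h : Euc N → ℝ, Continuous h → (∀ y, 0 ≤ h y) → Tk rho R h x ≤ K * Tk rho R0 h x0 := by
  obtain ⟨B, hB, hBr⟩ := (krn_rho (N := N)).exists_bound
  have hc : Continuous fun z : Euc N => (rho : Euc N → ℝ) (R0⁻¹ • (x0 - z)) := by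
    have := (krn_rho (N := N)).continuous
    fun_prop
  obtain ⟨z0, hz0, hmin⟩ := (isCompact_closedBall x R).exists_isMinOn ⟨x, mem_closedBall_self hR.le⟩ hc.continuousOn
  have hm : 0 < (rho : Euc N → ℝ) (R0⁻¹ • (x0 - z0)) := by
    refine rho_pos ?_
    have := mem_ball.1 (hsub hz0)
    rw [norm_smul, Real.norm_of_nonneg (inv_nonneg.2 hR0.le), ← dist_eq_norm, dist_comm, inv_mul_lt_one₀ hR0]
    exact this
  set m := (rho : Euc N → ℝ) (R0⁻¹ • (x0 - z0))
  refine ⟨(R ^ N)⁻¹ * (B / m) * R0 ^ N, by positivity, fun h hh h0 => ?_⟩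
  rw [Tk_eq _ hR, Tk_eq _ hR0]
  have hi : ∀ (p : Euc N) (s : ℝ), 0 < s → Integrable fun z => h z * (rho : Euc N → ℝ) (s⁻¹ • (p - z)) := by
    intro p s hs
    have h1 : Continuous fun z : Euc N => (rho : Euc N → ℝ) (s⁻¹ • (p - z)) := by
      have := (krn_rho (N := N)).continuous
      fun_prop
    refine (hh.mul h1).integrable_of_hasCompactSupport ?_
    refine HasCompactSupport.intro (isCompact_closedBall p s) fun z hz => ?_
    change h z * (rho : Euc N → ℝ) (s⁻¹ • (p - z)) = 0
    rw [krn_rho.supp, mul_zero]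
    rw [mem_closedBall, not_le, dist_comm, dist_eq_norm] at hz
    rw [norm_smul, Real.norm_of_nonneg (inv_nonneg.2 hs.le), le_inv_mul_iff₀ hs, mul_one]
    exact hz.le
  have hle : ∫ z, h z * (rho : Euc N → ℝ) (R⁻¹ • (x - z)) ≤ ∫ z, (B / m) * (h z * (rho : Euc N → ℝ) (R0⁻¹ • (x0 - z))) := by
    refine integral_mono (hi x R hR) ((hi x0 R0 hR0).const_mul _) fun z => ?_
    beta_reduce
    rw [mul_left_comm]
    refine mul_le_mul_of_nonneg_left ?_ (h0 z)
    by_cases hz : z ∈ closedBall x R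
    · have h1 : m ≤ (rho : Euc N → ℝ) (R0⁻¹ • (x0 - z)) := hmin hz
      calc _ ≤ B := (le_abs_self _).trans (hBr _)
        _ = B / m * m := by field_simp
        _ ≤ _ := by gcongr
    · rw [krn_rho.supp]
      · exact mul_nonneg (by positivity) (rho_nonneg _)
      · rw [mem_closedBall, not_le, dist_comm, dist_eq_norm] at hz
        rw [norm_smul, Real.norm_of_nonneg (inv_nonneg.2 hR.le), le_inv_mul_iff₀ hR, mul_one]
        exact hz.le
  rw [integral_const_mul] at hle
  calc _ ≤ (R ^ N)⁻¹ * (B / m * ∫ z, h z * (rho : Euc N → ℝ) (R0⁻¹ • (x0 - z))) := by gcongr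
    _ = _ := by field_simp

/-- If the mollified second derivatives are bounded below by `-m` and the bound is attained on a ball, then it is
attained on all smaller balls inside. -/
theorem Obst.Hes_eq_of_min {C : ℝ} (hC : 0 ≤ C) {u : Euc N → ℝ} (h : Obst C u univ) {e : Euc N} {m : ℝ}
    (hlow : ∀ s, 0 < s → ∀ x, -m ≤ Hes s u e x) {x0 : Euc N} {R0 : ℝ} (hR0 : 0 < R0) (hmin : Hes R0 u e x0 = -m)
    {x : Euc N} {R : ℝ} (hR : 0 < R) (hsub : closedBall x R ⊆ ball x0 R0) : Hes R u e x = -m := by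
  obtain ⟨K, hK, hcmp⟩ := exists_Tk_rho_le hR hR0 hsub
  have hcont : ∀ s, 0 < s → Continuous fun y => Hes s u e y + m := fun s hs =>
    (continuous_Hes hs h.contDiff.continuous e).add continuous_const
  have hT : ∀ (y : Euc N) (r : ℝ), 0 < r → ∀ s, 0 < s → Tk rho r (fun y => Hes s u e y + m) y = Tk rho r (Hes s u e) y + m := by
    intro y r hr s hs
    have := Tk_sub krn_rho hr (hcont s hs).locallyIntegrable (continuous_const (y := m)).locallyIntegrable y
    simp only [add_sub_cancel_right] at this
    rw [Tk_const, integral_rho, one_mul] at this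
    change Tk rho r (fun y => Hes s u e y) y = _ at this
    have h2 : Tk rho r (fun y => Hes s u e y) y = Tk rho r (Hes s u e) y := rfl
    rw [← h2, this]; ring
  have hlim : ∀ (y : Euc N) (r : ℝ), 0 < r → Tendsto (fun n => Tk rho r (Hes (rn n) u e) y + m) atTop (nhds (Hes r u e y + m)) := by
    intro y r hr
    refine Tendsto.add_const m ?_
    rw [tendsto_iff_norm_sub_tendsto_zero]
    have hz : Tendsto (fun n => r⁻¹ * ((∫ z, |_root_.dd e (rho : Euc N → ℝ) z|) * (C * ‖e‖ * rn n))) atTop (nhds 0) := by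
      have := (((tendsto_rn.mono_right nhdsWithin_le_nhds).const_mul (C * ‖e‖)).const_mul
        (∫ z, |_root_.dd e (rho : Euc N → ℝ) z|)).const_mul r⁻¹
      simpa using this
    exact squeeze_zero (fun n => norm_nonneg _) (fun n => h.abs_Tk_rho_Hes_sub_le hC hr (rn_pos n) e y) hz
  have h1 : Hes R u e x + m ≤ K * (Hes R0 u e x0 + m) := by
    refine le_of_tendsto_of_tendsto' (hlim x R hR) ((hlim x0 R0 hR0).const_mul K) fun n => ?_
    have := hcmp _ (hcont (rn n) (rn_pos n)) fun y => by linarith [hlow (rn n) (rn_pos n) y]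
    rwa [hT x R hR _ (rn_pos n), hT x0 R0 hR0 _ (rn_pos n)] at this
  rw [hmin] at h1
  have := hlow R hR x
  linarith

/-- A direction in which the mollified second derivatives are minimal is a principal direction. -/
theorem Obst.dd_affine_of_min {C : ℝ} (hC : 0 ≤ C) {u : Euc N → ℝ} (h : Obst C u univ) {e : Euc N} (he : ‖e‖ = 1) {m : ℝ}
    (hlow : ∀ a : Euc N, ‖a‖ = 1 → ∀ s, 0 < s → ∀ x, -m ≤ Hes s u a x) {x0 : Euc N} {R0 : ℝ} (hR0 : 0 < R0)
    (hmin : Hes R0 u e x0 = -m) : ∃ β, ∀ x ∈ ball x0 R0, _root_.dd e u x = -m * ⟪x, e⟫ + β := by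
  have hl := h.contDiff.continuous.locallyIntegrable (μ := volume)
  have key : ∀ s, 0 < s → ∀ x, closedBall x s ⊆ ball x0 R0 → ∀ a : Euc N,
      _root_.dd a (_root_.dd e (Tk rho s u)) x = -m * ⟪a, e⟫ := by
    intro s hs x hx a
    have hsm := contDiff_Tk krn_rho hs hl
    set T := Tk rho s u
    have hq : ∀ b : Euc N, -m * ‖b‖ ^ 2 ≤ _root_.dd b (_root_.dd b T) x := by
      intro b
      rcases eq_or_ne b 0 with rfl | hb
      · simp [_root_.dd]
      have hb' := norm_pos_iff.2 hb
      have h1 := hlow (‖b‖⁻¹ • b) (by rw [norm_smul, norm_inv, norm_norm, inv_mul_cancel₀ hb'.ne']) s hs x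
      rw [Hes_eq_dd_dd hs hl, dd_dd_smul_dir] at h1
      have h2 : ‖b‖ ^ 2 * (‖b‖⁻¹ ^ 2 * _root_.dd b (_root_.dd b T) x) = _root_.dd b (_root_.dd b T) x := by field_simp
      rw [← h2, mul_comm (-m)]
      exact mul_le_mul_of_nonneg_left h1 (by positivity)
    have hee : _root_.dd e (_root_.dd e T) x = -m := by
      rw [← Hes_eq_dd_dd hs hl]
      exact h.Hes_eq_of_min hC (hlow e he) hR0 hmin hs hx
    have hpoly : ∀ t : ℝ, 0 ≤ (_root_.dd a (_root_.dd a T) x + m * ‖a‖ ^ 2) * t ^ 2 +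
        2 * (_root_.dd a (_root_.dd e T) x + m * ⟪a, e⟫) * t := by
      intro t
      have h1 := hq (t • a + e)
      rw [dd_dd_add_dir hsm, dd_dd_smul_dir, hee, dd_smul_dir, norm_add_sq_real, norm_smul, inner_smul_left, he, mul_pow,
        Real.norm_eq_abs, sq_abs] at h1
      simp only [conj_trivial] at h1
      linarith
    have hb : _root_.dd a (_root_.dd e T) x + m * ⟪a, e⟫ = 0 := by
      set p := _root_.dd a (_root_.dd a T) x + m * ‖a‖ ^ 2
      set q := _root_.dd a (_root_.dd e T) x + m * ⟪a, e⟫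
      have hp : 0 ≤ p := by have := hq a; linarith
      by_contra hne
      have h1 := hpoly (-q / (p + 1))
      have : p * (-q / (p + 1)) ^ 2 + 2 * q * (-q / (p + 1)) = - (q ^ 2 * (p + 2) / (p + 1) ^ 2) := by field_simp; ring
      rw [this] at h1
      have : 0 < q ^ 2 * (p + 2) / (p + 1) ^ 2 := by positivity
      linarith
    linarith
  refine ⟨_root_.dd e u x0 + m * ⟪x0, e⟫, fun x hx => ?_⟩
  have hc := continuous_dd h.contDiff e
  have hx' : dist x x0 < R0 := hx
  have hev : ∀ᶠ s in nhdsWithin (0:ℝ) (Ioi 0), Tk rho s (_root_.dd e u) x + m * ⟪x, e⟫ = Tk rho s (_root_.dd e u) x0 + m * ⟪x0, e⟫ := by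
    filter_upwards [self_mem_nhdsWithin, nhdsWithin_le_nhds (gt_mem_nhds (show 0 < R0 - dist x x0 by linarith))] with s hs hs2
    have hs0 : 0 < s := hs
    have hsm := contDiff_Tk krn_rho hs0 hl
    rw [← dd_Tk_rho_eq h.contDiff]
    set g : Euc N → ℝ := fun y => _root_.dd e (Tk rho s u) y + m * ⟪y, e⟫
    have hD : DifferentiableOn ℝ g (ball x0 (R0 - s)) := fun y _ =>
      (((contDiff_dd hsm e).differentiable (by simp) y).add ((hasFDerivAt_inner_left e y).differentiableAt.const_mul m)).differentiableWithinAt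
    refine (convex_ball x0 (R0 - s)).is_const_of_fderivWithin_eq_zero (𝕜 := ℝ) hD (fun y hy => ?_)
      (mem_ball.2 (by linarith)) (mem_ball_self (by linarith [dist_nonneg (x := x) (y := x0)]))
    rw [fderivWithin_of_isOpen isOpen_ball hy]
    ext a
    have h1 := key s hs0 y (closedBall_subset_ball' (by have := mem_ball.1 hy; linarith)) a
    have h2 : HasFDerivAt g (fderiv ℝ (_root_.dd e (Tk rho s u)) y + m • innerSL ℝ e) y :=
      ((contDiff_dd hsm e).differentiable (by simp) y).hasFDerivAt.add ((hasFDerivAt_inner_left e y).const_mul m)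
    rw [h2.fderiv]
    change fderiv ℝ (_root_.dd e (Tk rho s u)) y a = _ at h1
    simp only [_root_.add_apply, _root_.smul_apply, innerSL_apply_apply, smul_eq_mul, h1, _root_.zero_apply, real_inner_comm]
    ring
  have l1 := (tendsto_Tk_rho hc x).add_const (m * ⟪x, e⟫)
  have l2 := (tendsto_Tk_rho hc x0).add_const (m * ⟪x0, e⟫)
  have := tendsto_nhds_unique (l1.congr' hev) l2
  linarith

theorem Tk_chi_eq_zero {ψ : Euc N → ℝ} (h : Krn ψ) {R : ℝ} (hR : 0 < R) {Λ : Set (Euc N)} (hΛ : MeasurableSet Λ) {x : Euc N}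
    (h0 : volume (Λ ∩ ball x R) = 0) : Tk ψ R (chi Λ) x = 0 := by
  obtain ⟨C, -, hC⟩ := h.exists_bound
  have h1 := abs_Tk_chi_le h hC hR hΛ x
  rw [measureReal_def, h0, ENNReal.toReal_zero, mul_zero] at h1
  exact abs_nonpos_iff.1 h1

theorem Obst.Hes_half {C : ℝ} (hC : 0 ≤ C) {u : Euc N → ℝ} (h : Obst C u univ) {R : ℝ} (hR : 0 < R) {x : Euc N}
    (h0 : volume (sing u ∩ ball x R) = 0) (e : Euc N) : Hes (R / 2) u e x = Hes R u e x := by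
  have h1 := (h.solOn hC).Hes_sub hR (subset_univ (closedBall x R)) e
  rw [Tk_chi_eq_zero ((krn_kap.dd e).dd e) hR (isClosed_sing h.contDiff).measurableSet h0] at h1
  linarith

theorem Obst.Hes_mul_rn {C : ℝ} (hC : 0 ≤ C) {u : Euc N → ℝ} (h : Obst C u univ) {R : ℝ} (hR : 0 < R) {x : Euc N}
    (h0 : volume (sing u ∩ ball x R) = 0) (e : Euc N) (n : ℕ) : Hes (R * rn n) u e x = Hes R u e x := by
  induction n with
  | zero => rw [rn_zero, mul_one]
  | succ n ih =>
    rw [← ih, rn_succ, show R * (rn n / 2) = R * rn n / 2 by ring]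
    refine h.Hes_half hC (mul_pos hR (rn_pos n)) (measure_mono_null (inter_subset_inter_right _ (ball_subset_ball ?_)) h0) e
    exact mul_le_of_le_one_right hR.le (rn_le_one n)

theorem volume_hyperplane {e : Euc N} (he : e ≠ 0) (c : ℝ) : volume {x : Euc N | ⟪x, e⟫ = c} = 0 := by
  by_cases hne : ∃ p : Euc N, ⟪p, e⟫ = c
  · obtain ⟨p, hp⟩ := hne
    have h1 : (fun x => x + p) ⁻¹' {x : Euc N | ⟪x, e⟫ = c} = (LinearMap.ker (innerSL ℝ e).toLinearMap : Set (Euc N)) := by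
      ext x
      change ⟪x + p, e⟫ = c ↔ ⟪e, x⟫ = 0
      rw [inner_add_left, hp, real_inner_comm]
      constructor <;> intro h <;> linarith
    rw [← measure_preimage_add_right volume p, h1]
    refine Measure.addHaar_submodule volume _ fun htop => he ?_
    have : e ∈ LinearMap.ker (innerSL ℝ e).toLinearMap := by rw [htop]; trivial
    simpa using this
  · push Not at hne
    rw [show {x : Euc N | ⟪x, e⟫ = c} = ∅ from eq_empty_of_forall_notMem fun x hx => hne x hx, measure_empty]

/-- The points near which `dd e u` equals `-m⟪x,e⟫+β`. -/
def affSet (u : Euc N → ℝ) (e : Euc N) (m β : ℝ) : Set (Euc N) :=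
  {p | ∀ᶠ x in nhds p, dd e u x = -m * ⟪x, e⟫ + β}

theorem isOpen_affSet (u : Euc N → ℝ) (e : Euc N) (m β : ℝ) : IsOpen (affSet u e m β) := isOpen_setOfPred_eventually_nhds

theorem affSet_neg (u : Euc N → ℝ) (e : Euc N) (m β : ℝ) : affSet u (-e) m (-β) = affSet u e m β := by
  ext p
  unfold affSet
  simp only [Set.mem_ofPred_eq]
  refine eventually_congr (Eventually.of_forall fun x => ?_)
  have : dd (-e) u x = - dd e u x := by simp [dd]
  rw [this, inner_neg_right]
  constructor <;> intro h <;> linarith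

section Propagation

variable {C m β : ℝ} {u : Euc N → ℝ} {e : Euc N}

theorem Obst.mem_affSet (hC : 0 ≤ C) (h : Obst C u univ) (he : ‖e‖ = 1)
    (hlow : ∀ a : Euc N, ‖a‖ = 1 → ∀ s, 0 < s → ∀ x, -m ≤ Hes s u a x) {p : Euc N} (hp : p ∉ sing u)
    (hpc : p ∈ closure (affSet u e m β)) : p ∈ affSet u e m β := by
  obtain ⟨r, hr, hball⟩ := Metric.isOpen_iff.1 (isClosed_sing h.contDiff).isOpen_compl p hp
  set q := r / 4
  have hq : 0 < q := by positivity
  obtain ⟨a, ha, hpa⟩ := Metric.mem_closure_iff.1 hpc q hq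
  obtain ⟨t, ht, hta⟩ := Metric.eventually_nhds_iff_ball.1 ha
  have hz : Tendsto (fun n => 2 * q * rn n) atTop (nhds (2 * q * 0)) :=
    (tendsto_rn.mono_right nhdsWithin_le_nhds).const_mul _
  rw [mul_zero] at hz
  obtain ⟨n, hn⟩ := (hz.eventually (gt_mem_nhds ht)).exists
  have e1 : Hes (2 * q * rn n) u e a = -m := by
    rw [Hes_eq_of_affine h.contDiff (mul_pos (by positivity) (rn_pos n)) fun y hy => hta y (ball_subset_ball hn.le hy),
      real_inner_self_eq_norm_sq, he]
    ring
  have hdist : dist a p < q := by rw [dist_comm]; exact hpa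
  rw [h.Hes_mul_rn hC (by positivity)] at e1
  · obtain ⟨β', hβ'⟩ := h.dd_affine_of_min hC he hlow (by positivity) e1
    have e2 := hβ' a (mem_ball_self (by positivity))
    have e3 := hta a (mem_ball_self ht)
    have : β' = β := by linarith
    subst this
    refine mem_of_superset (isOpen_ball.mem_nhds (show p ∈ ball a (2 * q) from ?_)) hβ'
    rw [mem_ball]; linarith
  · rw [show sing u ∩ ball a (2 * q) = ∅ from ?_, measure_empty]
    refine eq_empty_of_forall_notMem fun y hy => (hball (?_ : y ∈ ball p r)) hy.1
    have h1 := mem_ball.1 hy.2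
    have h2 := dist_triangle y a p
    have h3 : r = 4 * q := by ring
    rw [mem_ball]; linarith

theorem Obst.dd_eq_of_mem_closure_affSet (h : Obst C u univ) {p : Euc N} (hpc : p ∈ closure (affSet u e m β)) :
    _root_.dd e u p = -m * ⟪p, e⟫ + β := by
  have hcl : IsClosed {x : Euc N | _root_.dd e u x = -m * ⟪x, e⟫ + β} := isClosed_eq (continuous_dd h.contDiff e)
    (contDiff_affine (-m) β e).continuous
  exact hcl.closure_subset_iff.2 (fun x hx => hx.self_of_nhds) hpc

theorem Obst.subset_affSet (hC : 0 ≤ C) (h : Obst C u univ) (he : ‖e‖ = 1)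
    (hlow : ∀ a : Euc N, ‖a‖ = 1 → ∀ s, 0 < s → ∀ x, -m ≤ Hes s u a x) {H : Set (Euc N)} (hH : IsPreconnected H)
    (hne : (H ∩ affSet u e m β).Nonempty) (hHn : ∀ x ∈ H, m * ⟪x, e⟫ ≠ β) : H ⊆ affSet u e m β := by
  refine hH.subset_of_closure_inter_subset (isOpen_affSet u e m β) hne fun p hp => ?_
  refine h.mem_affSet hC he hlow (fun hs => hHn p hp.2 ?_) hp.1
  have h1 := h.dd_eq_of_mem_closure_affSet hp.1
  have h2 : _root_.dd e u p = 0 := by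
    unfold _root_.dd
    rw [hs.2]; rfl
  linarith

theorem Obst.false_of_half (hC : 0 ≤ C) (h : Obst C u univ) (hS : volume (sing u) ≠ 0) (hm : 0 < m) (he : ‖e‖ = 1)
    (hlow : ∀ a : Euc N, ‖a‖ = 1 → ∀ s, 0 < s → ∀ x, -m ≤ Hes s u a x) (hA : {x | β < m * ⟪x, e⟫} ⊆ affSet u e m β) :
    False := by
  have he0 : e ≠ 0 := fun h0 => by rw [h0, norm_zero] at he; exact zero_ne_one he
  have hee : ⟪e, e⟫ = 1 := by rw [real_inner_self_eq_norm_sq, he, one_pow]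
  have hline : ∀ (p : Euc N) (t : ℝ), ⟪p + t • e, e⟫ = ⟪p, e⟫ + t := fun p t => by
    rw [inner_add_left, inner_smul_left, hee]; simp
  have hcl : ∀ p : Euc N, m * ⟪p, e⟫ = β → p ∈ closure {x : Euc N | β < m * ⟪x, e⟫} := by
    intro p hp
    rw [Metric.mem_closure_iff]
    intro ε hε
    refine ⟨p + (ε / 2) • e, ?_, ?_⟩
    · change β < m * ⟪p + (ε / 2) • e, e⟫
      rw [hline, mul_add, hp]
      have : 0 < m * (ε / 2) := by positivity
      linarith
    · rw [dist_eq_norm, sub_add_cancel_left, norm_neg, norm_smul, he, Real.norm_of_nonneg (by positivity)]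
      linarith
  by_cases hex : ∃ p : Euc N, m * ⟪p, e⟫ = β ∧ p ∉ sing u
  · obtain ⟨p, hp, hps⟩ := hex
    have hpA := h.mem_affSet hC he hlow hps (closure_mono hA (hcl p hp))
    have hA' : {x | m * ⟪x, e⟫ < β} ⊆ affSet u e m β := by
      refine h.subset_affSet hC he hlow (Convex.isPreconnected ?_) ?_ fun x hx => (ne_of_lt hx)
      · have : {x : Euc N | m * ⟪x, e⟫ < β} = {x | ⟪x, e⟫ < β / m} := by
          ext x; rw [Set.mem_ofPred_eq, Set.mem_ofPred_eq, lt_div_iff₀' hm]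
        rw [this]
        exact convex_halfSpace_lt ⟨fun x y => inner_add_left _ _ _, fun c x => by rw [inner_smul_left]; simp⟩ _
      · obtain ⟨ε, hε, hball⟩ := Metric.isOpen_iff.1 (isOpen_affSet u e m β) p hpA
        refine ⟨p + (-(ε / 2)) • e, ?_, hball ?_⟩
        · change m * ⟪p + (-(ε / 2)) • e, e⟫ < β
          rw [hline, mul_add, hp]
          have : 0 < m * (ε / 2) := by positivity
          linarith
        · rw [mem_ball, dist_eq_norm, add_sub_cancel_left, norm_smul, he, norm_neg, Real.norm_of_nonneg (by positivity)]
          linarith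
    refine hS (measure_mono_null (fun x hx => ?_) (volume_hyperplane he0 (β / m)))
    rw [Set.mem_ofPred_eq, eq_div_iff hm.ne', mul_comm]
    by_contra hne
    have hxA : x ∈ affSet u e m β := (lt_or_gt_of_ne hne).elim (fun h => hA' h) fun h => hA h
    have h1 := h.dd_eq_of_mem_closure_affSet (subset_closure hxA)
    have h2 : _root_.dd e u x = 0 := by
      unfold _root_.dd
      rw [hx.2]; rfl
    exact hne (by linarith)
  · push Not at hex
    have hval : ∀ x : Euc N, β < m * ⟪x, e⟫ → u x = -(m * ⟪x, e⟫ - β) ^ 2 / (2 * m) := by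
      intro x hx
      set τ := ⟪x, e⟫ - β / m
      have hτ : 0 < τ := by
        have : β / m < ⟪x, e⟫ := by rw [div_lt_iff₀' hm]; exact hx
        exact sub_pos.2 this
      set p := x - τ • e
      have hpe : m * ⟪p, e⟫ = β := by
        have := hline x (-τ)
        rw [neg_smul, ← sub_eq_add_neg] at this
        rw [this]; simp only [τ]; field_simp; ring
      set g : ℝ → ℝ := fun t => u (p + t • e) + m * t ^ 2 / 2
      have hd : ∀ t, HasDerivAt g (_root_.dd e u (p + t • e) + m * t) t := by
        intro t
        have h1 : HasDerivAt (fun t : ℝ => p + t • e) e t := by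
          simpa using ((hasDerivAt_id t).smul_const e).const_add p
        have h2 := (h.differentiable (p + t • e)).hasFDerivAt.comp_hasDerivAt t h1
        have h3 : HasDerivAt (fun t : ℝ => m * t ^ 2 / 2) (m * t) t := by
          have := ((hasDerivAt_pow 2 t).const_mul m).div_const 2
          exact this.congr_deriv (by norm_num; ring)
        exact h2.add h3
      have hzero : ∀ t ∈ Ioo 0 τ, deriv g t = 0 := by
        intro t ht
        rw [(hd t).deriv]
        have h1 : p + t • e ∈ affSet u e m β := hA (by
          change β < m * ⟪p + t • e, e⟫
          rw [hline, mul_add, hpe]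
          have : 0 < m * t := mul_pos hm ht.1
          linarith)
        rw [h.dd_eq_of_mem_closure_affSet (subset_closure h1), hline]
        linarith
      obtain ⟨t, ht, hgt⟩ := exists_deriv_eq_slope g hτ (fun t _ => (hd t).continuousAt.continuousWithinAt)
        fun t _ => (hd t).differentiableAt.differentiableWithinAt
      rw [hzero t ht, eq_comm, div_eq_zero_iff, sub_zero, or_iff_left hτ.ne'] at hgt
      have hps : u p = 0 := (hex p hpe).1
      simp only [g, zero_smul, add_zero, hps, p, sub_add_cancel] at hgt
      have : m * ⟪x, e⟫ - β = m * τ := by simp only [τ]; field_simp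
      rw [this]
      field_simp
      linarith
    set x1 : Euc N := ((β + 1) / m + 1) • e
    have hx1 : ⟪x1, e⟫ = (β + 1) / m + 1 := by rw [inner_smul_left, hee]; simp
    have hball : ∀ y ∈ ball x1 1, β < m * ⟪y, e⟫ := by
      intro y hy
      have h1 : |⟪y - x1, e⟫| ≤ ‖y - x1‖ * ‖e‖ := abs_real_inner_le_norm _ _
      rw [he, mul_one, inner_sub_left, hx1] at h1
      rw [mem_ball, dist_eq_norm] at hy
      have h2 : (β + 1) / m < ⟪y, e⟫ := by linarith [(_root_.abs_le.1 h1).1]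
      rw [div_lt_iff₀' hm] at h2
      linarith
    have hHes : ∀ a : Euc N, Hes 1 u a x1 = -(m * ⟪a, e⟫) * ⟪a, e⟫ := by
      intro a
      refine Hes_eq_of_affine h.contDiff one_pos (β := β * ⟪a, e⟫) fun y hy => ?_
      have hev : u =ᶠ[nhds y] fun x => -(m * ⟪x, e⟫ + -β) ^ 2 / (2 * m) := by
        filter_upwards [isOpen_ball.mem_nhds hy] with z hz
        rw [hval z (hball z hz), sub_eq_add_neg]
      have h1 := ((((hasFDerivAt_inner_left e y).const_mul m).add_const (-β)).pow 2).const_mul (-(2 * m)⁻¹)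
      unfold _root_.dd
      rw [hev.fderiv_eq]
      have h2 : (fun x : Euc N => -(m * ⟪x, e⟫ + -β) ^ 2 / (2 * m))
          = fun x => -(2 * m)⁻¹ * (m * ⟪x, e⟫ + -β) ^ 2 := by
        funext x; field_simp
      rw [h2, h1.fderiv]
      simp [real_inner_comm]
      field_simp
      ring
    have hsum := (h.solOn hC).weak.sum_Hes (h.contDiff.continuous.locallyIntegrable) one_pos (subset_univ (closedBall x1 1))
    have hpos := Tk_rho_nonneg (chi_nonneg (sing u)ᶜ) 1 x1
    rw [← hsum] at hpos
    simp only [hHes] at hpos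
    have : ∑ i : Fin N, -(m * ⟪(EuclideanSpace.single i 1 : Euc N), e⟫) * ⟪(EuclideanSpace.single i 1 : Euc N), e⟫ = -m := by
      have h1 : ‖e‖ ^ 2 = ∑ i, e i ^ 2 := by rw [EuclideanSpace.norm_sq_eq]; simp
      rw [he] at h1
      have h2 : ∀ i : Fin N, ⟪(EuclideanSpace.single i 1 : Euc N), e⟫ = e i := fun i => by simp [EuclideanSpace.inner_single_left]
      simp only [h2]
      calc _ = -m * ∑ i, e i ^ 2 := by rw [Finset.mul_sum]; exact Finset.sum_congr rfl fun i _ => by ring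
        _ = _ := by rw [← h1]; ring
    linarith

theorem Obst.false_of_min (hC : 0 ≤ C) (h : Obst C u univ) (hS : volume (sing u) ≠ 0) (hm : 0 < m) (he : ‖e‖ = 1)
    (hlow : ∀ a : Euc N, ‖a‖ = 1 → ∀ s, 0 < s → ∀ x, -m ≤ Hes s u a x) {x0 : Euc N} {R0 : ℝ} (hR0 : 0 < R0)
    (hmin : Hes R0 u e x0 = -m) : False := by
  obtain ⟨β, hβ⟩ := h.dd_affine_of_min hC he hlow hR0 hmin
  have hx0 : x0 ∈ affSet u e m β := mem_of_superset (ball_mem_nhds x0 hR0) hβ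
  have hconv : ∀ (a : Euc N) (γ : ℝ), IsPreconnected {x : Euc N | γ < m * ⟪x, a⟫} := by
    intro a γ
    have : {x : Euc N | γ < m * ⟪x, a⟫} = {x | γ / m < ⟪x, a⟫} := by
      ext x; rw [Set.mem_ofPred_eq, Set.mem_ofPred_eq, div_lt_iff₀' hm]
    rw [this]
    exact (convex_halfSpace_gt ⟨fun x y => inner_add_left _ _ _, fun c x => by rw [inner_smul_left]; simp⟩ _).isPreconnected
  obtain ⟨x1, hx1, hx1n⟩ : ∃ x1 ∈ affSet u e m β, m * ⟪x1, e⟫ ≠ β := by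
    by_cases hc : m * ⟪x0, e⟫ = β
    · obtain ⟨ε, hε, hball⟩ := Metric.isOpen_iff.1 (isOpen_affSet u e m β) x0 hx0
      refine ⟨x0 + (ε / 2) • e, hball ?_, ?_⟩
      · rw [mem_ball, dist_eq_norm, add_sub_cancel_left, norm_smul, he, Real.norm_of_nonneg (by positivity)]
        linarith
      · rw [inner_add_left, inner_smul_left, real_inner_self_eq_norm_sq, he, mul_add, hc]
        have : m * (ε / 2) ≠ 0 := by positivity
        simpa using this
    · exact ⟨x0, hx0, hc⟩
  rcases lt_or_gt_of_ne hx1n with hlt | hgt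
  · refine h.false_of_half (e := -e) (β := -β) hC hS hm (by rwa [norm_neg]) hlow ?_
    refine h.subset_affSet hC (by rwa [norm_neg]) hlow (hconv _ _) ⟨x1, ?_, by rwa [affSet_neg]⟩ fun x hx => (ne_of_gt hx)
    change -β < m * ⟪x1, -e⟫
    rw [inner_neg_right]; linarith
  · exact h.false_of_half hC hS hm he hlow
      (h.subset_affSet hC he hlow (hconv _ _) ⟨x1, hgt, hx1⟩ fun x hx => (ne_of_gt hx))

end Propagation

theorem Obst.abs_dd_dd_Tk_le {C : ℝ} (hC : 0 ≤ C) {u : Euc N → ℝ} (h : Obst C u univ) {R : ℝ} (hR : 0 < R) (a b x : Euc N) :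
    |_root_.dd a (_root_.dd b (Tk rho R u)) x| ≤ C * ‖a‖ * ‖b‖ := by
  have hc := continuous_dd h.contDiff b
  have e1 : _root_.dd b (Tk rho R u) = Tk rho R (_root_.dd b u) := funext fun y => dd_Tk' krn_rho h.contDiff b y
  rw [e1]
  have h1 : ‖fderiv ℝ (Tk rho R (_root_.dd b u)) x‖ ≤ C * ‖b‖ := by
    refine norm_fderiv_le_of_lip' ℝ (by positivity) (Eventually.of_forall fun y => ?_)
    have := abs_Tk_sub_Tk_le krn_rho hR hc (h.abs_dd_sub_le b) y x
    rwa [integral_abs_rho, one_mul] at this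
  have h2 := (fderiv ℝ (Tk rho R (_root_.dd b u)) x).le_opNorm a
  calc _ ≤ _ := h2
    _ ≤ C * ‖b‖ * ‖a‖ := by gcongr
    _ = _ := by ring

theorem Obst.abs_Hes_dir_sub_le {C : ℝ} (hC : 0 ≤ C) {u : Euc N → ℝ} (h : Obst C u univ) {R : ℝ} (hR : 0 < R) (a b x : Euc N) :
    |Hes R u a x - Hes R u b x| ≤ C * ‖a - b‖ * (‖a - b‖ + 2 * ‖b‖) := by
  have hl := h.contDiff.continuous.locallyIntegrable (μ := volume)
  have h1 := dd_dd_add_dir (contDiff_Tk krn_rho hR hl) (a - b) b x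
  rw [sub_add_cancel] at h1
  rw [Hes_eq_dd_dd hR hl, Hes_eq_dd_dd hR hl, h1]
  have h2 := _root_.abs_le.1 (h.abs_dd_dd_Tk_le hC hR (a - b) (a - b) x)
  have h3 := _root_.abs_le.1 (h.abs_dd_dd_Tk_le hC hR (a - b) b x)
  rw [_root_.abs_le]
  constructor <;> linarith

section Limits

variable {C : ℝ} {F : Ultrafilter ℕ} {u : ℕ → Euc N → ℝ} {v : Euc N → ℝ}

theorem CV.eventually_contDiff (h : CV C F u v) : ∀ᶠ j in (F : Filter ℕ), ContDiff ℝ 1 (u j) :=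
  (h.sol 0).mono fun _ hj => hj.contDiff

theorem CV.eventually_Hes (h : CV C F u v) {e : Euc N} {es : ℕ → Euc N} (hes : ∀ j, ‖es j‖ = 1)
    (he : Tendsto es F (nhds e)) {R : ℝ} (hR : 0 < R) (R' : ℝ) {ε : ℝ} (hε : 0 < ε) :
    ∀ᶠ j in (F : Filter ℕ), ∀ x ∈ ball (0 : Euc N) R', |Hes R (u j) (es j) x - Hes R v e x| ≤ ε := by
  obtain ⟨B, hB, hBb⟩ := (krn_rho (N := N)).exists_bound_dd_dd
  set V := volume.real (closedBall (0 : Euc N) 1)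
  have hV : 0 ≤ V := measureReal_nonneg
  set δ := ε / 2 * R ^ 2 / (B * V + 1)
  have hBV : 0 < B * V + 1 := by positivity
  have hδ : 0 < δ := by positivity
  have hdir : Tendsto (fun j => C * ‖es j - e‖ * (‖es j - e‖ + 2 * ‖e‖)) F (nhds 0) := by
    have h0 : Tendsto (fun j => ‖es j - e‖) F (nhds 0) := tendsto_iff_norm_sub_tendsto_zero.1 he
    have := (h0.const_mul C).mul (h0.add_const (2 * ‖e‖))
    simpa using this
  filter_upwards [h.eventually_abs (R' + R) hδ, h.eventually_contDiff, hdir.eventually (gt_mem_nhds (half_pos hε))]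
    with j hj hcd hd x hx
  have hk := ((krn_rho (N := N)).dd (es j)).dd (es j)
  have h1 : |Tk (dd (es j) (dd (es j) rho)) R (u j) x - Tk (dd (es j) (dd (es j) rho)) R v x| ≤ B * V * δ := by
    rw [← Tk_sub hk hR hcd.continuous.locallyIntegrable h.contDiff.continuous.locallyIntegrable]
    refine (abs_Tk_le hk hR (A := δ) fun y hy => hj y ?_).trans ?_
    · have h2 := dist_triangle y x 0
      rw [mem_ball] at hx hy ⊢
      linarith
    · gcongr
      exact hk.integral_abs_le (hBb _ _ (hes j) (hes j))
  have h2 : |Hes R (u j) (es j) x - Hes R v (es j) x| ≤ ε / 2 := by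
    unfold Hes
    rw [← mul_sub, abs_mul, abs_of_pos (by positivity), inv_mul_le_iff₀ (by positivity)]
    refine h1.trans ?_
    rw [show δ = ε / 2 * R ^ 2 / (B * V + 1) from rfl, mul_div_assoc', div_le_iff₀ hBV]
    have : 0 < R ^ 2 * (ε / 2) := by positivity
    nlinarith
  have h3 := h.obst.abs_Hes_dir_sub_le h.nonneg hR (es j) e x
  calc _ ≤ |Hes R (u j) (es j) x - Hes R v (es j) x| + |Hes R v (es j) x - Hes R v e x| := abs_sub_le _ _ _
    _ ≤ ε := by linarith

theorem CV.tendsto_Hes (h : CV C F u v) {e : Euc N} {es : ℕ → Euc N} (hes : ∀ j, ‖es j‖ = 1)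
    (he : Tendsto es F (nhds e)) {R : ℝ} (hR : 0 < R) (x : Euc N) :
    Tendsto (fun j => Hes R (u j) (es j) x) F (nhds (Hes R v e x)) := by
  rw [Metric.tendsto_nhds]
  intro ε hε
  filter_upwards [h.eventually_Hes hes he hR (‖x‖ + 1) (half_pos hε)] with j hj
  rw [Real.dist_eq]
  have := hj x (by rw [mem_ball_zero_iff]; linarith)
  linarith

theorem CV.eventually_volume_le (h : CV C F u v) {R : ℝ} (h0 : volume (sing v ∩ closedBall 0 R) = 0) {ε : ℝ} (hε : 0 < ε) :
    ∀ᶠ j in (F : Filter ℕ), volume.real (sing (u j) ∩ ball 0 R) ≤ ε := by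
  obtain ⟨U, hU, hUo, hUv⟩ := (sing v ∩ closedBall (0 : Euc N) R).exists_isOpen_lt_of_lt (μ := volume) (ENNReal.ofReal ε)
    (by rw [h0]; exact ENNReal.ofReal_pos.2 hε)
  have hK : IsCompact (closedBall (0 : Euc N) R \ U) := (isCompact_closedBall 0 R).diff hUo
  filter_upwards [h.eventually_notMem_sing hK (eq_empty_of_forall_notMem fun x hx => hx.1.2 (hU ⟨hx.2, hx.1.1⟩))] with j hj
  have hsub : sing (u j) ∩ ball 0 R ⊆ U := fun x hx => by
    by_contra hxU
    exact (eq_empty_iff_forall_notMem.1 hj) x ⟨⟨ball_subset_closedBall hx.2, hxU⟩, hx.1⟩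
  exact ENNReal.toReal_le_of_le_ofReal hε.le ((measure_mono hsub).trans hUv.le)

theorem CV.mem_sing (h : CV C F u v) {p : Euc N} {ps : ℕ → Euc N} (hps : Tendsto ps F (nhds p))
    (hs : ∀ᶠ j in (F : Filter ℕ), ps j ∈ sing (u j)) : p ∈ sing v := by
  by_contra hp
  obtain ⟨r, hr, hball⟩ := Metric.isOpen_iff.1 (isClosed_sing h.contDiff).isOpen_compl p hp
  have hK := h.eventually_notMem_sing (isCompact_closedBall p (r / 2))
    (eq_empty_of_forall_notMem fun x hx => hball (closedBall_subset_ball (by linarith) hx.1) hx.2)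
  obtain ⟨j, h1, h2, h3⟩ := (hK.and (hs.and (hps.eventually (closedBall_mem_nhds p (half_pos hr))))).exists
  exact (eq_empty_iff_forall_notMem.1 h1) _ ⟨h3, h2⟩

end Limits

/-- A global solution with null singular set has its singular set inside a hyperplane. -/
theorem Obst.sing_subset_hyperplane {C : ℝ} (hC : 0 ≤ C) {u : Euc N → ℝ} (h : Obst C u univ) (hS : volume (sing u) = 0)
    (h0 : (0 : Euc N) ∈ sing u) : ∃ e : Euc N, ‖e‖ = 1 ∧ ∀ x ∈ sing u, ⟪x, e⟫ = 0 := by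
  have hl := h.contDiff.continuous.locallyIntegrable (μ := volume)
  have hnull : ∀ x R, volume (sing u ∩ ball x R) = 0 := fun x R => measure_mono_null inter_subset_left hS
  have hconst : ∀ (a x : Euc N), Hes 1 u a x = Hes 1 u a 0 := by
    intro a x
    have hpow : ∀ n : ℕ, ∀ y, Hes 1 u a y = Hes (rn n)⁻¹ u a y := fun n y => by
      have := h.Hes_mul_rn hC (inv_pos.2 (rn_pos n)) (hnull y _) a n
      rwa [inv_mul_cancel₀ (rn_pos n).ne'] at this
    have hb : ∀ n : ℕ, |Hes 1 u a x - Hes 1 u a 0| ≤ rn n * ((∫ z, |_root_.dd a (rho : Euc N → ℝ) z|) * (C * ‖a‖ * ‖x - 0‖)) := by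
      intro n
      have := h.abs_Hes_sub_le (inv_pos.2 (rn_pos n)) a x 0
      rwa [← hpow, ← hpow, inv_inv] at this
    have hz : Tendsto (fun n => rn n * ((∫ z, |_root_.dd a (rho : Euc N → ℝ) z|) * (C * ‖a‖ * ‖x - 0‖))) atTop (nhds 0) := by
      have := (tendsto_rn.mono_right nhdsWithin_le_nhds).mul_const
        ((∫ z, |_root_.dd a (rho : Euc N → ℝ) z|) * (C * ‖a‖ * ‖x - 0‖))
      simpa using this
    have := ge_of_tendsto' hz hb
    exact sub_eq_zero.1 (abs_nonpos_iff.1 this)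
  have hq : ∀ (n : ℕ) (a x : Euc N), _root_.dd a (_root_.dd a (Tk rho (rn n) u)) x = Hes 1 u a 0 := fun n a x => by
    rw [← Hes_eq_dd_dd (rn_pos n) hl, ← hconst a x]
    have := h.Hes_mul_rn hC one_pos (hnull x _) a n
    rwa [one_mul] at this
  set L : Euc N → Euc N → ℝ := fun b a => (Hes 1 u (a + b) 0 - Hes 1 u a 0 - Hes 1 u b 0) / 2
  have hpol : ∀ (n : ℕ) (a b x : Euc N), _root_.dd a (_root_.dd b (Tk rho (rn n) u)) x = L b a := fun n a b x => by
    have := dd_dd_add_dir (contDiff_Tk krn_rho (rn_pos n) hl) a b x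
    rw [hq, hq, hq] at this
    simp only [L]; linarith
  have hLdiag : ∀ a, L a a = Hes 1 u a 0 := fun a => by rw [← hpol 0 a a 0, hq]
  have hlin : ∀ b, ∃ T : Euc N →L[ℝ] ℝ, (∀ a, T a = L b a) ∧ ∀ x, _root_.dd b u x = T x := by
    intro b
    refine ⟨fderiv ℝ (_root_.dd b (Tk rho (rn 0) u)) 0, fun a => hpol 0 a b 0, fun x => ?_⟩
    set T := fderiv ℝ (_root_.dd b (Tk rho (rn 0) u)) 0
    have hn : ∀ n, _root_.dd b (Tk rho (rn n) u) x - _root_.dd b (Tk rho (rn n) u) 0 = T x := by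
      intro n
      have hsm := contDiff_dd (contDiff_Tk krn_rho (rn_pos n) hl) b
      have hd : ∀ y, HasFDerivAt (fun y => _root_.dd b (Tk rho (rn n) u) y - T y) (0 : Euc N →L[ℝ] ℝ) y := by
        intro y
        have h1 := (hsm.differentiable (by simp) y).hasFDerivAt.sub T.hasFDerivAt
        have h2 : fderiv ℝ (_root_.dd b (Tk rho (rn n) u)) y - T = 0 := by
          ext a
          have e1 := hpol n a b y
          have e2 := hpol 0 a b 0
          unfold _root_.dd at e1 e2
          change fderiv ℝ (_root_.dd b (Tk rho (rn n) u)) y a - T a = 0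
          rw [sub_eq_zero]
          exact e1.trans e2.symm
        rwa [h2] at h1
      have := is_const_of_fderiv_eq_zero (𝕜 := ℝ) (fun y => (hd y).differentiableAt) (fun y => (hd y).fderiv) x 0
      simp only [map_zero, sub_zero] at this
      linarith
    have hlim : ∀ y, Tendsto (fun n => _root_.dd b (Tk rho (rn n) u) y) atTop (nhds (_root_.dd b u y)) := by
      intro y
      have := (tendsto_Tk_rho (continuous_dd h.contDiff b) y).comp tendsto_rn
      refine this.congr fun n => ?_
      exact (dd_Tk' krn_rho h.contDiff b y).symm
    have h1 := tendsto_nhds_unique ((hlim x).sub (hlim 0)) (tendsto_const_nhds.congr fun n => (hn n).symm)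
    have h2 : _root_.dd b u 0 = 0 := by
      unfold _root_.dd
      rw [h0.2]; rfl
    rw [h2, sub_zero] at h1
    exact h1
  have hsum := (h.solOn hC).weak.sum_Hes hl one_pos (subset_univ (closedBall (0 : Euc N) 1))
  have hone : Tk rho 1 (chi (sing u)ᶜ) (0 : Euc N) = 1 := by
    have h1 := Tk_chi_eq_zero krn_rho one_pos (isClosed_sing h.contDiff).measurableSet (hnull (0 : Euc N) 1)
    rw [Tk_chi_compl krn_rho one_pos (isClosed_sing h.contDiff).measurableSet, h1, integral_rho, sub_zero]
  rw [hone] at hsum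
  obtain ⟨i, hi⟩ : ∃ i : Fin N, Hes 1 u (EuclideanSpace.single i 1) 0 ≠ 0 := by
    by_contra hcon
    push Not at hcon
    rw [Finset.sum_eq_zero fun i _ => hcon i] at hsum
    exact zero_ne_one hsum
  obtain ⟨T, hT1, hT2⟩ := hlin (EuclideanSpace.single i 1)
  have hT0 : T ≠ 0 := fun hz => hi (by rw [← hLdiag, ← hT1, hz]; rfl)
  set a := (InnerProductSpace.toDual ℝ (Euc N)).symm T
  have ha : a ≠ 0 := by simpa [a] using hT0
  refine ⟨‖a‖⁻¹ • a, by rw [norm_smul, norm_inv, norm_norm, inv_mul_cancel₀ (norm_pos_iff.2 ha).ne'], fun x hx => ?_⟩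
  have h1 : T x = 0 := by
    rw [← hT2]
    unfold _root_.dd
    rw [hx.2]; rfl
  rw [inner_smul_right, real_inner_comm, InnerProductSpace.toDual_symm_apply, h1, mul_zero]

theorem Obst.exists_normalized {C : ℝ} (hC : 0 ≤ C) {u : Euc N → ℝ} (h : Obst C u univ) (hS : volume (sing u) ≠ 0) {R : ℝ}
    (hR : 0 < R) (e x : Euc N) :
    ∃ w, Obst C w univ ∧ volume (sing w ∩ ball 0 2) ≠ 0 ∧ Hes 1 w e 0 = Hes R u e x := by
  have hex : ∃ k : ℕ, volume (sing u ∩ ball x (2 ^ k * R * 2)) ≠ 0 := by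
    by_contra hcon
    push Not at hcon
    refine hS (measure_mono_null (fun y hy => ?_) (measure_iUnion_null hcon))
    obtain ⟨k, hk⟩ := pow_unbounded_of_one_lt (dist y x / (R * 2)) one_lt_two
    refine mem_iUnion.2 ⟨k, hy, ?_⟩
    rw [div_lt_iff₀ (by positivity)] at hk
    rw [mem_ball]; linarith
  obtain ⟨k, hk, hHes⟩ : ∃ k : ℕ, volume (sing u ∩ ball x (2 ^ k * R * 2)) ≠ 0 ∧ Hes (2 ^ k * R) u e x = Hes R u e x := by
    classical
    refine ⟨Nat.find hex, Nat.find_spec hex, ?_⟩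
    rcases hf : Nat.find hex with _ | k
    · rw [pow_zero, one_mul]
    · have hmin := Nat.find_min hex (m := k) (by omega)
      rw [not_not, show (2 : ℝ) ^ k * R * 2 = 2 ^ (k + 1) * R by ring] at hmin
      rw [← h.Hes_mul_rn hC (by positivity) hmin e (k + 1)]
      congr 1
      rw [rn, one_div, inv_pow]
      field_simp
  have hR' : 0 < 2 ^ k * R := by positivity
  refine ⟨_root_.resc x (2 ^ k * R) u, h.resc hR' x, fun h0 => hk ?_, ?_⟩
  · have hball : ball (0 : Euc N) 2 = ball 0 ((2 ^ k * R)⁻¹ * (2 ^ k * R * 2)) := by rw [inv_mul_cancel_left₀ hR'.ne']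
    rw [sing_resc h.differentiable hR', hball] at h0
    have h1 := volume_real_preimage_affine hR' x (S := sing u ∩ ball x (2 ^ k * R * 2))
      ((isClosed_sing h.contDiff).measurableSet.inter measurableSet_ball)
    have h2 : (fun y => x + (2 ^ k * R) • y) ⁻¹' (sing u ∩ ball x (2 ^ k * R * 2))
        = (fun y => x + (2 ^ k * R) • y) ⁻¹' sing u ∩ ball 0 ((2 ^ k * R)⁻¹ * (2 ^ k * R * 2)) := by
      rw [preimage_inter, preimage_affine_ball hR', inv_mul_cancel_left₀ hR'.ne']
    rw [h2, measureReal_def, h0, ENNReal.toReal_zero, eq_comm, mul_eq_zero, or_iff_right (by positivity)] at h1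
    exact (measureReal_eq_zero_iff (volume_inter_ball_ne_top _ _ _)).1 h1
  · rw [Hes_resc, mul_one, smul_zero, add_zero, hHes]

/-- Global solutions with a fat singular set have nonnegative mollified second derivatives. -/
theorem Obst.Hes_nonneg {C : ℝ} (hC : 0 ≤ C) {u : Euc N → ℝ} (h : Obst C u univ) (hS : volume (sing u) ≠ 0) {e : Euc N}
    (he : ‖e‖ = 1) {R : ℝ} (hR : 0 < R) (x : Euc N) : 0 ≤ Hes R u e x := by
  by_contra! hneg
  set A : Set ℝ := {t | ∃ (w : Euc N → ℝ) (a : Euc N) (s : ℝ) (y : Euc N), Obst C w univ ∧ volume (sing w) ≠ 0 ∧ ‖a‖ = 1 ∧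
    0 < s ∧ Hes s w a y = t}
  have hmem : ∀ {w : Euc N → ℝ} {a : Euc N} {s : ℝ} {y : Euc N}, Obst C w univ → volume (sing w) ≠ 0 → ‖a‖ = 1 → 0 < s →
      Hes s w a y ∈ A := fun h1 h2 h3 h4 => ⟨_, _, _, _, h1, h2, h3, h4, rfl⟩
  have hbdd : BddBelow A := by
    refine ⟨-C, ?_⟩
    rintro t ⟨w, a, s, y, h1, -, h3, h4, rfl⟩
    have := h1.abs_Hes_le hC h4 a y
    rw [h3, one_pow, mul_one] at this
    exact (_root_.abs_le.1 this).1
  have hxA := hmem (y := x) h hS he hR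
  set m := - sInf A
  have hm : 0 < m := neg_pos.2 ((csInf_le hbdd hxA).trans_lt hneg)
  have hlowA : ∀ {w : Euc N → ℝ} {a : Euc N} {s : ℝ} {y : Euc N}, Obst C w univ → volume (sing w) ≠ 0 → ‖a‖ = 1 → 0 < s →
      -m ≤ Hes s w a y := fun h1 h2 h3 h4 => by
    rw [neg_neg]; exact csInf_le hbdd (hmem h1 h2 h3 h4)
  obtain ⟨t, -, ht, htA⟩ := exists_seq_tendsto_sInf ⟨_, hxA⟩ hbdd
  have hw : ∀ n, ∃ (w : Euc N → ℝ) (a : Euc N), Obst C w univ ∧ volume (sing w ∩ ball 0 2) ≠ 0 ∧ ‖a‖ = 1 ∧ Hes 1 w a 0 = t n := by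
    intro n
    obtain ⟨w, a, s, y, h1, h2, h3, h4, h5⟩ := htA n
    obtain ⟨w', h6, h7, h8⟩ := h1.exists_normalized hC h2 h4 a y
    exact ⟨w', a, h6, h7, h3, h8.trans h5⟩
  choose w a hwO hwS ha hwt using hw
  have hwS' : ∀ n, volume (sing (w n)) ≠ 0 := fun n h0 => hwS n (measure_mono_null inter_subset_left h0)
  set F : Ultrafilter ℕ := hyperfilter ℕ
  have hF : (F : Filter ℕ) ≤ atTop := Nat.hyperfilter_le_atTop
  obtain ⟨v, hv⟩ := exists_cv hC F (A := 2) (u := w) (fun R => Eventually.of_forall fun j => (hwO j).mono (subset_univ _))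
    (Eventually.of_forall fun j => by
      obtain ⟨p, hp⟩ := nonempty_of_measure_ne_zero (hwS j)
      exact ⟨p, hp.1, (mem_ball_zero_iff.1 hp.2).le⟩)
  obtain ⟨b, hb⟩ := F.exists_tendsto_of_bdd (a := a) (A := 1) (Eventually.of_forall fun j => (ha j).le)
  have hb1 : ‖b‖ = 1 := tendsto_nhds_unique hb.norm (tendsto_const_nhds.congr fun n => (ha n).symm)
  have hlow : ∀ a' : Euc N, ‖a'‖ = 1 → ∀ s, 0 < s → ∀ y, -m ≤ Hes s v a' y := by
    intro a' ha' s hs y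
    exact ge_of_tendsto' (hv.tendsto_Hes (es := fun _ => a') (fun _ => ha') tendsto_const_nhds hs y) fun j =>
      hlowA (hwO j) (hwS' j) ha' hs
  have hmin : Hes 1 v b 0 = -m := by
    refine tendsto_nhds_unique (hv.tendsto_Hes ha hb one_pos 0) ?_
    simp only [hwt, m, neg_neg]
    exact ht.mono_left hF
  by_cases hv0 : volume (sing v) = 0
  · have h8 : Hes 8 v b 0 = -m := by
      rw [← hmin, ← hv.obst.Hes_mul_rn hC (R := 8) (by norm_num) (measure_mono_null inter_subset_left hv0) b 3]
      congr 1
      rw [rn]; norm_num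
    have h2 : ∀ y ∈ ball (0 : Euc N) 4, Hes 2 v b y = -m := fun y hy =>
      hv.obst.Hes_eq_of_min hC (hlow b hb1) (by norm_num) h8 (by norm_num) fun z hz => by
        rw [mem_ball, mem_closedBall] at *
        linarith [dist_triangle z y 0]
    obtain ⟨c, hc, hsparse⟩ := exists_null_of_sparse (N := N) (m / 2) (half_pos hm)
    obtain ⟨j, hj1, hj2⟩ := ((hv.eventually_Hes ha hb two_pos 4 (half_pos hm)).and
      (hv.eventually_volume_le (R := 8) (measure_mono_null inter_subset_left hv0) (ε := c * 2 ^ N) (by positivity))).exists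
    refine hwS j (hsparse (w j) (sing (w j)) (a j) 0 2 two_pos (((hwO j).solOn hC).mono (subset_univ _)) (ha j) ?_ ?_)
    · intro y hy
      have hy' : y ∈ ball (0 : Euc N) 4 := by norm_num at hy; rw [mem_ball_zero_iff]; exact hy
      have h3 := _root_.abs_le.1 (hj1 y hy')
      rw [h2 y hy'] at h3
      linarith
    · rw [show (2 : ℝ) * 4 = 8 by norm_num, inv_mul_le_iff₀ (by positivity)]
      linarith
  · exact hv.obst.false_of_min hC hv0 hm hb1 hlow one_pos hmin

theorem hasDerivAt_line {f : Euc N → ℝ} (hf : Differentiable ℝ f) (p q : Euc N) (t : ℝ) :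
    HasDerivAt (fun t : ℝ => f (p + t • q)) (dd q f (p + t • q)) t := by
  have h1 : HasDerivAt (fun t : ℝ => p + t • q) q t := by
    simpa using ((hasDerivAt_id t).smul_const q).const_add p
  exact (hf (p + t • q)).hasFDerivAt.comp_hasDerivAt t h1

theorem convexOn_of_dd_dd_nonneg {T : Euc N → ℝ} (hT : ContDiff ℝ (⊤ : ℕ∞) T) (h : ∀ e x, 0 ≤ dd e (dd e T) x) :
    ConvexOn ℝ univ T := by
  refine ⟨convex_univ, fun x _ y _ a b ha hb hab => ?_⟩
  set q := y - x
  have h1 := hasDerivAt_line (hT.differentiable (by simp)) x q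
  have h2 := hasDerivAt_line ((contDiff_dd hT q).differentiable (by simp)) x q
  have e1 : deriv (fun t : ℝ => T (x + t • q)) = fun t => dd q T (x + t • q) := funext fun t => (h1 t).deriv
  have hc : ConvexOn ℝ univ fun t : ℝ => T (x + t • q) := by
    refine convexOn_univ_of_deriv2_nonneg (fun t => (h1 t).differentiableAt) ?_ fun t => ?_
    · rw [e1]; exact fun t => (h2 t).differentiableAt
    · rw [Function.iterate_succ, Function.iterate_one, Function.comp_apply, e1, (h2 t).deriv]
      exact h _ _
  have := hc.2 (mem_univ 0) (mem_univ 1) ha hb hab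
  simp only [smul_eq_mul, mul_zero, mul_one, zero_add, zero_smul, add_zero, one_smul, q, add_sub_cancel] at this
  have e2 : a • x + b • y = x + b • (y - x) := by
    rw [eq_sub_of_add_eq hab]
    module
  rw [e2]
  exact this

theorem Obst.convexOn {C : ℝ} (hC : 0 ≤ C) {u : Euc N → ℝ} (h : Obst C u univ) (hS : volume (sing u) ≠ 0) :
    ConvexOn ℝ univ u := by
  have hl := h.contDiff.continuous.locallyIntegrable (μ := volume)
  have hT : ∀ n, ConvexOn ℝ univ (Tk rho (rn n) u) := fun n => by
    refine convexOn_of_dd_dd_nonneg (contDiff_Tk krn_rho (rn_pos n) hl) fun e x => ?_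
    rcases eq_or_ne e 0 with rfl | he
    · simp [_root_.dd]
    have he' := norm_pos_iff.2 he
    have h1 := h.Hes_nonneg hC hS (e := ‖e‖⁻¹ • e) (by rw [norm_smul, norm_inv, norm_norm, inv_mul_cancel₀ he'.ne']) (rn_pos n) x
    rw [Hes_eq_dd_dd (rn_pos n) hl, dd_dd_smul_dir] at h1
    exact nonneg_of_mul_nonneg_right h1 (by positivity)
  have hlim : ∀ x, Tendsto (fun n => Tk rho (rn n) u x) atTop (nhds (u x)) := fun x =>
    (tendsto_Tk_rho h.contDiff.continuous x).comp tendsto_rn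
  refine ⟨convex_univ, fun x _ y _ a b ha hb hab => ?_⟩
  exact le_of_tendsto_of_tendsto' (hlim _) (((hlim x).const_smul a).add ((hlim y).const_smul b))
    fun n => (hT n).2 (mem_univ _) (mem_univ _) ha hb hab

/-- The mean value constant for the equation `Δw = 1`. -/
def cM (N : ℕ) : ℝ := 4 / 3 * ∫ x : Euc N, kap x

/-- The mean value constant for `‖x‖²`. -/
def qM (N : ℕ) : ℝ := ∫ x : Euc N, rho x * ‖x‖ ^ 2

theorem integral_pos_of_ne {f : Euc N → ℝ} (hf : Continuous f) (hs : HasCompactSupport f) (h0 : ∀ x, 0 ≤ f x) {p : Euc N}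
    (hp : f p ≠ 0) : 0 < ∫ x, f x :=
  hf.integral_pos_of_hasCompactSupport_nonneg_nonzero hs h0 hp

theorem exists_norm_one [NeZero N] : ∃ e : Euc N, ‖e‖ = 1 := ⟨EuclideanSpace.single 0 1, norm_single_one 0⟩

theorem cM_pos [NeZero N] : 0 < cM N := by
  have h : ∃ p : Euc N, kap p ≠ 0 := by
    by_contra hcon
    push Not at hcon
    obtain ⟨e, he⟩ := exists_norm_one (N := N)
    have h1 := dd_kap e ((1 / 4 : ℝ) • e)
    have h2 : dd e (kap : Euc N → ℝ) ((1 / 4 : ℝ) • e) = 0 := by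
      rw [show (kap : Euc N → ℝ) = fun _ => 0 from funext hcon, dd, fderiv_const_apply]
      rfl
    rw [h2, real_inner_smul_left, real_inner_self_eq_norm_sq, he] at h1
    have h3 := kapW_pos (x := (1 / 4 : ℝ) • e) (by rw [norm_smul, he]; norm_num)
    linarith
  obtain ⟨p, hp⟩ := h
  have := integral_pos_of_ne krn_kap.continuous krn_kap.hasCompactSupport kap_nonneg hp
  exact mul_pos (by norm_num) this

theorem qM_pos [NeZero N] : 0 < qM N := by
  obtain ⟨e, he⟩ := exists_norm_one (N := N)
  refine integral_pos_of_ne (p := (1 / 2 : ℝ) • e) (krn_rho.continuous.mul (by fun_prop)) krn_rho.hasCompactSupport.mul_right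
    (fun x => mul_nonneg (rho_nonneg x) (by positivity)) ?_
  have := rho_pos (x := (1 / 2 : ℝ) • e) (by rw [norm_smul, he]; norm_num)
  rw [norm_smul, he]
  exact mul_ne_zero this.ne' (by norm_num)

theorem WeakLap.Tk_rho_le {u f : Euc N → ℝ} {D : Set (Euc N)} (h : WeakLap u f D) (hu : Continuous u) (hf : ∀ x, 0 ≤ f x)
    {R : ℝ} (hR : 0 < R) {x : Euc N} (hx : closedBall x R ⊆ D) : u x ≤ Tk rho R u x := by
  have h1 : ∀ n, Tk rho (R * rn n) u x ≤ Tk rho R u x := by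
    intro n
    induction n with
    | zero => rw [rn_zero, mul_one]
    | succ n ih =>
      refine le_trans ?_ ih
      have hn := mul_pos hR (rn_pos n)
      have := h.Tk_rho_sub hu.locallyIntegrable hn
        ((closedBall_subset_closedBall (mul_le_of_le_one_right hR.le (rn_le_one n))).trans hx)
      rw [rn_succ, mul_div_assoc']
      have h2 : 0 ≤ Tk kap (R * rn n) f x := integral_nonneg fun y => mul_nonneg (kap_nonneg y) (hf _)
      have : 0 ≤ (R * rn n) ^ 2 * Tk kap (R * rn n) f x := by positivity
      linarith
  have hz : Tendsto (fun n => R * rn n) atTop (nhdsWithin 0 (Ioi 0)) := by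
    refine tendsto_nhdsWithin_iff.2 ⟨?_, Eventually.of_forall fun n => mul_pos hR (rn_pos n)⟩
    have := (tendsto_rn.mono_right nhdsWithin_le_nhds).const_mul R
    rwa [mul_zero] at this
  exact le_of_tendsto' ((tendsto_Tk_rho hu x).comp hz) h1

theorem WeakLap.Tk_rho_eq {u : Euc N → ℝ} {D : Set (Euc N)} (h : WeakLap u (fun _ => 1) D) (hu : Continuous u)
    {R : ℝ} (hR : 0 < R) {x : Euc N} (hx : closedBall x R ⊆ D) : Tk rho R u x = u x + cM N * R ^ 2 := by
  have h1 : ∀ n, Tk rho (R * rn n) u x - cM N * (R * rn n) ^ 2 = Tk rho R u x - cM N * R ^ 2 := by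
    intro n
    induction n with
    | zero => rw [rn_zero, mul_one]
    | succ n ih =>
      rw [← ih]
      have hn := mul_pos hR (rn_pos n)
      have := h.Tk_rho_sub hu.locallyIntegrable hn
        ((closedBall_subset_closedBall (mul_le_of_le_one_right hR.le (rn_le_one n))).trans hx)
      rw [Tk_const] at this
      rw [rn_succ, mul_div_assoc', cM]
      linear_combination -this
  have hz0 : Tendsto (fun n => R * rn n) atTop (nhds 0) := by
    have := (tendsto_rn.mono_right nhdsWithin_le_nhds).const_mul R
    rwa [mul_zero] at this
  have hz : Tendsto (fun n => R * rn n) atTop (nhdsWithin 0 (Ioi 0)) :=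
    tendsto_nhdsWithin_iff.2 ⟨hz0, Eventually.of_forall fun n => mul_pos hR (rn_pos n)⟩
  have hl := ((tendsto_Tk_rho hu x).comp hz).sub ((hz0.pow 2).const_mul (cM N))
  have := tendsto_nhds_unique hl (tendsto_const_nhds.congr fun n => (h1 n).symm)
  simp only [ne_eq, OfNat.ofNat_ne_zero, not_false_eq_true, zero_pow, mul_zero, sub_zero] at this
  linarith

theorem WeakLap.Tk_rho_dd_eq {u : Euc N → ℝ} {D : Set (Euc N)} (h : WeakLap u (fun _ => 1) D) (hD : IsOpen D)
    (hu : ContDiff ℝ 1 u) {R : ℝ} (hR : 0 < R) {x : Euc N} (hx : closedBall x R ⊆ D) (e : Euc N) :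
    Tk rho R (dd e u) x = dd e u x := by
  obtain ⟨δ, hδ, hδD⟩ := (isCompact_closedBall x R).exists_thickening_subset_open hD hx
  have hev : Tk rho R u =ᶠ[nhds x] fun y => u y + cM N * R ^ 2 := by
    filter_upwards [ball_mem_nhds x hδ] with y hy
    refine h.Tk_rho_eq hu.continuous hR fun z hz => hδD ?_
    rw [mem_thickening_iff]
    refine ⟨z + (x - y), ?_, ?_⟩
    · rw [mem_closedBall, dist_eq_norm] at hz ⊢
      rwa [show z + (x - y) - x = z - y by abel]
    · rw [dist_eq_norm, sub_add_cancel_left, neg_sub, ← dist_eq_norm]; exact hy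
  rw [← dd_Tk' krn_rho hu, dd, hev.fderiv_eq, fderiv_add_const]
  rfl

theorem Tk_rho_sq {R : ℝ} (y x : Euc N) : Tk rho R (fun z => ‖z - y‖ ^ 2) x = ‖x - y‖ ^ 2 + qM N * R ^ 2 := by
  have hρ := (krn_rho (N := N)).continuous
  have hi : ∀ g : Euc N → ℝ, Continuous g → Integrable fun z => rho z * g z := fun g hg =>
    (hρ.mul hg).integrable_of_hasCompactSupport krn_rho.hasCompactSupport.mul_right
  have hodd : ∫ z : Euc N, rho z * ⟪x - y, z⟫ = 0 := by
    have h1 := integral_neg_eq_self (fun z : Euc N => rho z * ⟪x - y, z⟫) volume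
    have h2 : ∀ z : Euc N, rho (-z) * ⟪x - y, -z⟫ = -(rho z * ⟪x - y, z⟫) := fun z => by
      rw [rho_neg, inner_neg_right, mul_neg]
    simp only [h2, integral_neg] at h1
    linarith
  have hexp : ∀ z : Euc N, rho z * ‖x - R • z - y‖ ^ 2
      = ‖x - y‖ ^ 2 * rho z - 2 * R * (rho z * ⟪x - y, z⟫) + R ^ 2 * (rho z * ‖z‖ ^ 2) := fun z => by
    rw [show x - R • z - y = (x - y) - R • z by abel, norm_sub_sq_real, inner_smul_right, norm_smul, mul_pow,
      Real.norm_eq_abs, sq_abs]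
    ring
  have h0 : Integrable fun z : Euc N => ‖x - y‖ ^ 2 * rho z := krn_rho.integrable.const_mul _
  have h1 : Integrable fun z : Euc N => 2 * R * (rho z * ⟪x - y, z⟫) := (hi _ (by fun_prop)).const_mul _
  have h2 : Integrable fun z : Euc N => R ^ 2 * (rho z * ‖z‖ ^ 2) := (hi _ (by fun_prop)).const_mul _
  have h01 : Integrable fun z : Euc N => ‖x - y‖ ^ 2 * rho z - 2 * R * (rho z * ⟪x - y, z⟫) := h0.sub h1
  unfold Tk
  simp only [hexp]
  rw [integral_add h01 h2, integral_sub h0 h1, integral_const_mul, integral_const_mul, integral_const_mul, integral_rho, hodd, qM]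
  ring

theorem eq_of_Tk_rho_le {v : Euc N → ℝ} (hv : Continuous v) {R μ : ℝ} {x : Euc N}
    (hμ : ∀ y ∈ ball x R, μ ≤ v y) (hR : 0 < R) (h : Tk rho R v x ≤ μ) : ∀ y ∈ ball x R, v y = μ := by
  intro y hy
  by_contra hne
  have hρ := (krn_rho (N := N)).continuous
  have hc : Continuous fun z => rho z * (v (x - R • z) - μ) := by fun_prop
  have hs : HasCompactSupport fun z => rho z * (v (x - R • z) - μ) := krn_rho.hasCompactSupport.mul_right
  have hpos : 0 < ∫ z, rho z * (v (x - R • z) - μ) := by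
    refine integral_pos_of_ne (p := R⁻¹ • (x - y)) hc hs (fun z => ?_) ?_
    · by_cases hz : ‖z‖ < 1
      · exact mul_nonneg (rho_nonneg z) (sub_nonneg.2 (hμ _ (mem_ball_sub_smul hR hz)))
      · rw [krn_rho.supp z (not_lt.1 hz), zero_mul]
    · rw [smul_inv_smul₀ hR.ne', sub_sub_cancel]
      refine mul_ne_zero (rho_pos ?_).ne' (sub_ne_zero.2 hne)
      rw [norm_smul, norm_inv, Real.norm_of_nonneg hR.le, inv_mul_lt_one₀ hR, ← dist_eq_norm, dist_comm]
      exact hy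
  have h1 := Tk_sub krn_rho hR hv.locallyIntegrable (continuous_const (y := μ)).locallyIntegrable x
  rw [Tk_const, integral_rho, one_mul] at h1
  have h2 : Tk rho R (fun y => v y - μ) x = ∫ z, rho z * (v (x - R • z) - μ) := rfl
  rw [← h2, h1] at hpos
  linarith

/-- Minimum principle for functions with the super mean value property. -/
theorem le_of_Tk_rho_le [NeZero N] {D : Set (Euc N)} (hD : IsOpen D) (hDb : Bornology.IsBounded D) {v : Euc N → ℝ} (hv : Continuous v)
    (hm : ∀ x ∈ D, ∃ s, 0 < s ∧ closedBall x s ⊆ D ∧ Tk rho s v x ≤ v x) {m : ℝ} (hfr : ∀ x ∈ frontier D, m ≤ v x) :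
    ∀ x ∈ D, m ≤ v x := by
  intro x hx
  by_contra! hlt
  have hK : IsCompact (closure D) := hDb.isCompact_closure
  obtain ⟨p, hp, hmin⟩ := hK.exists_isMinOn ⟨x, subset_closure hx⟩ hv.continuousOn
  have hpm : v p < m := (hmin (subset_closure hx)).trans_lt hlt
  have hED : ∀ y ∈ closure D, v y = v p → y ∈ D := fun y hy hyp => by
    by_contra hyD
    have := hfr y ⟨hy, by rwa [hD.interior_eq]⟩
    linarith
  have hclosed : IsClosed (closure D ∩ v ⁻¹' {v p}) := isClosed_closure.inter (isClosed_singleton.preimage hv)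
  have hopen : IsOpen (closure D ∩ v ⁻¹' {v p}) := by
    rw [Metric.isOpen_iff]
    rintro y ⟨hy, hyp⟩
    obtain ⟨s, hs, hsD, hT⟩ := hm y (hED y hy hyp)
    have hsub : ball y s ⊆ closure D := (ball_subset_closedBall.trans hsD).trans subset_closure
    exact ⟨s, hs, fun z hz => ⟨hsub hz, eq_of_Tk_rho_le hv (fun z hz => hmin (hsub hz)) hs (hT.trans_eq hyp) z hz⟩⟩
  have huniv := IsClopen.eq_univ ⟨hclosed, hopen⟩ ⟨p, hp, rfl⟩
  have : CompactSpace (Euc N) := ⟨huniv ▸ hK.inter_right (isClosed_singleton.preimage hv)⟩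
  obtain ⟨e, he⟩ := exists_norm_one (N := N)
  have : Nontrivial (Euc N) := ⟨e, 0, fun h => by rw [h, norm_zero] at he; exact zero_ne_one he⟩
  exact NormedSpace.noncompactSpace ℝ (Euc N) |>.noncompact_univ isCompact_univ

/-- Solutions on `D` of the free boundary problem with noncoincidence set `Ω`. -/
structure Free (C : ℝ) (u : Euc N → ℝ) (Ω D : Set (Euc N)) : Prop where
  isOpen : IsOpen Ω
  contDiff : ContDiff ℝ 1 u
  zero : ∀ x ∈ D, x ∉ Ω → x ∈ sing u
  lip : ∀ x ∈ D, ∀ y ∈ D, ‖fderiv ℝ u x - fderiv ℝ u y‖ ≤ C * ‖x - y‖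
  weak : WeakLap u (chi Ω) D

theorem Free.mono {C : ℝ} {u : Euc N → ℝ} {Ω D D' : Set (Euc N)} (h : Free C u Ω D) (hD : D' ⊆ D) : Free C u Ω D' :=
  ⟨h.isOpen, h.contDiff, fun x hx => h.zero x (hD hx), fun x hx y hy => h.lip x (hD hx) y (hD hy), h.weak.mono hD⟩

theorem Free.weak_one {C : ℝ} {u : Euc N → ℝ} {Ω D : Set (Euc N)} (h : Free C u Ω D) : WeakLap u (fun _ => 1) (Ω ∩ D) :=
  (h.weak.mono inter_subset_right).congr fun _ hx => chi_of_mem hx.1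

theorem Free.obst {C : ℝ} {u : Euc N → ℝ} {Ω D : Set (Euc N)} (h : Free C u Ω D) : Obst C u D :=
  ⟨h.contDiff, h.lip, h.weak_one.mono fun x hx => ⟨by_contra fun hn => hx.2 (h.zero x hx.1 hn), hx.1⟩⟩

theorem Free.resc {C : ℝ} {u : Euc N → ℝ} {Ω D : Set (Euc N)} (h : Free C u Ω D) {r : ℝ} (hr : 0 < r) (z : Euc N) :
    Free C (_root_.resc z r u) ((fun x => z + r • x) ⁻¹' Ω) ((fun x => z + r • x) ⁻¹' D) where
  isOpen := h.isOpen.preimage (by fun_prop)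
  contDiff := contDiff_resc (n := 1) h.contDiff z r
  zero x hx hxΩ := by
    rw [sing_resc (h.contDiff.differentiable (by simp)) hr]
    exact h.zero _ hx hxΩ
  lip := (h.obst.resc hr z).lip
  weak := (h.weak.resc hr z).congr fun x _ => rfl

/-- The quadratic coefficient matching `Δw = 1`. -/
def kM (N : ℕ) : ℝ := cM N / qM N

theorem kM_pos [NeZero N] : 0 < kM N := div_pos cM_pos qM_pos

theorem Tk_rho_add_sq [NeZero N] {u : Euc N → ℝ} (hu : Continuous u) {R : ℝ} (hR : 0 < R) (c : ℝ) (y x : Euc N) :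
    Tk rho R (fun z => u z - c * ‖z - y‖ ^ 2) x = Tk rho R u x - c * (‖x - y‖ ^ 2 + qM N * R ^ 2) := by
  have hc : Continuous fun z : Euc N => c * ‖z - y‖ ^ 2 := by fun_prop
  rw [Tk_sub krn_rho hR hu.locallyIntegrable hc.locallyIntegrable, Tk_const_mul, Tk_rho_sq]

theorem exists_closedBall_subset {D : Set (Euc N)} (hD : IsOpen D) {x : Euc N} (hx : x ∈ D) :
    ∃ s, 0 < s ∧ closedBall x s ⊆ D := Metric.nhds_basis_closedBall.mem_iff.1 (hD.mem_nhds hx)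

theorem exists_nondeg (N : ℕ) [NeZero N] : ∃ c, 0 < c ∧ ∀ (C : ℝ) (u : Euc N → ℝ) (Ω D : Set (Euc N)) (x0 : Euc N) (r : ℝ),
    Free C u Ω D → 0 < r → ball x0 r ⊆ D → x0 ∈ closure Ω → ∃ x ∈ ball x0 r, c * r ^ 2 ≤ |u x| := by
  have hk := kM_pos (N := N)
  have hcM := cM_pos (N := N)
  have hkq : kM N * qM N = cM N := div_mul_cancel₀ _ qM_pos.ne'
  refine ⟨min (kM N / 32) (cM N / 256), by positivity, fun C u Ω D x0 r h hr hrD hx0 => ?_⟩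
  by_contra! hsmall
  set c := min (kM N / 32) (cM N / 256)
  have hc1 : c ≤ kM N / 32 := min_le_left _ _
  have hc2 : c ≤ cM N / 256 := min_le_right _ _
  have hr2 : 0 < r ^ 2 := by positivity
  have huc := h.contDiff.continuous
  have hneg : ∀ y ∈ Ω ∩ ball x0 (r / 4), u y < 0 := by
    rintro y ⟨hyΩ, hy⟩
    by_contra! huy
    have hsub : closedBall y (r / 4) ⊆ ball x0 r := fun x hx => by
      rw [mem_ball, mem_closedBall] at *
      linarith [dist_triangle x y x0]
    obtain ⟨t, ht, htΩ⟩ := Metric.isOpen_iff.1 h.isOpen y hyΩ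
    have hop : IsOpen (Ω ∩ ball y (r / 4)) := h.isOpen.inter isOpen_ball
    set m := min (kM N * t ^ 2) (kM N * r ^ 2 / 32)
    have hm : 0 < m := by positivity
    have hfr : ∀ x ∈ frontier (Ω ∩ ball y (r / 4)), m ≤ -u x - (-kM N) * ‖x - y‖ ^ 2 := by
      intro x hx
      have hxc : x ∈ closedBall y (r / 4) := closure_ball_subset_closedBall (closure_mono inter_subset_right hx.1)
      by_cases hxΩ : x ∈ Ω
      · have hxn : r / 4 ≤ ‖x - y‖ := by
          by_contra! hlt
          refine hx.2 ?_
          rw [hop.interior_eq]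
          exact ⟨hxΩ, by rwa [mem_ball, dist_eq_norm]⟩
        have h1 := (_root_.abs_lt.1 (hsmall x (hsub hxc))).2
        have h2 : (r / 4) ^ 2 ≤ ‖x - y‖ ^ 2 := by gcongr
        have h3 : c * r ^ 2 ≤ kM N / 32 * r ^ 2 := by gcongr
        have h4 : kM N * (r / 4) ^ 2 ≤ kM N * ‖x - y‖ ^ 2 := by gcongr
        have h5 : m ≤ kM N * r ^ 2 / 32 := min_le_right _ _
        nlinarith
      · rw [(h.zero x (hrD (hsub hxc)) hxΩ).1]
        have hxn : t ≤ ‖x - y‖ := by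
          by_contra! hlt
          exact hxΩ (htΩ (by rwa [mem_ball, dist_eq_norm]))
        have h4 : kM N * t ^ 2 ≤ kM N * ‖x - y‖ ^ 2 := by gcongr
        have h5 : m ≤ kM N * t ^ 2 := min_le_left _ _
        linarith
    have key := le_of_Tk_rho_le hop (isBounded_ball.subset inter_subset_right) (by fun_prop) (fun x hx => ?_) hfr y
      ⟨hyΩ, mem_ball_self (by positivity)⟩
    · rw [sub_self, norm_zero] at key
      linarith
    · obtain ⟨s, hs, hsD⟩ := exists_closedBall_subset hop hx
      refine ⟨s, hs, hsD, le_of_eq ?_⟩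
      have h1 := h.weak_one.Tk_rho_eq huc hs
        (hsD.trans (inter_subset_inter_right _ ((ball_subset_closedBall.trans hsub).trans hrD)))
      have h2 := Tk_const_mul (ψ := rho) s (-1) u x
      simp only [neg_mul, one_mul] at h2
      rw [Tk_rho_add_sq (by fun_prop) hs, h2, h1]
      linear_combination s ^ 2 * hkq
  have hBD : ball x0 (r / 4) ⊆ D := (ball_subset_ball (by linarith)).trans hrD
  have hle : ∀ y ∈ ball x0 (r / 4), u y ≤ 0 := fun y hy => by
    by_cases hyΩ : y ∈ Ω
    · exact (hneg y ⟨hyΩ, hy⟩).le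
    · exact (h.zero y (hBD hy) hyΩ).1.le
  have hBΩ : ball x0 (r / 4) ⊆ Ω := by
    refine (convex_ball x0 (r / 4)).isPreconnected.subset_of_closure_inter_subset h.isOpen ?_ fun p hp => ?_
    · obtain ⟨q, hq1, hq2⟩ := mem_closure_iff.1 hx0 (ball x0 (r / 4)) isOpen_ball (mem_ball_self (by positivity))
      exact ⟨q, hq1, hq2⟩
    · by_contra hpΩ
      have hp0 := (h.zero p (hBD hp.2) hpΩ).1
      obtain ⟨s, hs, hsB⟩ := exists_closedBall_subset isOpen_ball hp.2
      have h1 := h.weak.Tk_rho_le huc (fun x => chi_nonneg _ x) hs (hsB.trans hBD)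
      have h2 := Tk_const_mul (ψ := rho) s (-1) u p
      simp only [neg_mul, one_mul] at h2
      have h3 := eq_of_Tk_rho_le (v := fun x => -u x) huc.neg (μ := 0)
        (fun y hy => neg_nonneg.2 (hle y (hsB (ball_subset_closedBall hy)))) hs (by rw [h2]; linarith)
      obtain ⟨q, hq1, hq2⟩ := mem_closure_iff.1 hp.1 (ball p s) isOpen_ball (mem_ball_self hs)
      have h4 := hneg q ⟨hq2, hsB (ball_subset_closedBall hq1)⟩
      have h5 : -u q = 0 := h3 q hq1
      linarith
  have hsub8 : closedBall x0 (r / 8) ⊆ ball x0 (r / 4) := closedBall_subset_ball (by linarith)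
  have h1 := h.weak_one.Tk_rho_eq huc (R := r / 8) (by positivity) fun x hx => ⟨hBΩ (hsub8 hx), hBD (hsub8 hx)⟩
  have h2 := abs_Tk_le krn_rho (R := r / 8) (f := u) (x := x0) (A := c * r ^ 2) (by positivity) fun y hy =>
    (hsmall y (ball_subset_ball (by linarith) hy)).le
  rw [integral_abs_rho, one_mul] at h2
  have h3 := hsmall x0 (mem_ball_self hr)
  rw [_root_.abs_lt] at h3
  rw [_root_.abs_le] at h2
  have h4 : c * r ^ 2 ≤ cM N / 256 * r ^ 2 := by gcongr
  nlinarith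

/-- Quadratic nondegeneracy at `p`. -/
def Nondeg (c : ℝ) (v : Euc N → ℝ) (p : Euc N) : Prop := ∀ r, 0 < r → ∃ x ∈ ball p r, c * r ^ 2 ≤ |v x|

theorem CV.nondeg {C c : ℝ} (hc : 0 < c) {F : Ultrafilter ℕ} {u : ℕ → Euc N → ℝ} {v : Euc N → ℝ} (h : CV C F u v) {p : Euc N}
    (hu : ∀ r, 0 < r → ∀ᶠ j in (F : Filter ℕ), ∃ x ∈ ball p r, c * r ^ 2 ≤ |u j x|) : Nondeg (c / 2) v p := by
  intro r hr
  obtain ⟨j, ⟨x, hx, hxc⟩, hj⟩ := ((hu r hr).and (h.eventually_abs (‖p‖ + r) (ε := c / 2 * r ^ 2) (by positivity))).exists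
  refine ⟨x, hx, ?_⟩
  have h1 := hj x (by
    rw [mem_ball_zero_iff]; rw [mem_ball, dist_eq_norm] at hx
    calc ‖x‖ = ‖p + (x - p)‖ := by rw [add_sub_cancel]
      _ ≤ ‖p‖ + ‖x - p‖ := norm_add_le _ _
      _ < _ := by linarith)
  have h2 := abs_sub_abs_le_abs_sub (u j x) (v x)
  linarith

theorem Nondeg.resc {c : ℝ} {v : Euc N → ℝ} {z : Euc N} (h : Nondeg c v z) {s : ℝ} (hs : 0 < s) :
    Nondeg c (_root_.resc z s v) 0 := by
  intro r hr
  obtain ⟨x, hx, hxc⟩ := h (s * r) (by positivity)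
  refine ⟨s⁻¹ • (x - z), ?_, ?_⟩
  · rw [mem_ball_zero_iff, norm_smul, norm_inv, Real.norm_of_nonneg hs.le, inv_mul_lt_iff₀ hs, ← dist_eq_norm]
    exact hx
  · rw [_root_.resc, smul_inv_smul₀ hs.ne', add_sub_cancel, abs_mul, abs_of_pos (by positivity), le_inv_mul_iff₀ (by positivity)]
    linarith

/-- The cone generated by a set that is star-shaped about the origin. -/
def tcone (S : Set (Euc N)) : Set (Euc N) := {x | ∃ k, rn k • x ∈ S}

section tcone

variable {S : Set (Euc N)}

theorem smul_rn_mem_of_le (hS : Convex ℝ S) (h0 : 0 ∈ S) {x : Euc N} {k m : ℕ} (hkm : k ≤ m) (hx : rn k • x ∈ S) :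
    rn m • x ∈ S := by
  have h1 : rn m • x = rn (m - k) • rn k • x := by
    rw [smul_smul, rn, rn, rn, ← pow_add, Nat.sub_add_cancel hkm]
  rw [h1]
  exact hS.smul_mem_of_zero_mem h0 hx ⟨(rn_pos _).le, rn_le_one _⟩

theorem eventually_of_mem_tcone (hS : Convex ℝ S) (h0 : 0 ∈ S) {x : Euc N} (hx : x ∈ tcone S) :
    ∀ᶠ k in atTop, rn k • x ∈ S := by
  obtain ⟨k, hk⟩ := hx
  filter_upwards [eventually_ge_atTop k] with m hm using smul_rn_mem_of_le hS h0 hm hk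

theorem measurableSet_tcone (hS : MeasurableSet S) : MeasurableSet (tcone S) := by
  have : tcone S = ⋃ k, (fun x => rn k • x) ⁻¹' S := by
    ext x
    simp [tcone]
  rw [this]
  exact MeasurableSet.iUnion fun k => (measurable_const_smul (rn k)) hS

theorem subset_tcone : S ⊆ tcone S := fun x hx => ⟨0, by simpa [rn_zero] using hx⟩

theorem smul_mem_tcone (hS : Convex ℝ S) (h0 : 0 ∈ S) {x : Euc N} (hx : x ∈ tcone S) {t : ℝ} (ht : 0 < t) :
    t • x ∈ tcone S := by
  obtain ⟨k, hk⟩ := hx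
  have h1 : ∀ᶠ j in atTop, rn j * t < rn k := by
    have := (tendsto_nhdsWithin_iff.1 tendsto_rn).1.mul_const t
    rw [zero_mul] at this
    exact this.eventually (gt_mem_nhds (rn_pos k))
  obtain ⟨j, hj⟩ := h1.exists
  refine ⟨j, ?_⟩
  have h2 : rn j • t • x = (rn j * t / rn k) • rn k • x := by
    rw [smul_smul, smul_smul, div_mul_cancel₀ _ (rn_pos k).ne']
  rw [h2]
  exact hS.smul_mem_of_zero_mem h0 hk ⟨by have := rn_pos j; have := rn_pos k; positivity, (div_le_one (rn_pos k)).2 hj.le⟩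

theorem add_mem_tcone (hS : Convex ℝ S) (h0 : 0 ∈ S) {x y : Euc N} (hx : x ∈ tcone S) (hy : y ∈ tcone S) :
    x + y ∈ tcone S := by
  obtain ⟨k, hk1, hk2⟩ := ((eventually_of_mem_tcone hS h0 hx).and (eventually_of_mem_tcone hS h0 hy)).exists
  refine ⟨k + 1, ?_⟩
  have h1 := hS hk1 hk2 (a := 1 / 2) (b := 1 / 2) (by norm_num) (by norm_num) (by norm_num)
  have h2 : rn (k + 1) • (x + y) = (1 / 2 : ℝ) • rn k • x + (1 / 2 : ℝ) • rn k • y := by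
    rw [rn_succ]
    module
  rwa [h2]

theorem tendsto_Tk_chi_tcone (hS : Convex ℝ S) (h0 : 0 ∈ S) (hSm : MeasurableSet S) {ψ : Euc N → ℝ} (hψ : Krn ψ) :
    Tendsto (fun k => Tk ψ (rn k) (chi S) 0) atTop (nhds (Tk ψ 1 (chi (tcone S)) 0)) := by
  unfold Tk
  refine tendsto_integral_of_dominated_convergence (fun y => |ψ y|) (fun k => ?_) hψ.integrable.abs (fun k => ?_) ?_
  · exact (hψ.continuous.measurable.mul ((measurable_chi hSm).comp (by fun_prop))).aestronglyMeasurable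
  · refine Eventually.of_forall fun y => ?_
    rw [Real.norm_eq_abs, abs_mul]
    exact mul_le_of_le_one_right (abs_nonneg _) (abs_chi_le _ _)
  · refine Eventually.of_forall fun y => tendsto_const_nhds.congr' ?_
    by_cases hy : -y ∈ tcone S
    · filter_upwards [eventually_of_mem_tcone hS h0 hy] with k hk
      rw [chi_of_mem, chi_of_mem]
      · rwa [zero_sub, ← smul_neg]
      · rwa [zero_sub, one_smul]
    · refine Eventually.of_forall fun k => ?_
      change ψ y * _ = ψ y * _
      rw [chi_of_notMem, chi_of_notMem]
      · rw [zero_sub, ← smul_neg]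
        exact fun h => hy ⟨k, h⟩
      · rwa [zero_sub, one_smul]

end tcone

theorem tendsto_zero_of_sum_bounded {a : ℕ → ℝ} {A B : ℝ} (ha : Tendsto a atTop (nhds A))
    (hB : ∀ n, |∑ i ∈ Finset.range n, a i| ≤ B) : A = 0 := by
  have h1 := ha.cesaro
  have h2 : Tendsto (fun n : ℕ => (n : ℝ)⁻¹ * ∑ i ∈ Finset.range n, a i) atTop (nhds 0) := by
    refine squeeze_zero_norm (a := fun n : ℕ => (n : ℝ)⁻¹ * B) (fun n => ?_) ?_
    · rw [Real.norm_eq_abs, abs_mul, _root_.abs_of_nonneg (inv_nonneg.2 (Nat.cast_nonneg n))]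
      exact mul_le_mul_of_nonneg_left (hB n) (inv_nonneg.2 (Nat.cast_nonneg n))
    · simpa using (tendsto_inv_atTop_nhds_zero_nat (𝕜 := ℝ)).mul_const B
  exact tendsto_nhds_unique h1 h2

theorem Obst.Tk_chi_tcone_eq_zero {C : ℝ} (hC : 0 ≤ C) {u : Euc N → ℝ} (h : Obst C u univ)
    (hS : Convex ℝ (sing u)) (h0 : 0 ∈ sing u) {e : Euc N} (he : ‖e‖ = 1) :
    Tk (_root_.dd e (_root_.dd e kap)) 1 (chi (tcone (sing u))) 0 = 0 := by
  have hm : MeasurableSet (sing u) := (isClosed_sing h.contDiff).measurableSet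
  refine tendsto_zero_of_sum_bounded (B := 2 * C) (tendsto_Tk_chi_tcone hS h0 hm ((krn_kap.dd e).dd e)) fun n => ?_
  have h1 : ∀ i, Tk (_root_.dd e (_root_.dd e kap)) (rn i) (chi (sing u)) 0 = Hes (rn (i + 1)) u e 0 - Hes (rn i) u e 0 := by
    intro i
    have := (h.solOn hC).Hes_sub (rn_pos i) (x := 0) (subset_univ _) e
    rw [rn_succ]
    linarith
  rw [Finset.sum_congr rfl fun i _ => h1 i, Finset.sum_range_sub (fun i => Hes (rn i) u e 0)]
  have h2 := h.abs_Hes_le hC (rn_pos n) e 0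
  have h3 := h.abs_Hes_le hC (rn_pos 0) e 0
  rw [he] at h2 h3
  rw [_root_.abs_le] at *
  constructor <;> linarith

theorem Tk_dd_chi_nonpos {ψ : Euc N → ℝ} (hψ : Krn ψ) {P : Set (Euc N)} (hPm : MeasurableSet P) {e : Euc N}
    (hPe : ∀ x ∈ P, ∀ t : ℝ, 0 ≤ t → x - t • e ∈ P) (hpos : ∀ y, -y ∈ P → 0 ≤ ψ y) :
    Tk (dd e ψ) 1 (chi P) 0 ≤ 0 := by
  have hli := locallyIntegrable_chi hPm
  have hd := hasDerivAt_line ((contDiff_Tk hψ one_pos hli).differentiable (by simp)) 0 e 0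
  rw [zero_smul, add_zero, dd_Tk hψ one_pos hli, inv_one, one_mul] at hd
  have hInt : ∀ x, Integrable fun y => ψ y * chi P (x - (1 : ℝ) • y) := fun x =>
    hψ.integrable.mul_bdd (c := 1) ((measurable_chi hPm).comp (by fun_prop)).aestronglyMeasurable
      (Eventually.of_forall fun y => abs_chi_le _ _)
  have hle : ∀ t : ℝ, 0 ≤ t → Tk ψ 1 (chi P) (0 + t • e) ≤ Tk ψ 1 (chi P) (0 + (0 : ℝ) • e) := fun t ht => by
    refine integral_mono (hInt _) (hInt _) fun y => ?_
    simp only [zero_smul, zero_add, one_smul, zero_sub]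
    by_cases hy : -y ∈ P
    · rw [chi_of_mem hy]
      exact mul_le_mul_of_nonneg_left (chi_le_one _ _) (hpos y hy)
    · rw [chi_of_notMem hy, chi_of_notMem]
      intro h
      have := hPe _ h t ht
      exact hy (by convert this using 1; abel)
  have h2 := hd.tendsto_slope
  have h3 : Tendsto (slope (fun t : ℝ => Tk ψ 1 (chi P) (0 + t • e)) 0) (nhdsWithin 0 (Ioi 0)) (nhds (Tk (dd e ψ) 1 (chi P) 0)) :=
    h2.mono_left (nhdsWithin_mono _ fun t ht => ne_of_gt ht)
  refine le_of_tendsto h3 ?_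
  filter_upwards [self_mem_nhdsWithin] with t ht
  rw [slope_def_field, sub_zero]
  exact div_nonpos_of_nonpos_of_nonneg (sub_nonpos.2 (hle t (le_of_lt ht))) (le_of_lt ht)

theorem Tk_dd_chi_eq_zero {P : Set (Euc N)} (hPm : MeasurableSet P) {e : Euc N}
    (hPe : ∀ x ∈ P, ∀ t : ℝ, 0 ≤ t → x - t • e ∈ P)
    (hA : Tk (dd e (dd e kap)) 1 (chi P) 0 = 0) {φ : Euc N → ℝ} (hφ : Krn φ) (hφ0 : ∀ x, 0 ≤ φ x)
    {c : ℝ} (hc : 0 < c) (hle : ∀ x, -x ∈ P → c * φ x ≤ ⟪x, e⟫ * kapW x) : Tk (dd e φ) 1 (chi P) 0 = 0 := by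
  refine le_antisymm (Tk_dd_chi_nonpos hφ hPm hPe fun y _ => hφ0 y) ?_
  have hk : Krn fun x => (-1) * dd e kap x - c * φ x := by
    refine ⟨?_, fun x hx => ?_⟩
    · exact (contDiff_const.mul (krn_kap.dd e).smooth).sub (contDiff_const.mul hφ.smooth)
    · rw [(krn_kap.dd e).supp x hx, hφ.supp x hx]
      ring
  have h1 := Tk_dd_chi_nonpos hk hPm hPe fun y hy => by
    rw [dd_kap]
    linarith [hle y hy]
  have h2 : dd e (fun x => (-1) * dd e kap x - c * φ x) = fun x => (-1) * dd e (dd e kap) x - c * dd e φ x := by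
    funext x
    have ha : DifferentiableAt ℝ (dd e kap) x := (krn_kap.dd e).differentiable x
    have hb : DifferentiableAt ℝ φ x := hφ.differentiable x
    have := (ha.hasFDerivAt.const_mul (-1)).sub (hb.hasFDerivAt.const_mul c)
    exact DFunLike.congr_fun this.fderiv e
  rw [h2, Tk_sub_kernel (ψ := fun x => (-1) * dd e (dd e kap) x) (χ := fun x => c * dd e φ x), Tk_kernel_mul, Tk_kernel_mul, hA] at h1
  · nlinarith
  · exact ⟨contDiff_const.mul ((krn_kap.dd e).dd e).smooth, fun x hx => by rw [((krn_kap.dd e).dd e).supp x hx, mul_zero]⟩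
  · exact ⟨contDiff_const.mul (hφ.dd e).smooth, fun x hx => by rw [(hφ.dd e).supp x hx, mul_zero]⟩
  · exact one_pos
  · exact locallyIntegrable_chi hPm

theorem dd_Tk_rho_chi_eq_zero {P : Set (Euc N)} (hPm : MeasurableSet P) {e : Euc N}
    (hPe : ∀ x ∈ P, ∀ t : ℝ, 0 ≤ t → x - t • e ∈ P) (hP : ∀ x ∈ P, ⟪x, e⟫ ≤ 0)
    (hA : Tk (dd e (dd e kap)) 1 (chi P) 0 = 0) {x : Euc N} {ε : ℝ} (hε : 0 < ε)
    (hx : closedBall x ε ⊆ {y | ⟪y, e⟫ < 0} ∩ ball 0 1) : dd e (Tk rho ε (chi P)) x = 0 := by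
  have hli := locallyIntegrable_chi hPm
  have hout : ∀ y, -y ∉ closedBall x ε → rho (ε⁻¹ • (x + y)) = 0 := fun y hy => by
    refine krn_rho.supp _ ?_
    rw [mem_closedBall, dist_eq_norm, not_le, ← norm_neg, neg_sub, sub_neg_eq_add] at hy
    rw [norm_smul, norm_inv, Real.norm_eq_abs, _root_.abs_of_pos hε, ← div_eq_inv_mul, one_le_div hε]
    exact hy.le
  have hφ : Krn fun y => rho (ε⁻¹ • (x + y)) := by
    refine ⟨krn_rho.smooth.comp (g := rho) (f := fun y => ε⁻¹ • (x + y)) (by fun_prop), fun y hy => hout y fun h => ?_⟩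
    have := (hx h).2
    rw [mem_ball_zero_iff, norm_neg] at this
    linarith
  have hcont : Continuous fun z : Euc N => -⟪z, e⟫ * kapW (-z) := by
    have := (krn_kapW (N := N)).continuous
    fun_prop
  obtain ⟨z0, hz0, hmin⟩ := (isCompact_closedBall x ε).exists_isMinOn ⟨x, mem_closedBall_self hε.le⟩ hcont.continuousOn
  have hm : 0 < -⟪z0, e⟫ * kapW (-z0) := by
    have h1 := hx hz0
    have h2 : ‖-z0‖ < 1 := by rw [norm_neg]; exact mem_ball_zero_iff.1 h1.2
    exact mul_pos (neg_pos.2 h1.1) (kapW_pos h2)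
  obtain ⟨B, hB, hBr⟩ := (krn_rho (N := N)).exists_bound
  have h0 := Tk_dd_chi_eq_zero hPm hPe hA hφ (fun y => rho_nonneg _) (div_pos hm hB) fun y hy => by
    by_cases hyx : -y ∈ closedBall x ε
    · have h1 : -⟪z0, e⟫ * kapW (-z0) ≤ -⟪-y, e⟫ * kapW (- -y) := hmin hyx
      rw [neg_neg, inner_neg_left, neg_neg] at h1
      refine le_trans ?_ h1
      rw [div_mul_eq_mul_div, div_le_iff₀ hB]
      exact mul_le_mul_of_nonneg_left ((le_abs_self _).trans (hBr _)) hm.le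
    · rw [hout y hyx, mul_zero]
      have := hP _ hy
      rw [inner_neg_left] at this
      exact mul_nonneg (by linarith) (kapW_nonneg _)
  have h1 : Tk (fun y => rho (ε⁻¹ • (x + y))) 1 (chi P) = fun z => ε ^ N * Tk rho ε (chi P) (x + z) := by
    funext z
    rw [Tk_eq _ one_pos, Tk_eq _ hε, ← mul_assoc, mul_inv_cancel₀ (by positivity), one_pow, inv_one]
    simp only [one_smul, one_mul, add_sub_assoc]
  have h2 : dd e (Tk (fun y => rho (ε⁻¹ • (x + y))) 1 (chi P)) 0 = ε ^ N * dd e (Tk rho ε (chi P)) x := by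
    rw [h1]
    have h3 : DifferentiableAt ℝ (Tk rho ε (chi P)) (x + 0) :=
      (contDiff_Tk krn_rho hε hli).differentiable (by simp) _
    have h4 := (h3.hasFDerivAt.comp (0 : Euc N) ((hasFDerivAt_id (0 : Euc N)).const_add x)).const_mul (ε ^ N)
    rw [add_zero] at h4
    exact DFunLike.congr_fun h4.fderiv e
  rw [dd_Tk hφ one_pos hli, h0, mul_zero] at h2
  exact (mul_eq_zero.1 h2.symm).resolve_left (by positivity)

theorem exists_mem_ball_of_inner_neg {P : Set (Euc N)} (hPm : MeasurableSet P) {e : Euc N} (he : ‖e‖ = 1)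
    (hcone : ∀ x ∈ P, ∀ t : ℝ, 0 < t → t • x ∈ P)
    (hPe : ∀ x ∈ P, ∀ t : ℝ, 0 ≤ t → x - t • e ∈ P) (hP : ∀ x ∈ P, ⟪x, e⟫ ≤ 0)
    (hA : Tk (dd e (dd e kap)) 1 (chi P) 0 = 0) (heP : -e ∈ interior P) {p : Euc N} (hp : ⟪p, e⟫ < 0)
    {ε : ℝ} (hε : 0 < ε) : ∃ x ∈ ball p ε, x ∈ P := by
  by_contra! hno
  obtain ⟨ε₁, hε₁, hb⟩ := Metric.isOpen_iff.1 isOpen_interior _ heP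
  obtain ⟨l, hl, hl1, hl2⟩ : ∃ l : ℝ, 0 < l ∧ l * ‖p‖ < ε₁ / 2 ∧ l * ‖p‖ < 1 := by
    refine ⟨min (ε₁ / 2) 1 / (‖p‖ + 1), by positivity, ?_, ?_⟩
    all_goals rw [div_mul_eq_mul_div, div_lt_iff₀ (by positivity)]
    · nlinarith [min_le_left (ε₁ / 2) 1, norm_nonneg p, lt_min (half_pos hε₁) one_pos]
    · nlinarith [min_le_right (ε₁ / 2) 1, norm_nonneg p, lt_min (half_pos hε₁) one_pos]
  set q := (l / 4) • p with hq
  have hqe : ⟪q, e⟫ < 0 := by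
    rw [hq, real_inner_smul_left]
    exact mul_neg_of_pos_of_neg (by positivity) hp
  have hqn : ‖q‖ < 1 / 4 := by
    rw [hq, norm_smul, Real.norm_eq_abs, _root_.abs_of_pos (by positivity)]
    linarith
  obtain ⟨r, hr, hr1, hr2, hr3, hr4⟩ : ∃ r : ℝ, 0 < r ∧ r ≤ ε₁ / 8 ∧ r ≤ l * ε / 4 ∧ r < -⟪q, e⟫ ∧ r ≤ 1 / 4 := by
    refine ⟨min (min (ε₁ / 8) (l * ε / 4)) (min (-⟪q, e⟫ / 2) (1 / 4)), ?_, ?_, ?_, ?_, ?_⟩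
    · exact lt_min (lt_min (by positivity) (by positivity)) (lt_min (by linarith) (by norm_num))
    · exact (min_le_left _ _).trans (min_le_left _ _)
    · exact (min_le_left _ _).trans (min_le_right _ _)
    · exact ((min_le_right _ _).trans (min_le_left _ _)).trans_lt (by linarith)
    · exact (min_le_right _ _).trans (min_le_right _ _)
  have hG0 : Tk rho r (chi P) (q + (0 : ℝ) • e) = 0 := by
    rw [zero_smul, add_zero, Tk_congr (g := fun _ => 0) krn_rho hr, Tk_const, mul_zero]
    intro y hy
    refine chi_of_notMem fun hyP => hno ((4 / l) • y) ?_ (hcone y hyP _ (by positivity))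
    rw [mem_ball, dist_eq_norm] at *
    have h1 : (4 / l) • y - p = (4 / l) • (y - q) := by
      rw [hq, smul_sub, smul_smul, show 4 / l * (l / 4) = 1 by field_simp, one_smul]
    rw [h1, norm_smul, Real.norm_eq_abs, _root_.abs_of_pos (by positivity), div_mul_eq_mul_div, div_lt_iff₀ hl]
    linarith
  have hG1 : Tk rho r (chi P) (q + (-(1 / 4) : ℝ) • e) = 1 := by
    rw [Tk_congr (g := fun _ => 1) krn_rho hr, Tk_const, integral_rho, mul_one]
    intro y hy
    refine chi_of_mem ?_
    have h1 : (4 : ℝ) • y ∈ P := by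
      refine interior_subset (hb ?_)
      rw [mem_ball, dist_eq_norm] at *
      have h1 : (4 : ℝ) • y - -e = (4 : ℝ) • (y - (q + (-(1 / 4) : ℝ) • e)) + l • p := by
        rw [hq]
        module
      rw [h1]
      have h2 := norm_add_le ((4 : ℝ) • (y - (q + (-(1 / 4) : ℝ) • e))) (l • p)
      rw [norm_smul, norm_smul, Real.norm_eq_abs, Real.norm_eq_abs, _root_.abs_of_pos hl, _root_.abs_of_pos (by norm_num)] at h2
      linarith
    have h2 := hcone _ h1 (1 / 4) (by norm_num)
    rwa [smul_smul, show (1 / 4 : ℝ) * 4 = 1 by norm_num, one_smul] at h2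
  have hd := hasDerivAt_line ((contDiff_Tk krn_rho hr (locallyIntegrable_chi hPm)).differentiable (by simp)) q e
  obtain ⟨s, hs, hs'⟩ := exists_hasDerivAt_eq_slope (fun t : ℝ => Tk rho r (chi P) (q + t • e)) _
    (show -(1 / 4 : ℝ) < 0 by norm_num) (fun t _ => (hd t).continuousAt.continuousWithinAt) fun t _ => hd t
  rw [hG0, hG1, dd_Tk_rho_chi_eq_zero hPm hPe hP hA hr] at hs'
  · norm_num at hs'
  · intro y hy
    clear_value q
    rw [mem_closedBall, dist_eq_norm] at hy
    have h1 : y = (y - (q + s • e)) + (q + s • e) := by abel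
    constructor
    · change ⟪y, e⟫ < 0
      rw [h1, inner_add_left, inner_add_left, real_inner_smul_left, real_inner_self_eq_norm_sq, he]
      have := (real_inner_le_norm (y - (q + s • e)) e)
      rw [he] at this
      linarith [hs.2]
    · rw [mem_ball_zero_iff, h1]
      have h2 := norm_add₃_le (a := y - (q + s • e)) (b := q) (c := s • e)
      rw [norm_smul, he, Real.norm_eq_abs, _root_.abs_of_neg hs.2] at h2
      rw [← add_assoc]
      linarith [hs.1]

open scoped Pointwise in
theorem exists_polar_direction {P : Set (Euc N)} (hcone : ∀ x ∈ P, ∀ t : ℝ, 0 < t → t • x ∈ P)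
    (hadd : ∀ x ∈ P, ∀ y ∈ P, x + y ∈ P) (hInt : (interior P).Nonempty) (hne : P ≠ univ) :
    ∃ e : Euc N, ‖e‖ = 1 ∧ -e ∈ interior P ∧ ∀ x ∈ P, ⟪x, e⟫ ≤ 0 := by
  have hconv : Convex ℝ P := by
    refine convex_iff_forall_pos.2 fun x hx y hy a b ha hb _ => hadd _ (hcone x hx a ha) _ (hcone y hy b hb)
  have hiscale : ∀ x ∈ interior P, ∀ t : ℝ, 0 < t → t • x ∈ interior P := fun x hx t ht => by
    have h1 : t • P ⊆ P := by
      rintro _ ⟨y, hy, rfl⟩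
      exact hcone y hy t ht
    have h2 := interior_mono h1
    rw [interior_smul₀ ht.ne'] at h2
    exact h2 (smul_mem_smul_set hx)
  set Q : Set (Euc N) := {b | ∀ x ∈ P, 0 ≤ ⟪x, b⟫} with hQ
  by_cases h : ∃ b ∈ Q, b ∈ interior P
  · obtain ⟨b, hbQ, hbP⟩ := h
    have hb0 : b ≠ 0 := by
      rintro rfl
      refine hne (eq_univ_of_forall fun x => ?_)
      obtain ⟨ε, hε, hb⟩ := Metric.isOpen_iff.1 isOpen_interior _ hbP
      have h1 : (ε / (‖x‖ + 1)) • x ∈ P := by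
        refine interior_subset (hb ?_)
        rw [mem_ball_zero_iff, norm_smul, Real.norm_eq_abs, _root_.abs_of_pos (by positivity), div_mul_eq_mul_div,
          div_lt_iff₀ (by positivity)]
        nlinarith [norm_nonneg x]
      have h2 := hcone _ h1 ((‖x‖ + 1) / ε) (by positivity)
      rwa [smul_smul, div_mul_div_cancel₀ hε.ne', div_self (by positivity), one_smul] at h2
    refine ⟨-(‖b‖⁻¹ • b), ?_, ?_, fun x hx => ?_⟩
    · rw [norm_neg, norm_smul, norm_inv, norm_norm, inv_mul_cancel₀ (norm_ne_zero_iff.2 hb0)]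
    · rw [neg_neg]
      exact hiscale b hbP _ (inv_pos.2 (norm_pos_iff.2 hb0))
    · rw [inner_neg_right, inner_smul_right]
      exact neg_nonpos.2 (mul_nonneg (inv_nonneg.2 (norm_nonneg _)) (hbQ x hx))
  · exfalso
    have hQc : Convex ℝ Q := convex_iff_forall_pos.2 fun x hx y hy a b ha hb _ z hz => by
      rw [inner_add_right, inner_smul_right, inner_smul_right]
      exact add_nonneg (mul_nonneg ha.le (hx z hz)) (mul_nonneg hb.le (hy z hz))
    obtain ⟨f, s, hf1, hf2⟩ := geometric_hahn_banach_open hconv.interior isOpen_interior hQc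
      (disjoint_left.2 fun x hx hxQ => h ⟨x, hxQ, hx⟩)
    have hs0 : s ≤ 0 := by simpa using hf2 0 fun x _ => by simp
    have hfP : ∀ x ∈ P, f x ≤ 0 := fun x hx => by
      have h1 : closure (interior P) ⊆ {x | f x ≤ 0} :=
        closure_minimal (fun y hy => ((hf1 y hy).trans_le hs0).le) (isClosed_le f.continuous continuous_const)
      rw [hconv.closure_interior_eq_closure_of_nonempty_interior hInt] at h1
      exact h1 (subset_closure hx)
    set g := (InnerProductSpace.toDual ℝ (Euc N)).symm f with hg
    have hgf : ∀ x, ⟪x, g⟫ = f x := fun x => by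
      rw [real_inner_comm]
      exact InnerProductSpace.toDual_symm_apply
    obtain ⟨a, ha⟩ := hInt
    have hga := hf1 a ha
    have hg0 : 0 < ⟪g, g⟫ := by
      rw [real_inner_self_eq_norm_sq]
      have : g ≠ 0 := fun hg0 => by
        rw [← hgf, hg0, inner_zero_right] at hga
        linarith
      positivity
    have h1 := hf2 (((|s| + 1) / ⟪g, g⟫) • (-g)) fun x hx => by
      rw [inner_smul_right, inner_neg_right, hgf x]
      have := hfP x hx
      exact mul_nonneg (by positivity) (by linarith)
    rw [map_smul, map_neg, ← hgf, smul_eq_mul, mul_neg, div_mul_cancel₀ _ hg0.ne'] at h1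
    linarith [neg_abs_le s]

theorem ConvexOn.nonneg_of_mem_sing {u : Euc N → ℝ} (hu : ConvexOn ℝ univ u) (hd : Differentiable ℝ u) {p : Euc N}
    (hp : p ∈ sing u) (x : Euc N) : 0 ≤ u x := by
  have hc : ConvexOn ℝ univ fun t : ℝ => u (p + t • (x - p)) := by
    have := hu.comp_affineMap (AffineMap.lineMap p x : ℝ →ᵃ[ℝ] Euc N)
    simpa [AffineMap.lineMap_apply, Function.comp_def, add_comm] using this
  have hder := hasDerivAt_line hd p (x - p) 0
  have h2 : dd (x - p) u (p + (0 : ℝ) • (x - p)) = 0 := by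
    rw [zero_smul, add_zero, dd, hp.2]
    rfl
  rw [h2] at hder
  have h3 := hc.le_slope_of_hasDerivAt (mem_univ 0) (mem_univ 1) one_pos hder
  rw [slope_def_field] at h3
  simpa [hp.1] using h3

theorem mem_sing_of_eq_zero {u : Euc N → ℝ} (hu : ∀ x, 0 ≤ u x) {x : Euc N} (hx : u x = 0) : x ∈ sing u := by
  refine ⟨hx, IsLocalMin.fderiv_eq_zero (Eventually.of_forall fun y => ?_)⟩
  change u x ≤ u y
  rw [hx]
  exact hu y

theorem ConvexOn.convex_sing {u : Euc N → ℝ} (hu : ConvexOn ℝ univ u) (h0 : ∀ x, 0 ≤ u x) : Convex ℝ (sing u) := by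
  have : sing u = {x ∈ univ | u x ≤ 0} := by
    ext x
    exact ⟨fun h => ⟨mem_univ x, h.1.le⟩, fun h => mem_sing_of_eq_zero h0 (le_antisymm h.2 (h0 x))⟩
  rw [this]
  exact hu.convex_le 0

theorem Convex.nonempty_interior_of_volume_ne_zero {S : Set (Euc N)} (hS : Convex ℝ S) (hv : volume S ≠ 0) :
    (interior S).Nonempty := by
  by_contra h
  rw [not_nonempty_iff_eq_empty] at h
  refine hv (measure_mono_null (t := frontier S) (fun x hx => ⟨subset_closure hx, ?_⟩) (hS.addHaar_frontier volume))
  rw [h]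
  exact notMem_empty x

theorem ConvexOn.add_le_of_orthogonal {v : Euc N → ℝ} (hv : ConvexOn ℝ univ v) (hc : Continuous v) {e : Euc N} (he : ‖e‖ = 1)
    (hz : ∀ x, ⟪x, e⟫ ≤ 0 → v x = 0) {x y : Euc N} (hy : ⟪y, e⟫ = 0) : v (x + y) ≤ v x := by
  set m := |⟪x, e⟫| with hm
  have h1 : Tendsto (fun l : ℝ => v (x + y - (l * m) • e)) (nhdsWithin 0 (Ioi 0)) (nhds (v (x + y))) := by
    have : Continuous fun l : ℝ => v (x + y - (l * m) • e) := by fun_prop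
    have h := this.tendsto 0
    simp only [zero_mul, zero_smul, sub_zero] at h
    exact h.mono_left nhdsWithin_le_nhds
  have h2 : Tendsto (fun l : ℝ => (1 - l) * v x) (nhdsWithin 0 (Ioi 0)) (nhds (v x)) := by
    have : Continuous fun l : ℝ => (1 - l) * v x := by fun_prop
    have h := this.tendsto 0
    simp only [sub_zero, one_mul] at h
    exact h.mono_left nhdsWithin_le_nhds
  refine le_of_tendsto_of_tendsto h1 h2 ?_
  filter_upwards [Ioo_mem_nhdsGT (show (0 : ℝ) < 1 by norm_num)] with l hl
  have h3 := hv.2 (mem_univ x) (mem_univ (x + l⁻¹ • y - m • e)) (sub_nonneg.2 hl.2.le) hl.1.le (sub_add_cancel 1 l)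
  rw [hz (x + l⁻¹ • y - m • e), smul_zero, add_zero, smul_eq_mul] at h3
  · convert h3 using 2
    have : l • l⁻¹ • y = y := by rw [smul_smul, mul_inv_cancel₀ hl.1.ne', one_smul]
    rw [smul_sub, smul_add, this]
    module
  · rw [inner_sub_left, inner_add_left, real_inner_smul_left, real_inner_smul_left, hy, real_inner_self_eq_norm_sq, he]
    linarith [le_abs_self ⟪x, e⟫]

theorem eq_comp_inner_of_orthogonal {v : Euc N → ℝ} {e : Euc N} (he : ‖e‖ = 1)
    (h : ∀ x y, ⟪y, e⟫ = 0 → v (x + y) ≤ v x) (x : Euc N) : v x = v (⟪x, e⟫ • e) := by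
  have h1 : ⟪x - ⟪x, e⟫ • e, e⟫ = 0 := by
    rw [inner_sub_left, real_inner_smul_left, real_inner_self_eq_norm_sq, he]
    ring
  refine le_antisymm ?_ ?_
  · have := h (⟪x, e⟫ • e) _ h1
    rwa [add_sub_cancel] at this
  · have := h x (-(x - ⟪x, e⟫ • e)) (by rw [inner_neg_left, h1, neg_zero])
    rwa [neg_sub, add_sub_cancel] at this

theorem hasFDerivAt_comp_inner {f : ℝ → ℝ} {f' : ℝ} {e x : Euc N} (hf : HasDerivAt f f' ⟪x, e⟫) :
    HasFDerivAt (fun x => f ⟪x, e⟫) (f' • innerSL ℝ e) x :=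
  hf.comp_hasFDerivAt x (hasFDerivAt_inner_left e x)

theorem eqOn_of_hasDerivAt {f g f' : ℝ → ℝ} (hf : Continuous f) (hg : Continuous g)
    (h : ∀ t, 0 < t → HasDerivAt f (f' t) t) (h' : ∀ t, 0 < t → HasDerivAt g (f' t) t) (h0 : f 0 = g 0) {t : ℝ} (ht : 0 < t) :
    f t = g t := by
  obtain ⟨s, hs, hs'⟩ := exists_hasDerivAt_eq_slope (fun t => f t - g t) (fun t => f' t - f' t) ht
    (hf.sub hg).continuousOn fun s hs => (h s hs.1).sub (h' s hs.1)
  rw [sub_self, h0, sub_self, sub_zero, sub_zero, eq_comm, div_eq_zero_iff] at hs'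
  linarith [hs'.resolve_right ht.ne']

theorem Obst.hasDerivAt_dd_of_comp_inner {C : ℝ} {v : Euc N → ℝ} (h : Obst C v univ) {e : Euc N} (he : ‖e‖ = 1)
    (hv : ∀ x, v x = v (⟪x, e⟫ • e)) (hpos : ∀ x, 0 < ⟪x, e⟫ → v x ≠ 0) {t : ℝ} (ht : 0 < t) :
    HasDerivAt (fun s : ℝ => _root_.dd e v (s • e)) 1 t := by
  have hd := h.differentiable
  have hfd : ∀ x, HasFDerivAt v (_root_.dd e v (⟪x, e⟫ • e) • innerSL ℝ e) x := fun x => by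
    have h1 := hasDerivAt_line hd 0 e ⟪x, e⟫
    simp only [zero_add] at h1
    have h2 := hasFDerivAt_comp_inner h1
    rwa [← funext hv] at h2
  have hdd : ∀ a x, _root_.dd a v x = ⟪a, e⟫ * _root_.dd e v (⟪x, e⟫ • e) := fun a x => by
    rw [_root_.dd, (hfd x).fderiv, smul_apply, innerSL_apply_apply, smul_eq_mul, mul_comm, real_inner_comm]
  have hw : WeakLap v (fun _ => 1) {x | 0 < ⟪x, e⟫} := h.weak.mono fun x hx => ⟨mem_univ x, fun hs => hpos x hx hs.1⟩
  have hop : IsOpen {x : Euc N | 0 < ⟪x, e⟫} := isOpen_lt continuous_const (by fun_prop)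
  have hR : 0 < t / 2 := half_pos ht
  have hsub : ∀ x : Euc N, t / 2 < ⟪x, e⟫ → closedBall x (t / 2) ⊆ {x | 0 < ⟪x, e⟫} := fun x hx y hy => by
    rw [mem_closedBall', dist_eq_norm] at hy
    have h1 := real_inner_le_norm (x - y) e
    rw [he, inner_sub_left] at h1
    change 0 < ⟪y, e⟫
    linarith
  set G := Tk rho (t / 2) (_root_.dd e v) with hG
  have hGe : ∀ x : Euc N, t / 2 < ⟪x, e⟫ → G x = _root_.dd e v (⟪x, e⟫ • e) := fun x hx => by
    rw [hG, hw.Tk_rho_dd_eq hop h.contDiff hR (hsub x hx), hdd, real_inner_self_eq_norm_sq, he]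
    ring
  have hGd : Differentiable ℝ G :=
    (contDiff_Tk krn_rho hR (continuous_dd h.contDiff e).locallyIntegrable).differentiable (by simp)
  have hte : ∀ s : ℝ, ⟪s • e, e⟫ = s := fun s => by
    rw [real_inner_smul_left, real_inner_self_eq_norm_sq, he]
    ring
  have h1 := hasDerivAt_line hGd 0 e t
  simp only [zero_add] at h1
  have h2 : HasDerivAt (fun s : ℝ => _root_.dd e v (s • e)) (_root_.dd e G (t • e)) t := by
    refine h1.congr_of_eventuallyEq ?_
    filter_upwards [lt_mem_nhds (half_lt_self ht)] with s hs
    rw [hGe _ (by rwa [hte]), hte]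
  have h3 : HasFDerivAt G (_root_.dd e G (t • e) • innerSL ℝ e) (t • e) := by
    have h4 : HasFDerivAt (fun x : Euc N => _root_.dd e v (⟪x, e⟫ • e)) (_root_.dd e G (t • e) • innerSL ℝ e) (t • e) :=
      hasFDerivAt_comp_inner (f := fun s : ℝ => _root_.dd e v (s • e)) (by rwa [hte])
    refine h4.congr_of_eventuallyEq ?_
    have : {x : Euc N | t / 2 < ⟪x, e⟫} ∈ nhds (t • e) :=
      (isOpen_lt continuous_const (by fun_prop)).mem_nhds (by change t / 2 < ⟪t • e, e⟫; rw [hte]; linarith)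
    filter_upwards [this] with x hx using hGe x hx
  have h5 : ∀ a, Hes (t / 2) v a (t • e) = ⟪a, e⟫ ^ 2 * _root_.dd e G (t • e) := fun a => by
    have h6 : Tk rho (t / 2) (_root_.dd a v) = fun x => ⟪a, e⟫ * G x := by
      funext x
      have h7 : _root_.dd a v = fun x => ⟪a, e⟫ * _root_.dd e v x := by
        funext x
        rw [hdd a x, hdd e x, real_inner_self_eq_norm_sq, he]
        ring
      rw [h7, Tk_const_mul]
    rw [Hes_eq_dd_Tk hR h.contDiff, h6]
    have h8 := h3.const_mul ⟪a, e⟫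
    rw [_root_.dd, h8.fderiv, smul_apply, smul_apply, innerSL_apply_apply, smul_eq_mul, smul_eq_mul, real_inner_comm e a]
    ring
  have h6 := hw.sum_Hes h.contDiff.continuous.locallyIntegrable hR (hsub (t • e) (by rw [hte]; linarith))
  rw [Finset.sum_congr rfl fun i _ => h5 _, ← Finset.sum_mul, Tk_const, integral_rho] at h6
  have h7 : ∑ i : Fin N, ⟪(EuclideanSpace.single i (1 : ℝ) : Euc N), e⟫ ^ 2 = 1 := by
    have := EuclideanSpace.real_norm_sq_eq e
    rw [he] at this
    simpa [EuclideanSpace.inner_single_left] using this.symm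
  rw [h7, one_mul, one_mul] at h6
  rwa [h6] at h2

theorem Obst.eq_halfSpace {C c : ℝ} {v : Euc N → ℝ} (h : Obst C v univ) (hv : ConvexOn ℝ univ v)
    (hv0 : ∀ x, 0 ≤ v x) {e : Euc N} (he : ‖e‖ = 1) (hz : ∀ x, ⟪x, e⟫ ≤ 0 → v x = 0) (hc : 0 < c) (hn : Nondeg c v 0) (x : Euc N) :
    v x = (max ⟪x, e⟫ 0) ^ 2 / 2 ∧ fderiv ℝ v x = max ⟪x, e⟫ 0 • innerSL ℝ e := by
  have heq := eq_comp_inner_of_orthogonal he fun x y hy => hv.add_le_of_orthogonal h.differentiable.continuous he hz (x := x) hy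
  have hte : ∀ s : ℝ, ⟪s • e, e⟫ = s := fun s => by
    rw [real_inner_smul_left, real_inner_self_eq_norm_sq, he]
    ring
  have hsing : ∀ t : ℝ, t ≤ 0 → t • e ∈ sing v := fun t ht => mem_sing_of_eq_zero hv0 (hz _ (by rwa [hte]))
  have hpos : ∀ x, 0 < ⟪x, e⟫ → v x ≠ 0 := fun x hx h0 => by
    obtain ⟨y, hy, hy'⟩ := hn ⟪x, e⟫ hx
    have hvy : v y ≠ 0 := fun h => by
      rw [h, abs_zero] at hy'
      have : 0 < c * ⟪x, e⟫ ^ 2 := by positivity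
      linarith
    have hy0 : 0 < ⟪y, e⟫ := by
      by_contra hcon
      exact hvy (hz y (not_lt.1 hcon))
    have hyx : ⟪y, e⟫ < ⟪x, e⟫ := by
      have := real_inner_le_norm y e
      rw [he, mul_one] at this
      exact this.trans_lt (mem_ball_zero_iff.1 hy)
    have h1 := hv.2 (mem_univ (⟪x, e⟫ • e)) (mem_univ (0 : Euc N)) (div_nonneg hy0.le hx.le)
      (sub_nonneg.2 ((div_le_one hx).2 hyx.le)) (add_sub_cancel _ _)
    rw [smul_zero, add_zero, smul_smul, div_mul_cancel₀ _ hx.ne', ← heq, ← heq, h0, hz 0 (by simp), smul_zero, smul_zero, add_zero] at h1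
    exact hvy (le_antisymm h1 (hv0 y))
  have hd := fun t ht => h.hasDerivAt_dd_of_comp_inner he heq hpos (t := t) ht
  have h00 := hsing 0 le_rfl
  have hg : ∀ t, 0 < t → _root_.dd e v (t • e) = t := fun t ht => by
    refine eqOn_of_hasDerivAt (f := fun t : ℝ => _root_.dd e v (t • e)) (g := id) (f' := fun _ => 1) ?_ continuous_id hd
      (fun t _ => hasDerivAt_id t) ?_ ht
    · exact (continuous_dd h.contDiff e).comp (by fun_prop)
    · rw [_root_.dd, h00.2]
      rfl
  have hline := fun t => hasDerivAt_line h.differentiable 0 e t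
  simp only [zero_add] at hline
  have hF : ∀ t, 0 < t → v (t • e) = t ^ 2 / 2 := fun t ht => by
    refine eqOn_of_hasDerivAt (f := fun t : ℝ => v (t • e)) (g := fun t => t ^ 2 / 2) (f' := id) ?_ (by fun_prop) (fun t ht => ?_)
      (fun t _ => ?_) ?_ ht
    · exact h.differentiable.continuous.comp (by fun_prop)
    · exact (hline t).congr_deriv (hg t ht)
    · exact ((hasDerivAt_pow 2 t).div_const 2).congr_deriv (by simp)
    · simpa using h00.1
  have hfd : HasFDerivAt v (_root_.dd e v (⟪x, e⟫ • e) • innerSL ℝ e) x := by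
    have h2 := hasFDerivAt_comp_inner (e := e) (x := x) (hline ⟪x, e⟫)
    rwa [← funext heq] at h2
  rcases le_or_gt ⟪x, e⟫ 0 with hx | hx
  · have := mem_sing_of_eq_zero hv0 (hz x hx)
    rw [max_eq_right hx, this.1, this.2]
    simp
  · rw [max_eq_left hx.le, hfd.fderiv, hg _ hx, heq, hF _ hx]
    exact ⟨rfl, rfl⟩

/-- `w` is `η`-close in `C¹` on the unit ball to the half-space solution in direction `ν`. -/
def Flat (η : ℝ) (w : Euc N → ℝ) (ν : Euc N) : Prop :=
  ∀ x ∈ ball (0 : Euc N) 1, |w x - (max ⟪x, ν⟫ 0) ^ 2 / 2| ≤ η ∧ ‖fderiv ℝ w x - max ⟪x, ν⟫ 0 • innerSL ℝ ν‖ ≤ η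

theorem Obst.exists_halfSpace_blowUp {C c : ℝ} (hC : 0 ≤ C) (hc : 0 < c) {u : Euc N → ℝ} (h : Obst C u univ)
    (hS : volume (sing u) ≠ 0) (h0 : 0 ∈ sing u) (hn : Nondeg c u 0) {η : ℝ} (hη : 0 < η) :
    ∃ r : ℝ, 0 < r ∧ ∃ ν : Euc N, ‖ν‖ = 1 ∧ Flat η (_root_.resc 0 r u) ν := by
  have hconv := h.convexOn hC hS
  have hu0 := hconv.nonneg_of_mem_sing h.differentiable h0
  have hSc := hconv.convex_sing hu0
  have hmem : ∀ k x, rn k • x ∈ sing u → x ∈ sing (_root_.resc 0 (rn k) u) := fun k x hx => by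
    rw [sing_resc h.differentiable (rn_pos k), mem_preimage, zero_add]
    exact hx
  have hob : ∀ k, Obst C (_root_.resc 0 (rn k) u) univ := fun k => h.resc (rn_pos k) 0
  obtain ⟨v, hv⟩ := exists_cv hC (hyperfilter ℕ) (u := fun k => _root_.resc 0 (rn k) u) (A := 0)
    (fun R => Eventually.of_forall fun k => (hob k).mono (subset_univ _))
    (Eventually.of_forall fun k => ⟨0, hmem k 0 (by rwa [smul_zero]), norm_zero.le⟩)
  have hvo := hv.obst
  have hPv : tcone (sing u) ⊆ sing v := fun x hx =>
    hv.mem_sing tendsto_const_nhds (((eventually_of_mem_tcone hSc h0 hx).mono fun k hk => hmem k x hk).filter_mono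
      Nat.hyperfilter_le_atTop)
  have hvc : ConvexOn ℝ univ v := hvo.convexOn hC fun h => hS (measure_mono_null (subset_tcone.trans hPv) h)
  have h0v : (0 : Euc N) ∈ sing v := hPv (subset_tcone h0)
  have hv0 := hvc.nonneg_of_mem_sing hvo.differentiable h0v
  have hvn : Nondeg (c / 2) v 0 := hv.nondeg hc fun r hr => Eventually.of_forall fun k => hn.resc (rn_pos k) r hr
  have hcl := isClosed_sing hvo.contDiff
  obtain ⟨e, he, heP, hPe⟩ := exists_polar_direction (P := tcone (sing u)) (fun x hx t ht => smul_mem_tcone hSc h0 hx ht)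
    (fun x hx y hy => add_mem_tcone hSc h0 hx hy)
    ((hSc.nonempty_interior_of_volume_ne_zero hS).mono (interior_mono subset_tcone)) (by
      intro h
      obtain ⟨x, -, hx⟩ := hvn 1 one_pos
      have := (hPv (h ▸ mem_univ x)).1
      rw [this, abs_zero] at hx
      linarith)
  have hPsub : ∀ x ∈ tcone (sing u), ∀ t : ℝ, 0 ≤ t → x - t • e ∈ tcone (sing u) := fun x hx t ht => by
    rcases ht.eq_or_lt with rfl | ht
    · simpa using hx
    · have := add_mem_tcone hSc h0 hx (smul_mem_tcone hSc h0 (interior_subset heP) ht)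
      rwa [smul_neg, ← sub_eq_add_neg] at this
  have hneg : ∀ x, ⟪x, e⟫ < 0 → x ∈ sing v := fun x hx => by
    rw [← hcl.closure_eq, Metric.mem_closure_iff]
    intro ε hε
    obtain ⟨y, hy, hyP⟩ := exists_mem_ball_of_inner_neg (measurableSet_tcone (isClosed_sing h.contDiff).measurableSet) he
      (fun x hx t ht => smul_mem_tcone hSc h0 hx ht) hPsub hPe (h.Tk_chi_tcone_eq_zero hC hSc h0 he) heP hx hε
    exact ⟨y, hPv hyP, by rwa [dist_comm]⟩
  have hnonpos : ∀ x, ⟪x, e⟫ ≤ 0 → v x = 0 := fun x hx => by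
    have h1 : Tendsto (fun t : ℝ => v (x - t • e)) (nhdsWithin 0 (Ioi 0)) (nhds (v x)) := by
      have hcont : Continuous fun t : ℝ => v (x - t • e) := hvo.differentiable.continuous.comp (by fun_prop)
      have := hcont.tendsto 0
      simp only [zero_smul, sub_zero] at this
      exact this.mono_left nhdsWithin_le_nhds
    refine tendsto_nhds_unique h1 (tendsto_const_nhds.congr' ?_)
    filter_upwards [self_mem_nhdsWithin] with t ht
    refine (hneg _ ?_).1.symm
    rw [inner_sub_left, real_inner_smul_left, real_inner_self_eq_norm_sq, he]
    have : 0 < t := ht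
    linarith
  have hhalf := hvo.eq_halfSpace hvc hv0 he hnonpos (half_pos hc) hvn
  obtain ⟨k, hk1, hk2⟩ := ((hv.eventually_abs 1 hη).and (hv.eventually_fderiv 1 hη)).exists
  refine ⟨rn k, rn_pos k, e, he, fun x hx => ?_⟩
  rw [← (hhalf x).1, ← (hhalf x).2]
  exact ⟨hk1 x hx, hk2 x hx⟩

theorem CV.eventually_flat {C c : ℝ} (hc : 0 < c) {F : Ultrafilter ℕ} {u : ℕ → Euc N → ℝ} {v : Euc N → ℝ} (h : CV C F u v)
    (hS : volume (sing v) ≠ 0) (h0 : 0 ∈ sing v) (hn : Nondeg c v 0) {η : ℝ} (hη : 0 < η) :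
    ∃ r : ℝ, 0 < r ∧ ∃ ν : Euc N, ‖ν‖ = 1 ∧ ∀ᶠ j in (F : Filter ℕ), Flat η (_root_.resc 0 r (u j)) ν := by
  have hvo := h.obst
  obtain ⟨r, hr, ν, hν, hf⟩ := hvo.exists_halfSpace_blowUp h.nonneg hc hS h0 hn (half_pos hη)
  refine ⟨r, hr, ν, hν, ?_⟩
  filter_upwards [h.eventually_abs r (show 0 < r ^ 2 * (η / 2) by positivity),
    h.eventually_fderiv r (show 0 < r * (η / 2) by positivity), h.eventually_contDiff] with j h1 h2 h3 x hx
  have hrx : (0 : Euc N) + r • x ∈ ball 0 r := by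
    rw [zero_add, mem_ball_zero_iff, norm_smul, Real.norm_eq_abs, _root_.abs_of_pos hr]
    exact mul_lt_of_lt_one_right hr (mem_ball_zero_iff.1 hx)
  have hfx := hf x hx
  constructor
  · have h4 : |_root_.resc 0 r (u j) x - _root_.resc 0 r v x| ≤ η / 2 := by
      unfold _root_.resc
      rw [← mul_sub, abs_mul, _root_.abs_of_pos (by positivity), inv_mul_le_iff₀ (by positivity)]
      exact h1 _ hrx
    exact (abs_sub_le _ (_root_.resc 0 r v x) _).trans (by linarith [hfx.1])
  · have h4 : ‖fderiv ℝ (_root_.resc 0 r (u j)) x - fderiv ℝ (_root_.resc 0 r v) x‖ ≤ η / 2 := by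
      rw [fderiv_resc hr _ _ (h3.differentiable one_ne_zero _), fderiv_resc hr _ _ (hvo.differentiable _), ← smul_sub, norm_smul,
        Real.norm_eq_abs, _root_.abs_of_pos (by positivity), inv_mul_le_iff₀ hr]
      exact h2 _ hrx
    exact (norm_sub_le_norm_sub_add_norm_sub _ (fderiv ℝ (_root_.resc 0 r v) x) _).trans (by linarith [hfx.2])

/-- On `D`, the set `Ω` is monotone in all directions making a small enough angle with `ν`. -/
def ConeMono (δ : ℝ) (Ω : Set (Euc N)) (ν : Euc N) (D : Set (Euc N)) : Prop :=
  ∀ p ∈ D, ∀ q ∈ D, δ * ‖p - q‖ ≤ ⟪p - q, ν⟫ → q ∈ Ω → p ∈ Ω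

theorem exists_forall_dd_ge (N : ℕ) [NeZero N] {δ : ℝ} (hδ : 0 < δ) (hδ1 : δ ≤ 1) : ∃ η₀, 0 < η₀ ∧
    ∀ (C η : ℝ) (w : Euc N → ℝ) (Ω : Set (Euc N)) (ν τ : Euc N), η ≤ η₀ → Free C w Ω (ball 0 1) → ‖ν‖ = 1 → Flat η w ν → ‖τ‖ = 1 →
      δ ≤ ⟪τ, ν⟫ → ∀ y ∈ ball (0 : Euc N) (1 / 2), δ * w y ≤ dd τ w y := by
  have hk := kM_pos (N := N)
  have hkq : kM N * qM N = cM N := div_mul_cancel₀ _ qM_pos.ne'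
  refine ⟨δ * kM N / 32, by positivity, fun C η w Ω ν τ hη h hν hf hτ hτν y hy => ?_⟩
  have hbase : ∀ x ∈ ball (0 : Euc N) 1, -(2 * η) ≤ dd τ w x - δ * w x := fun x hx => by
    have h1 := (hf x hx).1
    have h2 := ((fderiv ℝ w x - max ⟪x, ν⟫ 0 • innerSL ℝ ν).le_opNorm τ).trans
      (mul_le_mul_of_nonneg_right (hf x hx).2 (norm_nonneg τ))
    rw [hτ, mul_one, Real.norm_eq_abs] at h2
    have h3 : (fderiv ℝ w x - max ⟪x, ν⟫ 0 • innerSL ℝ ν) τ = dd τ w x - max ⟪x, ν⟫ 0 * ⟪τ, ν⟫ := by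
      rw [sub_apply, smul_apply, innerSL_apply_apply, smul_eq_mul, real_inner_comm τ ν]
      rfl
    rw [h3] at h2
    have hm1 : max ⟪x, ν⟫ 0 ≤ 2 := by
      have := real_inner_le_norm x ν
      rw [hν, mul_one] at this
      exact max_le (by linarith [mem_ball_zero_iff.1 hx]) (by norm_num)
    rw [_root_.abs_le] at h1 h2
    have hm0 : 0 ≤ max ⟪x, ν⟫ 0 := le_max_right _ _
    have h4 : max ⟪x, ν⟫ 0 * δ ≤ max ⟪x, ν⟫ 0 * ⟪τ, ν⟫ := mul_le_mul_of_nonneg_left hτν hm0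
    have h5 : δ * w x ≤ δ * (η + max ⟪x, ν⟫ 0 ^ 2 / 2) := mul_le_mul_of_nonneg_left (by linarith) hδ.le
    have h6 : 0 ≤ η := by linarith
    nlinarith [mul_nonneg (mul_nonneg hδ.le hm0) (sub_nonneg.2 hm1), mul_nonneg h6 (sub_nonneg.2 hδ1)]
  have hzero : ∀ x ∈ ball (0 : Euc N) 1, x ∉ Ω → dd τ w x - δ * w x = 0 := fun x hx hxΩ => by
    rw [dd, (h.zero x hx hxΩ).1, (h.zero x hx hxΩ).2]
    simp
  have hy1 : y ∈ ball (0 : Euc N) 1 := ball_subset_ball (by norm_num) hy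
  by_cases hyΩ : y ∈ Ω
  · have hop : IsOpen (Ω ∩ ball y (1 / 4)) := h.isOpen.inter isOpen_ball
    have hsub : closedBall y (1 / 4) ⊆ ball (0 : Euc N) 1 := fun x hx => by
      rw [mem_ball, mem_closedBall] at *
      linarith [dist_triangle x y 0]
    have hcd := continuous_dd h.contDiff τ
    have hcw := h.contDiff.continuous
    have hmin := le_of_Tk_rho_le hop (isBounded_ball.subset inter_subset_right)
      (v := fun x => (dd τ w x - δ * w x) - (-(δ * kM N)) * ‖x - y‖ ^ 2) (m := 0) (by fun_prop) (fun x hx => ?_) (fun x hx => ?_) y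
      ⟨hyΩ, mem_ball_self (by norm_num)⟩
    · simp only [sub_self, norm_zero] at hmin
      linarith
    · obtain ⟨s, hs, hsD⟩ := exists_closedBall_subset hop hx
      refine ⟨s, hs, hsD, le_of_eq ?_⟩
      have hsub' : closedBall x s ⊆ Ω ∩ ball 0 1 :=
        hsD.trans (inter_subset_inter_right _ (ball_subset_closedBall.trans hsub))
      have h1 := h.weak_one.Tk_rho_eq hcw hs hsub'
      have h2 := h.weak_one.Tk_rho_dd_eq (h.isOpen.inter isOpen_ball) h.contDiff hs hsub' τ
      rw [Tk_rho_add_sq (by fun_prop) hs, Tk_sub krn_rho hs hcd.locallyIntegrable (hcw.const_mul δ).locallyIntegrable,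
        Tk_const_mul, h1, h2]
      linear_combination δ * s ^ 2 * hkq
    · have hxc : x ∈ closedBall y (1 / 4) := closure_ball_subset_closedBall (closure_mono inter_subset_right hx.1)
      have hx1 := hsub hxc
      by_cases hxΩ : x ∈ Ω
      · have hxn : 1 / 4 ≤ ‖x - y‖ := by
          by_contra! hlt
          refine hx.2 ?_
          rw [hop.interior_eq]
          exact ⟨hxΩ, by rwa [mem_ball, dist_eq_norm]⟩
        have h1 : (1 / 4) ^ 2 ≤ ‖x - y‖ ^ 2 := by gcongr
        have h2 := mul_le_mul_of_nonneg_left h1 (mul_nonneg hδ.le hk.le)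
        linarith [hbase x hx1]
      · rw [hzero x hx1 hxΩ]
        have : 0 ≤ δ * kM N * ‖x - y‖ ^ 2 := by positivity
        linarith
  · linarith [hzero y hy1 hyΩ]

theorem exists_coneMono_of_flat (N : ℕ) [NeZero N] {δ θ : ℝ} (hδ : 0 < δ) (hδ1 : δ ≤ 1 / 2) (hθ : 0 < θ) (hθ1 : θ ≤ 1 / 8) :
    ∃ η₀, 0 < η₀ ∧ ∀ (C η : ℝ) (w : Euc N → ℝ) (Ω : Set (Euc N)) (ν : Euc N), η ≤ η₀ → Free C w Ω (ball 0 1) → ‖ν‖ = 1 →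
      Flat η w ν → ConeMono δ Ω ν (ball 0 (1 / 8)) ∧
        ∀ p ∈ ball (0 : Euc N) (1 / 2), (⟪p, ν⟫ ≤ -θ → p ∉ closure Ω) ∧ (θ ≤ ⟪p, ν⟫ → p ∈ Ω) := by
  obtain ⟨η₁, hη₁, hdir⟩ := exists_forall_dd_ge N hδ (by linarith)
  obtain ⟨c, hc, hnd⟩ := exists_nondeg N
  have hcM := cM_pos (N := N)
  refine ⟨min η₁ (min (c * θ ^ 2 / 2) (θ ^ 2 / 4)), by positivity, fun C η w Ω ν hη h hν hf => ?_⟩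
  have hη1 : η ≤ η₁ := hη.trans (min_le_left _ _)
  have hη2 : η ≤ c * θ ^ 2 / 2 := hη.trans ((min_le_right _ _).trans (min_le_left _ _))
  have hη3 : η ≤ θ ^ 2 / 4 := hη.trans ((min_le_right _ _).trans (min_le_right _ _))
  have hside : ∀ p ∈ ball (0 : Euc N) (1 / 2), (⟪p, ν⟫ ≤ -θ → p ∉ closure Ω) ∧ (θ ≤ ⟪p, ν⟫ → p ∈ Ω) := fun p hp => by
    rw [mem_ball_zero_iff] at hp
    constructor
    · intro hpν hpΩ
      have hsub : ball p θ ⊆ ball 0 1 := fun x hx => by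
        rw [mem_ball_zero_iff]
        rw [mem_ball, dist_eq_norm] at hx
        linarith [norm_le_norm_add_norm_sub' x p]
      obtain ⟨x, hx, hxw⟩ := hnd C w Ω (ball 0 1) p θ h hθ hsub hpΩ
      have h1 := (hf x (hsub hx)).1
      have h2 : ⟪x, ν⟫ ≤ 0 := by
        have h3 := real_inner_le_norm (x - p) ν
        rw [mem_ball, dist_eq_norm] at hx
        rw [hν, inner_sub_left] at h3
        linarith
      rw [max_eq_right h2] at h1
      have : 0 < c * θ ^ 2 := by positivity
      simp only [ne_eq, OfNat.ofNat_ne_zero, not_false_eq_true, zero_pow, zero_div, sub_zero] at h1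
      linarith
    · intro hpν
      by_contra hpΩ
      have hp1 : p ∈ ball (0 : Euc N) 1 := mem_ball_zero_iff.2 (by linarith)
      have h1 := (hf p hp1).1
      rw [(h.zero p hp1 hpΩ).1, max_eq_left (hθ.le.trans hpν), zero_sub, abs_neg, _root_.abs_of_nonneg (by positivity)] at h1
      have : θ ^ 2 ≤ ⟪p, ν⟫ ^ 2 := by gcongr
      nlinarith
  refine ⟨?_, hside⟩
  have hd : Differentiable ℝ w := h.contDiff.differentiable one_ne_zero
  have hsub2 : ball (0 : Euc N) (1 / 8) ⊆ ball 0 (1 / 2) := ball_subset_ball (by norm_num)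
  have hnn : ∀ p ∈ ball (0 : Euc N) (1 / 8), 0 ≤ w p := fun p hp => by
    rw [mem_ball_zero_iff] at hp
    have hline : ∀ t : ℝ, -(1 / 4) ≤ t → t ≤ 0 → p + t • ν ∈ ball (0 : Euc N) (1 / 2) := fun t ht ht0 => by
      have h1 := norm_add_le p (t • ν)
      rw [norm_smul, hν, Real.norm_eq_abs, _root_.abs_of_nonpos ht0] at h1
      rw [mem_ball_zero_iff]
      linarith
    have hder : ∀ t, HasDerivAt (fun t => Real.exp (-(δ * t)) * w (p + t • ν))
        (Real.exp (-(δ * t)) * (dd ν w (p + t • ν) - δ * w (p + t • ν))) t := fun t => by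
      have h1 := (((hasDerivAt_id t).const_mul δ).neg.exp).mul (hasDerivAt_line hd p ν t)
      refine h1.congr_deriv ?_
      simp only [id_eq, Pi.neg_apply]
      ring
    obtain ⟨t, ht, ht'⟩ := exists_hasDerivAt_eq_slope _ _ (show -(1 / 4 : ℝ) < 0 by norm_num)
      (fun t _ => (hder t).continuousAt.continuousWithinAt) fun t _ => hder t
    have hend : w (p + (-(1 / 4) : ℝ) • ν) = 0 := by
      have h1 := hline (-(1 / 4)) le_rfl (by norm_num)
      have h2 : p + (-(1 / 4) : ℝ) • ν ∉ closure Ω := by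
        refine (hside _ h1).1 ?_
        rw [inner_add_left, real_inner_smul_left, real_inner_self_eq_norm_sq, hν]
        have := real_inner_le_norm p ν
        rw [hν] at this
        linarith
      exact (h.zero _ (ball_subset_ball (by norm_num) h1) fun h => h2 (subset_closure h)).1
    have h3 := hdir C η w Ω ν ν hη1 h hν hf hν (by rw [real_inner_self_eq_norm_sq, hν]; linarith) _ (hline t ht.1.le ht.2.le)
    have h4 : 0 ≤ Real.exp (-(δ * t)) * (dd ν w (p + t • ν) - δ * w (p + t • ν)) :=
      mul_nonneg (Real.exp_pos _).le (by linarith)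
    rw [ht', hend] at h4
    simp only [mul_zero, neg_zero, Real.exp_zero, zero_smul, add_zero, one_mul, sub_zero] at h4
    by_contra! hneg
    have := div_neg_of_neg_of_pos hneg (show (0 : ℝ) < 0 - -(1 / 4) by norm_num)
    linarith
  have hmono : ∀ p ∈ ball (0 : Euc N) (1 / 8), ∀ q ∈ ball (0 : Euc N) (1 / 8), δ * ‖p - q‖ ≤ ⟪p - q, ν⟫ → w q ≤ w p := by
    intro p hp q hq hpq
    rcases eq_or_ne p q with rfl | hne
    · exact le_rfl
    have hn : 0 < ‖p - q‖ := norm_pos_iff.2 (sub_ne_zero.2 hne)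
    obtain ⟨t, ht, ht'⟩ := exists_hasDerivAt_eq_slope _ _ (show (0 : ℝ) < 1 by norm_num)
      (fun t _ => (hasDerivAt_line hd q (p - q) t).continuousAt.continuousWithinAt) fun t _ => hasDerivAt_line hd q (p - q) t
    have hx : q + t • (p - q) ∈ ball (0 : Euc N) (1 / 8) :=
      (convex_ball 0 (1 / 8)).add_smul_sub_mem hq hp ⟨ht.1.le, ht.2.le⟩
    have h1 := hdir C η w Ω ν (‖p - q‖⁻¹ • (p - q)) hη1 h hν hf
      (by rw [norm_smul, norm_inv, norm_norm, inv_mul_cancel₀ hn.ne'])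
      (by rw [real_inner_smul_left, ← div_eq_inv_mul, le_div_iff₀ hn]; exact hpq) _ (hsub2 hx)
    have h2 := (mul_nonneg hδ.le (hnn _ hx)).trans h1
    rw [dd_smul_dir] at h2
    have h3 : 0 ≤ dd (p - q) w (q + t • (p - q)) := nonneg_of_mul_nonneg_right h2 (inv_pos.2 hn)
    rw [ht'] at h3
    simp only [one_smul, zero_smul, add_zero, sub_zero, div_one, add_sub_cancel] at h3
    linarith
  have hpos : ∀ q ∈ ball (0 : Euc N) (1 / 8), q ∈ Ω → w q ≠ 0 := fun q hq hqΩ hw => by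
    obtain ⟨ε, hε, hb⟩ := Metric.isOpen_iff.1 (h.isOpen.inter isOpen_ball) q ⟨hqΩ, hq⟩
    have hz : ∀ x ∈ ball (q - (ε / 2) • ν) (ε / 6), x ∈ Ω ∩ ball 0 (1 / 8) ∧ w x = 0 := fun x hx => by
      rw [mem_ball, dist_eq_norm] at hx
      have h1 : q - x = (ε / 2) • ν - (x - (q - (ε / 2) • ν)) := by abel
      have h2 : ‖(ε / 2) • ν‖ = ε / 2 := by rw [norm_smul, hν, mul_one, Real.norm_eq_abs, _root_.abs_of_pos (by positivity)]
      have h3 : ‖q - x‖ ≤ ε / 2 + ε / 6 := by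
        rw [h1]
        exact (norm_sub_le _ _).trans (by linarith)
      have hxb := hb (show x ∈ ball q ε by rw [mem_ball', dist_eq_norm]; linarith)
      refine ⟨hxb, le_antisymm ?_ (hnn x hxb.2)⟩
      rw [← hw]
      refine hmono q hq x hxb.2 ?_
      have h4 := real_inner_le_norm (x - (q - (ε / 2) • ν)) ν
      rw [hν] at h4
      have h5 : ⟪q - x, ν⟫ = ε / 2 - ⟪x - (q - (ε / 2) • ν), ν⟫ := by
        rw [h1, inner_sub_left, real_inner_smul_left, real_inner_self_eq_norm_sq, hν]
        ring
      rw [h5]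
      nlinarith [norm_nonneg (q - x)]
    have hsub : closedBall (q - (ε / 2) • ν) (ε / 12) ⊆ ball (q - (ε / 2) • ν) (ε / 6) := closedBall_subset_ball (by linarith)
    have h1 := h.weak_one.Tk_rho_eq h.contDiff.continuous (show 0 < ε / 12 by positivity)
      (hsub.trans fun x hx => ⟨(hz x hx).1.1, ball_subset_ball (by norm_num) (hz x hx).1.2⟩)
    rw [Tk_congr (g := fun _ => 0) krn_rho (by positivity) fun y hy => (hz y (hsub (ball_subset_closedBall hy))).2, Tk_const,
      (hz _ (mem_ball_self (by positivity))).2] at h1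
    have : 0 < cM N * (ε / 12) ^ 2 := by positivity
    linarith
  intro p hp q hq hpq hqΩ
  by_contra hpΩ
  have h1 := hmono p hp q hq hpq
  rw [(h.zero p (ball_subset_ball (by norm_num) hp) hpΩ).1] at h1
  exact hpos q hq hqΩ (le_antisymm h1 (hnn q hq))

/-- The homeomorphism `x ↦ z + r • x` for `r ≠ 0`. -/
def affineHomeo (z : Euc N) {r : ℝ} (hr : r ≠ 0) : Euc N ≃ₜ Euc N :=
  (Homeomorph.smulOfNeZero r hr).trans (Homeomorph.addLeft z)

theorem preimage_affine_frontier (z : Euc N) {r : ℝ} (hr : r ≠ 0) (s : Set (Euc N)) :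
    (fun x => z + r • x) ⁻¹' frontier s = frontier ((fun x => z + r • x) ⁻¹' s) :=
  (affineHomeo z hr).preimage_frontier s

theorem ConeMono.of_preimage {δ b r : ℝ} (hr : 0 < r) {Ω : Set (Euc N)} {ν z : Euc N}
    (h : ConeMono δ ((fun x => z + r • x) ⁻¹' Ω) ν (ball 0 b)) : ConeMono δ Ω ν (ball z (r * b)) := by
  have hmem : ∀ p ∈ ball z (r * b), r⁻¹ • (p - z) ∈ ball (0 : Euc N) b ∧ z + r • (r⁻¹ • (p - z)) = p := fun p hp => by
    have h2 : z + r • (r⁻¹ • (p - z)) = p := by rw [smul_inv_smul₀ hr.ne', add_sub_cancel]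
    refine ⟨?_, h2⟩
    rw [← preimage_affine_ball hr z, mem_preimage, h2]
    exact hp
  intro p hp q hq hpq hqΩ
  obtain ⟨h1, h2⟩ := hmem p hp
  obtain ⟨h3, h4⟩ := hmem q hq
  have h5 : r⁻¹ • (p - z) - r⁻¹ • (q - z) = r⁻¹ • (p - q) := by rw [← smul_sub, sub_sub_sub_cancel_right]
  have := h _ h1 _ h3 (by
    rw [h5, norm_smul, real_inner_smul_left, Real.norm_eq_abs, _root_.abs_of_pos (inv_pos.2 hr)]
    nlinarith [inv_pos.2 hr]) (by rw [mem_preimage, h4]; exact hqΩ)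
  rwa [mem_preimage, h2] at this

/-- Points of the free boundary satisfy a two-sided cone estimate. -/
theorem ConeMono.inner_le {δ : ℝ} {Ω D : Set (Euc N)} {ν : Euc N} (h : ConeMono δ Ω ν D) (hD : IsOpen D)
    {p q : Euc N} (hp : p ∈ D) (hpΩ : p ∉ Ω) (hq : q ∈ D) (hqΩ : q ∈ closure Ω) : ⟪p - q, ν⟫ ≤ δ * ‖p - q‖ := by
  by_contra! hlt
  have ho : IsOpen (D ∩ {y | δ * ‖p - y‖ < ⟪p - y, ν⟫}) := hD.inter (isOpen_lt (by fun_prop) (by fun_prop))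
  obtain ⟨y, hy, hyΩ⟩ := mem_closure_iff.1 hqΩ _ ho ⟨hq, hlt⟩
  exact hpΩ (h p hp y hy.1 hy.2.le hyΩ)

theorem exists_cv_of_free [NeZero N] {C : ℝ} (hC : 0 ≤ C) (F : Ultrafilter ℕ) {u : ℕ → Euc N → ℝ} {Ω : ℕ → Set (Euc N)}
    (hf : ∀ R : ℝ, ∀ᶠ j in (F : Filter ℕ), Free C (u j) (Ω j) (ball 0 R))
    (h0 : ∀ j, (0 : Euc N) ∈ frontier (Ω j)) :
    ∃ v, CV C F u v ∧ 0 ∈ sing v ∧ ∃ c, 0 < c ∧ Nondeg c v 0 := by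
  have hs : ∀ᶠ j in (F : Filter ℕ), (0 : Euc N) ∈ sing (u j) := by
    filter_upwards [hf 1] with j hj
    exact hj.zero 0 (mem_ball_self one_pos) fun h => (h0 j).2 (by rwa [hj.isOpen.interior_eq])
  obtain ⟨v, hv⟩ := exists_cv hC F (A := 0) (fun R => (hf R).mono fun j hj => hj.obst)
    (hs.mono fun j hj => ⟨0, hj, by simp⟩)
  obtain ⟨c, hc, hn⟩ := exists_nondeg N
  refine ⟨v, hv, hv.mem_sing tendsto_const_nhds hs, c / 2, by positivity, hv.nondeg hc fun r hr => ?_⟩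
  filter_upwards [hf r] with j hj
  exact hn C (u j) (Ω j) _ 0 r hj hr subset_rfl (frontier_subset_closure (h0 j))

theorem exists_coneMono_of_cv [NeZero N] {δ θ c C : ℝ} (hδ : 0 < δ) (hδ1 : δ ≤ 1 / 2) (hθ : 0 < θ) (hθ1 : θ ≤ 1 / 8)
    {F : Ultrafilter ℕ} {u : ℕ → Euc N → ℝ} {Ω : ℕ → Set (Euc N)} {v : Euc N → ℝ}
    (hf : ∀ R : ℝ, ∀ᶠ j in (F : Filter ℕ), Free C (u j) (Ω j) (ball 0 R))
    (h : CV C F u v) (hS : volume (sing v) ≠ 0) (h0 : 0 ∈ sing v) (hc : 0 < c) (hn : Nondeg c v 0) :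
    ∃ r, 0 < r ∧ ∃ ν : Euc N, ‖ν‖ = 1 ∧ ∀ᶠ j in (F : Filter ℕ),
      Free C (resc 0 r (u j)) ((fun x => 0 + r • x) ⁻¹' Ω j) (ball 0 1) ∧
      ConeMono δ ((fun x => 0 + r • x) ⁻¹' Ω j) ν (ball 0 (1 / 8)) ∧
      ∀ p ∈ ball (0 : Euc N) (1 / 2), (⟪p, ν⟫ ≤ -θ → p ∉ closure ((fun x => 0 + r • x) ⁻¹' Ω j)) ∧
        (θ ≤ ⟪p, ν⟫ → p ∈ (fun x => 0 + r • x) ⁻¹' Ω j) := by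
  obtain ⟨η, hη, H⟩ := exists_coneMono_of_flat N hδ hδ1 hθ hθ1
  obtain ⟨r, hr, ν, hν, hfl⟩ := CV.eventually_flat hc h hS h0 hn hη
  refine ⟨r, hr, ν, hν, ?_⟩
  filter_upwards [hfl, hf r] with j hj hfj
  have hfr : Free C (resc 0 r (u j)) ((fun x => 0 + r • x) ⁻¹' Ω j) (ball 0 1) := by
    have := hfj.resc hr 0
    rwa [show ball (0 : Euc N) r = ball 0 (r * 1) by rw [mul_one], preimage_affine_ball hr] at this
  exact ⟨hfr, H C η _ _ ν le_rfl hfr hν hj⟩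

/-- At a free boundary point the cone of monotonicity opens up to a half-space. -/
theorem ConeMono.exists_ball [NeZero N] {C δ δ' ρ : ℝ} (hC : 0 ≤ C) (hδ1 : δ ≤ 1 / 2) (hδ'0 : 0 < δ')
    (hδ' : δ' ≤ 1 / 2) (hρ : ρ ≤ 1) {w : Euc N → ℝ} {Ω : Set (Euc N)} {ν z : Euc N} (hf : Free C w Ω (ball 0 1)) (hν : ‖ν‖ = 1)
    (hm : ConeMono δ Ω ν (ball 0 ρ)) (hz : z ∈ ball 0 ρ) (hzf : z ∈ frontier Ω) :
    ∃ s, 0 < s ∧ ∃ ν' : Euc N, ‖ν'‖ = 1 ∧ ConeMono δ' Ω ν' (ball z s) := by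
  have hzΩ : z ∉ Ω := fun h => hzf.2 (by rwa [hf.isOpen.interior_eq])
  have hev : ∀ R : ℝ, ∀ᶠ j in ((hyperfilter ℕ : Ultrafilter ℕ) : Filter ℕ), ball (0 : Euc N) R ⊆ (fun x => z + rn j • x) ⁻¹' ball 0 ρ := by
    intro R
    have hd : 0 < ρ - ‖z‖ := by rw [mem_ball_zero_iff] at hz; linarith
    have h1 : Tendsto (fun j => rn j * (|R| + 1)) atTop (nhds 0) := by
      simpa using (tendsto_rn.mono_right nhdsWithin_le_nhds).mul_const (|R| + 1)
    filter_upwards [Nat.hyperfilter_le_atTop (h1.eventually (gt_mem_nhds hd))] with j hj x hx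
    rw [mem_preimage, mem_ball_zero_iff]
    rw [mem_ball_zero_iff] at hx
    have h2 := norm_add_le z (rn j • x)
    rw [norm_smul, Real.norm_eq_abs, _root_.abs_of_pos (rn_pos j)] at h2
    nlinarith [rn_pos j, le_abs_self R]
  have hfr : ∀ R : ℝ, ∀ᶠ j in ((hyperfilter ℕ : Ultrafilter ℕ) : Filter ℕ),
      Free C (resc z (rn j) w) ((fun x => z + rn j • x) ⁻¹' Ω) (ball 0 R) := fun R =>
    (hev R).mono fun j hj => (hf.resc (rn_pos j) z).mono (hj.trans (preimage_mono (ball_subset_ball hρ)))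
  obtain ⟨v, hv, h0, c, hc, hn⟩ := exists_cv_of_free hC (hyperfilter ℕ) hfr fun j => by
    rw [← preimage_affine_frontier z (rn_pos j).ne']
    simpa using hzf
  have hcone : ball (-ν) (1 / 4) ⊆ sing v := fun x hx => by
    refine hv.mem_sing tendsto_const_nhds ?_
    filter_upwards [hev 2, hfr 2] with j hj hfj
    rw [mem_ball, dist_eq_norm, sub_neg_eq_add] at hx
    have hx2 : ‖x‖ ≤ 5 / 4 := by
      have := norm_sub_le (x + ν) ν
      rw [add_sub_cancel_right, hν] at this
      linarith
    have hxb : x ∈ ball (0 : Euc N) 2 := by rw [mem_ball_zero_iff]; linarith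
    refine hfj.zero x hxb fun hxΩ => hzΩ (hm z hz _ (hj hxb) ?_ hxΩ)
    have h1 : z - (z + rn j • x) = rn j • (-x) := by rw [smul_neg]; abel
    have h2 : ⟪-x, ν⟫ = 1 - ⟪x + ν, ν⟫ := by
      rw [inner_add_left, inner_neg_left, real_inner_self_eq_norm_sq, hν]
      ring
    have h3 := real_inner_le_norm (x + ν) ν
    rw [hν] at h3
    have h5 : δ * ‖x‖ ≤ ⟪-x, ν⟫ := by nlinarith [norm_nonneg x]
    rw [h1, norm_smul, norm_neg, real_inner_smul_left, Real.norm_eq_abs, _root_.abs_of_pos (rn_pos j)]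
    nlinarith [rn_pos j]
  have hS : volume (sing v) ≠ 0 := fun h =>
    (measure_ball_pos volume (-ν) (show (0 : ℝ) < 1 / 4 by norm_num)).ne' (measure_mono_null hcone h)
  obtain ⟨r, hr, ν', hν', H⟩ := exists_coneMono_of_cv hδ'0 hδ' (θ := 1 / 8) (by norm_num) le_rfl hfr hv hS h0 hc hn
  obtain ⟨j, hj⟩ := H.exists
  exact ⟨rn j * (r * (1 / 8)), by have := rn_pos j; positivity, ν', hν', (hj.2.1.of_preimage hr).of_preimage (rn_pos j)⟩

theorem contDiffOn_one_of_approx {E : Type*} [NormedAddCommGroup E] [NormedSpace ℝ E] {g : E → ℝ} {U : Set E} (hU : IsOpen U)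
    (h : ∀ x ∈ U, ∀ ε : ℝ, 0 < ε → ∃ ℓ : E →L[ℝ] ℝ, ∃ s, 0 < s ∧ ∀ y ∈ ball x s, ∀ z ∈ ball x s,
      |g y - g z - ℓ (y - z)| ≤ ε * ‖y - z‖) : ContDiffOn ℝ 1 g U := by
  have key : ∀ x ∈ U, ∃ L : E →L[ℝ] ℝ, HasFDerivAt g L x := by
    intro x hx
    choose ℓ s hs hb using fun n => h x hx (rn n) (rn_pos n)
    have hd : ∀ m n, ‖ℓ m - ℓ n‖ ≤ rn m + rn n := fun m n => by
      refine ContinuousLinearMap.opNorm_le_of_ball (lt_min (hs m) (hs n)) (by have := rn_pos m; have := rn_pos n; positivity) fun y hy => ?_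
      rw [mem_ball_zero_iff] at hy
      have hm := hb m (x + y) (by rw [mem_ball, dist_eq_norm, add_sub_cancel_left]; exact hy.trans_le (min_le_left _ _)) x
        (mem_ball_self (hs m))
      have hn := hb n (x + y) (by rw [mem_ball, dist_eq_norm, add_sub_cancel_left]; exact hy.trans_le (min_le_right _ _)) x
        (mem_ball_self (hs n))
      rw [add_sub_cancel_left] at hm hn
      rw [_root_.sub_apply, Real.norm_eq_abs, show ℓ m y - ℓ n y = (g (x + y) - g x - ℓ n y) - (g (x + y) - g x - ℓ m y) by ring]
      refine (abs_sub _ _).trans ?_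
      linarith
    have h0 : Tendsto rn atTop (nhds 0) := tendsto_rn.mono_right nhdsWithin_le_nhds
    have hanti : ∀ {m n}, m ≤ n → rn n ≤ rn m := fun hmn => pow_le_pow_of_le_one (by norm_num) (by norm_num) hmn
    have hcau : CauchySeq ℓ := cauchySeq_of_le_tendsto_0 (fun n => rn n + rn n)
      (fun n m k hn hm => by
        rw [dist_eq_norm]
        exact (hd n m).trans (add_le_add (hanti hn) (hanti hm))) (by simpa using h0.add h0)
    obtain ⟨L, hL⟩ := cauchySeq_tendsto_of_complete hcau
    have hdL : ∀ n, ‖ℓ n - L‖ ≤ rn n := fun n => by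
      have h1 : Tendsto (fun m => ‖ℓ n - ℓ m‖) atTop (nhds ‖ℓ n - L‖) := (tendsto_const_nhds.sub hL).norm
      exact le_of_tendsto_of_tendsto h1 (by simpa using h0.const_add (rn n)) (Eventually.of_forall fun m => hd n m)
    refine ⟨L, hasFDerivAt_iff_isLittleO.2 (Asymptotics.isLittleO_iff.2 fun ε hε => ?_)⟩
    obtain ⟨n, hn⟩ := (h0.eventually (gt_mem_nhds (show 0 < ε / 2 by positivity))).exists
    filter_upwards [ball_mem_nhds x (hs n)] with y hy
    have h1 := hb n y hy x (mem_ball_self (hs n))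
    have h2 := (ℓ n - L).le_opNorm (y - x)
    rw [_root_.sub_apply, Real.norm_eq_abs] at h2
    rw [Real.norm_eq_abs, show g y - g x - L (y - x) = (g y - g x - ℓ n (y - x)) + (ℓ n (y - x) - L (y - x)) by ring]
    refine (abs_add_le _ _).trans ?_
    nlinarith [hdL n, norm_nonneg (y - x)]
  rw [← zero_add (1 : WithTop ℕ∞), contDiffOn_succ_iff_fderiv_of_isOpen hU, contDiffOn_zero]
  refine ⟨fun x hx => (key x hx).choose_spec.differentiableAt.differentiableWithinAt, by simp, fun x hx => ?_⟩
  refine ContinuousAt.continuousWithinAt (Metric.continuousAt_iff.2 fun ε hε => ?_)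
  obtain ⟨ℓ, s, hs, hb⟩ := h x hx (ε / 3) (by positivity)
  obtain ⟨t, ht, htU⟩ := Metric.isOpen_iff.1 hU x hx
  have hfd : ∀ y ∈ ball x (min s t), ‖fderiv ℝ g y - ℓ‖ ≤ ε / 3 := fun y hy => by
    have hys : y ∈ ball x s := ball_subset_ball (min_le_left _ _) hy
    obtain ⟨L, hL⟩ := key y (htU (ball_subset_ball (min_le_right _ _) hy))
    have hd : HasFDerivAt (fun z => g z - ℓ z) (fderiv ℝ g y - ℓ) y := hL.differentiableAt.hasFDerivAt.sub ℓ.hasFDerivAt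
    refine hd.le_of_lip' (by positivity) ?_
    filter_upwards [isOpen_ball.mem_nhds hys] with z hz
    have := hb z hz y hys
    rw [map_sub] at this
    rw [Real.norm_eq_abs]
    convert this using 2
    ring
  refine ⟨min s t, lt_min hs ht, fun {y} hy => ?_⟩
  have h1 := hfd y hy
  have h2 := hfd x (mem_ball_self (lt_min hs ht))
  rw [dist_eq_norm, ← sub_sub_sub_cancel_right _ _ ℓ]
  exact (norm_sub_le _ _).trans_lt (by linarith)

set_option maxHeartbeats 1000000 in
/-- A monotone open set whose boundary has a tangent plane, uniformly near every point, is bounded by a `C¹` graph. -/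
theorem ConeMono.isC1Graph {Ω : Set (Euc N)} {ν : Euc N} (hΩ : IsOpen Ω) (hν : ‖ν‖ = 1) (hm : ConeMono (1 / 8) Ω ν (ball 0 (1 / 8)))
    (hlo : ∀ p ∈ ball (0 : Euc N) (1 / 8), ⟪p, ν⟫ ≤ -(1 / 32) → p ∉ Ω)
    (hhi : ∀ p ∈ ball (0 : Euc N) (1 / 8), 1 / 32 ≤ ⟪p, ν⟫ → p ∈ Ω)
    (htan : ∀ z ∈ frontier Ω, z ∈ ball (0 : Euc N) (1 / 8) → ∀ δ : ℝ, 0 < δ → δ ≤ 1 / 2 →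
      ∃ s, 0 < s ∧ ∃ ν' : Euc N, ‖ν'‖ = 1 ∧ ConeMono δ Ω ν' (ball z s)) : IsC1Graph N Ω (ball 0 (1 / 32)) := by
  have hνν : ⟪ν, ν⟫ = 1 := by rw [real_inner_self_eq_norm_sq, hν, one_pow]
  obtain ⟨P, hP⟩ : ∃ P : Euc N →L[ℝ] Euc N, ∀ y, P y = y - ⟪y, ν⟫ • ν :=
    ⟨ContinuousLinearMap.id ℝ _ - (innerSL ℝ ν).smulRight ν, fun y => by simp [real_inner_comm]⟩
  have hPν : ∀ y, ⟪P y, ν⟫ = 0 := fun y => by rw [hP, inner_sub_left, real_inner_smul_left, hνν, mul_one, sub_self]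
  have hPP : ∀ y, P (P y) = P y := fun y => by rw [hP (P y), hPν, zero_smul, sub_zero]
  have hPn : ∀ y, ‖P y‖ ≤ ‖y‖ := fun y => by
    have h1 : ‖P y‖ ^ 2 = ‖y‖ ^ 2 - ⟪y, ν⟫ ^ 2 := by
      rw [← real_inner_self_eq_norm_sq, hP, inner_sub_left, inner_sub_right, inner_sub_right, real_inner_smul_left, real_inner_smul_left,
        real_inner_smul_right, real_inner_smul_right, hνν, real_inner_self_eq_norm_sq, real_inner_comm y ν]
      ring
    exact le_of_sq_le_sq (by nlinarith [sq_nonneg ⟪y, ν⟫]) (norm_nonneg y)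
  have hPadd : ∀ y, P y + ⟪y, ν⟫ • ν = y := fun y => by rw [hP, sub_add_cancel]
  have hball : ∀ (y : Euc N) (t : ℝ), ‖P y‖ < 1 / 16 → |t| < 1 / 16 → P y + t • ν ∈ ball (0 : Euc N) (1 / 8) := fun y t hy ht => by
    rw [mem_ball_zero_iff]
    have := norm_add_le (P y) (t • ν)
    rw [norm_smul, hν, mul_one, Real.norm_eq_abs] at this
    linarith
  have hinner : ∀ (y : Euc N) (t : ℝ), ⟪P y + t • ν, ν⟫ = t := fun y t => by rw [inner_add_left, hPν, real_inner_smul_left, hνν]; ring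
  set K : Euc N → Set ℝ := fun y => Icc (-(1 / 32)) (1 / 32) ∩ (fun t : ℝ => P y + t • ν) ⁻¹' Ωᶜ with hK
  set g : Euc N → ℝ := fun y => sSup (K y) with hg
  have hKc : ∀ y, IsCompact (K y) := fun y => isCompact_Icc.inter_right (hΩ.isClosed_compl.preimage (by fun_prop))
  have hgK : ∀ y, ‖P y‖ < 1 / 16 → g y ∈ K y := fun y hy =>
    (hKc y).sSup_mem ⟨-(1 / 32), ⟨by norm_num, by norm_num⟩, hlo _ (hball y _ hy (by norm_num [_root_.abs_of_neg])) (hinner y _).le⟩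
  have hga : ∀ y, ‖P y‖ < 1 / 16 → |g y| < 1 / 16 := fun y hy => by
    have := (hgK y hy).1
    rw [_root_.abs_lt]
    constructor <;> linarith [this.1, this.2]
  have hchar : ∀ (y : Euc N) (t : ℝ), ‖P y‖ < 1 / 16 → |t| < 1 / 16 → (P y + t • ν ∈ Ω ↔ g y < t) := fun y t hy ht => by
    constructor
    · intro h
      by_contra! hle
      refine (hgK y hy).2 (hm _ (hball y _ hy (hga y hy)) _ (hball y t hy ht) ?_ h)
      rw [add_sub_add_left_eq_sub, ← sub_smul, norm_smul, real_inner_smul_left, hν, hνν, Real.norm_eq_abs,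
        _root_.abs_of_nonneg (sub_nonneg.2 hle)]
      linarith
    · intro h
      by_contra hn
      have ht2 : t < 1 / 32 := by
        by_contra! ht2
        exact hn (hhi _ (hball y t hy ht) (by rwa [hinner]))
      exact absurd (le_csSup (hKc y).bddAbove ⟨⟨(hgK y hy).1.1.trans h.le, ht2.le⟩, hn⟩) (not_le.2 h)
  have hfr : ∀ y, ‖P y‖ < 1 / 16 → P y + g y • ν ∈ frontier Ω := fun y hy => by
    rw [frontier, hΩ.interior_eq]
    refine ⟨?_, (hgK y hy).2⟩
    have h1 : Tendsto (fun t : ℝ => P y + t • ν) (nhdsWithin (g y) (Ioi (g y))) (nhds (P y + g y • ν)) :=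
      (Continuous.tendsto (by fun_prop) _).mono_left nhdsWithin_le_nhds
    refine mem_closure_of_tendsto h1 ?_
    filter_upwards [self_mem_nhdsWithin, nhdsWithin_le_nhds (Ioo_mem_nhds (_root_.abs_lt.1 (hga y hy)).1 (_root_.abs_lt.1 (hga y hy)).2)]
      with t ht ht2
    exact (hchar y t hy (_root_.abs_lt.2 ht2)).2 ht
  have hGb : ∀ y, ‖P y‖ < 1 / 16 → P y + g y • ν ∈ ball (0 : Euc N) (1 / 8) := fun y hy => hball y _ hy (hga y hy)
  have hlip1 : ∀ y, ‖P y‖ < 1 / 16 → ∀ z, ‖P z‖ < 1 / 16 → g y - g z ≤ 1 / 8 * (‖y - z‖ + |g y - g z|) := fun y hy z hz => by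
    have h1 := hm.inner_le isOpen_ball (hGb y hy) (hgK y hy).2 (hGb z hz) (frontier_subset_closure (hfr z hz))
    rw [inner_sub_left, hinner, hinner] at h1
    have h2 : P y + g y • ν - (P z + g z • ν) = P (y - z) + (g y - g z) • ν := by rw [map_sub, sub_smul]; abel
    have h3 := norm_add_le (P (y - z)) ((g y - g z) • ν)
    rw [norm_smul, hν, mul_one, Real.norm_eq_abs] at h3
    rw [h2] at h1
    linarith [hPn (y - z)]
  have hlip : ∀ y, ‖P y‖ < 1 / 16 → ∀ z, ‖P z‖ < 1 / 16 → |g y - g z| ≤ 1 / 7 * ‖y - z‖ := fun y hy z hz => by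
    have h1 := hlip1 y hy z hz
    have h2 := hlip1 z hz y hy
    rw [norm_sub_rev z y, abs_sub_comm] at h2
    rcases abs_cases (g y - g z) with h | h <;> linarith
  have hGlip : ∀ y, ‖P y‖ < 1 / 16 → ∀ z, ‖P z‖ < 1 / 16 → ‖P y + g y • ν - (P z + g z • ν)‖ ≤ 2 * ‖y - z‖ := fun y hy z hz => by
    have h2 : P y + g y • ν - (P z + g z • ν) = P (y - z) + (g y - g z) • ν := by rw [map_sub, sub_smul]; abel
    rw [h2]
    refine (norm_add_le _ _).trans ?_
    rw [norm_smul, hν, mul_one, Real.norm_eq_abs]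
    linarith [hPn (y - z), hlip y hy z hz, norm_nonneg (y - z)]
  have hUo : IsOpen {y | ‖P y‖ < 1 / 16} := isOpen_lt (by fun_prop) continuous_const
  have hgC : ContDiffOn ℝ 1 g {y | ‖P y‖ < 1 / 16} := by
    refine contDiffOn_one_of_approx hUo fun x hx ε hε => ?_
    obtain ⟨δ, hδ, hδ1, hδε⟩ : ∃ δ : ℝ, 0 < δ ∧ δ ≤ 1 / 8 ∧ 4 * δ ≤ ε :=
      ⟨min (1 / 8) (ε / 4), by positivity, min_le_left _ _, by linarith [min_le_right (1 / 8 : ℝ) (ε / 4)]⟩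
    obtain ⟨s, hs, ν', hν', hcone⟩ := htan _ (hfr x hx) (hGb x hx) δ hδ (by linarith)
    obtain ⟨t, ht, htU⟩ := Metric.isOpen_iff.1 hUo x hx
    have hr : 0 < min (s / 2) t := by positivity
    have hU : ∀ y ∈ ball x (min (s / 2) t), ‖P y‖ < 1 / 16 := fun y hy => htU (ball_subset_ball (min_le_right _ _) hy)
    have hGs : ∀ y ∈ ball x (min (s / 2) t), P y + g y • ν ∈ ball (P x + g x • ν) s := fun y hy => by
      rw [mem_ball, dist_eq_norm]
      have h1 := hGlip y (hU y hy) x hx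
      have h2 := ball_subset_ball (min_le_left _ _) hy
      rw [mem_ball, dist_eq_norm] at h2
      linarith
    set b : Euc N := ν' - ⟪ν', ν⟫ • ν with hb
    have hexp : ∀ y z, ⟪P y + g y • ν - (P z + g z • ν), ν'⟫ = ⟪b, y - z⟫ + (g y - g z) * ⟪ν', ν⟫ := fun y z => by
      simp only [hb, hP, inner_sub_left, inner_add_left, inner_sub_right, real_inner_smul_left]
      rw [real_inner_comm y ν', real_inner_comm z ν', real_inner_comm ν' ν, real_inner_comm ν y, real_inner_comm ν z]
      ring
    have hle : ∀ y ∈ ball x (min (s / 2) t), ∀ z ∈ ball x (min (s / 2) t),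
        ⟪b, y - z⟫ + (g y - g z) * ⟪ν', ν⟫ ≤ 2 * δ * ‖y - z‖ := fun y hy z hz => by
      have h1 := hcone.inner_le isOpen_ball (hGs y hy) (hgK y (hU y hy)).2 (hGs z hz) (frontier_subset_closure (hfr z (hU z hz)))
      rw [hexp] at h1
      have := hGlip y (hU y hy) z (hU z hz)
      nlinarith
    have hab : ∀ y ∈ ball x (min (s / 2) t), ∀ z ∈ ball x (min (s / 2) t),
        |⟪b, y - z⟫ + (g y - g z) * ⟪ν', ν⟫| ≤ 2 * δ * ‖y - z‖ := fun y hy z hz => by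
      have h1 := hle z hz y hy
      rw [← neg_sub y z, inner_neg_right, norm_neg] at h1
      exact _root_.abs_le.2 ⟨by linarith, hle y hy z hz⟩
    have hbc : ‖b‖ ^ 2 + ⟪ν', ν⟫ ^ 2 = 1 := by
      rw [← real_inner_self_eq_norm_sq, hb, inner_sub_left, inner_sub_right, inner_sub_right, real_inner_smul_left, real_inner_smul_left,
        real_inner_smul_right, real_inner_smul_right, hνν, real_inner_self_eq_norm_sq, hν', real_inner_comm ν' ν]
      ring
    have hbsmall : ‖b‖ ≤ 2 * δ + |⟪ν', ν⟫| / 7 := by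
      rcases eq_or_ne b 0 with hb0 | hb0
      · rw [hb0, norm_zero]
        positivity
      have hbn : 0 < ‖b‖ := norm_pos_iff.2 hb0
      set τ := min (s / 2) t / 2 / ‖b‖ with hτ
      have hτ0 : 0 < τ := by positivity
      have hτb : ‖τ • b‖ = τ * ‖b‖ := by rw [norm_smul, Real.norm_eq_abs, _root_.abs_of_pos hτ0]
      have hy : x + τ • b ∈ ball x (min (s / 2) t) := by
        rw [mem_ball, dist_eq_norm, add_sub_cancel_left, hτb, hτ, div_mul_cancel₀ _ hbn.ne']
        linarith
      have h1 := hle _ hy x (mem_ball_self hr)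
      have h2 := hlip _ (hU _ hy) x hx
      rw [add_sub_cancel_left, hτb] at h1 h2
      rw [real_inner_smul_right, real_inner_self_eq_norm_sq] at h1
      have h3 : -((g (x + τ • b) - g x) * ⟪ν', ν⟫) ≤ 1 / 7 * (τ * ‖b‖) * |⟪ν', ν⟫| := by
        refine (neg_le_abs _).trans ?_
        rw [abs_mul]
        gcongr
      have h4 : (τ * ‖b‖) * ‖b‖ ≤ (τ * ‖b‖) * (2 * δ + |⟪ν', ν⟫| / 7) := by linarith
      exact le_of_mul_le_mul_left h4 (by positivity)
    have hc : 1 / 2 ≤ |⟪ν', ν⟫| := by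
      by_contra! hlt
      have h1 := sq_abs ⟪ν', ν⟫
      nlinarith [norm_nonneg b, abs_nonneg ⟪ν', ν⟫]
    have hc0 : ⟪ν', ν⟫ ≠ 0 := fun h => by rw [h, abs_zero] at hc; norm_num at hc
    refine ⟨innerSL ℝ (-(⟪ν', ν⟫⁻¹) • b), min (s / 2) t, hr, fun y hy z hz => ?_⟩
    rw [innerSL_apply_apply, real_inner_smul_left]
    have h1 := hab y hy z hz
    have h2 : ⟪b, y - z⟫ + (g y - g z) * ⟪ν', ν⟫ = ⟪ν', ν⟫ * (g y - g z - -⟪ν', ν⟫⁻¹ * ⟪b, y - z⟫) := by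
      field_simp
      ring
    rw [h2, abs_mul] at h1
    have h3 : 1 / 2 * |g y - g z - -⟪ν', ν⟫⁻¹ * ⟪b, y - z⟫| ≤ 2 * δ * ‖y - z‖ := le_trans (by gcongr) h1
    nlinarith [norm_nonneg (y - z)]
  let φ : ContDiffBump (0 : Euc N) := ⟨1 / 32, 1 / 20, by norm_num, by norm_num⟩
  have hφ : ∀ x ∈ ball (0 : Euc N) (1 / 32), φ (P x) * g (P x) = g x ∧ ‖P x‖ < 1 / 16 := fun x hx => by
    rw [mem_ball_zero_iff] at hx
    have h1 := (hPn x).trans_lt hx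
    refine ⟨?_, by linarith⟩
    rw [φ.one_of_mem_closedBall (by rw [mem_closedBall_zero_iff]; exact h1.le), one_mul]
    simp only [hg, hK, hPP]
  refine ⟨ν, fun x => φ x * g x, hν, ?_, ?_, ?_⟩
  · refine contDiff_iff_contDiffAt.2 fun x => ?_
    rcases lt_or_ge ‖x‖ (1 / 16) with hx | hx
    · exact φ.contDiff.contDiffAt.mul (hgC.contDiffAt (hUo.mem_nhds ((hPn x).trans_lt hx)))
    · refine contDiffAt_const (c := (0 : ℝ)) |>.congr_of_eventuallyEq ?_
      have : x ∉ tsupport φ := by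
        rw [φ.tsupport_eq, mem_closedBall_zero_iff, not_le]
        exact lt_of_lt_of_le (show (1 / 20 : ℝ) < 1 / 16 by norm_num) hx
      filter_upwards [(isClosed_tsupport φ).isOpen_compl.mem_nhds this] with y hy
      rw [image_eq_zero_of_notMem_tsupport hy, zero_mul]
  all_goals
    ext x
    rw [Set.mem_ofPred_eq, mem_inter_iff, and_comm]
    refine and_congr_right fun hx => ?_
    rw [← hP]
    beta_reduce
    rw [(hφ x hx).1]
    have hPx := (hφ x hx).2
    have hxt : |⟪x, ν⟫| < 1 / 16 := by
      rw [mem_ball_zero_iff] at hx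
      have := abs_real_inner_le_norm x ν
      rw [hν] at this
      linarith
    have hch := hchar x _ hPx hxt
    rw [hPadd] at hch
  · exact hch
  · constructor
    · intro h
      refine le_antisymm (not_lt.1 fun h1 => h.2 (by rw [hΩ.interior_eq]; exact hch.2 h1)) ?_
      have h1 := hm.inner_le isOpen_ball (hGb x hPx) (hgK x hPx).2 (ball_subset_ball (by norm_num) hx) (frontier_subset_closure h)
      have h2 : P x + g x • ν - x = (g x - ⟪x, ν⟫) • ν := by rw [hP, sub_smul]; abel
      rw [h2, norm_smul, real_inner_smul_left, hν, hνν, Real.norm_eq_abs] at h1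
      rcases abs_cases (g x - ⟪x, ν⟫) with h | h <;> linarith
    · intro h
      have := hfr x hPx
      rwa [← h, hPadd] at this

theorem gradient_eq_zero_iff (u : Euc N → ℝ) (x : Euc N) : gradient u x = 0 ↔ fderiv ℝ u x = 0 := by
  rw [gradient, LinearIsometryEquiv.map_eq_zero_iff]

theorem setOf_gradient_eq_sing (u : Euc N → ℝ) : {x | u x = 0 ∧ gradient u x = 0} = sing u := by
  simp only [gradient_eq_zero_iff, sing]

theorem MemP.solOn {r M : ℝ} {z : Euc N} {Ω : Set (Euc N)} {u : Euc N → ℝ} (h : MemP N r z M Ω u) : SolOn u Ωᶜ (ball z r) := by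
  refine ⟨h.2.1, h.1.isClosed_compl.measurableSet, fun x hx => ?_, fun φ h1 _ h3 => ?_⟩
  · exact (gradient_eq_zero_iff u x).1 (h.2.2.2.1 x ⟨hx.2, hx.1⟩).2
  · rw [h.2.2.1 φ h1 h3, compl_compl, ← integral_indicator h.1.measurableSet]
    congr 1
    ext x
    by_cases hx : x ∈ Ω
    · rw [chi_of_mem hx, indicator_of_mem hx, one_mul]
    · rw [chi_of_notMem hx, indicator_of_notMem hx, zero_mul]

theorem exists_free_of_memP (N : ℕ) {M : ℝ} (hM : 0 ≤ M) : ∃ C, 0 < C ∧ ∀ (Ω : Set (Euc N)) (u : Euc N → ℝ), MemP N 1 0 M Ω u →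
    Free C u Ω (ball 0 (1 / 2)) := by
  obtain ⟨C, hC, H⟩ := exists_lipschitz_fderiv (N := N) M hM
  refine ⟨C, hC, fun Ω u h => ⟨h.1, h.2.1, fun x hx hxΩ => ?_, H u Ωᶜ h.solOn h.2.2.2.2.1, ?_⟩⟩
  · rw [← setOf_gradient_eq_sing]
    exact h.2.2.2.1 x ⟨ball_subset_ball (by norm_num) hx, hxΩ⟩
  · have := (h.solOn.mono (ball_subset_ball (show (1 / 2 : ℝ) ≤ 1 by norm_num))).weak
    rwa [compl_compl] at this

theorem bddAbove_bddBelow_inner {D : Set (Euc N)} {r : ℝ} (hD : D ⊆ ball 0 r) (e : Euc N) :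
    BddAbove (range fun x : D => ⟪(x : Euc N), e⟫) ∧ BddBelow (range fun x : D => ⟪(x : Euc N), e⟫) := by
  have h : ∀ x : D, |⟪(x : Euc N), e⟫| ≤ r * ‖e‖ := fun x => by
    refine (abs_real_inner_le_norm _ _).trans ?_
    have := mem_ball_zero_iff.1 (hD x.2)
    gcongr
  exact ⟨⟨_, forall_mem_range.2 fun x => (_root_.abs_le.1 (h x)).2⟩, ⟨_, forall_mem_range.2 fun x => (_root_.abs_le.1 (h x)).1⟩⟩

theorem MD_le {D : Set (Euc N)} {r a : ℝ} (hD : D ⊆ ball 0 r) (hne : D.Nonempty) {e : Euc N} (he : ‖e‖ = 1)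
    (ha : ∀ x ∈ D, |⟪x, e⟫| ≤ a) : MD N D ≤ 2 * a := by
  have : Nonempty D := hne.to_subtype
  have h0 : ∀ e : {e : Euc N // ‖e‖ = 1}, 0 ≤ (⨆ x : D, ⟪(x : Euc N), (e : Euc N)⟫) - ⨅ x : D, ⟪(x : Euc N), (e : Euc N)⟫ := fun e =>
    sub_nonneg.2 (ciInf_le_ciSup (bddAbove_bddBelow_inner hD e).2 (bddAbove_bddBelow_inner hD e).1)
  refine (ciInf_le ⟨0, forall_mem_range.2 h0⟩ ⟨e, he⟩).trans ?_
  have h1 : (⨆ x : D, ⟪(x : Euc N), e⟫) ≤ a := ciSup_le fun x => (_root_.abs_le.1 (ha x x.2)).2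
  have h2 : -a ≤ ⨅ x : D, ⟪(x : Euc N), e⟫ := le_ciInf fun x => (_root_.abs_le.1 (ha x x.2)).1
  dsimp only
  linarith

theorem IsC1Graph.of_preimage {Ω : Set (Euc N)} {s b b' : ℝ} (hs : 0 < s) (hb : b' ≤ s * b)
    (h : IsC1Graph N ((fun x => 0 + s • x) ⁻¹' Ω) (ball 0 b)) : IsC1Graph N Ω (ball 0 b') := by
  obtain ⟨e, f, he, hf, h1, h2⟩ := h
  have hmem : ∀ x ∈ ball (0 : Euc N) b', s⁻¹ • x ∈ ball (0 : Euc N) b ∧ (0 : Euc N) + s • s⁻¹ • x = x := fun x hx => by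
    have h3 : (0 : Euc N) + s • s⁻¹ • x = x := by rw [smul_inv_smul₀ hs.ne', zero_add]
    refine ⟨?_, h3⟩
    rw [← preimage_affine_ball hs 0, mem_preimage, h3]
    exact ball_subset_ball hb hx
  have hval : ∀ x : Euc N, s⁻¹ • x - ⟪s⁻¹ • x, e⟫ • e = s⁻¹ • (x - ⟪x, e⟫ • e) := fun x => by
    rw [real_inner_smul_left, smul_sub, smul_smul]
  refine ⟨e, fun y => s * f (s⁻¹ • y), he, contDiff_const.mul (hf.comp (contDiff_const_smul s⁻¹)), ?_, ?_⟩
  all_goals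
    ext x
    rw [Set.mem_ofPred_eq, mem_inter_iff, and_comm]
    refine and_congr_right fun hx => ?_
    obtain ⟨h3, h4⟩ := hmem x hx
  · have h5 := Set.ext_iff.1 h1 (s⁻¹ • x)
    rw [Set.mem_ofPred_eq, mem_inter_iff, mem_preimage, h4, hval, real_inner_smul_left, ← div_eq_inv_mul, lt_div_iff₀' hs] at h5
    simpa [h3] using h5
  · have h5 := Set.ext_iff.1 h2 (s⁻¹ • x)
    rw [Set.mem_ofPred_eq, mem_inter_iff, ← preimage_affine_frontier 0 hs.ne', mem_preimage, h4, hval, real_inner_smul_left,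
      ← div_eq_inv_mul, div_eq_iff hs.ne', mul_comm (f _)] at h5
    simpa [h3] using h5

theorem exists_isC1Graph_of_lt_deltaFn (N : ℕ) [NeZero N] {M ε : ℝ} (hM : 0 ≤ M) (hε : 0 < ε) : ∃ R, 0 < R ∧ ∀ r, 0 < r → r < R →
    ∀ (Ω : Set (Euc N)) (u : Euc N → ℝ), MemP N 1 0 M Ω u → ε < deltaFn N u r → IsC1Graph N Ω (ball 0 (r ^ 2)) := by
  obtain ⟨C, hC, HC⟩ := exists_free_of_memP N hM
  by_contra! hcon
  choose r hr hrk Ω u hu hδ hng using fun k => hcon (rn k) (rn_pos k)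
  have hr0 : Tendsto r atTop (nhds 0) := squeeze_zero (fun k => (hr k).le) (fun k => (hrk k).le) (tendsto_rn.mono_right nhdsWithin_le_nhds)
  have hsm : ∀ a : ℝ, 0 < a → ∀ᶠ j in ((hyperfilter ℕ : Ultrafilter ℕ) : Filter ℕ), r j < a := fun a ha =>
    Nat.hyperfilter_le_atTop (hr0.eventually (gt_mem_nhds ha))
  have hfr : ∀ R : ℝ, ∀ᶠ j in ((hyperfilter ℕ : Ultrafilter ℕ) : Filter ℕ),
      Free C (resc 0 (r j) (u j)) ((fun x => 0 + r j • x) ⁻¹' Ω j) (ball 0 R) := fun R => by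
    filter_upwards [hsm (1 / 2 / (|R| + 1)) (by positivity)] with j hj
    refine ((HC _ _ (hu j)).resc (hr j) 0).mono fun x hx => ?_
    rw [lt_div_iff₀ (by positivity)] at hj
    rw [mem_preimage, zero_add, mem_ball_zero_iff, norm_smul, Real.norm_eq_abs, _root_.abs_of_pos (hr j)]
    rw [mem_ball_zero_iff] at hx
    nlinarith [hr j, le_abs_self R]
  have h0f : ∀ j, (0 : Euc N) ∈ frontier ((fun x => 0 + r j • x) ⁻¹' Ω j) := fun j => by
    rw [← preimage_affine_frontier 0 (hr j).ne']
    simpa using (hu j).2.2.2.2.2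
  obtain ⟨v, hv, h0, c, hc, hn⟩ := exists_cv_of_free hC.le (hyperfilter ℕ) hfr h0f
  have hS : volume (sing v) ≠ 0 := fun hS => by
    obtain ⟨e, he, hse⟩ := hv.obst.sing_subset_hyperplane hC.le hS h0
    have hK : IsCompact (closedBall (0 : Euc N) 1 ∩ {x | ε / 4 ≤ |⟪x, e⟫|}) :=
      (isCompact_closedBall 0 1).inter_right (isClosed_le (by fun_prop) (by fun_prop))
    have hdisj : (closedBall (0 : Euc N) 1 ∩ {x | ε / 4 ≤ |⟪x, e⟫|}) ∩ sing v = ∅ := by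
      refine eq_empty_of_forall_notMem fun x hx => ?_
      have : ε / 4 ≤ |⟪x, e⟫| := hx.1.2
      rw [hse x hx.2, abs_zero] at this
      linarith
    obtain ⟨j, hj⟩ := (hv.eventually_notMem_sing hK hdisj).exists
    have hd : MD N (sing (u j) ∩ ball 0 (r j)) ≤ 2 * (r j * (ε / 4)) := by
      refine MD_le inter_subset_right ⟨0, ?_, mem_ball_self (hr j)⟩ he fun x hx => ?_
      · refine (HC _ _ (hu j)).zero 0 (mem_ball_self (by norm_num)) fun h => (hu j).2.2.2.2.2.2 ?_
        rwa [(hu j).1.interior_eq]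
      · by_contra! hlt
        have h2 : (0 : Euc N) + r j • (r j)⁻¹ • x = x := by rw [smul_inv_smul₀ (hr j).ne', zero_add]
        refine eq_empty_iff_forall_notMem.1 hj ((r j)⁻¹ • x) ⟨⟨?_, ?_⟩, ?_⟩
        · refine ball_subset_closedBall ?_
          rw [← preimage_affine_ball (hr j) 0, mem_preimage, h2, mul_one]
          exact hx.2
        · rw [Set.mem_ofPred_eq, real_inner_smul_left, abs_mul, _root_.abs_of_pos (inv_pos.2 (hr j)), ← div_eq_inv_mul, le_div_iff₀ (hr j)]
          linarith
        · rw [sing_resc ((hu j).2.1.differentiable one_ne_zero) (hr j), mem_preimage, h2]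
          exact hx.1
    have h3 := hδ j
    rw [deltaFn, setOf_gradient_eq_sing, lt_div_iff₀ (hr j)] at h3
    nlinarith [hr j]
  obtain ⟨s, hs, ν, hν, H⟩ := exists_coneMono_of_cv (δ := 1 / 8) (θ := 1 / 32) (by norm_num) (by norm_num) (by norm_num) (by norm_num)
    hfr hv hS h0 hc hn
  obtain ⟨j, ⟨hfj, hmj, hsl⟩, hrj⟩ := (H.and (hsm (s * (1 / 32)) (by positivity))).exists
  have hsub : ball (0 : Euc N) (1 / 8) ⊆ ball 0 (1 / 2) := ball_subset_ball (by norm_num)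
  have hgr := hmj.isC1Graph hfj.isOpen hν (fun p hp hpν h => (hsl p (hsub hp)).1 hpν (subset_closure h))
    (fun p hp => (hsl p (hsub hp)).2)
    fun z hz hzb δ hδ hδ1 => hmj.exists_ball hC.le (by norm_num) hδ hδ1 (by norm_num) hfj hν hzb hz
  exact hng j ((hgr.of_preimage hs le_rfl).of_preimage (hr j) (by nlinarith [hr j]))

theorem deltaFn_le_two [NeZero N] {u : Euc N → ℝ} {r : ℝ} (hr : 0 < r) (h0 : 0 ∈ sing u) : deltaFn N u r ≤ 2 := by
  rw [deltaFn, setOf_gradient_eq_sing, div_le_iff₀ hr]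
  refine MD_le inter_subset_right ⟨0, h0, mem_ball_self hr⟩ (norm_single_one 0) fun x hx => ?_
  refine (abs_real_inner_le_norm _ _).trans ?_
  rw [norm_single_one, mul_one]
  exact (mem_ball_zero_iff.1 hx.2).le

end

/-- under the thickness condition the free boundary is a `C¹` graph
in a small ball around the origin. -/
theorem free_boundary_C1 (N : ℕ) (hN : 2 ≤ N) (M : ℝ) (hM : 0 < M) :
    ∃ (σ : ℝ → ℝ) (c₀ : ℝ), 0 < c₀ ∧
      (∀ r : ℝ, 0 < r → r < 1 → 0 < σ r) ∧
      Filter.Tendsto σ (nhdsWithin 0 (Set.Ioi 0)) (nhds 0) ∧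
      ∀ (Ω : Set (EuclideanSpace ℝ (Fin N))) (u : EuclideanSpace ℝ (Fin N) → ℝ),
        MemP N 1 0 M Ω u →
          ∀ r₀ : ℝ, 0 < r₀ → r₀ < 1 → σ r₀ < deltaFn N u r₀ →
            IsC1Graph N Ω (ball 0 (c₀ * r₀ ^ 2)) := by
  have : NeZero N := ⟨by omega⟩
  obtain ⟨C, -, HC⟩ := exists_free_of_memP N hM.le
  let S : ℝ → Set ℝ := fun r => {d | ∃ (Ω : Set (Euc N)) (u : Euc N → ℝ), MemP N 1 0 M Ω u ∧ d = deltaFn N u r ∧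
    ¬ IsC1Graph N Ω (ball 0 (1 * r ^ 2))}
  refine ⟨fun r => r + max 0 (sSup (S r)), 1, one_pos, fun r hr _ => ?_, ?_, fun Ω u hu r hr _ hσ => ?_⟩
  · have := le_max_left 0 (sSup (S r))
    linarith
  · rw [Metric.tendsto_nhdsWithin_nhds]
    intro ε hε
    obtain ⟨R, hR, H⟩ := exists_isC1Graph_of_lt_deltaFn N hM.le (half_pos hε)
    refine ⟨min R (ε / 2), by positivity, fun {r} hr hrd => ?_⟩
    rw [mem_Ioi] at hr
    rw [dist_zero_right, Real.norm_eq_abs, _root_.abs_of_pos hr, lt_min_iff] at hrd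
    have h1 : sSup (S r) ≤ ε / 2 := by
      refine Real.sSup_le ?_ (by positivity)
      rintro d ⟨Ω, u, hu, rfl, hng⟩
      by_contra! hlt
      rw [one_mul] at hng
      exact hng (H r hr hrd.1 Ω u hu hlt)
    have h2 : max 0 (sSup (S r)) ≤ ε / 2 := max_le (by positivity) h1
    have h3 := le_max_left 0 (sSup (S r))
    rw [dist_zero_right, Real.norm_eq_abs, _root_.abs_of_pos (by positivity)]
    linarith
  · by_contra hng
    have hb : BddAbove (S r) := by
      refine ⟨2, ?_⟩
      rintro d ⟨Ω', u', hu', rfl, -⟩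
      refine deltaFn_le_two hr ((HC _ _ hu').zero 0 (mem_ball_self (by norm_num)) fun h => hu'.2.2.2.2.2.2 ?_)
      rwa [hu'.1.interior_eq]
    have h1 : deltaFn N u r ≤ sSup (S r) := le_csSup hb ⟨Ω, u, hu, rfl, hng⟩
    have h2 := le_max_right 0 (sSup (S r))
    beta_reduce at hσ
    linarith
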